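/- For every integer t ≥ 1 and every finite graph G with nonnegative vertex weights of total weight W, either G contains an induced copy of S_{t,t,t}, or there exists a set S ⊆ V(G) with |S| ≤ 3t + 11 and a rigid extended strip decomposition of G − N[S] whose every particle has weight at most W/2. -/

import Mathlib

/-- Closed neighborhood of a set `S` in a graph `G`. -/
def closedNbhd {V : Type*} (G : SimpleGraph V) (S : Set V) : Set V :=
  S ∪ {v | ∃ s ∈ S, G.Adj s v}

/-- Open neighborhood of a set `S` in a graph `G`. -/
def openNbhd {V : Type*} (G : SimpleGraph V) (S : Set V) : Set V :=
  {v | v ∉ S ∧ ∃ s ∈ S, G.Adj s v}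

/-- Reachability inside the induced subgraph of `G` on the vertex set `T`. -/
def ReachIn {V : Type*} (G : SimpleGraph V) (T : Set V) : V → V → Prop :=
  Relation.ReflTransGen (fun a b => G.Adj a b ∧ a ∈ T ∧ b ∈ T)

/-- Total weight of a vertex set. -/
noncomputable def wsum {V : Type*} [Fintype V] (w : V → ℕ) (S : Set V) : ℕ :=
  ∑ v ∈ S.toFinite.toFinset, w v

/-- `l` is the vertex sequence of an induced path of `G`:
nonempty, no repetitions, and two vertices of `l` are adjacent in `G`
iff they are consecutive in `l`. -/
def IsInducedPathList {V : Type*} (G : SimpleGraph V) (l : List V) : Prop :=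
  l ≠ [] ∧ l.Nodup ∧
  ∀ (i j : ℕ) (hi : i < l.length) (hj : j < l.length),
    G.Adj (l.get ⟨i, hi⟩) (l.get ⟨j, hj⟩) ↔ (i + 1 = j ∨ j + 1 = i)

/-- Every connected component of the induced subgraph of `G` on `T`
has `w`-weight at most `b`. -/
def CompsSmall {V : Type*} [Fintype V] (G : SimpleGraph V) (w : V → ℕ)
    (T : Set V) (b : ℕ) : Prop :=
  ∀ v ∈ T, wsum w {u | ReachIn G T v u} ≤ b

/-- `x`, `y`, `z` form a triangle in `H`. -/
def Tri {H' : Type*} (H : SimpleGraph H') (x y z : H') : Prop :=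
  H.Adj x y ∧ H.Adj y z ∧ H.Adj x z

/-- An extended strip decomposition `(H, η)` of a graph `G`.
`ηv x` is `η(x)`, `ηe x y` is `η(xy)`, `ηi x y` is the interface `η(xy, x)`,
and `ηt x y z` is `η(xyz)`. -/
structure ESD {V : Type*} {H' : Type*} (G : SimpleGraph V) (H : SimpleGraph H') where
  ηv : H' → Set V
  ηe : H' → H' → Set V
  ηi : H' → H' → Set V
  ηt : H' → H' → H' → Set V
  ηe_symm : ∀ x y, ηe x y = ηe y x
  ηt_symm12 : ∀ x y z, ηt x y z = ηt y x z
  ηt_symm23 : ∀ x y z, ηt x y z = ηt x z y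
  ηe_empty : ∀ x y, ¬ H.Adj x y → ηe x y = ∅
  ηt_empty : ∀ x y z, ¬ Tri H x y z → ηt x y z = ∅
  ηi_sub : ∀ x y, ηi x y ⊆ ηe x y
  cover : ∀ v : V, (∃ x, v ∈ ηv x) ∨ (∃ x y, v ∈ ηe x y) ∨ (∃ x y z, v ∈ ηt x y z)
  disj_vv : ∀ x y, x ≠ y → ηv x ∩ ηv y = ∅
  disj_ve : ∀ x y z, ηv x ∩ ηe y z = ∅
  disj_vt : ∀ x a b c, ηv x ∩ ηt a b c = ∅
  disj_ee : ∀ x y a b, ¬ (x = a ∧ y = b) → ¬ (x = b ∧ y = a) → ηe x y ∩ ηe a b = ∅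
  disj_et : ∀ x y a b c, ηe x y ∩ ηt a b c = ∅
  disj_tt : ∀ a b c d e f, ({a, b, c} : Set H') ≠ ({d, e, f} : Set H') →
    ηt a b c ∩ ηt d e f = ∅
  complete : ∀ x y z, H.Adj x y → H.Adj x z → y ≠ z →
    ∀ u ∈ ηi x y, ∀ v ∈ ηi x z, G.Adj u v
  edge_cond : ∀ u v : V, G.Adj u v →
    (∃ x, u ∈ ηv x ∧ v ∈ ηv x) ∨
    (∃ x y, u ∈ ηe x y ∧ v ∈ ηe x y) ∨
    (∃ x y z, u ∈ ηt x y z ∧ v ∈ ηt x y z) ∨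
    (∃ x y z, H.Adj x y ∧ H.Adj x z ∧ y ≠ z ∧
      ((u ∈ ηi x y ∧ v ∈ ηi x z) ∨ (v ∈ ηi x y ∧ u ∈ ηi x z))) ∨
    (∃ x y, H.Adj x y ∧ ((u ∈ ηi x y ∧ v ∈ ηv x) ∨ (v ∈ ηi x y ∧ u ∈ ηv x))) ∨
    (∃ x y z, Tri H x y z ∧
      ((u ∈ ηt x y z ∧ v ∈ ηi x y ∩ ηi y x) ∨ (v ∈ ηt x y z ∧ u ∈ ηi x y ∩ ηi y x)))

namespace ESD

variable {V : Type*} {H' : Type*} {G : SimpleGraph V} {H : SimpleGraph H'}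

/-- A rigid extended strip decomposition: every edge of `H` has nonempty interfaces
and every isolated vertex `x` of `H` has `η(x) ≠ ∅`. -/
def IsRigid (D : ESD G H) : Prop :=
  (∀ x y, H.Adj x y → (D.ηi x y).Nonempty) ∧
  (∀ x, (∀ y, ¬ H.Adj x y) → (D.ηv x).Nonempty)

/-- A vertex `z` of `G` is peripheral in `(H, η)`. -/
def Peripheral (D : ESD G H) (z : V) : Prop :=
  ∃ x y, H.Adj x y ∧ (∀ u, H.Adj x u → u = y) ∧ D.ηi x y = {z} ∧ D.ηv x = ∅

/-- The full edge particle `A_{pq}^{pq}`. -/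
def fullEdge (D : ESD G H) (p q : H') : Set V :=
  D.ηv p ∪ D.ηv q ∪ D.ηe p q ∪ {v | ∃ r, v ∈ D.ηt p q r}

/-- Every particle of `D` has `w`-weight at most `b`. -/
def ParticlesSmall [Fintype V] (D : ESD G H) (w : V → ℕ) (b : ℕ) : Prop :=
  (∀ x, wsum w (D.ηv x) ≤ b) ∧
  (∀ x y, H.Adj x y → wsum w (D.ηe x y \ (D.ηi x y ∪ D.ηi y x)) ≤ b) ∧
  (∀ x y, H.Adj x y → wsum w (D.ηv x ∪ (D.ηe x y \ D.ηi y x)) ≤ b) ∧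
  (∀ x y, H.Adj x y → wsum w (D.fullEdge x y) ≤ b) ∧
  (∀ x y z, Tri H x y z → wsum w (D.ηt x y z) ≤ b)

end ESD

/-- The subdivided claw `S_{t,t,t}`: a center vertex and three arms of length `t`. -/
def StttRel (t : ℕ) : (Unit ⊕ Fin 3 × Fin t) → (Unit ⊕ Fin 3 × Fin t) → Prop
  | Sum.inl _, Sum.inr p => p.2.val = 0
  | Sum.inr p, Sum.inr q => p.1 = q.1 ∧ p.2.val + 1 = q.2.val
  | _, _ => False

def Sttt (t : ℕ) : SimpleGraph (Unit ⊕ Fin 3 × Fin t) :=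
  SimpleGraph.fromRel (StttRel t)

section InducedPaths

variable {V : Type*}

/-- `IPath G a T b`: the vertex set `T` induces a path of `G` with ends `a` and `b`. -/
inductive IPath (G : SimpleGraph V) : V → Set V → V → Prop
  | single (a : V) : IPath G a {a} a
  | cons {a b e : V} {T : Set V} : a ∉ T → G.Adj a b → (∀ y ∈ T, G.Adj a y → y = b) →
      IPath G b T e → IPath G a (insert a T) e

/-- `A` and `B` are disjoint and anticomplete apart from the vertex `m`. -/
def SepAt (G : SimpleGraph V) (m : V) (A B : Set V) : Prop :=
  ∀ x ∈ A, ∀ y ∈ B, (x = y ∨ G.Adj x y) → x = m ∨ y = m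

/-- `A` and `B` are disjoint and anticomplete. -/
def Apart (G : SimpleGraph V) (A B : Set V) : Prop :=
  ∀ x ∈ A, ∀ y ∈ B, x ≠ y ∧ ¬ G.Adj x y

/-- `b` is reachable from `a` along an induced path inside `S`. -/
def Conn (G : SimpleGraph V) (S : Set V) (a b : V) : Prop :=
  ∃ T, T ⊆ S ∧ IPath G a T b

/-- `U` contains an induced subdivided claw (legs may be trivial) with leaves `a`, `b`, `c`. -/
def Claw3 (G : SimpleGraph V) (U : Set V) (a b c : V) : Prop :=
  ∃ m A B C, IPath G m A a ∧ IPath G m B b ∧ IPath G m C c ∧ A ⊆ U ∧ B ⊆ U ∧ C ⊆ U ∧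
    SepAt G m A B ∧ SepAt G m A C ∧ SepAt G m B C

variable {G : SimpleGraph V}

theorem SepAt.symm {m : V} {A B : Set V} (h : SepAt G m A B) : SepAt G m B A :=
  fun x hx y hy hxy => (h y hy x hx (hxy.imp Eq.symm SimpleGraph.Adj.symm)).symm

theorem SepAt.mono {m : V} {A B A' B' : Set V} (h : SepAt G m A B) (hA : A' ⊆ A) (hB : B' ⊆ B) :
    SepAt G m A' B' :=
  fun x hx y hy hxy => h x (hA hx) y (hB hy) hxy

theorem Apart.symm {A B : Set V} (h : Apart G A B) : Apart G B A :=
  fun x hx y hy => ⟨(h y hy x hx).1.symm, fun e => (h y hy x hx).2 e.symm⟩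

namespace IPath

theorem start_mem {a e : V} {T : Set V} (h : IPath G a T e) : a ∈ T := by
  cases h <;> simp

theorem end_mem {a e : V} {T : Set V} (h : IPath G a T e) : e ∈ T := by
  induction h <;> simp_all

theorem finite {a e : V} {T : Set V} (h : IPath G a T e) : T.Finite := by
  induction h with
  | single a => exact Set.finite_singleton a
  | cons _ _ _ _ ih => exact ih.insert _

theorem eq_singleton {a : V} {T : Set V} (h : IPath G a T a) : T = {a} := by
  cases h with
  | single => rfl
  | cons h1 _ _ h4 => exact absurd h4.end_mem h1

theorem eq_pair {a e : V} {T : Set V} (h : IPath G a T e) (hae : G.Adj a e) : T = {a, e} := by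
  cases h with
  | single => exact absurd hae (G.loopless.irrefl _)
  | cons h1 h2 h3 h4 =>
    have := h3 _ h4.end_mem hae
    subst this
    rw [h4.eq_singleton]

theorem pair {a b : V} (h : G.Adj a b) : IPath G a {a, b} b :=
  cons (by simpa using h.ne) h (by simp) (single b)

theorem append {a m e : V} {A B : Set V} (hA : IPath G a A m) (hB : IPath G m B e)
    (hs : SepAt G m A B) : IPath G a (A ∪ B) e := by
  induction hA with
  | single a => rwa [Set.union_eq_right.2 (by simpa using hB.start_mem)]
  | @cons a b m T h1 h2 h3 h4 ih =>
    rw [Set.insert_union]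
    have ham : a ≠ m := fun h => h1 (h ▸ h4.end_mem)
    refine cons ?_ h2 ?_ (ih hB (hs.mono (Set.subset_insert _ _) subset_rfl))
    · rintro (h | h)
      · exact h1 h
      · have := hs a (by simp) a h (Or.inl rfl)
        tauto
    · rintro y (hy | hy) hay
      · exact h3 y hy hay
      · rcases hs a (by simp) y hy (Or.inr hay) with h | h
        · exact absurd h ham
        · exact h3 y (h ▸ h4.end_mem) hay

theorem join {a m n e : V} {A B : Set V} (hA : IPath G a A m) (hB : IPath G n B e)
    (hmn : G.Adj m n) (hd : ∀ x ∈ A, x ∉ B)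
    (hs : ∀ x ∈ A, ∀ y ∈ B, G.Adj x y → x = m ∧ y = n) : IPath G a (A ∪ B) e := by
  induction hA with
  | single a =>
    rw [Set.singleton_union]
    exact cons (hd _ rfl) hmn (fun y hy h => (hs a rfl y hy h).2) hB
  | @cons a b m T h1 h2 h3 h4 ih =>
    rw [Set.insert_union]
    refine cons ?_ h2 ?_ (ih hmn (fun x hx => hd x (Or.inr hx))
      (fun x hx => hs x (Or.inr hx)))
    · rintro (h | h)
      · exact h1 h
      · exact hd a (by simp) h
    · rintro y (hy | hy) hay
      · exact h3 y hy hay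
      · have := (hs a (by simp) y hy hay).1
        exact absurd (this ▸ h4.end_mem) h1

theorem symm {a e : V} {T : Set V} (h : IPath G a T e) : IPath G e T a := by
  induction h with
  | single a => exact single a
  | @cons a b e T h1 h2 h3 h4 ih =>
    rw [← Set.union_singleton]
    refine ih.join (single a) h2.symm ?_ ?_
    · rintro x hx rfl
      exact h1 hx
    · rintro x hx y rfl h
      exact ⟨h3 x hx h.symm, rfl⟩

end IPath

/-- `T` is cut by its vertex `y` into the prefix `A` and the suffix `B`. -/
structure PathSplit (G : SimpleGraph V) (a e y : V) (T A B : Set V) : Prop where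
  left : IPath G a A y
  right : IPath G y B e
  union : A ∪ B = T
  sep : SepAt G y A B

theorem PathSplit.left_sub {a e y : V} {T A B : Set V} (h : PathSplit G a e y T A B) : A ⊆ T :=
  h.union ▸ Set.subset_union_left

theorem PathSplit.right_sub {a e y : V} {T A B : Set V} (h : PathSplit G a e y T A B) : B ⊆ T :=
  h.union ▸ Set.subset_union_right

theorem PathSplit.symm {a e y : V} {T A B : Set V} (h : PathSplit G a e y T A B) :
    PathSplit G e a y T B A :=
  ⟨h.right.symm, h.left.symm, by rw [Set.union_comm, h.union], h.sep.symm⟩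

theorem PathSplit.mem_inter {a e y : V} {T A B : Set V} (h : PathSplit G a e y T A B)
    {x : V} (hA : x ∈ A) (hB : x ∈ B) : x = y := by
  have := h.sep x hA x hB (Or.inl rfl)
  tauto

namespace IPath

/-- The first vertex of an induced path with a given property. -/
theorem first_hit {a e : V} {T : Set V} (h : IPath G a T e) (P : V → Prop)
    (hP : ∃ y ∈ T, P y) :
    ∃ y A B, PathSplit G a e y T A B ∧ P y ∧ ∀ x ∈ A, P x → x = y := by
  induction h with
  | single a =>
    obtain ⟨y, rfl, hy⟩ := hP
    exact ⟨y, {y}, {y}, ⟨single y, single y, by simp, fun x hx z _ _ => Or.inl hx⟩, hy,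
      fun x hx _ => hx⟩
  | @cons a b e T h1 h2 h3 h4 ih =>
    by_cases ha : P a
    · exact ⟨a, {a}, insert a T, ⟨single a, cons h1 h2 h3 h4, by simp,
        fun x hx z _ _ => Or.inl hx⟩, ha, fun x hx _ => hx⟩
    · obtain ⟨y, A, B, hs, hy, hA⟩ := ih (by
        obtain ⟨y, hy, hPy⟩ := hP
        rcases hy with rfl | hy
        · exact absurd hPy ha
        · exact ⟨y, hy, hPy⟩)
      have haA : a ∉ A := fun h => h1 (hs.left_sub h)
      have haB : a ∉ B := fun h => h1 (hs.right_sub h)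
      refine ⟨y, insert a A, B, ⟨cons haA h2 (fun z hz => h3 z (hs.left_sub hz)) hs.left,
        hs.right, by rw [Set.insert_union, hs.union], ?_⟩, hy, ?_⟩
      · rintro x (rfl | hx) z hz hxz
        · rcases hxz with rfl | hxz
          · exact absurd hz haB
          · have := h3 z (hs.right_sub hz) hxz
            subst this
            exact Or.inr (hs.mem_inter hs.left.start_mem hz)
        · exact hs.sep x hx z hz hxz
      · rintro x (rfl | hx) hPx
        · exact absurd hPx ha
        · exact hA x hx hPx

/-- The last vertex of an induced path with a given property. -/
theorem last_hit {a e : V} {T : Set V} (h : IPath G a T e) (P : V → Prop)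
    (hP : ∃ y ∈ T, P y) :
    ∃ y A B, PathSplit G a e y T A B ∧ P y ∧ ∀ x ∈ B, P x → x = y := by
  obtain ⟨y, A, B, hs, hy, hA⟩ := h.symm.first_hit P hP
  exact ⟨y, B, A, hs.symm, hy, hA⟩

theorem split {a e : V} {T : Set V} (h : IPath G a T e) {y : V} (hy : y ∈ T) :
    ∃ A B, PathSplit G a e y T A B := by
  obtain ⟨z, A, B, hs, rfl, -⟩ := h.first_hit (· = y) ⟨y, hy, rfl⟩
  exact ⟨A, B, hs⟩

/-- How the vertices with a given property may lie on an induced path. -/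
theorem trichotomy {a e : V} {T : Set V} (h : IPath G a T e) (P : V → Prop)
    (hP : ∃ y ∈ T, P y) :
    ∃ p q A B, P p ∧ P q ∧ IPath G a A p ∧ IPath G q B e ∧ A ⊆ T ∧ B ⊆ T ∧
      (∀ x ∈ A, P x → x = p) ∧ (∀ x ∈ B, P x → x = q) ∧
      ((p = q ∧ PathSplit G a e p T A B) ∨
       (G.Adj p q ∧ A ∪ B = T ∧ (∀ x ∈ A, x ∉ B) ∧
          ∀ x ∈ A, ∀ y ∈ B, G.Adj x y → x = p ∧ y = q) ∨
       Apart G A B) := by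
  obtain ⟨p, A, C, hs, hp, hA⟩ := h.first_hit P hP
  obtain ⟨q, M, B, ht, hq, hB⟩ := hs.right.last_hit P ⟨p, hs.right.start_mem, hp⟩
  refine ⟨p, q, A, B, hp, hq, hs.left, ht.right, hs.left_sub,
    ht.right_sub.trans hs.right_sub, hA, hB, ?_⟩
  by_cases hpq : p = q
  · subst hpq
    have hM := ht.left.eq_singleton
    have : B = C := by
      rw [← ht.union, hM, Set.singleton_union, Set.insert_eq_of_mem ht.right.start_mem]
    subst this
    exact Or.inl ⟨rfl, hs⟩
  · right
    have hpB : p ∉ B := fun hh => hpq (ht.mem_inter ht.left.start_mem hh)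
    have key : ∀ x ∈ A, ∀ y ∈ B, (x = y ∨ G.Adj x y) → x = p ∧ y = q ∧ G.Adj p q := by
      intro x hx y hy hxy
      rcases hs.sep x hx y (ht.right_sub hy) hxy with rfl | rfl
      · rcases ht.sep x ht.left.start_mem y hy hxy with rfl | rfl
        · exact absurd rfl hpq
        · refine ⟨rfl, rfl, ?_⟩
          tauto
      · exact absurd hy hpB
    by_cases hadj : G.Adj p q
    · left
      refine ⟨hadj, ?_, ?_, ?_⟩
      · rw [← hs.union, ← ht.union, ht.left.eq_pair hadj]
        ext x
        have h1 := hs.left.end_mem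
        have h2 := ht.right.start_mem
        simp only [Set.mem_union, Set.mem_insert_iff, Set.mem_singleton_iff]
        constructor
        · tauto
        · rintro (h | (rfl | rfl) | h) <;> tauto
      · intro x hx hxB
        have := key x hx x hxB (Or.inl rfl)
        exact hpq (this.1.symm.trans this.2.1)
      · intro x hx y hy hxy
        have := key x hx y hy (Or.inr hxy)
        tauto
    · right
      intro x hx y hy
      constructor
      · intro hxy
        exact hadj (key x hx y hy (Or.inl hxy)).2.2
      · intro hxy
        exact hadj (key x hx y hy (Or.inr hxy)).2.2

/-- Start an induced path from a vertex on or adjacent to a given one. -/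
theorem shortcut {b e a : V} {T : Set V} (h : IPath G b T e)
    (ha : ∃ y ∈ T, a = y ∨ G.Adj a y) : ∃ T', T' ⊆ insert a T ∧ IPath G a T' e := by
  induction h with
  | single b =>
    obtain ⟨y, rfl, rfl | hy⟩ := ha
    · exact ⟨{a}, by simp, single a⟩
    · exact ⟨{a, y}, by simp, pair hy⟩
  | @cons b c e T h1 h2 h3 h4 ih =>
    by_cases hT : ∃ y ∈ T, a = y ∨ G.Adj a y
    · obtain ⟨T', h, h'⟩ := ih hT
      exact ⟨T', h.trans (Set.insert_subset_insert (Set.subset_insert _ _)), h'⟩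
    · push Not at hT
      obtain ⟨y, hy, hay⟩ := ha
      rcases hy with rfl | hy
      · rcases hay with rfl | hay
        · exact ⟨insert a T, by simp, cons h1 h2 h3 h4⟩
        · refine ⟨insert a (insert y T), subset_rfl, cons ?_ hay ?_ (cons h1 h2 h3 h4)⟩
          · rintro (rfl | h)
            · exact G.loopless.irrefl _ hay
            · exact (hT a h).1 rfl
          · rintro z (rfl | hz) haz
            · rfl
            · exact absurd haz (hT z hz).2
      · exact absurd hay (by have := hT y hy; tauto)

end IPath

namespace Conn

theorem refl {S : Set V} {a : V} (ha : a ∈ S) : Conn G S a a :=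
  ⟨{a}, by simpa using ha, .single a⟩

theorem left_mem {S : Set V} {a b : V} (h : Conn G S a b) : a ∈ S :=
  let ⟨_, h1, h2⟩ := h; h1 h2.start_mem

theorem right_mem {S : Set V} {a b : V} (h : Conn G S a b) : b ∈ S :=
  let ⟨_, h1, h2⟩ := h; h1 h2.end_mem

theorem symm {S : Set V} {a b : V} (h : Conn G S a b) : Conn G S b a :=
  let ⟨T, h1, h2⟩ := h; ⟨T, h1, h2.symm⟩

theorem mono {S S' : Set V} {a b : V} (h : Conn G S a b) (hS : S ⊆ S') : Conn G S' a b :=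
  let ⟨T, h1, h2⟩ := h; ⟨T, h1.trans hS, h2⟩

theorem head {S : Set V} {a b c : V} (ha : a ∈ S) (hab : G.Adj a b) (h : Conn G S b c) :
    Conn G S a c := by
  obtain ⟨T, h1, h2⟩ := h
  obtain ⟨T', h3, h4⟩ := h2.shortcut ⟨b, h2.start_mem, Or.inr hab⟩
  exact ⟨T', h3.trans (Set.insert_subset ha h1), h4⟩

theorem trans {S : Set V} {a b c : V} (h : Conn G S a b) (h' : Conn G S b c) : Conn G S a c := by
  obtain ⟨T, h1, h2⟩ := h
  induction h2 with
  | single => exact h'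
  | cons _ h2 _ _ ih =>
    exact head (h1 (Set.mem_insert _ _)) h2 (ih h' ((Set.subset_insert _ _).trans h1))

theorem adj {S : Set V} {a b : V} (ha : a ∈ S) (hb : b ∈ S) (h : G.Adj a b) : Conn G S a b :=
  head ha h (refl hb)

theorem tail {S : Set V} {a b c : V} (h : Conn G S a b) (hbc : G.Adj b c) (hc : c ∈ S) :
    Conn G S a c :=
  h.trans (adj h.right_mem hc hbc)

/-- A set closed under adjacency within `S` absorbs connectedness in `S`. -/
theorem closed {S P : Set V} {a b : V} (h : Conn G S a b) (ha : a ∈ P)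
    (hP : ∀ x ∈ P, ∀ y ∈ S, G.Adj x y → y ∈ P) : b ∈ P := by
  obtain ⟨T, h1, h2⟩ := h
  induction h2 with
  | single => exact ha
  | cons _ h2 _ h4 ih =>
    have hT := (Set.subset_insert _ _).trans h1
    exact ih (hP _ ha _ (hT h4.start_mem) h2) hT

end Conn

theorem IPath.conn {a b : V} {T : Set V} (h : IPath G a T b) : Conn G T a b := ⟨T, subset_rfl, h⟩

theorem IPath.conn_mem {a b c : V} {T : Set V} (h : IPath G a T b) (hc : c ∈ T) :
    Conn G T a c := by
  obtain ⟨A, B, hs⟩ := h.split hc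
  exact ⟨A, hs.left_sub, hs.left⟩

/-- A path starting in `P` with an end outside `P` has an edge leaving `P`. -/
theorem IPath.exists_exit {a b : V} {T P : Set V} (h : IPath G a T b) (ha : a ∈ P) (hb : b ∉ P) :
    ∃ x ∈ T, ∃ y ∈ T, x ∈ P ∧ y ∉ P ∧ G.Adj x y := by
  by_contra! hcon
  refine hb (h.conn.closed (P := P ∩ T) ⟨ha, h.start_mem⟩ ?_).1
  rintro x ⟨hx, hxT⟩ y hy hxy
  exact ⟨by_contra fun hyP => hcon x hxT y hy hx hyP hxy, hy⟩

end InducedPaths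

section Claws

variable {V : Type*} {G : SimpleGraph V}

theorem Claw3.mono {U U' : Set V} {a b c : V} (h : Claw3 G U a b c) (hU : U ⊆ U') :
    Claw3 G U' a b c :=
  let ⟨m, A, B, C, h1, h2, h3, h4, h5, h6, h7⟩ := h
  ⟨m, A, B, C, h1, h2, h3, h4.trans hU, h5.trans hU, h6.trans hU, h7⟩

theorem Claw3.swap12 {U : Set V} {a b c : V} (h : Claw3 G U a b c) : Claw3 G U b a c :=
  let ⟨m, A, B, C, h1, h2, h3, h4, h5, h6, h7, h8, h9⟩ := h
  ⟨m, B, A, C, h2, h1, h3, h5, h4, h6, h7.symm, h9, h8⟩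

theorem Claw3.swap23 {U : Set V} {a b c : V} (h : Claw3 G U a b c) : Claw3 G U a c b :=
  let ⟨m, A, B, C, h1, h2, h3, h4, h5, h6, h7, h8, h9⟩ := h
  ⟨m, A, C, B, h1, h3, h2, h4, h6, h5, h8, h7, h9.symm⟩

/-- Extend the first leg of a claw. -/
theorem Claw3.extend {U R U' : Set V} {a b c a' : V} (h : Claw3 G U a b c)
    (hR : IPath G a R a') (hs : SepAt G a R U) (hab : a ≠ b) (hac : a ≠ c) (hU : U ⊆ U')
    (hRU : R ⊆ U') : Claw3 G U' a' b c := by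
  obtain ⟨m, A, B, C, hA, hB, hC, sA, sB, sC, h1, h2, h3⟩ := h
  have key : ∀ {D : Set V} {d : V}, IPath G m D d → a ≠ d → D ⊆ U → SepAt G m A D →
      SepAt G m (A ∪ R) D := by
    intro D d hD had hDU hAD x hx y hy hxy
    rcases hx with hx | hx
    · exact hAD x hx y hy hxy
    · rcases hs x hx y (hDU hy) hxy with rfl | rfl
      · exact hAD x hA.end_mem y hy hxy
      · have := hAD y hA.end_mem y hy (Or.inl rfl)
        tauto
  exact ⟨m, A ∪ R, B, C, hA.append hR (hs.symm.mono sA subset_rfl), hB, hC,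
    Set.union_subset (sA.trans hU) hRU, sB.trans hU, sC.trans hU,
    key hB hab sB h1, key hC hac sC h2, h3⟩

/-- The claw centred at a vertex of an induced path, with a third leg. -/
theorem Claw3.of_split {U T A B C : Set V} {a b c m : V} (h : PathSplit G a b m T A B)
    (hC : IPath G m C c) (hT : T ⊆ U) (hCU : C ⊆ U) (hs : SepAt G m C T) : Claw3 G U a b c :=
  ⟨m, A, B, C, h.left.symm, h.right, hC, h.left_sub.trans hT, h.right_sub.trans hT, hCU, h.sep,
    hs.symm.mono h.left_sub subset_rfl, hs.symm.mono h.right_sub subset_rfl⟩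

/-- Three pairwise adjacent vertices with disjoint pairwise anticomplete paths to
`a`, `b`, `c`. -/
def Tripod (G : SimpleGraph V) (U : Set V) (a b c : V) : Prop :=
  ∃ x y z A B C, IPath G x A a ∧ IPath G y B b ∧ IPath G z C c ∧ A ⊆ U ∧ B ⊆ U ∧ C ⊆ U ∧
    G.Adj x y ∧ G.Adj y z ∧ G.Adj x z ∧
    (∀ u ∈ A, ∀ v ∈ B, u ≠ v ∧ (G.Adj u v → u = x ∧ v = y)) ∧
    (∀ u ∈ B, ∀ v ∈ C, u ≠ v ∧ (G.Adj u v → u = y ∧ v = z)) ∧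
    (∀ u ∈ A, ∀ v ∈ C, u ≠ v ∧ (G.Adj u v → u = x ∧ v = z))

/-- Three mutually connected vertices are the leaves of a claw or of a tripod. -/
theorem claw_or_tripod {S : Set V} {a b c : V} (hab : Conn G S a b) (hac : Conn G S a c) :
    Claw3 G S a b c ∨ Tripod G S a b c := by
  obtain ⟨T, hTS, hT⟩ := hab
  obtain ⟨R, hRS, hR⟩ := hac.symm
  obtain ⟨y, C, D, hs, hy, hC⟩ := hR.first_hit (fun u => ∃ t ∈ T, u = t ∨ G.Adj u t)
    ⟨a, hR.end_mem, a, hT.start_mem, Or.inl rfl⟩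
  have hCS : C ⊆ S := hs.left_sub.trans hRS
  by_cases hyT : y ∈ T
  · left
    obtain ⟨A, B, ht⟩ := hT.split hyT
    refine Claw3.of_split ht hs.left.symm hTS hCS ?_
    intro u hu v hv huv
    exact Or.inl (hC u hu ⟨v, hv, huv⟩)
  obtain ⟨p, q, A, B, hp, hq, hA, hB, sA, sB, uA, uB, h⟩ :=
    hT.trichotomy (fun u => G.Adj y u) (by
      obtain ⟨t, ht, rfl | h⟩ := hy
      · exact absurd ht hyT
      · exact ⟨t, ht, h⟩)
  have hCT : ∀ u ∈ C, ∀ v ∈ T, u ≠ v ∧ (G.Adj u v → u = y) := by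
    intro u hu v hv
    constructor
    · rintro rfl
      have := hC u hu ⟨u, hv, Or.inl rfl⟩
      exact hyT (this ▸ hv)
    · intro huv
      exact hC u hu ⟨v, hv, Or.inr huv⟩
  rcases h with ⟨rfl, h⟩ | ⟨h1, h2, h3, h4⟩ | h
  · left
    have hC' : IPath G p (insert p C) c :=
      .cons (fun hh => (hCT p hh p (sA hA.end_mem)).1 rfl) hp.symm
        (fun z hz hpz => (hCT z hz p (sA hA.end_mem)).2 hpz.symm) hs.left.symm
    refine Claw3.of_split h hC' hTS (Set.insert_subset (hTS (sA hA.end_mem)) hCS) ?_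
    rintro u (rfl | hu) v hv huv
    · exact Or.inl rfl
    · right
      have h5 := hCT u hu v hv
      rcases huv with huv | huv
      · exact absurd huv h5.1
      · have := h5.2 huv
        subst this
        rw [← h.union] at hv
        rcases hv with hv | hv
        · exact uA v hv huv
        · exact uB v hv huv
  · right
    refine ⟨p, q, y, A, B, C, hA.symm, hB, hs.left.symm, sA.trans hTS, sB.trans hTS, hCS, h1,
      hq.symm, hp.symm, ?_, ?_, ?_⟩
    · intro u hu v hv
      exact ⟨fun e => h3 u hu (e ▸ hv), h4 u hu v hv⟩
    · intro u hu v hv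
      have h5 := hCT v hv u (sB hu)
      refine ⟨h5.1.symm, fun e => ?_⟩
      have := h5.2 e.symm
      subst this
      exact ⟨uB u hu e.symm, rfl⟩
    · intro u hu v hv
      have h5 := hCT v hv u (sA hu)
      refine ⟨h5.1.symm, fun e => ?_⟩
      have := h5.2 e.symm
      subst this
      exact ⟨uA u hu e.symm, rfl⟩
  · left
    have aux : ∀ {X Y : Set V} {r d : V}, IPath G r X d → X ⊆ T → G.Adj y r →
        (∀ u ∈ X, G.Adj y u → u = r) → IPath G y (insert y X) d := by
      intro X Y r d hX hXT hyr hu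
      exact .cons (fun hh => hyT (hXT hh)) hyr hu hX
    refine ⟨y, insert y A, insert y B, C, aux (Y := A) hA.symm sA hp uA,
      aux (Y := A) hB sB hq uB, hs.left.symm,
      Set.insert_subset (hCS hs.left.end_mem) (sA.trans hTS),
      Set.insert_subset (hCS hs.left.end_mem) (sB.trans hTS), hCS, ?_, ?_, ?_⟩
    · rintro u (rfl | hu) v (rfl | hv) huv
      · exact Or.inl rfl
      · exact Or.inl rfl
      · exact Or.inr rfl
      · have := h u hu v hv
        tauto
    · rintro u (rfl | hu) v hv huv
      · exact Or.inl rfl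
      · have h5 := hCT v hv u (sA hu)
        rcases huv with rfl | huv
        · exact absurd rfl h5.1
        · exact Or.inr (h5.2 huv.symm)
    · rintro u (rfl | hu) v hv huv
      · exact Or.inl rfl
      · have h5 := hCT v hv u (sB hu)
        rcases huv with rfl | huv
        · exact absurd rfl h5.1
        · exact Or.inr (h5.2 huv.symm)

end Claws

section Labelings

variable {V : Type*}

/-- The ways in which adjacent vertices may be placed by a labeling. -/
def LinkOK (h I : V → Finset ℕ) (u w : V) : Prop :=
  h u = h w ∨ (∃ a, a ∈ I u ∧ a ∈ I w) ∨ (∃ a, a ∈ I w ∧ h u = {a}) ∨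
    (∃ a, a ∈ I u ∧ h w = {a}) ∨ ((h u).card = 3 ∧ h w ⊆ h u ∧ I w = h w) ∨
    ((h w).card = 3 ∧ h u ⊆ h w ∧ I u = h u)

/-- A labeling encodes an extended strip decomposition of `G[U]`: every vertex has a home,
which is a node, a pair of nodes or a triple of nodes, and vertices whose home is a pair carry
flags recording the interfaces they belong to. -/
structure Lab (G : SimpleGraph V) (U : Set V) (h I : V → Finset ℕ) : Prop where
  sub : ∀ u ∈ U, I u ⊆ h u
  pos : ∀ u ∈ U, 1 ≤ (h u).card
  le : ∀ u ∈ U, (h u).card ≤ 3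
  flag : ∀ u ∈ U, ∀ a ∈ I u, (h u).card = 2
  complete : ∀ u ∈ U, ∀ w ∈ U, ∀ a, a ∈ I u → a ∈ I w → h u ≠ h w → G.Adj u w
  edge : ∀ u ∈ U, ∀ w ∈ U, G.Adj u w → LinkOK h I u w

/-- The vertices `z i` are peripheral: each is alone in a strip ending at a node `ℓ i` that is
used by no other vertex. -/
structure Term (U : Set V) (z : Fin 3 → V) (h I : V → Finset ℕ) (ℓ x : Fin 3 → ℕ) : Prop where
  mem : ∀ i, z i ∈ U
  ne : ∀ i, ℓ i ≠ x i
  home : ∀ i, h (z i) = {ℓ i, x i}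
  flags : ∀ i, I (z i) = {ℓ i, x i}
  unique : ∀ i, ∀ u ∈ U, ℓ i ∈ h u → u = z i

/-- `G[U]` has a labeling in which the `z i` are peripheral. -/
def TL (G : SimpleGraph V) (U : Set V) (z : Fin 3 → V) : Prop :=
  ∃ h I ℓ x, Lab G U h I ∧ Term U z h I ℓ x

/-- A vertex off `κ` to which vertices of home `κ` may be adjacent. -/
def Attach (h I : V → Finset ℕ) (κ : Finset ℕ) (w : V) : Prop :=
  h w = κ ∨ (∃ a, a ∈ I w ∧ κ = {a}) ∨ (κ.card = 3 ∧ h w ⊆ κ ∧ I w = h w)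

/-- A path through the strip `{a, b}` from its `a`-interface to its `b`-interface. -/
structure Rung (G : SimpleGraph V) (U : Set V) (h I : V → Finset ℕ) (a b : ℕ) (T : Set V)
    (r s : V) : Prop where
  path : IPath G r T s
  sub : T ⊆ U
  home : ∀ y ∈ T, h y = {a, b}
  fa : a ∈ I r
  fb : b ∈ I s
  ua : ∀ y ∈ T, a ∈ I y → y = r
  ub : ∀ y ∈ T, b ∈ I y → y = s

/-- The vertices lying on rungs. -/
def rungSet (G : SimpleGraph V) (U : Set V) (h I : V → Finset ℕ) : Set V :=
  {w | ∃ a b T r s, Rung G U h I a b T r s ∧ w ∈ T}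

/-- The graph on the nodes formed by the nonempty strips. -/
def nodeGraph (U : Set V) (h : V → Finset ℕ) : SimpleGraph ℕ where
  Adj a b := a ≠ b ∧ ∃ u ∈ U, h u = {a, b}
  symm := ⟨fun _ _ ⟨h1, u, h2, h3⟩ => ⟨h1.symm, u, h2, by rw [h3, Finset.pair_comm]⟩⟩
  loopless := ⟨fun _ h => h.1 rfl⟩

/-- The nodes appearing in some home. -/
def usedNodes (U : Set V) (h : V → Finset ℕ) : Set ℕ := {a | ∃ u ∈ U, a ∈ h u}

variable {G : SimpleGraph V} {U : Set V} {h I : V → Finset ℕ}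

theorem LinkOK.symm {u w : V} (hl : LinkOK h I u w) : LinkOK h I w u := by
  rcases hl with h1 | ⟨a, h1, h2⟩ | h1 | h1 | h1 | h1
  · exact Or.inl h1.symm
  · exact Or.inr (Or.inl ⟨a, h2, h1⟩)
  · exact Or.inr (Or.inr (Or.inr (Or.inl h1)))
  · exact Or.inr (Or.inr (Or.inl h1))
  · exact Or.inr (Or.inr (Or.inr (Or.inr (Or.inr h1))))
  · exact Or.inr (Or.inr (Or.inr (Or.inr (Or.inl h1))))

theorem LinkOK.of_attach {κ : Finset ℕ} {u w : V} (hu : h u = κ) (hw : Attach h I κ w) :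
    LinkOK h I u w := by
  subst hu
  rcases hw with h1 | h1 | h1
  · exact Or.inl h1.symm
  · exact Or.inr (Or.inr (Or.inl h1))
  · exact Or.inr (Or.inr (Or.inr (Or.inr (Or.inl h1))))

theorem Lab.mono (L : Lab G U h I) {U' : Set V} (hU : U' ⊆ U) : Lab G U' h I :=
  ⟨fun u hu => L.sub u (hU hu), fun u hu => L.pos u (hU hu), fun u hu => L.le u (hU hu),
    fun u hu => L.flag u (hU hu), fun u hu w hw => L.complete u (hU hu) w (hU hw),
    fun u hu w hw => L.edge u (hU hu) w (hU hw)⟩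

theorem Finset.eq_pair_of_mem {s : Finset ℕ} {a b : ℕ} (hs : s.card = 2) (ha : a ∈ s)
    (hb : b ∈ s) (hab : a ≠ b) : s = {a, b} :=
  (Finset.eq_of_subset_of_card_le (by simp [Finset.insert_subset_iff, ha, hb])
    (by rw [hs, Finset.card_pair hab])).symm

theorem Finset.exists_eq_pair {s : Finset ℕ} {a : ℕ} (hs : s.card = 2) (ha : a ∈ s) :
    ∃ b, a ≠ b ∧ s = {a, b} := by
  obtain ⟨p, q, hpq, rfl⟩ := Finset.card_eq_two.1 hs
  simp only [Finset.mem_insert, Finset.mem_singleton] at ha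
  rcases ha with rfl | rfl
  · exact ⟨q, hpq, rfl⟩
  · exact ⟨p, hpq.symm, Finset.pair_comm _ _⟩

theorem Finset.exists_eq_triple {s : Finset ℕ} {a : ℕ} (hs : s.card = 3) (ha : a ∈ s) :
    ∃ b c, a ≠ b ∧ a ≠ c ∧ b ≠ c ∧ s = {a, b, c} := by
  obtain ⟨p, q, r, hpq, hpr, hqr, rfl⟩ := Finset.card_eq_three.1 hs
  simp only [Finset.mem_insert, Finset.mem_singleton] at ha
  rcases ha with rfl | rfl | rfl
  · exact ⟨q, r, hpq, hpr, hqr, rfl⟩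
  · exact ⟨p, r, hpq.symm, hqr, hpr, by ext; simp; tauto⟩
  · exact ⟨p, q, hpr.symm, hqr.symm, hpq, by ext; simp; tauto⟩

theorem Finset.card_ne_one_of_pair {a b c : ℕ} (hab : a ≠ b) : ({a, b} : Finset ℕ) ≠ {c} := by
  intro hh
  have := congrArg Finset.card hh
  simp [hab] at this

namespace Rung

variable {a b : ℕ} {T : Set V} {r s : V}

theorem symm (R : Rung G U h I a b T r s) : Rung G U h I b a T s r :=
  ⟨R.path.symm, R.sub, fun y hy => by rw [R.home y hy, Finset.pair_comm], R.fb, R.fa, R.ub, R.ua⟩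

theorem ne (R : Rung G U h I a b T r s) (L : Lab G U h I) : a ≠ b := by
  rintro rfl
  have h1 := L.flag r (R.sub R.path.start_mem) a R.fa
  rw [R.home r R.path.start_mem] at h1
  simp at h1

theorem mem_rungSet (R : Rung G U h I a b T r s) {y : V} (hy : y ∈ T) : y ∈ rungSet G U h I :=
  ⟨a, b, T, r, s, R, hy⟩

/-- The rung through a vertex, oriented by the nodes of its strip. -/
theorem of_mem_rungSet {w : V} (hw : w ∈ rungSet G U h I) {c d : ℕ} (hcd : h w = {c, d}) :
    ∃ T r s, Rung G U h I c d T r s ∧ w ∈ T := by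
  obtain ⟨p, q, T, r, s, R, hT⟩ := hw
  have hpq := (R.home w hT).symm.trans hcd
  have h1 : p ∈ ({c, d} : Finset ℕ) := hpq ▸ Finset.mem_insert_self _ _
  have h2 : q ∈ ({c, d} : Finset ℕ) := hpq ▸ by simp
  have h3 : c ∈ ({p, q} : Finset ℕ) := hpq ▸ Finset.mem_insert_self _ _
  have h4 : d ∈ ({p, q} : Finset ℕ) := hpq ▸ by simp
  simp only [Finset.mem_insert, Finset.mem_singleton] at h1 h2 h3 h4
  by_cases hpc : p = c
  · have : q = d := by
      rcases h2 with h2 | h2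
      · rcases h4 with h4 | h4 <;> omega
      · exact h2
    subst hpc this
    exact ⟨T, r, s, R, hT⟩
  · have h5 : p = d := by tauto
    have h6 : q = c := by tauto
    subst h5 h6
    exact ⟨T, s, r, R.symm, hT⟩

end Rung

theorem rungSet_sub : rungSet G U h I ⊆ U := by
  rintro w ⟨a, b, T, r, s, R, hw⟩
  exact R.sub hw

theorem Lab.card_rung (L : Lab G U h I) {w : V} (hw : w ∈ rungSet G U h I) :
    (h w).card = 2 := by
  obtain ⟨a, b, T, r, s, R, hw⟩ := hw
  rw [R.home w hw, Finset.card_pair (R.ne L)]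

/-- A vertex flagged at `a` that is joined to a vertex flagged at `b` inside the strip without
meeting further vertices flagged at `a` starts a rung. -/
theorem mem_rungSet_of_conn {a b : ℕ} {u s : V} (hu : u ∈ U) (hh : h u = {a, b}) (ha : a ∈ I u)
    (hs : b ∈ I s) (hc : Conn G (insert u {y | y ∈ U ∧ h y = {a, b} ∧ a ∉ I y}) u s) :
    u ∈ rungSet G U h I := by
  obtain ⟨T, hT, hp⟩ := hc
  obtain ⟨y, A, B, hsp, hy, hA⟩ := hp.first_hit (fun y => b ∈ I y) ⟨s, hp.end_mem, hs⟩
  have key : ∀ z ∈ A, z = u ∨ (z ∈ U ∧ h z = {a, b} ∧ a ∉ I z) :=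
    fun z hz => hT (hsp.left_sub hz)
  refine ⟨a, b, A, u, y, ⟨hsp.left, ?_, ?_, ha, hy, ?_, hA⟩, hsp.left.start_mem⟩
  · intro z hz
    rcases key z hz with rfl | h1
    · exact hu
    · exact h1.1
  · intro z hz
    rcases key z hz with rfl | h1
    · exact hh
    · exact h1.2.1
  · intro z hz hza
    rcases key z hz with rfl | h1
    · rfl
    · exact absurd hza h1.2.2

/-- Give all vertices of `Q` the home `κ` and no flags. -/
theorem Lab.relabel (L : Lab G U h I) {Q : Set V} {κ : Finset ℕ} {h' I' : V → Finset ℕ}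
    (h1 : 1 ≤ κ.card) (h3 : κ.card ≤ 3) (hQ : ∀ u ∈ Q, h' u = κ ∧ I' u = ∅)
    (hQ' : ∀ u, u ∉ Q → h' u = h u ∧ I' u = I u)
    (hat : ∀ y ∈ Q, ∀ w ∈ U, w ∉ Q → G.Adj y w → Attach h I κ w) : Lab G U h' I' := by
  have hat' : ∀ y ∈ Q, ∀ w ∈ U, w ∉ Q → G.Adj y w → LinkOK h' I' y w := by
    intro y hy w hw hwQ hyw
    refine LinkOK.of_attach (hQ y hy).1 ?_
    have := hat y hy w hw hwQ hyw
    unfold Attach at *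
    rwa [(hQ' w hwQ).1, (hQ' w hwQ).2]
  constructor
  · intro u hu
    by_cases hq : u ∈ Q
    · simp [(hQ u hq).2]
    · rw [(hQ' u hq).1, (hQ' u hq).2]
      exact L.sub u hu
  · intro u hu
    by_cases hq : u ∈ Q
    · rwa [(hQ u hq).1]
    · rw [(hQ' u hq).1]
      exact L.pos u hu
  · intro u hu
    by_cases hq : u ∈ Q
    · rwa [(hQ u hq).1]
    · rw [(hQ' u hq).1]
      exact L.le u hu
  · intro u hu a ha
    by_cases hq : u ∈ Q
    · simp [(hQ u hq).2] at ha
    · rw [(hQ' u hq).2] at ha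
      rw [(hQ' u hq).1]
      exact L.flag u hu a ha
  · intro u hu w hw a hau haw hne
    by_cases hq : u ∈ Q
    · simp [(hQ u hq).2] at hau
    by_cases hq2 : w ∈ Q
    · simp [(hQ w hq2).2] at haw
    rw [(hQ' u hq).2] at hau
    rw [(hQ' w hq2).2] at haw
    rw [(hQ' u hq).1, (hQ' w hq2).1] at hne
    exact L.complete u hu w hw a hau haw hne
  · intro u hu w hw huw
    by_cases hq : u ∈ Q
    · by_cases hq2 : w ∈ Q
      · exact Or.inl ((hQ u hq).1.trans (hQ w hq2).1.symm)
      · exact hat' u hq w hw hq2 huw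
    · by_cases hq2 : w ∈ Q
      · exact (hat' w hq2 u hu hq huw.symm).symm
      · have := L.edge u hu w hw huw
        unfold LinkOK at *
        rwa [(hQ' u hq).1, (hQ' u hq).2, (hQ' w hq2).1, (hQ' w hq2).2]

end Labelings

section Minimal

variable {V : Type*} [Fintype V]

/-- Complexity of a labeling: number of nodes used, total size of homes, number of vertices
whose home is not the node `o`. -/
noncomputable def complexity (U : Set V) (o : ℕ) (h : V → Finset ℕ) : ℕ ×ₗ ℕ ×ₗ ℕ :=
  open Classical in
  toLex ((U.toFinite.toFinset.biUnion h).card,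
    toLex (∑ u ∈ U.toFinite.toFinset, (h u).card,
      (U.toFinite.toFinset.filter fun u => h u ≠ {o}).card))

/-- A labeling with peripheral vertices `z i` of least complexity. -/
structure MinLab (G : SimpleGraph V) (U : Set V) (z : Fin 3 → V) (h I : V → Finset ℕ)
    (ℓ x : Fin 3 → ℕ) : Prop extends Lab G U h I, Term U z h I ℓ x where
  inj : Function.Injective z
  min : ∀ h' I', Lab G U h' I' → Term U z h' I' ℓ x →
    ¬ complexity U (x 0) h' < complexity U (x 0) h

variable {G : SimpleGraph V} {U : Set V} {z : Fin 3 → V}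

theorem TL.exists_minLab (hz : Function.Injective z) (H : TL G U z) :
    ∃ h I ℓ x, MinLab G U z h I ℓ x := by
  obtain ⟨h, I, ℓ, x, hL, hT⟩ := H
  obtain ⟨p, hp, hmin⟩ := (InvImage.wf
      (fun p : (V → Finset ℕ) × (V → Finset ℕ) => complexity U (x 0) p.1)
      (wellFounded_lt (α := ℕ ×ₗ ℕ ×ₗ ℕ))).has_min
    {p | Lab G U p.1 p.2 ∧ Term U z p.1 p.2 ℓ x} ⟨(h, I), hL, hT⟩
  exact ⟨p.1, p.2, ℓ, x, { hp.1, hp.2 with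
    inj := hz
    min := fun h' I' h1 h2 => hmin (h', I') ⟨h1, h2⟩ }⟩

namespace MinLab

variable {h I : V → Finset ℕ} {ℓ x : Fin 3 → ℕ}

theorem l_ne_x (M : MinLab G U z h I ℓ x) (i j : Fin 3) : ℓ i ≠ x j := by
  intro hij
  have : z j = z i := M.unique i (z j) (M.mem j) (by rw [M.home j, hij]; simp)
  have := M.inj this
  subst this
  exact M.ne _ hij

theorem l_inj (M : MinLab G U z h I ℓ x) {i j : Fin 3} (hij : ℓ i = ℓ j) : i = j :=
  M.inj (M.unique j (z i) (M.mem i) (by rw [M.home i, hij]; simp))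

theorem mem_rung (M : MinLab G U z h I ℓ x) (i : Fin 3) :
    Rung G U h I (ℓ i) (x i) {z i} (z i) (z i) :=
  ⟨.single _, by simpa using M.mem i, by simpa using M.home i, by simp [M.flags],
    by simp [M.flags], by simp, by simp⟩

theorem mem_rungSet (M : MinLab G U z h I ℓ x) (i : Fin 3) : z i ∈ rungSet G U h I :=
  (M.mem_rung i).mem_rungSet rfl

theorem used_eq (M : MinLab G U z h I ℓ x) {h' I' : V → Finset ℕ} (L' : Lab G U h' I')
    (T' : Term U z h' I' ℓ x) (hs : usedNodes U h' ⊆ usedNodes U h) :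
    usedNodes U h ⊆ usedNodes U h' := by
  classical
  intro a ha
  by_contra ha'
  refine M.min h' I' L' T' ?_
  rw [complexity, complexity, Prod.Lex.toLex_lt_toLex]
  left
  refine Finset.card_lt_card (Finset.ssubset_iff_subset_ne.2 ⟨?_, ?_⟩)
  · intro b hb
    simp only [Finset.mem_biUnion, Set.Finite.mem_toFinset] at hb ⊢
    exact hs hb
  · intro he
    have h1 : a ∈ U.toFinite.toFinset.biUnion h := by
      simpa only [Finset.mem_biUnion, Set.Finite.mem_toFinset, usedNodes, Set.mem_ofPred_eq]
        using ha
    rw [← he] at h1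
    simp only [Finset.mem_biUnion, Set.Finite.mem_toFinset] at h1
    exact ha' h1

theorem home_eq (M : MinLab G U z h I ℓ x) {h' I' : V → Finset ℕ} (L' : Lab G U h' I')
    (T' : Term U z h' I' ℓ x) (hs : ∀ u ∈ U, h' u ⊆ h u ∨ h' u = {x 0}) :
    ∀ u ∈ U, h' u = h u := by
  classical
  by_contra! hcon
  obtain ⟨u, hu, hne⟩ := hcon
  have hle : ∀ v ∈ U, (h' v).card ≤ (h v).card := by
    intro v hv
    rcases hs v hv with h1 | h1
    · exact Finset.card_le_card h1
    · rw [h1, Finset.card_singleton]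
      exact M.pos v hv
  refine M.min h' I' L' T' ?_
  rw [complexity, complexity, Prod.Lex.toLex_lt_toLex]
  have hsub : U.toFinite.toFinset.biUnion h' ⊆ U.toFinite.toFinset.biUnion h := by
    intro b hb
    simp only [Finset.mem_biUnion, Set.Finite.mem_toFinset] at hb ⊢
    obtain ⟨v, hv, hb⟩ := hb
    rcases hs v hv with h1 | h1
    · exact ⟨v, hv, h1 hb⟩
    · rw [h1, Finset.mem_singleton] at hb
      exact ⟨z 0, M.mem 0, by rw [M.home, hb]; simp⟩
  rcases (Finset.card_le_card hsub).lt_or_eq with h1 | h1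
  · exact Or.inl h1
  refine Or.inr ⟨h1, ?_⟩
  rw [Prod.Lex.toLex_lt_toLex]
  by_cases hlt : ∃ v ∈ U, (h' v).card < (h v).card
  · left
    obtain ⟨v, hv, hlt⟩ := hlt
    exact Finset.sum_lt_sum (fun v hv => hle v (by simpa using hv)) ⟨v, by simpa using hv, hlt⟩
  · push Not at hlt
    right
    have hcard : ∀ v ∈ U, (h' v).card = (h v).card := fun v hv =>
      le_antisymm (hle v hv) (hlt v hv)
    refine ⟨Finset.sum_congr rfl fun v hv => hcard v (by simpa using hv), ?_⟩
    have hor : ∀ v ∈ U, h' v = h v ∨ h' v = {x 0} := by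
      intro v hv
      rcases hs v hv with h2 | h2
      · exact Or.inl (Finset.eq_of_subset_of_card_le h2 (hlt v hv))
      · exact Or.inr h2
    refine Finset.card_lt_card (Finset.ssubset_iff_subset_ne.2 ⟨?_, ?_⟩)
    · intro v hv
      simp only [Finset.mem_filter, Set.Finite.mem_toFinset] at hv ⊢
      refine ⟨hv.1, ?_⟩
      rcases hor v hv.1 with h2 | h2
      · exact h2 ▸ hv.2
      · exact absurd h2 hv.2
    · intro he
      have h2 : h' u = {x 0} := (hor u hu).resolve_left hne
      have h3 : u ∈ U.toFinite.toFinset.filter fun u => h u ≠ {x 0} := by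
        simp only [Finset.mem_filter, Set.Finite.mem_toFinset]
        exact ⟨hu, fun h4 => hne (h2.trans h4.symm)⟩
      rw [← he] at h3
      simp only [Finset.mem_filter, Set.Finite.mem_toFinset] at h3
      exact h3.2 h2

theorem relabel_eq (M : MinLab G U z h I ℓ x) {Q : Set V} {κ : Finset ℕ}
    (hQU : Q ⊆ U) (h1 : 1 ≤ κ.card) (h3 : κ.card ≤ 3) (hz : ∀ i, z i ∉ Q) (hl : ∀ i, ℓ i ∉ κ)
    (hs : ∀ y ∈ Q, κ ⊆ h y ∨ κ = {x 0})
    (hat : ∀ y ∈ Q, ∀ w ∈ U, w ∉ Q → G.Adj y w → Attach h I κ w) : ∀ y ∈ Q, h y = κ := by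
  classical
  set h' : V → Finset ℕ := fun u => if u ∈ Q then κ else h u with hh'
  set I' : V → Finset ℕ := fun u => if u ∈ Q then ∅ else I u with hI'
  have e1 : ∀ u ∈ Q, h' u = κ ∧ I' u = ∅ := fun u hu => by simp [hh', hI', hu]
  have e2 : ∀ u, u ∉ Q → h' u = h u ∧ I' u = I u := fun u hu => by simp [hh', hI', hu]
  have L' := M.toLab.relabel h1 h3 e1 e2 hat
  have T' : Term U z h' I' ℓ x := by
    refine ⟨M.mem, M.ne, fun i => ?_, fun i => ?_, fun i u hu hlu => ?_⟩
    · rw [(e2 _ (hz i)).1, M.home]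
    · rw [(e2 _ (hz i)).2, M.flags]
    · by_cases hq : u ∈ Q
      · rw [(e1 u hq).1] at hlu
        exact absurd hlu (hl i)
      · rw [(e2 u hq).1] at hlu
        exact M.unique i u hu hlu
  have := M.home_eq L' T' (by
    intro u hu
    by_cases hq : u ∈ Q
    · rw [(e1 u hq).1]
      exact hs u hq
    · rw [(e2 u hq).1]
      exact Or.inl subset_rfl)
  intro y hy
  rw [← this y (hQU hy), (e1 y hy).1]

/-- Flagged vertices lie on rungs. -/
theorem flag_rung (M : MinLab G U z h I ℓ x) {u : V} (hu : u ∈ U) {a : ℕ} (ha : a ∈ I u) :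
    u ∈ rungSet G U h I := by
  by_contra hur
  obtain ⟨b, hab, hh⟩ := Finset.exists_eq_pair (M.flag u hu a ha) (M.sub u hu ha)
  set B : Set V := {y | y ∈ U ∧ h y = {a, b} ∧ y ∉ rungSet G U h I} with hB
  set Q : Set V := {y | Conn G B u y} with hQ
  set N : Set V := {y | y ∈ U ∧ h y = {a, b} ∧ a ∉ I y} with hN
  have huB : u ∈ B := ⟨hu, hh, hur⟩
  have hQB : ∀ y ∈ Q, y ∈ B := fun y hy => Conn.right_mem hy
  have nob : ∀ y ∈ Q, ∀ s, b ∈ I s → ¬ Conn G (insert y N) y s := by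
    intro y hy s hs hc
    obtain ⟨T, hT, hp⟩ := hy
    obtain ⟨y', A, C, hsp, hy', hC⟩ := hp.last_hit (fun v => a ∈ I v) ⟨u, hp.start_mem, ha⟩
    have h2 := hT (hsp.left_sub hsp.left.end_mem)
    refine h2.2.2 (mem_rungSet_of_conn h2.1 h2.2.1 hy' hs ?_)
    have hCs : C ⊆ insert y' N := by
      intro v hv
      by_cases hva : a ∈ I v
      · exact Or.inl (hC v hv hva)
      · have h3 := hT (hsp.right_sub hv)
        exact Or.inr ⟨h3.1, h3.2.1, hva⟩
    refine (Conn.mono ⟨C, subset_rfl, hsp.right⟩ hCs).trans (hc.mono ?_)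
    intro v hv
    rcases hv with rfl | hv
    · exact hCs hsp.right.end_mem
    · exact Or.inr hv
  have hbQ : ∀ y ∈ Q, b ∉ I y := fun y hy hb => nob y hy y hb (Conn.refl (by simp))
  have := M.relabel_eq (Q := Q) (κ := {a}) (fun y hy => (hQB y hy).1) (by simp) (by simp)
    (fun i hi => (hQB _ hi).2.2 (M.mem_rungSet i)) (by
      intro i hi
      simp only [Finset.mem_singleton] at hi
      have : u = z i := M.unique i u hu (by rw [hh, hi]; simp)
      exact hur (this ▸ M.mem_rungSet i)) (by
      intro y hy
      left
      rw [(hQB y hy).2.1]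
      simp) (by
      intro y hy w hw hwQ hyw
      have hyh := (hQB y hy).2.1
      have hIy : ∀ c ∈ I y, c = a := by
        intro c hc
        have h1 := M.sub y (hQB y hy).1 hc
        rw [hyh] at h1
        simp only [Finset.mem_insert, Finset.mem_singleton] at h1
        rcases h1 with h1 | rfl
        · exact h1
        · exact absurd hc (hbQ y hy)
      rcases M.edge y (hQB y hy).1 w hw hyw with h1 | ⟨c, h1, h2⟩ | ⟨c, -, h2⟩ | ⟨c, h1, h2⟩ |
        h1 | h1
      · refine Or.inr (Or.inl ⟨a, ?_, rfl⟩)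
        by_contra haw
        have hwW : w ∈ rungSet G U h I := by
          by_contra hwW
          exact hwQ (Conn.tail hy hyw ⟨hw, h1.symm.trans hyh, hwW⟩)
        obtain ⟨T, r, s, R, hwT⟩ := Rung.of_mem_rungSet hwW (h1.symm.trans hyh)
        obtain ⟨A, C, hsp⟩ := R.path.split hwT
        refine nob y hy s R.fb (Conn.head (b := w) (by simp) hyw ⟨C, ?_, hsp.right⟩)
        intro v hv
        right
        refine ⟨R.sub (hsp.right_sub hv), R.home v (hsp.right_sub hv), fun hav => ?_⟩
        have := R.ua v (hsp.right_sub hv) hav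
        subst this
        have := hsp.mem_inter hsp.left.start_mem hv
        exact haw (this ▸ hav)
      · have := hIy c h1
        subst this
        exact Or.inr (Or.inl ⟨c, h2, rfl⟩)
      · exact absurd (hyh.symm.trans h2) (Finset.card_ne_one_of_pair hab)
      · rw [← hIy c h1]
        exact Or.inl h2
      · rw [hyh, Finset.card_pair hab] at h1
        omega
      · refine absurd ?_ (hbQ y hy)
        rw [h1.2.2, hyh]
        simp)
  have h1 := this u (Conn.refl huB)
  rw [hh] at h1
  exact Finset.card_ne_one_of_pair hab h1

theorem not_flag (M : MinLab G U z h I ℓ x) {u : V} (hu : u ∈ U) (hW : u ∉ rungSet G U h I) :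
    I u = ∅ := by
  by_contra hne
  obtain ⟨a, ha⟩ := Finset.nonempty_iff_ne_empty.2 hne
  exact hW (M.flag_rung hu ha)

theorem l_mem (M : MinLab G U z h I ℓ x) {u : V} (hu : u ∈ U) (hz : ∀ i, z i ≠ u) (i : Fin 3) :
    ℓ i ∉ h u := fun hi => hz i (M.unique i u hu hi).symm

/-- Every nonempty strip has a rung. -/
theorem exists_rung (M : MinLab G U z h I ℓ x) {u : V} (hu : u ∈ U) {a b : ℕ} (hab : a ≠ b)
    (hh : h u = {a, b}) : ∃ T r s, Rung G U h I a b T r s := by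
  by_contra hcon
  have hoff : ∀ y ∈ U, h y = {a, b} → y ∉ rungSet G U h I := by
    intro y hy hyh hyW
    obtain ⟨T, r, s, R, -⟩ := Rung.of_mem_rungSet hyW hyh
    exact hcon ⟨T, r, s, R⟩
  have hzu : ∀ i, ∀ y ∈ U, h y = {a, b} → z i ≠ y := by
    rintro i y hy hyh rfl
    exact hoff _ hy hyh (M.mem_rungSet i)
  have := M.relabel_eq (Q := {y | y ∈ U ∧ h y = {a, b}}) (κ := {a}) (fun y hy => hy.1)
    (by simp) (by simp) (fun i hi => hzu i _ hi.1 hi.2 rfl) (by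
      intro i hi
      simp only [Finset.mem_singleton] at hi
      exact M.l_mem hu (fun i => hzu i u hu hh) i (by rw [hh, hi]; simp)) (by
      rintro y ⟨hy, hyh⟩
      left
      rw [hyh]
      simp) (by
      rintro y ⟨hy, hyh⟩ w hw hwQ hyw
      have hI := M.not_flag hy (hoff y hy hyh)
      rcases M.edge y hy w hw hyw with h1 | ⟨c, h1, h2⟩ | ⟨c, -, h2⟩ | ⟨c, h1, h2⟩ |
        h1 | h1
      · exact absurd ⟨hw, h1.symm.trans hyh⟩ hwQ
      · simp [hI] at h1
      · exact absurd (hyh.symm.trans h2) (Finset.card_ne_one_of_pair hab)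
      · simp [hI] at h1
      · rw [hyh, Finset.card_pair hab] at h1
        omega
      · have h2 := h1.2.2
        rw [hI, hyh] at h2
        exact absurd h2.symm (by simp))
  have h1 := this u ⟨hu, hh⟩
  rw [hh] at h1
  exact Finset.card_ne_one_of_pair hab h1

/-- The strips along a used triangle are nonempty. -/
theorem exists_pair (M : MinLab G U z h I ℓ x) {u : V} (hu : u ∈ U) {a b c : ℕ} (hab : a ≠ b)
    (hac : a ≠ c) (hbc : b ≠ c) (hh : h u = {a, b, c}) : ∃ w ∈ U, h w = {b, c} := by
  by_contra! hcon
  have hc3 : ({a, b, c} : Finset ℕ).card = 3 := Finset.card_eq_three.2 ⟨a, b, c, hab, hac, hbc, rfl⟩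
  have hnz : ∀ y ∈ U, h y = {a, b, c} → ∀ i, z i ≠ y := by
    rintro y hy hyh i rfl
    have := hyh.symm.trans (M.home i)
    rw [this, Finset.card_pair (M.ne i)] at hc3
    omega
  have hIe : ∀ y ∈ U, h y = {a, b, c} → I y = ∅ := by
    intro y hy hyh
    by_contra hne
    obtain ⟨d, hd⟩ := Finset.nonempty_iff_ne_empty.2 hne
    have := M.flag y hy d hd
    rw [hyh] at this
    omega
  have := M.relabel_eq (Q := {y | y ∈ U ∧ h y = {a, b, c}}) (κ := {a}) (fun y hy => hy.1)
    (by simp) (by simp) (fun i hi => hnz _ hi.1 hi.2 i rfl) (by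
      intro i hi
      simp only [Finset.mem_singleton] at hi
      exact M.l_mem hu (hnz u hu hh) i (by rw [hh, hi]; simp)) (by
      rintro y ⟨hy, hyh⟩
      left
      rw [hyh]
      simp) (by
      rintro y ⟨hy, hyh⟩ w hw hwQ hyw
      have hI := hIe y hy hyh
      rcases M.edge y hy w hw hyw with h1 | ⟨d, h1, h2⟩ | ⟨d, -, h2⟩ | ⟨d, h1, h2⟩ |
        h1 | h1
      · exact absurd ⟨hw, h1.symm.trans hyh⟩ hwQ
      · simp [hI] at h1
      · rw [hyh] at h2
        rw [h2] at hc3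
        simp at hc3
      · simp [hI] at h1
      · obtain ⟨-, h4, h5⟩ := h1
        refine Or.inr (Or.inl ⟨a, ?_, rfl⟩)
        rw [h5]
        by_contra haw
        refine hcon w hw ?_
        have hne : I w ≠ ∅ := by
          rw [h5]
          intro he
          have := M.pos w hw
          rw [he] at this
          simp at this
        obtain ⟨d, hd⟩ := Finset.nonempty_iff_ne_empty.2 hne
        refine Finset.eq_of_subset_of_card_le ?_ ?_
        · intro e he
          have := h4 he
          rw [hyh] at this
          simp only [Finset.mem_insert, Finset.mem_singleton] at this ⊢
          rcases this with rfl | h6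
          · exact absurd he haw
          · exact h6
        · rw [M.flag w hw d hd, Finset.card_pair hbc]
      · have h2 := h1.2.2
        rw [hI, hyh] at h2
        exact absurd h2.symm (by simp))
  have h1 := this u ⟨hu, hh⟩
  rw [hh] at h1
  rw [h1] at hc3
  simp at hc3

/-- Any two nodes of a home are adjacent in the node graph. -/
theorem node_adj (M : MinLab G U z h I ℓ x) {u : V} (hu : u ∈ U) {a b : ℕ} (ha : a ∈ h u)
    (hb : b ∈ h u) (hab : a ≠ b) : (nodeGraph U h).Adj a b := by
  refine ⟨hab, ?_⟩
  have h1 := M.le u hu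
  have h2 : 2 ≤ (h u).card := by
    rw [← Finset.card_pair hab]
    exact Finset.card_le_card (by simp [Finset.insert_subset_iff, ha, hb])
  rcases (by omega : (h u).card = 2 ∨ (h u).card = 3) with h3 | h3
  · exact ⟨u, hu, Finset.eq_pair_of_mem h3 ha hb hab⟩
  · obtain ⟨p, q, hap, haq, hpq, he⟩ := Finset.exists_eq_triple h3 ha
    rw [he] at hb
    simp only [Finset.mem_insert, Finset.mem_singleton] at hb
    rcases hb with rfl | rfl | rfl
    · exact absurd rfl hab
    · exact M.exists_pair hu (a := q) (b := a) (c := b) haq.symm hpq.symm hap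
        (by rw [he]; ext; simp; tauto)
    · exact M.exists_pair hu (a := p) (b := a) (c := b) hap.symm hpq haq
        (by rw [he]; ext; simp; tauto)

/-- Off-rung vertices leaving their union only towards the node `x 0` live at that node. -/
theorem home_of_closed (M : MinLab G U z h I ℓ x) {Q : Set V} (hQU : Q ⊆ U)
    (hQW : ∀ y ∈ Q, y ∉ rungSet G U h I)
    (hat : ∀ y ∈ Q, ∀ w ∈ U, w ∉ Q → G.Adj y w → x 0 ∈ I w ∨ h w = {x 0}) :
    ∀ y ∈ Q, h y = {x 0} := by
  refine M.relabel_eq hQU (by simp) (by simp) (fun i hi => hQW _ hi (M.mem_rungSet i)) ?_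
    (fun y hy => Or.inr rfl) ?_
  · intro i hi
    simp only [Finset.mem_singleton] at hi
    exact M.l_ne_x i 0 hi
  · intro y hy w hw hwQ hyw
    rcases hat y hy w hw hwQ hyw with h1 | h1
    · exact Or.inr (Or.inl ⟨_, h1, rfl⟩)
    · exact Or.inl h1

/-- The nodes in use other than those of the first peripheral strip. -/
def inner (U : Set V) (h : V → Finset ℕ) (ℓ x : Fin 3 → ℕ) : Set ℕ :=
  {a | a ∈ usedNodes U h ∧ a ≠ x 0 ∧ a ≠ ℓ 0}

/-- No node separates a part of the node graph from the other two peripheral strips. -/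
theorem no_cut (M : MinLab G U z h I ℓ x) {c s : ℕ} (hc : c ∈ inner U h ℓ x)
    (hc1 : c ≠ ℓ 1) (hc2 : c ≠ ℓ 2) (hs : s ∈ inner U h ℓ x) (hsc : s ≠ c) :
    Conn (nodeGraph U h) (inner U h ℓ x \ {c}) s (ℓ 1) ∨
      Conn (nodeGraph U h) (inner U h ℓ x \ {c}) s (ℓ 2) := by
  classical
  by_contra! hcon
  set K := inner U h ℓ x \ {c} with hK
  set D : Set ℕ := {d | Conn (nodeGraph U h) K s d} with hD
  have hDK : ∀ d ∈ D, d ∈ K := fun d hd => Conn.right_mem hd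
  have hsD : s ∈ D := Conn.refl ⟨hs, hsc⟩
  have hcl : ∀ i, c ≠ ℓ i := by
    intro i
    fin_cases i
    · exact hc.2.2
    · exact hc1
    · exact hc2
  have hlD : ∀ i, ℓ i ∉ D := by
    intro i
    fin_cases i
    · exact fun h => (hDK _ h).1.2.2 rfl
    · exact hcon.1
    · exact hcon.2
  have hx0 : x 0 ∉ D := fun h => (hDK _ h).1.2.1 rfl
  have hxc : x 0 ≠ c := hc.2.1.symm
  have hzD : ∀ i, ∀ d ∈ h (z i), d ∉ D := by
    intro i d hd hdD
    rw [M.home i] at hd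
    simp only [Finset.mem_insert, Finset.mem_singleton] at hd
    rcases hd with rfl | rfl
    · exact hlD i hdD
    · have hi0 : i ≠ 0 := by
        rintro rfl
        exact hx0 hdD
      refine hlD i (Conn.tail hdD (M.node_adj (M.mem i) (a := x i) (b := ℓ i) ?_ ?_ ?_) ?_)
      · rw [M.home]; simp
      · rw [M.home]; simp
      · exact (M.ne i).symm
      · refine ⟨⟨⟨z i, M.mem i, by rw [M.home]; simp⟩, M.l_ne_x i 0, fun e => hi0 (M.l_inj e)⟩, ?_⟩
        exact (hcl i).symm
  have hsub : ∀ u ∈ U, (∃ d ∈ h u, d ∈ D) → ∀ y ∈ h u, y ∈ D ∨ y = c ∨ y = x 0 := by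
    rintro u hu ⟨d, hd, hdD⟩ y hy
    by_cases hyd : y = d
    · exact Or.inl (hyd ▸ hdD)
    by_cases hyc : y = c
    · tauto
    by_cases hyx : y = x 0
    · tauto
    left
    refine Conn.tail hdD (M.node_adj hu hd hy (Ne.symm hyd)) ⟨⟨⟨u, hu, hy⟩, hyx, ?_⟩, hyc⟩
    rintro rfl
    have := M.unique 0 u hu hy
    subst this
    exact hzD 0 d hd hdD
  set h' : V → Finset ℕ := fun u => if ∃ d ∈ h u, d ∈ D then {x 0, c} else h u with hh'
  set I' : V → Finset ℕ := fun u => if ∃ d ∈ h u, d ∈ D then I u ∩ {x 0, c} else I u with hI'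
  have e1 : ∀ u, (∃ d ∈ h u, d ∈ D) → h' u = {x 0, c} ∧ I' u = I u ∩ {x 0, c} :=
    fun u hu => by simp only [hh', hI', if_pos hu, and_self]
  have e2 : ∀ u, ¬ (∃ d ∈ h u, d ∈ D) → h' u = h u ∧ I' u = I u :=
    fun u hu => by simp only [hh', hI', if_neg hu, and_self]
  have hIsub : ∀ u, I' u ⊆ I u := by
    intro u
    by_cases hu : ∃ d ∈ h u, d ∈ D
    · rw [(e1 u hu).2]
      exact Finset.inter_subset_left
    · rw [(e2 u hu).2]
  have L' : Lab G U h' I' := by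
    have key : ∀ u ∈ U, ∀ w ∈ U, G.Adj u w → (∃ d ∈ h u, d ∈ D) → ¬ (∃ d ∈ h w, d ∈ D) →
        LinkOK h' I' u w := by
      intro u hu w hw huw hud hwd
      have hin : ∀ a ∈ h u, a ∈ h w → a ∈ ({x 0, c} : Finset ℕ) := by
        intro a hau haw
        have := hsub u hu hud a hau
        have h2 : a ∉ D := fun h3 => hwd ⟨a, haw, h3⟩
        simp only [Finset.mem_insert, Finset.mem_singleton]
        tauto
      unfold LinkOK
      rw [(e1 u hud).1, (e1 u hud).2, (e2 w hwd).1, (e2 w hwd).2]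
      rcases M.edge u hu w hw huw with h1 | ⟨a, h1, h2⟩ | ⟨a, h1, h2⟩ | ⟨a, h1, h2⟩ | h1 | h1
      · rw [h1] at hud
        exact absurd hud hwd
      · exact Or.inr (Or.inl ⟨a, Finset.mem_inter.2 ⟨h1, hin a (M.sub u hu h1)
          (M.sub w hw h2)⟩, h2⟩)
      · obtain ⟨d, hd, hdD⟩ := hud
        rw [h2, Finset.mem_singleton] at hd
        subst hd
        exact absurd ⟨d, M.sub w hw h1, hdD⟩ hwd
      · refine Or.inr (Or.inr (Or.inr (Or.inl ⟨a, Finset.mem_inter.2 ⟨h1, hin a (M.sub u hu h1)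
          (by rw [h2]; simp)⟩, h2⟩)))
      · left
        obtain ⟨-, h4, h5⟩ := h1
        obtain ⟨d, hd⟩ := Finset.card_pos.1 (M.pos w hw)
        symm
        refine Finset.eq_of_subset_of_card_le (fun a ha => hin a (h4 ha) ha) ?_
        rw [M.flag w hw d (h5 ▸ hd), Finset.card_pair hxc]
      · obtain ⟨d, hd, hdD⟩ := hud
        exact absurd ⟨d, h1.2.1 hd, hdD⟩ hwd
    constructor
    · intro u hu
      by_cases hud : ∃ d ∈ h u, d ∈ D
      · rw [(e1 u hud).1, (e1 u hud).2]
        exact Finset.inter_subset_right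
      · rw [(e2 u hud).1, (e2 u hud).2]
        exact M.sub u hu
    · intro u hu
      by_cases hud : ∃ d ∈ h u, d ∈ D
      · rw [(e1 u hud).1, Finset.card_pair hxc]
        omega
      · rw [(e2 u hud).1]
        exact M.pos u hu
    · intro u hu
      by_cases hud : ∃ d ∈ h u, d ∈ D
      · rw [(e1 u hud).1, Finset.card_pair hxc]
        omega
      · rw [(e2 u hud).1]
        exact M.le u hu
    · intro u hu a ha
      by_cases hud : ∃ d ∈ h u, d ∈ D
      · rw [(e1 u hud).1, Finset.card_pair hxc]
      · rw [(e2 u hud).1]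
        exact M.flag u hu a (hIsub u ha)
    · intro u hu w hw a hau haw hne
      refine M.complete u hu w hw a (hIsub u hau) (hIsub w haw) ?_
      intro he
      by_cases hud : ∃ d ∈ h u, d ∈ D
      · exact hne ((e1 u hud).1.trans (e1 w (he ▸ hud)).1.symm)
      · exact hne (by rw [(e2 u hud).1, (e2 w (he ▸ hud)).1, he])
    · intro u hu w hw huw
      by_cases hud : ∃ d ∈ h u, d ∈ D
      · by_cases hwd : ∃ d ∈ h w, d ∈ D
        · exact Or.inl ((e1 u hud).1.trans (e1 w hwd).1.symm)
        · exact key u hu w hw huw hud hwd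
      · by_cases hwd : ∃ d ∈ h w, d ∈ D
        · exact (key w hw u hu huw.symm hwd hud).symm
        · have := M.edge u hu w hw huw
          unfold LinkOK at *
          rwa [(e2 u hud).1, (e2 u hud).2, (e2 w hwd).1, (e2 w hwd).2]
  have T' : Term U z h' I' ℓ x := by
    have hz : ∀ i, ¬ ∃ d ∈ h (z i), d ∈ D := by
      rintro i ⟨d, hd, hdD⟩
      exact hzD i d hd hdD
    refine ⟨M.mem, M.ne, fun i => ?_, fun i => ?_, fun i u hu hlu => ?_⟩
    · rw [(e2 _ (hz i)).1, M.home]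
    · rw [(e2 _ (hz i)).2, M.flags]
    · by_cases hud : ∃ d ∈ h u, d ∈ D
      · rw [(e1 u hud).1] at hlu
        simp only [Finset.mem_insert, Finset.mem_singleton] at hlu
        rcases hlu with h1 | h1
        · exact absurd h1 (M.l_ne_x i 0)
        · exact absurd h1.symm (hcl i)
      · rw [(e2 u hud).1] at hlu
        exact M.unique i u hu hlu
  have := M.used_eq L' T' (by
    rintro a ⟨u, hu, ha⟩
    by_cases hud : ∃ d ∈ h u, d ∈ D
    · rw [(e1 u hud).1] at ha
      simp only [Finset.mem_insert, Finset.mem_singleton] at ha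
      rcases ha with rfl | rfl
      · exact ⟨z 0, M.mem 0, by rw [M.home]; simp⟩
      · exact hc.1
    · rw [(e2 u hud).1] at ha
      exact ⟨u, hu, ha⟩)
  obtain ⟨u, hu, hsu⟩ := this hs.1
  by_cases hud : ∃ d ∈ h u, d ∈ D
  · rw [(e1 u hud).1] at hsu
    simp only [Finset.mem_insert, Finset.mem_singleton] at hsu
    rcases hsu with h1 | h1
    · exact hs.2.1 h1
    · exact hsc h1
  · rw [(e2 u hud).1] at hsu
    exact hud ⟨s, hsu, hsD⟩

end MinLab

end Minimal

section Hub

variable {V : Type*}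

/-- Off-rung vertices whose home is not the node `o`. -/
def freeJunk (G : SimpleGraph V) (U : Set V) (h I : V → Finset ℕ) (o : ℕ) : Set V :=
  {f | f ∈ U ∧ f ∉ rungSet G U h I ∧ h f ≠ {o}}

/-- The vertices reachable from the new vertex `v` through off-rung vertices. -/
def hub (G : SimpleGraph V) (U : Set V) (h I : V → Finset ℕ) (o : ℕ) (v : V) : Set V :=
  {f | Conn G (insert v (freeJunk G U h I o)) v f}

/-- The on-rung vertices adjacent to the hub. -/
def touch (G : SimpleGraph V) (U : Set V) (h I : V → Finset ℕ) (o : ℕ) (v : V) : Set V :=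
  {w | w ∈ rungSet G U h I ∧ ∃ f ∈ hub G U h I o v, G.Adj f w}

theorem Lab.adj_rung {G : SimpleGraph V} {U : Set V} {h I : V → Finset ℕ} (L : Lab G U h I)
    {u w : V} (hu : u ∈ rungSet G U h I) (hw : w ∈ rungSet G U h I) (ha : G.Adj u w) :
    h u = h w ∨ ∃ a, a ∈ I u ∧ a ∈ I w := by
  have h1 := L.card_rung hu
  have h2 := L.card_rung hw
  rcases L.edge u (rungSet_sub hu) w (rungSet_sub hw) ha with h | h | ⟨a, -, h⟩ | ⟨a, -, h⟩ |
    h | h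
  · exact Or.inl h
  · exact Or.inr h
  · rw [h, Finset.card_singleton] at h1; omega
  · rw [h, Finset.card_singleton] at h2; omega
  · omega
  · omega

/-- On-rung vertices attached to the same home are adjacent unless they share a strip. -/
theorem Lab.adj_of_attach {G : SimpleGraph V} {U : Set V} {h I : V → Finset ℕ} (L : Lab G U h I)
    {u w : V} (hu : u ∈ rungSet G U h I) (hw : w ∈ rungSet G U h I) {κ : Finset ℕ}
    (au : Attach h I κ u) (aw : Attach h I κ w) (hne : h u ≠ h w) : G.Adj u w := by
  have h1 := L.card_rung hu
  have h2 := L.card_rung hw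
  rcases au with e1 | ⟨a, e1, e2⟩ | ⟨e1, e2, e3⟩ <;> rcases aw with f1 | ⟨b, f1, f2⟩ | ⟨f1, f2, f3⟩
  · exact absurd (e1.trans f1.symm) hne
  · rw [e1, f2, Finset.card_singleton] at h1; omega
  · rw [← e1] at f1; omega
  · rw [f1, e2, Finset.card_singleton] at h2; omega
  · rw [e2] at f2
    have := Finset.singleton_injective f2
    subst this
    exact L.complete u (rungSet_sub hu) w (rungSet_sub hw) a e1 f1 hne
  · rw [e2, Finset.card_singleton] at f1; omega
  · rw [← f1] at e1; omega
  · rw [f2, Finset.card_singleton] at e1; omega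
  · have h3 : (h u ∪ h w).card ≤ 3 := e1 ▸ Finset.card_le_card (Finset.union_subset e2 f2)
    have h4 := Finset.card_union_add_card_inter (h u) (h w)
    obtain ⟨a, ha⟩ := Finset.card_pos.1 (by omega : 0 < (h u ∩ h w).card)
    rw [Finset.mem_inter] at ha
    exact L.complete u (rungSet_sub hu) w (rungSet_sub hw) a (e3 ▸ ha.1) (f3 ▸ ha.2) hne

theorem Lab.attach_rung {G : SimpleGraph V} {U : Set V} {h I : V → Finset ℕ} (L : Lab G U h I)
    {f w : V} (hf : f ∈ U) (hI : I f = ∅) (hw : w ∈ rungSet G U h I) (ha : G.Adj f w) :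
    Attach h I (h f) w := by
  have h2 := L.card_rung hw
  rcases L.edge f hf w (rungSet_sub hw) ha with h | ⟨a, h, -⟩ | h | ⟨a, h, -⟩ | h | h
  · exact Or.inl h.symm
  · simp [hI] at h
  · exact Or.inr (Or.inl h)
  · simp [hI] at h
  · exact Or.inr (Or.inr h)
  · omega

variable [Fintype V] {G : SimpleGraph V} {U : Set V} {z : Fin 3 → V} {h I : V → Finset ℕ}
  {ℓ x : Fin 3 → ℕ}

theorem MinLab.junk_adj (M : MinLab G U z h I ℓ x) {f g : V} (hf : f ∈ U)
    (hf' : f ∉ rungSet G U h I) (hg : g ∈ U) (hg' : g ∉ rungSet G U h I) (ha : G.Adj f g) :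
    h f = h g := by
  have h1 := M.not_flag hf hf'
  have h2 := M.not_flag hg hg'
  rcases M.edge f hf g hg ha with h | ⟨a, h, -⟩ | ⟨a, h, -⟩ | ⟨a, h, -⟩ | ⟨-, -, h⟩ | ⟨-, -, h⟩
  · exact h
  · simp [h1] at h
  · simp [h2] at h
  · simp [h1] at h
  · have := M.pos g hg
    rw [← h, h2] at this
    simp at this
  · have := M.pos f hf
    rw [← h, h1] at this
    simp at this

theorem MinLab.flag_pair (M : MinLab G U z h I ℓ x) {w : V} (hw : w ∈ U) {a : ℕ}
    (ha : a ∈ I w) : ∃ b, a ≠ b ∧ h w = {a, b} :=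
  Finset.exists_eq_pair (M.flag w hw a ha) (M.sub w hw ha)

theorem MinLab.rung_pair (M : MinLab G U z h I ℓ x) {w : V} (hw : w ∈ rungSet G U h I) {a : ℕ}
    (ha : a ∈ h w) : ∃ b, a ≠ b ∧ h w = {a, b} :=
  Finset.exists_eq_pair (M.card_rung hw) ha

theorem MinLab.not_home_singleton (M : MinLab G U z h I ℓ x) {w : V}
    (hw : w ∈ rungSet G U h I) {a : ℕ} : h w ≠ {a} := by
  intro he
  have := M.card_rung hw
  rw [he, Finset.card_singleton] at this
  omega

/-- Continue a rung by a path through later strips. -/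
theorem MinLab.rung_append (M : MinLab G U z h I ℓ x) {s t : ℕ} {T B T' : Set V} {r r' q e : V}
    (R : Rung G U h I t s T r r') (hB : IPath G q B r') (hBT : B ⊆ T) (hT' : IPath G r' T' e)
    {S : Set ℕ} (ht : t ∉ S)
    (hh : ∀ u ∈ T', u = r' ∨ (u ∈ rungSet G U h I ∧ ∀ a ∈ h u, a ∈ S)) :
    IPath G q (B ∪ T') e := by
  refine hB.append hT' ?_
  intro u hu y hy huy
  rcases hh y hy with rfl | ⟨hyW, hyS⟩
  · exact Or.inr rfl
  · have huh := R.home u (hBT hu)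
    have hne : h u ≠ h y := by
      intro he
      exact ht (hyS t (by rw [← he, huh]; simp))
    rcases huy with rfl | huy
    · exact absurd rfl hne
    rcases M.adj_rung (R.mem_rungSet (hBT hu)) hyW huy with h1 | ⟨a, h1, h2⟩
    · exact absurd h1 hne
    · have h3 := M.sub u (R.sub (hBT hu)) h1
      have h4 := hyS a (M.sub y (rungSet_sub hyW) h2)
      rw [huh] at h3
      simp only [Finset.mem_insert, Finset.mem_singleton] at h3
      rcases h3 with rfl | rfl
      · exact absurd h4 ht
      · exact Or.inl (R.ub u (hBT hu) h1)

/-- Follow a path of the node graph towards a peripheral vertex. -/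
theorem MinLab.exists_leg (M : MinLab G U z h I ℓ x) {s : ℕ} {S : Set ℕ} {i : Fin 3}
    (hS : IPath (nodeGraph U h) s S (ℓ i)) {r : V} (hr : r ∈ U) (hs : s ∈ I r)
    (hrS : ∀ a ∈ h r, a ∈ S → a = s) :
    ∃ T, IPath G r T (z i) ∧
      ∀ u ∈ T, u = r ∨ (u ∈ rungSet G U h I ∧ ∀ a ∈ h u, a ∈ S) := by
  generalize hl : ℓ i = l at hS
  induction hS generalizing r with
  | single s =>
    subst hl
    have := M.unique i r hr (M.sub r hr hs)
    subst this
    exact ⟨_, .single _, fun u hu => Or.inl hu⟩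
  | @cons s s' e S' h1 h2 h3 h4 ih =>
    obtain ⟨hne, w, hw, hhw⟩ := h2
    obtain ⟨T, r1, r2, R⟩ := M.exists_rung hw hne hhw
    have hr2 := R.home r2 R.path.end_mem
    obtain ⟨T', hT', hh⟩ := ih (r := r2) (R.sub R.path.end_mem) R.fb (by
      intro a ha haS
      rw [hr2] at ha
      simp only [Finset.mem_insert, Finset.mem_singleton] at ha
      rcases ha with rfl | ha
      · exact absurd haS h1
      · exact ha) hl
    have hp := M.rung_append R R.path subset_rfl hT' h1 hh
    have hall : ∀ u ∈ T ∪ T', u ∈ rungSet G U h I ∧ ∀ a ∈ h u, a ∈ insert s S' := by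
      have hTT : ∀ u ∈ T, u ∈ rungSet G U h I ∧ ∀ a ∈ h u, a ∈ insert s S' := by
        intro u hu
        refine ⟨R.mem_rungSet hu, fun a ha => ?_⟩
        rw [R.home u hu] at ha
        simp only [Finset.mem_insert, Finset.mem_singleton] at ha
        rcases ha with rfl | rfl
        · exact Or.inl rfl
        · exact Or.inr h4.start_mem
      rintro u (hu | hu)
      · exact hTT u hu
      · rcases hh u hu with rfl | ⟨h5, h6⟩
        · exact hTT _ R.path.end_mem
        · exact ⟨h5, fun a ha => Or.inr (h6 a ha)⟩
    have hr2' := M.flag r hr s hs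
    have hne' : ∀ u ∈ T ∪ T', h u ≠ h r := by
      intro u hu he
      have : h r ⊆ {s} := by
        intro a ha
        rw [Finset.mem_singleton]
        exact hrS a ha ((hall u hu).2 a (he ▸ ha))
      have := Finset.card_le_card this
      rw [Finset.card_singleton] at this
      omega
    have hr1 : s ∈ I r1 := R.fa
    refine ⟨insert r (T ∪ T'), .cons (fun hu => hne' r hu rfl) (b := r1) ?_ ?_ hp, ?_⟩
    · exact M.complete r hr r1 (R.sub R.path.start_mem) s hs hr1
        (hne' r1 (Or.inl R.path.start_mem)).symm
    · intro y hy hry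
      rcases M.adj_rung (M.flag_rung hr hs) (hall y hy).1 hry with h5 | ⟨a, h5, h6⟩
      · exact absurd h5.symm (hne' y hy)
      · have hyU := rungSet_sub (hall y hy).1
        have := hrS a (M.sub r hr h5) ((hall y hy).2 a (M.sub y hyU h6))
        subst this
        rcases hy with hy | hy
        · exact R.ua y hy h6
        · rcases hh y hy with rfl | ⟨h7, h8⟩
          · exact R.ua _ R.path.end_mem h6
          · exact absurd (h8 a (M.sub y hyU h6)) h1
    · rintro u (rfl | hu)
      · exact Or.inl rfl
      · exact Or.inr (hall u hu)

/-- Follow a path of the node graph, starting with a rung. -/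
theorem MinLab.exists_leg_inside (M : MinLab G U z h I ℓ x) {s : ℕ} {S : Set ℕ} {i : Fin 3}
    (hS : IPath (nodeGraph U h) s S (ℓ i)) (hsl : s ≠ ℓ i) :
    ∃ r T, IPath G r T (z i) ∧ s ∈ I r ∧
      ∀ u ∈ T, u ∈ rungSet G U h I ∧ (∀ a ∈ h u, a ∈ S) ∧ (s ∈ I u → u = r) := by
  generalize hl : ℓ i = l at hS
  cases hS with
  | single s => exact absurd hl.symm hsl
  | @cons s s' e S' h1 h2 h3 h4 =>
    subst hl
    obtain ⟨hne, w, hw, hhw⟩ := h2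
    obtain ⟨T, r1, r2, R⟩ := M.exists_rung hw hne hhw
    have hr2 := R.home r2 R.path.end_mem
    obtain ⟨T', hT', hh⟩ := M.exists_leg h4 (r := r2) (R.sub R.path.end_mem) R.fb (by
      intro a ha haS
      rw [hr2] at ha
      simp only [Finset.mem_insert, Finset.mem_singleton] at ha
      rcases ha with rfl | ha
      · exact absurd haS h1
      · exact ha)
    have hTT : ∀ u ∈ T, u ∈ rungSet G U h I ∧ (∀ a ∈ h u, a ∈ insert s S') ∧
        (s ∈ I u → u = r1) := by
      intro u hu
      refine ⟨R.mem_rungSet hu, fun a ha => ?_, R.ua u hu⟩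
      rw [R.home u hu] at ha
      simp only [Finset.mem_insert, Finset.mem_singleton] at ha
      rcases ha with rfl | rfl
      · exact Or.inl rfl
      · exact Or.inr h4.start_mem
    refine ⟨r1, T ∪ T', M.rung_append R R.path subset_rfl hT' h1 hh, R.fa, ?_⟩
    rintro u (hu | hu)
    · exact hTT u hu
    · rcases hh u hu with rfl | ⟨h5, h6⟩
      · exact hTT _ R.path.end_mem
      · exact ⟨h5, fun a ha => Or.inr (h6 a ha),
          fun hsu => absurd (h6 s (M.sub u (rungSet_sub h5) hsu)) h1⟩

/-- From an on-rung vertex of the strip `{s, t}`, leave through `s` and follow `S`. -/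
theorem MinLab.exists_route (M : MinLab G U z h I ℓ x) {s t : ℕ} {S : Set ℕ} {i : Fin 3}
    (hS : IPath (nodeGraph U h) s S (ℓ i)) (ht : t ∉ S) {q : V} (hq : q ∈ rungSet G U h I)
    (hqh : h q = {s, t}) :
    ∃ T, IPath G q T (z i) ∧ ∀ u ∈ T, u ∈ rungSet G U h I ∧
      ((∀ a ∈ h u, a ∈ S) ∨ (h u = {s, t} ∧ (t ∈ I u → u = q))) := by
  obtain ⟨T, r, r', R, hqT⟩ := Rung.of_mem_rungSet hq (hqh.trans (Finset.pair_comm _ _))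
  obtain ⟨A, B, hsp⟩ := R.path.split hqT
  have hr := R.home r' R.path.end_mem
  obtain ⟨T', hT', hh⟩ := M.exists_leg hS (r := r') (R.sub R.path.end_mem) R.fb (by
    intro a ha haS
    rw [hr] at ha
    simp only [Finset.mem_insert, Finset.mem_singleton] at ha
    rcases ha with rfl | ha
    · exact absurd haS ht
    · exact ha)
  have hBB : ∀ u ∈ B, u ∈ rungSet G U h I ∧
      ((∀ a ∈ h u, a ∈ S) ∨ (h u = {s, t} ∧ (t ∈ I u → u = q))) := by
    intro u hu
    have huT := hsp.right_sub hu
    refine ⟨R.mem_rungSet huT, Or.inr ⟨(R.home u huT).trans (Finset.pair_comm _ _), fun htu => ?_⟩⟩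
    have := R.ua u huT htu
    subst this
    exact hsp.mem_inter hsp.left.start_mem hu
  refine ⟨B ∪ T', M.rung_append R hsp.right hsp.right_sub hT' ht hh, ?_⟩
  rintro u (hu | hu)
  · exact hBB u hu
  · rcases hh u hu with rfl | ⟨h1, h2⟩
    · exact hBB _ hsp.right.end_mem
    · exact ⟨h1, Or.inl h2⟩

end Hub

section Tails

variable {V : Type*}

/-- The vertices adjacent to the hub that are on rungs but not flagged at `o`. -/
def goodTouch (G : SimpleGraph V) (U : Set V) (h I : V → Finset ℕ) (o : ℕ) (v : V) : Set V :=
  {p | p ∈ touch G U h I o v ∧ o ∉ I p}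

/-- An induced path along rungs to a peripheral vertex that meets the neighbourhood of the hub
and the interface at `o` at most in its first vertex. -/
structure Tail (G : SimpleGraph V) (U : Set V) (h I : V → Finset ℕ) (o : ℕ) (v p : V)
    (T : Set V) (e : V) : Prop where
  path : IPath G p T e
  rung : T ⊆ rungSet G U h I
  flag : ∀ u ∈ T, o ∈ I u → u = p
  touch : ∀ u ∈ T, u ∈ touch G U h I o v → u = p

variable [Fintype V]

/-- A minimal labeling of `U` together with a new vertex `v` adjacent to the anchor `z 0`. -/
structure Ctx (G : SimpleGraph V) (U : Set V) (z : Fin 3 → V) (h I : V → Finset ℕ)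
    (ℓ x : Fin 3 → ℕ) (v : V) : Prop extends MinLab G U z h I ℓ x where
  notin : v ∉ U
  adj0 : G.Adj v (z 0)
  nadj : ∀ i, i ≠ 0 → ¬ G.Adj (z 0) (z i)
  noclaw : ∀ i j, i ≠ 0 → j ≠ 0 → i ≠ j → ¬ Claw3 G (insert v U) (z 0) (z i) (z j)

/-- An off-rung path reaches on-rung vertices through its common home. -/
theorem MinLab.attach_of_path {G : SimpleGraph V} {U : Set V} {z : Fin 3 → V}
    {h I : V → Finset ℕ} {ℓ x : Fin 3 → ℕ} (M : MinLab G U z h I ℓ x) {f p : V} {B : Set V}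
    (hB : IPath G f B p) (hJ : ∀ y ∈ B, y = p ∨ (y ∈ U ∧ y ∉ rungSet G U h I))
    (hp : p ∈ rungSet G U h I) (hfp : f ≠ p) : Attach h I (h f) p := by
  induction hB with
  | single => exact absurd rfl hfp
  | @cons f b p T h1 h2 h3 h4 ih =>
    have hf := (hJ f (by simp)).resolve_left hfp
    by_cases hbp : b = p
    · subst hbp
      exact M.attach_rung hf.1 (M.not_flag hf.1 hf.2) hp h2
    · have hb := (hJ b (Or.inr h4.start_mem)).resolve_left hbp
      rw [M.junk_adj hf.1 hf.2 hb.1 hb.2 h2]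
      exact ih (fun y hy => hJ y (Or.inr hy)) hp hbp

namespace Ctx

variable {G : SimpleGraph V} {U : Set V} {z : Fin 3 → V} {h I : V → Finset ℕ}
  {ℓ x : Fin 3 → ℕ} {v : V}

local notation "𝓦" => rungSet G U h I
local notation "𝓕" => hub G U h I (x 0) v
local notation "𝓧" => touch G U h I (x 0) v
local notation "𝓟" => goodTouch G U h I (x 0) v

theorem hub_cases {f : V} (hf : f ∈ 𝓕) (hv : f ≠ v) : f ∈ freeJunk G U h I (x 0) :=
  (Conn.right_mem hf).resolve_left hv

theorem v_mem_hub : v ∈ 𝓕 := Conn.refl (Or.inl rfl)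

theorem hub_step {f g : V} (hf : f ∈ 𝓕) (hg : g ∈ freeJunk G U h I (x 0)) (ha : G.Adj f g) :
    g ∈ 𝓕 := Conn.tail hf ha (Or.inr hg)

theorem hub_conn {f : V} (hf : f ∈ 𝓕) : Conn G 𝓕 v f := by
  obtain ⟨T, hT, hp⟩ := hf
  exact ⟨T, fun y hy => (hp.conn_mem hy).mono hT, hp⟩

theorem notin_rung (C : Ctx G U z h I ℓ x v) : v ∉ 𝓦 := fun hv => C.notin (rungSet_sub hv)

theorem hub_not_rung (C : Ctx G U z h I ℓ x v) {f : V} (hf : f ∈ 𝓕) : f ∉ 𝓦 := by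
  by_cases hv : f = v
  · subst hv
    exact C.notin_rung
  · exact (hub_cases hf hv).2.1

theorem hub_sub {f : V} (hf : f ∈ 𝓕) : f ∈ insert v U := by
  by_cases hv : f = v
  · exact Or.inl hv
  · exact Or.inr (hub_cases hf hv).1

theorem anchor_adj (C : Ctx G U z h I ℓ x v) {w : V} (hw : w ∈ U) (ha : G.Adj (z 0) w) :
    x 0 ∈ I w ∨ h w = {x 0} := by
  have hl : ℓ 0 ∉ h w := fun hl => by
    have := C.unique 0 w hw hl
    subst this
    exact G.loopless.irrefl _ ha
  have hl0 : ℓ 0 ∈ h (z 0) := by rw [C.home]; simp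
  rcases C.edge _ (C.mem 0) w hw ha with h1 | ⟨a, h1, h2⟩ | ⟨a, h1, h2⟩ | ⟨a, h1, h2⟩ |
    h1 | h1
  · exact absurd (h1 ▸ hl0) hl
  · rw [C.flags] at h1
    simp only [Finset.mem_insert, Finset.mem_singleton] at h1
    rcases h1 with rfl | rfl
    · exact absurd (C.sub w hw h2) hl
    · exact Or.inl h2
  · exact absurd (h2 ▸ hl0 : ℓ 0 ∈ ({a} : Finset ℕ)) (by
      rw [Finset.mem_singleton]
      rintro rfl
      exact hl (C.sub w hw h1))
  · rw [C.flags] at h1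
    simp only [Finset.mem_insert, Finset.mem_singleton] at h1
    rcases h1 with rfl | rfl
    · exact absurd (h2 ▸ Finset.mem_singleton_self _) hl
    · exact Or.inr h2
  · rw [C.home, Finset.card_pair (C.ne 0)] at h1
    omega
  · exact absurd (h1.2.1 hl0) hl

theorem anchor_not_adj_hub (C : Ctx G U z h I ℓ x v) {f : V} (hf : f ∈ 𝓕) (hv : f ≠ v) :
    ¬ G.Adj (z 0) f := by
  intro ha
  obtain ⟨h1, h2, h3⟩ := hub_cases hf hv
  rcases C.anchor_adj h1 ha with h4 | h4
  · rw [C.not_flag h1 h2] at h4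
    simp at h4
  · exact h3 h4

theorem anchor_not_hub (C : Ctx G U z h I ℓ x v) : z 0 ∉ 𝓕 := fun hh =>
  C.hub_not_rung hh (C.mem_rungSet 0)

theorem anchor_adj_rung (C : Ctx G U z h I ℓ x v) {w : V} (hw : w ∈ 𝓦) (ha : G.Adj (z 0) w) :
    x 0 ∈ I w := by
  rcases C.anchor_adj (rungSet_sub hw) ha with h1 | h1
  · exact h1
  · exact absurd h1 (C.not_home_singleton hw)

theorem ne_anchor {p : V} (C : Ctx G U z h I ℓ x v) (hp : p ∈ 𝓟) : p ≠ z 0 := by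
  rintro rfl
  refine hp.2 ?_
  rw [C.flags]
  simp

/-- Every off-rung hub vertex reaches a good vertex inside its home. -/
theorem hub_touch (C : Ctx G U z h I ℓ x v) {f : V} (hf : f ∈ 𝓕) (hv : f ≠ v) :
    ∃ g ∈ 𝓕, g ≠ v ∧ h g = h f ∧ Conn G (𝓕 \ {v}) f g ∧ ∃ p ∈ 𝓟, G.Adj g p := by
  by_contra! hcon
  set Q : Set V := {g | Conn G (𝓕 \ {v}) f g} with hQ
  have hQF : ∀ g ∈ Q, g ∈ 𝓕 ∧ g ≠ v := fun g hg =>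
    (Conn.right_mem (show Conn G (𝓕 \ {v}) f g from hg) : g ∈ 𝓕 \ {v})
  have hhome : ∀ g ∈ Q, h g = h f := by
    intro g hg
    refine (hg.closed (P := {y | y ∈ 𝓕 \ {v} ∧ h y = h f}) ⟨⟨hf, hv⟩, rfl⟩ ?_).2
    rintro a ⟨⟨ha1, ha2⟩, ha3⟩ b ⟨hb1, hb2⟩ hab
    have h1 := hub_cases ha1 ha2
    have h2 := hub_cases hb1 hb2
    exact ⟨⟨hb1, hb2⟩, (C.junk_adj h1.1 h1.2.1 h2.1 h2.2.1 hab).symm.trans ha3⟩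
  have := C.home_of_closed (Q := Q) (fun g hg => (hub_cases (hQF g hg).1 (hQF g hg).2).1)
    (fun g hg => (hub_cases (hQF g hg).1 (hQF g hg).2).2.1) (by
      intro y hy w hw hwQ hyw
      by_cases hwW : w ∈ 𝓦
      · left
        by_contra hx
        exact hcon y (hQF y hy).1 (hQF y hy).2 (hhome y hy) hy w
          ⟨⟨hwW, y, (hQF y hy).1, hyw⟩, hx⟩ hyw
      · right
        by_contra hx
        have hw' := hub_step (hQF y hy).1 ⟨hw, hwW, hx⟩ hyw
        refine hwQ (Conn.tail hy hyw ⟨hw', ?_⟩)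
        rintro rfl
        exact C.notin hw)
  exact (hub_cases hf hv).2.2 (this f (Conn.refl ⟨hf, hv⟩))

/-- The anchor reaches every neighbour of the hub through the hub. -/
theorem anchor_conn {p : V} (C : Ctx G U z h I ℓ x v) (hp : p ∈ 𝓧) {S : Set V} (hS : 𝓕 ⊆ S)
    (h0 : z 0 ∈ S) (hpS : p ∈ S) : Conn G S (z 0) p := by
  obtain ⟨-, f, hf, hfp⟩ := hp
  exact Conn.head h0 C.adj0.symm (((hub_conn hf).mono hS).tail hfp hpS)

theorem tail_sep (C : Ctx G U z h I ℓ x v) {p e : V} {T : Set V}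
    (hT : Tail G U h I (x 0) v p T e) : SepAt G p T (insert (z 0) (insert p 𝓕)) := by
  rintro u hu y (rfl | rfl | hy) huy
  · left
    apply hT.flag u hu
    rcases huy with rfl | huy
    · rw [C.flags]; simp
    · exact C.anchor_adj_rung (hT.rung hu) huy.symm
  · exact Or.inr rfl
  · rcases huy with rfl | huy
    · exact absurd (hT.rung hu) (C.hub_not_rung hy)
    · exact Or.inl (hT.touch u hu ⟨hT.rung hu, y, hy, huy.symm⟩)

theorem Tail.sub {p e : V} {T : Set V} (hT : Tail G U h I (x 0) v p T e) : T ⊆ insert v U :=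
  fun _ hu => Or.inr (rungSet_sub (hT.rung hu))

/-- Two anticomplete tails to distinct peripheral vertices start in a common strip and are
joined through the hub. -/
theorem two_tails (C : Ctx G U z h I ℓ x v) {i j : Fin 3} (hi : i ≠ 0) (hj : j ≠ 0)
    (hij : i ≠ j) {p q : V} {A B : Set V} (hA : Tail G U h I (x 0) v p A (z i))
    (hB : Tail G U h I (x 0) v q B (z j)) (hAB : Apart G A B) (hp : p ∈ 𝓟) (hq : q ∈ 𝓟) :
    h p = h q ∧ ∃ T, IPath G p T q ∧ ∀ u ∈ T, u = p ∨ u = q ∨ (u ∈ 𝓕 ∧ u ≠ v) := by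
  have hpq := hAB p hA.path.start_mem q hB.path.start_mem
  set S : Set V := insert (z 0) (insert p (insert q 𝓕)) with hS
  have hFS : 𝓕 ⊆ S := fun y hy => Or.inr (Or.inr (Or.inr hy))
  have hpS : p ∈ S := Or.inr (Or.inl rfl)
  have hqS : q ∈ S := Or.inr (Or.inr (Or.inl rfl))
  have hzS : z 0 ∈ S := Or.inl rfl
  have hSU : S ⊆ insert v U := by
    rintro y (rfl | rfl | rfl | hy)
    · exact Or.inr (C.mem 0)
    · exact Tail.sub hA hA.path.start_mem
    · exact Tail.sub hB hB.path.start_mem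
    · exact hub_sub hy
  have sA : SepAt G p A S := by
    rintro u hu y (rfl | rfl | rfl | hy) huy
    · exact C.tail_sep hA u hu _ (Or.inl rfl) huy
    · exact Or.inr rfl
    · have := hAB u hu _ hB.path.start_mem
      tauto
    · exact C.tail_sep hA u hu y (Or.inr (Or.inr hy)) huy
  have sB : SepAt G q B (S ∪ A) := by
    rintro u hu y ((rfl | rfl | rfl | hy) | hy) huy
    · exact C.tail_sep hB u hu _ (Or.inl rfl) huy
    · have := hAB.symm u hu _ hA.path.start_mem
      tauto
    · exact Or.inr rfl
    · exact C.tail_sep hB u hu y (Or.inr (Or.inr hy)) huy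
    · have := hAB.symm u hu _ hy
      tauto
  have hT : ∃ T, IPath G p T q ∧ ∀ u ∈ T, u = p ∨ u = q ∨ (u ∈ 𝓕 ∧ u ≠ v) := by
    rcases claw_or_tripod (C.anchor_conn hp.1 hFS hzS hpS) (C.anchor_conn hq.1 hFS hzS hqS) with
      hc | ⟨t1, t2, t3, A', B', C', hA', hB', hC', sA', sB', sC', h12, h23, h13, d1, d2, d3⟩
    · exfalso
      have c1 := hc.swap12.extend hA.path sA (C.ne_anchor hp) hpq.1
        (U' := S ∪ A) Set.subset_union_left Set.subset_union_right
      have c2 := c1.swap23.swap12.extend hB.path sB (by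
          rintro rfl
          have := hAB _ hA.path.end_mem _ hB.path.start_mem
          tauto) (C.ne_anchor hq)
        (U' := insert v U) (Set.union_subset hSU (Tail.sub hA)) (Tail.sub hB)
      exact C.noclaw i j hi hj hij c2.swap12.swap23.swap12
    · have hz : ∀ y ∈ S, G.Adj (z 0) y → y = v := by
        rintro y (rfl | rfl | rfl | hy) hay
        · exact absurd hay (G.loopless.irrefl _)
        · exact absurd (C.anchor_adj_rung hp.1.1 hay) hp.2
        · exact absurd (C.anchor_adj_rung hq.1.1 hay) hq.2
        · by_contra hv
          exact C.anchor_not_adj_hub hy hv hay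
      have hvA : v ∈ A' := by
        have hA2 := hA'.symm
        have h0 : z 0 ≠ t1 := by
          rintro rfl
          have e1 := hz t2 (sB' hB'.start_mem) h12
          have e2 := hz t3 (sC' hC'.start_mem) h13
          exact h23.ne (e1.trans e2.symm)
        generalize z 0 = w at *
        cases hA2 with
        | single => exact absurd rfl h0
        | @cons _ b _ T e1 e2 e3 e4 =>
          have := hz b (sA' (Or.inr e4.start_mem)) e2
          exact Or.inr (this ▸ e4.start_mem)
      refine ⟨B' ∪ C', hB'.symm.join hC' h23 (fun u hu hu' => (d2 u hu u hu').1 rfl)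
        (fun u hu w hw => (d2 u hu w hw).2), ?_⟩
      have key : ∀ u ∈ B' ∪ C', u ∈ S ∧ u ≠ z 0 ∧ u ≠ v := by
        rintro u (hu | hu)
        · exact ⟨sB' hu, ((d1 _ hA'.end_mem u hu).1).symm, ((d1 _ hvA u hu).1).symm⟩
        · exact ⟨sC' hu, ((d3 _ hA'.end_mem u hu).1).symm, ((d3 _ hvA u hu).1).symm⟩
      intro u hu
      obtain ⟨e1 | e1 | e1 | e1, e2, e3⟩ := key u hu
      · exact absurd e1 e2
      · exact Or.inl e1
      · exact Or.inr (Or.inl e1)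
      · exact Or.inr (Or.inr ⟨e1, e3⟩)
  refine ⟨?_, hT⟩
  obtain ⟨T, hT, hh⟩ := hT
  by_contra hne
  cases hT with
  | single => exact hpq.1 rfl
  | @cons _ b _ T e1 e2 e3 e4 =>
    have hbq : b ≠ q := fun e => hpq.2 (e ▸ e2)
    have hJ : ∀ y ∈ T, y = q ∨ (y ∈ U ∧ y ∉ 𝓦) := by
      intro y hy
      rcases hh y (Or.inr hy) with rfl | h5 | ⟨h5, h6⟩
      · exact absurd hy e1
      · exact Or.inl h5
      · exact Or.inr ⟨(hub_cases h5 h6).1, (hub_cases h5 h6).2.1⟩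
    have hb := (hJ b e4.start_mem).resolve_left hbq
    exact hpq.2 (C.adj_of_attach hp.1.1 hq.1.1
      (C.attach_rung hb.1 (C.not_flag hb.1 hb.2) hp.1.1 e2.symm)
      (C.attach_of_path e4 hJ hq.1.1 hbq) hne)

/-- A path between two peripheral vertices cannot meet the neighbourhood of the hub in a single
vertex. -/
theorem single_touch (C : Ctx G U z h I ℓ x v) {i j : Fin 3} (hi : i ≠ 0) (hj : j ≠ 0)
    (hij : i ≠ j) {p : V} {T : Set V} (hT : IPath G (z i) T (z j)) (hW : T ⊆ 𝓦)
    (hx : ∀ u ∈ T, x 0 ∉ I u) (hp : p ∈ 𝓧) (hpT : p ∈ T) (hone : ∀ u ∈ T, u ∈ 𝓧 → u = p) :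
    False := by
  obtain ⟨A, B, hs⟩ := hT.split hpT
  obtain ⟨D, hD, hc⟩ := C.anchor_conn hp (S := insert (z 0) (insert p 𝓕))
    (fun y hy => Or.inr (Or.inr hy)) (Or.inl rfl) (Or.inr (Or.inl rfl))
  have hTU : T ⊆ insert v U := fun u hu => Or.inr (rungSet_sub (hW hu))
  have hDU : D ⊆ insert v U := by
    refine hD.trans ?_
    rintro y (rfl | rfl | hy)
    · exact Or.inr (C.mem 0)
    · exact hTU hpT
    · exact hub_sub hy
  have := Claw3.of_split hs hc.symm hTU hDU (by
    intro u hu y hy huy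
    rcases hD hu with rfl | rfl | hu
    · exfalso
      refine hx y hy ?_
      rcases huy with rfl | huy
      · rw [C.flags]; simp
      · exact C.anchor_adj_rung (hW hy) huy
    · exact Or.inl rfl
    · rcases huy with rfl | huy
      · exact absurd (hW hy) (C.hub_not_rung hu)
      · exact Or.inr (hone y hy ⟨hW hy, u, hu, huy⟩))
  exact C.noclaw i j hi hj hij this.swap23.swap12

/-- A vertex flagged at `x 0` whose tail is anticomplete to the tail of a good vertex is adjacent
to the new vertex. -/
theorem adj_of_tails (C : Ctx G U z h I ℓ x v) {i j : Fin 3} (hi : i ≠ 0) (hj : j ≠ 0)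
    (hij : i ≠ j) {p w : V} {A B : Set V} (hA : Tail G U h I (x 0) v w A (z i))
    (hB : Tail G U h I (x 0) v p B (z j)) (hAB : Apart G A B) (hw : x 0 ∈ I w) (hp : p ∈ 𝓟)
    (hne : h w ≠ h p) : G.Adj v w := by
  by_contra hvw
  have hw0 : w ≠ z 0 := by
    rintro rfl
    exact hvw C.adj0
  have hwW := hA.rung hA.path.start_mem
  obtain ⟨-, f, hf, hfp⟩ := hp.1
  obtain ⟨D, hD, hc⟩ := ((hub_conn hf).mono (S' := insert p 𝓕) (Set.subset_insert _ _)).tail hfp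
    (Or.inl rfl)
  have hDp : ∀ y ∈ D, y = p ∨ y ∈ 𝓕 := fun y hy => hD hy
  have hpF : p ∉ 𝓕 := fun hh => C.hub_not_rung hh hp.1.1
  have hvp : v ≠ p := by
    rintro rfl
    exact hpF v_mem_hub
  have hatt : ∀ f ∈ D, f ≠ v → f ≠ p → Attach h I (h f) p := by
    intro f hf hfv hfp
    obtain ⟨X, Y, hs⟩ := hc.split hf
    refine C.attach_of_path hs.right ?_ hp.1.1 hfp
    intro y hy
    rcases hDp y (hs.right_sub hy) with h1 | h1
    · exact Or.inl h1
    · have hyv : y ≠ v := by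
        rintro rfl
        exact hfv (hs.mem_inter hs.left.start_mem hy).symm
      exact Or.inr ⟨(hub_cases h1 hyv).1, (hub_cases h1 hyv).2.1⟩
  have hDB : IPath G v (D ∪ B) (z j) := by
    refine hc.append hB.path ?_
    intro u hu y hy huy
    rcases hDp u hu with rfl | hu
    · exact Or.inl rfl
    · exact (C.tail_sep hB y hy u (Or.inr (Or.inr hu))
        (huy.imp Eq.symm SimpleGraph.Adj.symm)).symm
  have hz0 : ∀ y ∈ D ∪ B, G.Adj (z 0) y → y = v := by
    rintro y (hy | hy) hay
    · rcases hDp y hy with rfl | hy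
      · exact absurd (C.anchor_adj_rung hp.1.1 hay) hp.2
      · by_contra hv
        exact C.anchor_not_adj_hub hy hv hay
    · have h1 := C.anchor_adj_rung (hB.rung hy) hay
      rw [hB.flag y hy h1] at h1
      exact absurd h1 hp.2
  have hz0D : z 0 ∉ D ∪ B := by
    rintro (hy | hy)
    · rcases hDp _ hy with h1 | h1
      · exact C.ne_anchor hp h1.symm
      · exact C.anchor_not_hub h1
    · exact C.ne_anchor hp (hB.flag _ hy (by rw [C.flags]; simp)).symm
  have hz0A : z 0 ∉ A := fun hy => hw0 (hA.flag _ hy (by rw [C.flags]; simp)).symm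
  have hC2 : IPath G (z 0) (insert (z 0) (D ∪ B)) (z j) := .cons hz0D C.adj0.symm hz0 hDB
  have hC1 : IPath G (z 0) (insert (z 0) A) (z i) := by
    refine .cons hz0A (b := w) ?_ ?_ hA.path
    · refine C.complete _ (C.mem 0) w (rungSet_sub hwW) (x 0) (by rw [C.flags]; simp) hw ?_
      intro hh
      exact hw0 (C.unique 0 w (rungSet_sub hwW) (by rw [← hh, C.home]; simp))
    · intro y hy hay
      exact hA.flag y hy (C.anchor_adj_rung (hA.rung hy) hay)
  have hU1 : insert (z 0) A ⊆ insert v U :=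
    Set.insert_subset (Or.inr (C.mem 0)) (Tail.sub hA)
  have hU2 : insert (z 0) (D ∪ B) ⊆ insert v U := by
    refine Set.insert_subset (Or.inr (C.mem 0)) (Set.union_subset ?_ (Tail.sub hB))
    intro y hy
    rcases hDp y hy with rfl | hy
    · exact Or.inr (rungSet_sub hp.1.1)
    · exact hub_sub hy
  refine C.noclaw i j hi hj hij ⟨z 0, {z 0}, insert (z 0) A, insert (z 0) (D ∪ B), .single _, hC1,
    hC2, by simpa using Or.inr (C.mem 0), hU1, hU2, ?_, ?_, ?_⟩
  · intro u hu y hy _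
    exact Or.inl hu
  · intro u hu y hy _
    exact Or.inl hu
  · rintro u (rfl | hu) y (rfl | hy | hy) huy
    · exact Or.inl rfl
    · exact Or.inl rfl
    · exact Or.inl rfl
    · exact Or.inr rfl
    · exfalso
      rcases hDp y hy with rfl | hyF
      · have := hAB u hu _ hB.path.start_mem
        tauto
      rcases huy with rfl | huy
      · exact C.hub_not_rung hyF (hA.rung hu)
      · have := hA.touch u hu ⟨hA.rung hu, y, hyF, huy.symm⟩
        subst this
        have hyv : y ≠ v := by
          rintro rfl
          exact hvw huy.symm
        have hyp : y ≠ p := by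
          rintro rfl
          exact hpF hyF
        have hj := hub_cases hyF hyv
        have := C.adj_of_attach hwW hp.1.1
          (C.attach_rung hj.1 (C.not_flag hj.1 hj.2.1) hwW huy.symm) (hatt y hy hyv hyp) hne
        exact (hAB u hu p hB.path.start_mem).2 this
    · have := hAB u hu y hy
      tauto

end Ctx

end Tails

section TwoPaths

variable {N : Type*}

/-- A connected set in which no single vertex separates a vertex from both terminals. -/
structure Terminals (K : SimpleGraph N) (S : Set N) (l x : Bool → N) : Prop where
  mem : ∀ m, l m ∈ S
  next : ∀ m, x m ∈ S
  ne : ∀ m m', x m ≠ l m'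
  inj : ∀ m, l m ≠ l !m
  unique : ∀ m, ∀ a ∈ S, K.Adj (l m) a → a = x m
  cut : ∀ c ∈ S, (∀ m, c ≠ l m) → ∀ s ∈ S, s ≠ c → ∃ m, Conn K (S \ {c}) s (l m)

/-- `a` and `b` are linked to the two terminals by disjoint paths. -/
def Linked (K : SimpleGraph N) (S : Set N) (l : Bool → N) (a b : N) : Prop :=
  ∃ A B, A ⊆ S ∧ B ⊆ S ∧ Disjoint A B ∧ ∃ m, Conn K A a (l m) ∧ Conn K B b (l !m)

namespace Terminals

variable {K : SimpleGraph N} {S : Set N} {l x : Bool → N}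

theorem Linked.symm {a b : N} (h : Linked K S l a b) : Linked K S l b a := by
  obtain ⟨A, B, hA, hB, hd, m, h1, h2⟩ := h
  exact ⟨B, A, hB, hA, hd.symm, !m, h2, by simpa using h1⟩

/-- A vertex is linked to one terminal while avoiding the other. -/
theorem linked_terminal (T : Terminals K S l x) {a : N} (ha : a ∈ S) (m : Bool) (ham : a ≠ l m)
    (hx : a = x m → Conn K S (l m) (l !m)) : Linked K S l (l m) a := by
  refine ⟨{l m}, S \ {l m}, by simpa using T.mem m, Set.sdiff_subset,
    Set.disjoint_sdiff_right, m, Conn.refl rfl, ?_⟩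
  by_cases hax : a = x m
  · obtain ⟨P, hP, hp⟩ := hx hax
    have hne := T.inj m
    generalize (l !m) = e at hp hne ⊢
    cases hp with
    | single => exact absurd rfl hne
    | @cons a' b e T' h1 h2 h3 h4 =>
      have : b = x m := T.unique m b (hP (Or.inr h4.start_mem)) h2
      rw [hax, ← this]
      refine ⟨T', fun y hy => ⟨hP (Or.inr hy), ?_⟩, h4⟩
      rintro rfl
      exact h1 hy
  · have key : ∀ y, Conn K (S \ {x m}) a y → y ≠ l m := by
      intro y hy
      refine hy.closed (P := {y | y ∈ S \ {x m} ∧ y ≠ l m}) ⟨⟨ha, hax⟩, ham⟩ ?_ |>.2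
      rintro c ⟨hc, hcl⟩ d hd hcd
      refine ⟨hd, ?_⟩
      rintro rfl
      exact hc.2 (T.unique m c hc.1 hcd.symm)
    obtain ⟨m', hm'⟩ := T.cut (x m) (T.next m) (T.ne m) a ha hax
    have hmm : m' = !m := by
      rcases Bool.eq_or_eq_not m' m with rfl | h'
      · exact absurd rfl (key _ hm')
      · exact h'
    subst hmm
    obtain ⟨P, hP, hp⟩ := hm'
    exact ⟨P, fun y hy => ⟨(hP hy).1, key y ((hp.conn_mem hy).mono hP)⟩, hp⟩

theorem linked_of_path (T : Terminals K S l x) {a b e : N} {A : Set N} (hA : IPath K a A e)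
    (hAS : A ⊆ S) (he : ∃ m, e = l m) (hb : b ∈ S) (hbA : b ∉ A) (hbl : ∀ m, b ≠ l m)
    (hbx : ∀ m, l m ∈ A → b ≠ x m) : Linked K S l a b := by
  induction hA with
  | single a =>
    obtain ⟨m, rfl⟩ := he
    exact T.linked_terminal hb m (hbl m) fun h => absurd h (hbx m rfl)
  | @cons a a₁ e A h1 h2 h3 h4 ih =>
    by_cases hal : ∃ m, a = l m
    · obtain ⟨m, rfl⟩ := hal
      exact T.linked_terminal hb m (hbl m) fun h => absurd h (hbx m (Or.inl rfl))
    push Not at hal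
    have haS : a ∈ S := hAS (Or.inl rfl)
    have hba : b ≠ a := fun h => hbA (Or.inl h)
    obtain ⟨A₁, B₁, hA₁, hB₁, hd, m, hc, hc'⟩ := ih (fun y hy => hAS (Or.inr hy)) he
      (fun h => hbA (Or.inr h)) (fun m hm => hbx m (Or.inr hm))
    by_cases haB : a ∈ B₁
    swap
    · exact ⟨insert a A₁, B₁, Set.insert_subset haS hA₁, hB₁,
        Set.disjoint_insert_left.2 ⟨haB, hd⟩, m,
        Conn.head (Or.inl rfl) h2 (hc.mono (Set.subset_insert _ _)), hc'⟩
    obtain ⟨A₂, hA₂, pA⟩ := hc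
    obtain ⟨B₂, hB₂, pB⟩ := hc'
    by_cases haB2 : a ∈ B₂
    swap
    · exact ⟨insert a A₂, B₂, Set.insert_subset haS (hA₂.trans hA₁), hB₂.trans hB₁,
        Set.disjoint_insert_left.2 ⟨haB2, hd.mono hA₂ hB₂⟩, m,
        Conn.head (Or.inl rfl) h2 (pA.conn.mono (Set.subset_insert _ _)), pB.conn⟩
    have hd2 : Disjoint A₂ B₂ := hd.mono hA₂ hB₂
    obtain ⟨B₃, Q, hQ⟩ := pB.split haB2
    have hQd : Disjoint A₂ Q := hd2.mono_right hQ.right_sub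
    have hQS : Q ⊆ S := hQ.right_sub.trans (hB₂.trans hB₁)
    have hAS2 : A₂ ⊆ S := hA₂.trans hA₁
    obtain ⟨k, R, hR, pR⟩ := T.cut a haS hal b hb hba
    have hend : l k ∈ Q ∪ A₂ := by
      rcases Bool.eq_or_eq_not k m with rfl | rfl
      · exact Or.inr pA.end_mem
      · exact Or.inl hQ.right.end_mem
    obtain ⟨y, P, R', hs, hy, hP⟩ := pR.first_hit (· ∈ Q ∪ A₂) ⟨_, pR.end_mem, hend⟩
    have hPR : P ⊆ S \ {a} := hs.left_sub.trans hR
    rcases hy with hy | hy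
    · obtain ⟨L, Q', hq⟩ := hQ.right.split hy
      have hya : y ≠ a := (hPR hs.left.end_mem).2
      have haQ' : a ∉ Q' := fun h => hya (hq.mem_inter hq.left.start_mem h).symm
      refine ⟨insert a A₂, P ∪ Q', Set.insert_subset haS hAS2,
        Set.union_subset (hPR.trans Set.sdiff_subset) (hq.right_sub.trans hQS), ?_, m,
        Conn.head (Or.inl rfl) h2 (pA.conn.mono (Set.subset_insert _ _)),
        (hs.left.conn.mono Set.subset_union_left).trans
          (hq.right.conn.mono Set.subset_union_right)⟩
      rw [Set.disjoint_insert_left]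
      refine ⟨?_, ?_⟩
      · rintro (h | h)
        · exact (hPR h).2 rfl
        · exact haQ' h
      · rw [Set.disjoint_union_right]
        refine ⟨?_, hQd.mono_right hq.right_sub⟩
        rw [Set.disjoint_left]
        intro u hu huP
        rw [hP u huP (Or.inr hu)] at hu
        exact Set.disjoint_left.1 hQd hu hy
    · obtain ⟨L, A', hq⟩ := pA.split hy
      refine ⟨Q, P ∪ A', hQS,
        Set.union_subset (hPR.trans Set.sdiff_subset) (hq.right_sub.trans hAS2), ?_, !m,
        hQ.right.conn, ?_⟩
      · rw [Set.disjoint_union_right]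
        refine ⟨?_, hQd.symm.mono_right hq.right_sub⟩
        rw [Set.disjoint_left]
        intro u hu huP
        rw [hP u huP (Or.inl hu)] at hu
        exact Set.disjoint_left.1 hQd hy hu
      · rw [Bool.not_not]
        exact (hs.left.conn.mono Set.subset_union_left).trans
          (hq.right.conn.mono Set.subset_union_right)

/-- Any two vertices are linked to the terminals, with the obvious exception. -/
theorem linked (T : Terminals K S l x) {a b : N} (ha : a ∈ S) (hb : b ∈ S) (hab : a ≠ b)
    (hbad : Conn K S (l true) (l false) ∨ ∀ m, ¬ (a = x m ∧ b = l m) ∧ ¬ (a = l m ∧ b = x m)) :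
    Linked K S l a b := by
  have hc : Conn K S (l true) (l false) → ∀ m, Conn K S (l m) (l !m) := by
    rintro h (_ | _)
    · exact h.symm
    · exact h
  by_cases hal : ∃ m, a = l m
  · obtain ⟨m, rfl⟩ := hal
    refine T.linked_terminal hb m hab.symm fun h => ?_
    rcases hbad with h' | h'
    · exact hc h' m
    · exact absurd ⟨rfl, h⟩ (h' m).2
  by_cases hbl : ∃ m, b = l m
  · obtain ⟨m, rfl⟩ := hbl
    refine Linked.symm (T.linked_terminal ha m hab fun h => ?_)
    rcases hbad with h' | h'
    · exact hc h' m
    · exact absurd ⟨h, rfl⟩ (h' m).1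
  push Not at hal hbl
  obtain ⟨m, P, hP, hp⟩ := T.cut b hb hbl a ha hab
  refine T.linked_of_path hp (fun y hy => (hP hy).1) ⟨m, rfl⟩ hb (fun h => (hP h).2 rfl) hbl ?_
  rintro m' hm' rfl
  obtain ⟨A, B, hs⟩ := hp.split hm'
  have := hs.left.symm
  cases this with
  | single => exact hal m' rfl
  | @cons _ c _ A' h1 h2 h3 h4 =>
    have hcP : c ∈ P := hs.left_sub (Or.inr h4.start_mem)
    exact (hP hcP).2 (T.unique m' c (hP hcP).1 h2)

end Terminals

end TwoPaths

section Arms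

variable {V : Type*}

/-- An induced path along rungs that starts in the strip `{s, t}` and leaves it through `s` into
the node set `S`. -/
structure Arm (G : SimpleGraph V) (U : Set V) (h I : V → Finset ℕ) (o : ℕ) (v p : V)
    (S : Set ℕ) (s t : ℕ) (T : Set V) (e : V) : Prop where
  path : IPath G p T e
  rung : T ⊆ rungSet G U h I
  home : ∀ u ∈ T, (∀ a ∈ h u, a ∈ S) ∨ (h u = {s, t} ∧ (t ∈ I u → u = p))
  mem : s ∈ S
  notin : t ∉ S
  free : o ∉ S
  touch : ∀ u ∈ T, u ∈ goodTouch G U h I o v → u = p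

/-- The index of a terminal other than the anchor. -/
def side (m : Bool) : Fin 3 := if m then 1 else 2

theorem side_ne_zero (m : Bool) : side m ≠ 0 := by cases m <;> decide

theorem side_ne_not (m : Bool) : side m ≠ side !m := by cases m <;> decide

variable [Fintype V]

namespace Ctx

variable {G : SimpleGraph V} {U : Set V} {z : Fin 3 → V} {h I : V → Finset ℕ}
  {ℓ x : Fin 3 → ℕ} {v : V}

local notation "𝓦" => rungSet G U h I
local notation "𝓕" => hub G U h I (x 0) v
local notation "𝓧" => touch G U h I (x 0) v
local notation "𝓟" => goodTouch G U h I (x 0) v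
local notation "𝓗" => MinLab.inner U h ℓ x
local notation "𝓝" => nodeGraph U h

theorem rung_flag_mem (C : Ctx G U z h I ℓ x v) {u : V} (hu : u ∈ 𝓦) {a : ℕ} (ha : a ∈ I u) :
    a ∈ h u := C.sub u (rungSet_sub hu) ha

theorem arm_tail (C : Ctx G U z h I ℓ x v) {p e : V} {S : Set ℕ} {s t : ℕ} {T : Set V}
    (hT : Arm G U h I (x 0) v p S s t T e) : Tail G U h I (x 0) v p T e := by
  have hf : ∀ u ∈ T, x 0 ∈ I u → u = p := by
    intro u hu hx
    have hm := C.rung_flag_mem (hT.rung hu) hx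
    rcases hT.home u hu with h1 | ⟨h1, h2⟩
    · exact absurd (h1 _ hm) hT.free
    · rw [h1, Finset.mem_insert, Finset.mem_singleton] at hm
      rcases hm with hm | hm
      · exact absurd (hm ▸ hT.mem) hT.free
      · exact h2 (hm ▸ hx)
  refine ⟨hT.path, hT.rung, hf, fun u hu hX => ?_⟩
  by_cases hx : x 0 ∈ I u
  · exact hf u hu hx
  · exact hT.touch u hu ⟨hX, hx⟩

theorem arm_apart (C : Ctx G U z h I ℓ x v) {p e p' e' : V} {S S' : Set ℕ} {s t s' t' : ℕ}
    {T T' : Set V} (hT : Arm G U h I (x 0) v p S s t T e)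
    (hT' : Arm G U h I (x 0) v p' S' s' t' T' e') (hd : Disjoint S S')
    (hne : ({s, t} : Finset ℕ) ≠ {s', t'}) (h1 : t ∈ I p → t ∉ S') (h2 : t' ∈ I p' → t' ∉ S)
    (h3 : t = t' → t ∈ I p → t' ∈ I p' → False) : Apart G T T' := by
  rw [Set.disjoint_left] at hd
  intro u hu w hw
  have huw : h u ≠ h w := by
    intro heq
    rcases hT.home u hu with h4 | ⟨h4, -⟩ <;> rcases hT'.home w hw with h5 | ⟨h5, -⟩
    · obtain ⟨a, ha⟩ := Finset.card_pos.1 (C.pos u (rungSet_sub (hT.rung hu)))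
      exact hd (h4 a ha) (h5 a (heq ▸ ha))
    · exact hd (h4 s' (by rw [heq, h5]; simp)) hT'.mem
    · exact hd hT.mem (h5 s (by rw [← heq, h4]; simp))
    · exact hne (h4.symm.trans (heq.trans h5))
  refine ⟨fun he => huw (by rw [he]), fun hadj => ?_⟩
  rcases C.toLab.adj_rung (hT.rung hu) (hT'.rung hw) hadj with h4 | ⟨a, ha, ha'⟩
  · exact huw h4
  have e1 : a ∈ S ∨ (a = t ∧ t ∈ I p) := by
    have hm := C.rung_flag_mem (hT.rung hu) ha
    rcases hT.home u hu with h5 | ⟨h5, h6⟩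
    · exact Or.inl (h5 a hm)
    · rw [h5, Finset.mem_insert, Finset.mem_singleton] at hm
      rcases hm with rfl | rfl
      · exact Or.inl hT.mem
      · exact Or.inr ⟨rfl, h6 ha ▸ ha⟩
  have e2 : a ∈ S' ∨ (a = t' ∧ t' ∈ I p') := by
    have hm := C.rung_flag_mem (hT'.rung hw) ha'
    rcases hT'.home w hw with h5 | ⟨h5, h6⟩
    · exact Or.inl (h5 a hm)
    · rw [h5, Finset.mem_insert, Finset.mem_singleton] at hm
      rcases hm with rfl | rfl
      · exact Or.inl hT'.mem
      · exact Or.inr ⟨rfl, h6 ha' ▸ ha'⟩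
  rcases e1 with e1 | ⟨rfl, e1⟩ <;> rcases e2 with e2 | ⟨e2', e2⟩
  · exact hd e1 e2
  · exact h2 e2 (e2' ▸ e1)
  · exact h1 e1 e2
  · exact h3 e2' e1 e2

theorem exists_arm (C : Ctx G U z h I ℓ x v) {s t : ℕ} {S : Set ℕ} {i : Fin 3}
    (hS : IPath 𝓝 s S (ℓ i)) (ht : t ∉ S) (ho : x 0 ∉ S) {q : V} (hq : q ∈ 𝓦)
    (hqh : h q = {s, t}) (hX : ∀ p ∈ 𝓟, ¬ ∀ a ∈ h p, a ∈ S) :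
    ∃ p T, Arm G U h I (x 0) v p S s t T (z i) ∧ (p = q ∨ p ∈ 𝓟) ∧ h p = {s, t} ∧
      (t ∈ I p → p = q) := by
  obtain ⟨T, hT, hu⟩ := C.exists_route hS ht hq hqh
  obtain ⟨p, A, B, hs, hp, hB⟩ := hT.last_hit (fun u => u = q ∨ u ∈ 𝓟)
    ⟨q, hT.start_mem, Or.inl rfl⟩
  have hph : h p = {s, t} ∧ (t ∈ I p → p = q) := by
    rcases hp with rfl | hp
    · exact ⟨hqh, fun _ => rfl⟩
    · rcases (hu p (hs.left_sub hs.left.end_mem)).2 with h1 | h1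
      · exact absurd h1 (hX p hp)
      · exact h1
  refine ⟨p, B, ⟨hs.right, fun u huB => (hu u (hs.right_sub huB)).1, ?_, hS.start_mem, ht, ho,
    fun u huB hP => hB u huB (Or.inr hP)⟩, hp, hph⟩
  intro u huB
  rcases (hu u (hs.right_sub huB)).2 with h1 | ⟨h1, h2⟩
  · exact Or.inl h1
  · exact Or.inr ⟨h1, fun h3 => hB u huB (Or.inl (h2 h3))⟩

theorem x_ne_side (C : Ctx G U z h I ℓ x v) {i : Fin 3} (hi : i ≠ 0) : x i ≠ x 0 := by
  intro hx
  refine C.nadj i hi (C.complete _ (C.mem 0) _ (C.mem i) (x 0) (by simp [C.flags])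
    (by simp [C.flags, hx]) fun he => hi ?_)
  exact C.inj (C.unique 0 (z i) (C.mem i) (by rw [← he, C.home]; simp))

theorem l_mem_inner (C : Ctx G U z h I ℓ x v) {i : Fin 3} (hi : i ≠ 0) : ℓ i ∈ 𝓗 :=
  ⟨⟨z i, C.mem i, by simp [C.home]⟩, by
    have h1 := C.l_ne_x i 0
    have h2 : ℓ i ≠ ℓ 0 := fun hh => hi (C.l_inj hh)
    simp [h1, h2]⟩

theorem x_mem_inner (C : Ctx G U z h I ℓ x v) {i : Fin 3} (hi : i ≠ 0) : x i ∈ 𝓗 :=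
  ⟨⟨z i, C.mem i, by simp [C.home]⟩, by
    have h1 := (C.l_ne_x 0 i).symm
    have h2 := C.x_ne_side hi
    simp [h1, h2]⟩

theorem adj_l (C : Ctx G U z h I ℓ x v) {i : Fin 3} {a : ℕ} (ha : (𝓝).Adj (ℓ i) a) :
    a = x i := by
  obtain ⟨hne, u, hu, hh⟩ := ha
  have := C.unique i u hu (by simp [hh])
  subst this
  have h1 : a ∈ ({ℓ i, x i} : Finset ℕ) := by rw [← C.home, hh]; simp
  simp only [Finset.mem_insert, Finset.mem_singleton] at h1
  exact h1.resolve_left hne.symm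

theorem terminals (C : Ctx G U z h I ℓ x v) :
    Terminals 𝓝 𝓗 (fun m => ℓ (side m)) (fun m => x (side m)) where
  mem m := C.l_mem_inner (side_ne_zero m)
  next m := C.x_mem_inner (side_ne_zero m)
  ne m m' := (C.l_ne_x _ _).symm
  inj m hh := side_ne_not m (C.l_inj hh)
  unique m a _ ha := C.adj_l ha
  cut c hc hcl s hs hsc := by
    rcases C.no_cut hc (hcl true) (hcl false) hs hsc with h1 | h1
    · exact ⟨true, h1⟩
    · exact ⟨false, h1⟩

theorem zero_notin {S : Set ℕ} (hS : S ⊆ 𝓗) : x 0 ∉ S := fun hh => (hS hh).2.1 rfl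

end Ctx

end Arms

section Placing

variable {V : Type*}

/-- Changing a labeling on a set `Q`. -/
theorem Lab.patch {G : SimpleGraph V} {U U' Q : Set V} {h I h' I' : V → Finset ℕ}
    (L : Lab G U h I) (hU : ∀ u ∈ U', u ∉ Q → u ∈ U)
    (hQ : ∀ u, u ∉ Q → h' u = h u ∧ I' u = I u)
    (hI : ∀ u ∈ Q, I' u ⊆ h' u) (h1 : ∀ u ∈ Q, 1 ≤ (h' u).card) (h3 : ∀ u ∈ Q, (h' u).card ≤ 3)
    (hf : ∀ u ∈ Q, ∀ a ∈ I' u, (h' u).card = 2)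
    (hc : ∀ u ∈ Q, ∀ w ∈ U', ∀ a, a ∈ I' u → a ∈ I' w → h' u ≠ h' w →
      G.Adj u w)
    (he : ∀ u ∈ Q, ∀ w ∈ U', G.Adj u w → LinkOK h' I' u w) : Lab G U' h' I' where
  sub u hu := by
    by_cases hq : u ∈ Q
    · exact hI u hq
    · rw [(hQ u hq).1, (hQ u hq).2]; exact L.sub u (hU u hu hq)
  pos u hu := by
    by_cases hq : u ∈ Q
    · exact h1 u hq
    · rw [(hQ u hq).1]; exact L.pos u (hU u hu hq)
  le u hu := by
    by_cases hq : u ∈ Q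
    · exact h3 u hq
    · rw [(hQ u hq).1]; exact L.le u (hU u hu hq)
  flag u hu := by
    by_cases hq : u ∈ Q
    · exact hf u hq
    · rw [(hQ u hq).1, (hQ u hq).2]; exact L.flag u (hU u hu hq)
  complete u hu w hw a ha hb hne := by
    by_cases hq : u ∈ Q
    · exact hc u hq w hw a ha hb hne
    by_cases hq' : w ∈ Q
    · exact (hc w hq' u hu a hb ha hne.symm).symm
    rw [(hQ u hq).2] at ha
    rw [(hQ w hq').2] at hb
    rw [(hQ u hq).1, (hQ w hq').1] at hne
    exact L.complete u (hU u hu hq) w (hU w hw hq') a ha hb hne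
  edge u hu w hw ha := by
    by_cases hq : u ∈ Q
    · exact he u hq w hw ha
    by_cases hq' : w ∈ Q
    · exact (he w hq' u hu ha.symm).symm
    have := L.edge u (hU u hu hq) w (hU w hw hq') ha
    unfold LinkOK at this ⊢
    rwa [(hQ u hq).2, (hQ w hq').2, (hQ u hq).1, (hQ w hq').1]

variable [Fintype V]

namespace Ctx

variable {G : SimpleGraph V} {U : Set V} {z : Fin 3 → V} {h I : V → Finset ℕ}
  {ℓ x : Fin 3 → ℕ} {v : V}

local notation "𝓦" => rungSet G U h I
local notation "𝓕" => hub G U h I (x 0) v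
local notation "𝓧" => touch G U h I (x 0) v
local notation "𝓟" => goodTouch G U h I (x 0) v
local notation "𝓗" => MinLab.inner U h ℓ x
local notation "𝓝" => nodeGraph U h

/-- Neighbours of the hub outside it. -/
theorem hub_out (C : Ctx G U z h I ℓ x v) {f w : V} (hf : f ∈ 𝓕) (hw : w ∈ insert v U)
    (hwF : w ∉ 𝓕) (ha : G.Adj f w) :
    (f = v ∧ h w = {x 0} ∧ w ∉ 𝓦) ∨ (w ∈ 𝓧 ∧ (f ≠ v → Attach h I (h f) w)) := by
  have hwU : w ∈ U := by
    rcases hw with rfl | hw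
    · exact absurd v_mem_hub hwF
    · exact hw
  by_cases hW : w ∈ 𝓦
  · refine Or.inr ⟨⟨hW, f, hf, ha⟩, fun hv => ?_⟩
    have := hub_cases hf hv
    exact C.toLab.attach_rung this.1 (C.not_flag this.1 this.2.1) hW ha
  · have hx : h w = {x 0} := by
      by_contra hx
      exact hwF (hub_step hf ⟨hwU, hW, hx⟩ ha)
    refine Or.inl ⟨?_, hx, hW⟩
    by_contra hv
    have := hub_cases hf hv
    exact this.2.2 ((C.junk_adj this.1 this.2.1 hwU hW ha).trans hx)

theorem term_patch (C : Ctx G U z h I ℓ x v) {h' I' : V → Finset ℕ}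
    (hQ : ∀ u, u ∉ 𝓕 → h' u = h u ∧ I' u = I u) (hl : ∀ u ∈ 𝓕, ∀ i, ℓ i ∉ h' u) :
    Term (insert v U) z h' I' ℓ x where
  mem i := Or.inr (C.mem i)
  ne := C.ne
  home i := by
    rw [(hQ _ fun hh => C.hub_not_rung hh (C.mem_rungSet i)).1, C.home]
  flags i := by
    rw [(hQ _ fun hh => C.hub_not_rung hh (C.mem_rungSet i)).2, C.flags]
  unique i u hu hi := by
    by_cases hq : u ∈ 𝓕
    · exact absurd hi (hl u hq i)
    · rw [(hQ u hq).1] at hi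
      rcases hu with rfl | hu
      · exact absurd v_mem_hub hq
      · exact C.unique i u hu hi

open scoped Classical in
/-- Extending the labeling when the hub touches nothing off the anchor's node. -/
theorem tl_of_empty (C : Ctx G U z h I ℓ x v) (h0 : ∀ p, p ∉ 𝓟) : TL G (insert v U) z := by
  have hF : ∀ f ∈ 𝓕, f = v := by
    intro f hf
    by_contra hv
    obtain ⟨g, -, -, -, -, p, hp, -⟩ := C.hub_touch hf hv
    exact h0 p hp
  let h' : V → Finset ℕ := fun u => if u ∈ 𝓕 then {x 0} else h u
  let I' : V → Finset ℕ := fun u => if u ∈ 𝓕 then ∅ else I u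
  have e1 : ∀ u ∈ 𝓕, h' u = {x 0} ∧ I' u = ∅ := fun u hu => by simp [h', I', hu]
  have e2 : ∀ u, u ∉ 𝓕 → h' u = h u ∧ I' u = I u := fun u hu => by simp [h', I', hu]
  refine ⟨h', I', ℓ, x, C.toLab.patch (Q := 𝓕) ?_ e2 ?_ ?_ ?_ ?_ ?_ ?_, C.term_patch e2 ?_⟩
  · rintro u (rfl | hu) hq
    · exact absurd v_mem_hub hq
    · exact hu
  · intro u hu; simp [e1 u hu]
  · intro u hu; simp [e1 u hu]
  · intro u hu; simp [e1 u hu]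
  · intro u hu; simp [e1 u hu]
  · intro u hu; simp [e1 u hu]
  · intro u hu w hw ha
    by_cases hq : w ∈ 𝓕
    · exact Or.inl (by rw [(e1 u hu).1, (e1 w hq).1])
    rcases C.hub_out hu hw hq ha with ⟨-, h1, -⟩ | ⟨h1, -⟩
    · exact Or.inl (by rw [(e1 u hu).1, (e2 w hq).1, h1])
    · refine Or.inr (Or.inr (Or.inl ⟨x 0, ?_, (e1 u hu).1⟩))
      rw [(e2 w hq).2]
      by_contra hx
      exact h0 w ⟨h1, hx⟩
  · intro u hu i
    rw [(e1 u hu).1, Finset.mem_singleton]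
    exact C.l_ne_x i 0

/-- A good vertex with an arm forces adjacency with the anchor's interface. -/
theorem adj_of_arm (C : Ctx G U z h I ℓ x v) {i j : Fin 3} (hi : i ≠ 0) (hj : j ≠ 0)
    (hij : i ≠ j) {p w : V} {S B : Set ℕ} {s t y : ℕ} {T : Set V}
    (hA : Arm G U h I (x 0) v p S s t T (z i)) (hp : p ∈ 𝓟) (hph : h p = {s, t})
    (hB : IPath 𝓝 y B (ℓ j)) (hBH : B ⊆ 𝓗) (hd : Disjoint S B) (ht : t ∈ I p → t ∉ B)
    (hw : w ∈ U) (hxw : x 0 ∈ I w) (hwh : h w = {y, x 0})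
    (hX : ∀ q ∈ 𝓟, ¬ ∀ a ∈ h q, a ∈ B) (hX' : ∀ q ∈ 𝓟, h q ≠ {y, x 0}) : G.Adj v w := by
  have hx0 : x 0 ∉ B := zero_notin hBH
  obtain ⟨p', T', hA', hp', hph', -⟩ :=
    C.exists_arm hB hx0 hx0 (C.flag_rung hw hxw) hwh hX
  have : p' = w := hp'.resolve_right fun hh => hX' p' hh hph'
  subst this
  have hst : ({s, t} : Finset ℕ) ≠ {y, x 0} := fun hh => hX' p hp (hph.trans hh)
  refine C.adj_of_tails hj hi hij.symm (C.arm_tail hA') (C.arm_tail hA) ?_ hxw hp ?_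
  · refine (C.arm_apart hA hA' hd hst ht (fun _ => hA.free) ?_).symm
    rintro rfl h1 _
    exact hp.2 h1
  · rw [hph, hph']
    exact hst.symm

/-- The anchor's interface flags a pair with an inner node, apart from the anchor. -/
theorem anchor_flag (C : Ctx G U z h I ℓ x v) {w : V} (hw : w ∈ U) (hx : x 0 ∈ I w)
    (h0 : w ≠ z 0) : ∃ y ∈ 𝓗, h w = {y, x 0} ∧ ∀ i, y ≠ ℓ i := by
  obtain ⟨y, hy, hh⟩ := C.flag_pair hw hx
  have hl : ∀ i, y ≠ ℓ i := by
    rintro i rfl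
    have := C.unique i w hw (by simp [hh])
    subst this
    rw [C.flags] at hx
    simp only [Finset.mem_insert, Finset.mem_singleton] at hx
    rcases hx with hx | hx
    · exact C.l_ne_x _ _ hx.symm
    · exact C.x_ne_side (fun hi => h0 (by rw [hi])) hx.symm
  exact ⟨y, ⟨⟨w, hw, by simp [hh]⟩, hy.symm, hl 0⟩, by rw [hh, Finset.pair_comm], hl⟩

end Ctx

end Placing

section StripCase

variable {V : Type*} [Fintype V]

namespace Ctx

variable {G : SimpleGraph V} {U : Set V} {z : Fin 3 → V} {h I : V → Finset ℕ}
  {ℓ x : Fin 3 → ℕ} {v : V}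

local notation "𝓦" => rungSet G U h I
local notation "𝓕" => hub G U h I (x 0) v
local notation "𝓧" => touch G U h I (x 0) v
local notation "𝓟" => goodTouch G U h I (x 0) v
local notation "𝓗" => MinLab.inner U h ℓ x
local notation "𝓝" => nodeGraph U h

theorem good_card (C : Ctx G U z h I ℓ x v) {p : V} (hp : p ∈ 𝓟) : (h p).card = 2 :=
  C.toLab.card_rung hp.1.1

theorem not_sub_singleton (C : Ctx G U z h I ℓ x v) (k : ℕ) :
    ∀ p ∈ 𝓟, ¬ ∀ a ∈ h p, a ∈ ({k} : Set ℕ) := by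
  intro p hp hh
  have h1 : h p ⊆ {k} := fun a ha => by simpa using hh a ha
  have := Finset.card_le_card h1
  rw [C.good_card hp] at this
  simp at this

/-- All hub contacts lie in the strip between the anchor's node and `c`, or are a peripheral
vertex next to `c`. -/
def Narrow (G : SimpleGraph V) (U : Set V) (z : Fin 3 → V) (h I : V → Finset ℕ)
    (x : Fin 3 → ℕ) (v : V) (c : ℕ) : Prop :=
  ∀ p ∈ goodTouch G U h I (x 0) v, h p = {x 0, c} ∨ ∃ m, p = z (side m) ∧ c = x (side m) ∧
    ∀ w ∈ U, c ∈ I w → h w = {x 0, c} ∨ w = z (side m)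

theorem narrow_adj (C : Ctx G U z h I ℓ x v) {c : ℕ} (hc : c ∈ 𝓗) (hcl : ∀ i, c ≠ ℓ i)
    (hN : Narrow G U z h I x v c) (hP : ∃ p, p ∈ 𝓟) {w : V} (hw : w ∈ U) (hxw : x 0 ∈ I w)
    (hwc : h w ≠ {x 0, c}) : G.Adj v w := by
  by_cases hw0 : w = z 0
  · rw [hw0]; exact C.adj0
  obtain ⟨y, hy, hwh, hyl⟩ := C.anchor_flag hw hxw hw0
  have hyc : y ≠ c := by
    rintro rfl
    exact hwc (by rw [hwh, Finset.pair_comm])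
  have hX' : ∀ q ∈ 𝓟, h q ≠ {y, x 0} := by
    intro q hq hh
    rcases hN q hq with h1 | ⟨k, rfl, -, -⟩
    · exact hwc (by rw [hwh, ← hh, h1])
    · have : ℓ (side k) ∈ ({y, x 0} : Finset ℕ) := by rw [← hh, C.home]; simp
      simp only [Finset.mem_insert, Finset.mem_singleton] at this
      rcases this with h1 | h1
      · exact hyl _ h1.symm
      · exact C.l_ne_x _ _ h1
  obtain ⟨A, B, hA, hB, hd, m, ⟨A', hA', pA⟩, B', hB', pB⟩ := C.terminals.linked hc hy hyc.symm
    (Or.inr fun m => ⟨fun hh => hyl _ hh.2, fun hh => hcl _ hh.1⟩)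
  have hcB : c ∉ B' := fun hh => Set.disjoint_left.1 hd (hA' pA.start_mem) (hB' hh)
  have hXB : ∀ q ∈ 𝓟, ¬ ∀ a ∈ h q, a ∈ B' := by
    intro q hq hh
    apply hcB
    apply hh
    rcases hN q hq with h1 | ⟨k, rfl, hk, -⟩
    · simp [h1]
    · rw [C.home, hk]; simp
  have hmn : side m ≠ side !m := side_ne_not m
  by_cases hz : ∃ k, z (side k) ∈ 𝓟 ∧ c = x (side k)
  · obtain ⟨k, hk, hck⟩ := hz
    have hkm : k = m := by
      by_contra hne
      have : k = !m := by revert hne; cases k <;> cases m <;> simp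
      subst this
      have := pB.symm
      cases this with
      | single => exact hyl _ rfl
      | @cons _ b _ T h1 h2 h3 h4 =>
        have hb := C.adj_l h2
        exact hcB (Or.inr (hck ▸ hb ▸ h4.start_mem))
    subst hkm
    obtain ⟨p, T, hT, hp, hph, -⟩ := C.exists_arm (t := c) (IPath.single (ℓ (side k)))
      (hcl (side k)) (C.l_ne_x _ _).symm (C.mem_rungSet (side k)) (by rw [C.home, hck])
      (C.not_sub_singleton _)
    have hp : p ∈ 𝓟 := by
      rcases hp with rfl | hp
      · exact hk
      · exact hp
    refine C.adj_of_arm (side_ne_zero k) (side_ne_zero _) hmn hT hp hph pB (hB'.trans hB) ?_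
      (fun _ => hcB) hw hxw hwh hXB hX'
    rw [Set.disjoint_singleton_left]
    exact fun hh => Set.disjoint_left.1 hd (hA' pA.end_mem) (hB' hh)
  · have hall : ∀ q ∈ 𝓟, h q = {x 0, c} := fun q hq => (hN q hq).resolve_right fun ⟨k, h1, h2, _⟩ =>
      hz ⟨k, h1 ▸ hq, h2⟩
    obtain ⟨q, hq⟩ := hP
    have hx0 : x 0 ∉ A' := zero_notin (hA'.trans hA)
    obtain ⟨p, T, hT, hp, hph, -⟩ := C.exists_arm pA hx0 hx0 hq.1.1
      (by rw [hall q hq, Finset.pair_comm]) fun q' hq' hh => hx0 (hh _ (by simp [hall q' hq']))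
    have hp : p ∈ 𝓟 := by
      rcases hp with rfl | hp
      · exact hq
      · exact hp
    exact C.adj_of_arm (side_ne_zero _) (side_ne_zero _) hmn hT hp hph pB (hB'.trans hB)
      (hd.mono hA' hB') (fun _ => zero_notin (hB'.trans hB)) hw hxw hwh hXB hX'

open scoped Classical in
/-- Extending the labeling by putting the hub into a single strip. -/
theorem tl_of_narrow (C : Ctx G U z h I ℓ x v) {c : ℕ} (hc : c ∈ 𝓗) (hcl : ∀ i, c ≠ ℓ i)
    (hN : Narrow G U z h I x v c) (hP : ∃ p, p ∈ 𝓟) : TL G (insert v U) z := by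
  have hcx : x 0 ≠ c := fun hh => hc.2.1 hh.symm
  let h' : V → Finset ℕ := fun u => if u ∈ 𝓕 then {x 0, c} else h u
  let I' : V → Finset ℕ := fun u => if u ∈ 𝓕 then
    ({x 0, c} : Finset ℕ).filter fun a => (a = x 0 ∧ u = v) ∨
      (a = c ∧ ∃ m, z (side m) ∈ 𝓟 ∧ c = x (side m) ∧ G.Adj u (z (side m))) else I u
  have e1 : ∀ u ∈ 𝓕, h' u = {x 0, c} := fun u hu => by simp [h', hu]
  have e2 : ∀ u, u ∉ 𝓕 → h' u = h u ∧ I' u = I u := fun u hu => by simp [h', I', hu]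
  have e3 : ∀ u ∈ 𝓕, ∀ a, a ∈ I' u ↔ (a = x 0 ∧ u = v) ∨
      (a = c ∧ ∃ m, z (side m) ∈ 𝓟 ∧ c = x (side m) ∧ G.Adj u (z (side m))) := by
    intro u hu a
    simp only [I', hu, if_true, Finset.mem_filter, Finset.mem_insert, Finset.mem_singleton]
    tauto
  have hsub : ∀ u ∈ 𝓕, I' u ⊆ h' u := by
    intro u hu
    simp only [I', h', hu, if_true]
    exact Finset.filter_subset _ _
  have hUF : ∀ u ∈ insert v U, u ∉ 𝓕 → u ∈ U := by
    rintro u (rfl | hu) hq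
    · exact absurd v_mem_hub hq
    · exact hu
  have hspec : ∀ p ∈ 𝓟, h p ≠ {x 0, c} → ∃ m, p = z (side m) ∧ c = x (side m) ∧
    ∀ w ∈ U, c ∈ I w → h w = {x 0, c} ∨ w = z (side m) := fun p hp hne =>
      (hN p hp).resolve_left hne
  refine ⟨h', I', ℓ, x, C.toLab.patch (Q := 𝓕) hUF e2 hsub ?_ ?_ ?_ ?_ ?_, C.term_patch e2 ?_⟩
  · intro u hu; simp [e1 u hu]
  · intro u hu; simp [e1 u hu, Finset.card_pair hcx]
  · intro u hu; simp [e1 u hu, Finset.card_pair hcx]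
  · intro u hu w hw a ha ha' hne
    have hwF : w ∉ 𝓕 := fun hq => hne (by rw [e1 u hu, e1 w hq])
    rw [(e2 w hwF).2] at ha'
    rw [e1 u hu, (e2 w hwF).1] at hne
    rcases (e3 u hu a).1 ha with ⟨rfl, rfl⟩ | ⟨rfl, m, hm, hcm, hum⟩
    · exact C.narrow_adj hc hcl hN hP (hUF w hw hwF) ha' hne.symm
    · have : h (z (side m)) ≠ {x 0, a} := by
        intro hh
        have h1 : ℓ (side m) ∈ ({x 0, a} : Finset ℕ) := by rw [← hh, C.home]; simp
        simp only [Finset.mem_insert, Finset.mem_singleton] at h1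
        rcases h1 with h1 | h1
        · exact C.l_ne_x _ _ h1
        · exact hcl _ h1.symm
      obtain ⟨m', h1, -, h2⟩ := hspec _ hm this
      rcases h2 w (hUF w hw hwF) ha' with h3 | h3
      · exact absurd h3.symm hne
      · rw [h3, ← h1]; exact hum
  · intro u hu w hw ha
    by_cases hq : w ∈ 𝓕
    · exact Or.inl (by rw [e1 u hu, e1 w hq])
    have hxv : u = v → x 0 ∈ I' u := fun hh => (e3 u hu _).2 (Or.inl ⟨rfl, hh⟩)
    have hwU := hUF w hw hq
    rcases C.hub_out hu hw hq ha with ⟨h0, h1, -⟩ | ⟨h1, h2⟩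
    · exact Or.inr (Or.inr (Or.inr (Or.inl ⟨x 0, hxv h0, by rw [(e2 w hq).1, h1]⟩)))
    by_cases hw' : w ∈ 𝓟
    · rcases hN w hw' with h3 | ⟨m, rfl, hm, -⟩
      · exact Or.inl (by rw [e1 u hu, (e2 w hq).1, h3])
      · refine Or.inr (Or.inl ⟨c, (e3 u hu c).2 (Or.inr ⟨rfl, m, hw', hm, ha⟩), ?_⟩)
        rw [(e2 _ hq).2, C.flags, hm]; simp
    have hxw : x 0 ∈ I w := by
      by_contra hx
      exact hw' ⟨h1, hx⟩
    by_cases huv : u = v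
    · exact Or.inr (Or.inl ⟨x 0, hxv huv, by rwa [(e2 _ hq).2]⟩)
    obtain ⟨g, hg, hgv, hgu, -, p, hp, hgp⟩ := C.hub_touch hu huv
    have hat : Attach h I (h u) p := by
      rcases C.hub_out hg (Or.inr (rungSet_sub hp.1.1)) (fun hh => C.hub_not_rung hh hp.1.1)
        hgp with h3 | h3
      · exact absurd hp.1.1 h3.2.2
      · rw [← hgu]; exact h3.2 hgv
    left
    rw [e1 u hu, (e2 w hq).1]
    have hxh : x 0 ∈ h w := C.sub w hwU hxw
    rcases h2 huv with h3 | ⟨a, h3, h4⟩ | ⟨h3, h4, h5⟩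
    · rcases hat with h6 | ⟨a, -, h6⟩ | ⟨h6, -⟩
      · rcases hN p hp with h7 | ⟨m, rfl, -⟩
        · rw [h3, ← h6, h7]
        · exfalso
          rw [h3, ← h6, C.home] at hxh
          simp only [Finset.mem_insert, Finset.mem_singleton] at hxh
          rcases hxh with hxh | hxh
          · exact C.l_ne_x _ _ hxh.symm
          · exact C.x_ne_side (side_ne_zero m) hxh.symm
      · have := C.toLab.card_rung h1.1
        rw [h3, h6] at this
        simp at this
      · have := C.toLab.card_rung h1.1
        rw [h3, h6] at this
        simp at this
    · have hax : a ≠ x 0 := by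
        rintro rfl
        exact (hub_cases hu huv).2.2 h4
      obtain ⟨b, hab, hwb⟩ := C.flag_pair hwU h3
      have hb : b = x 0 := by
        rw [hwb] at hxh
        simp only [Finset.mem_insert, Finset.mem_singleton] at hxh
        rcases hxh with hxh | hxh
        · exact absurd hxh.symm hax
        · exact hxh.symm
      subst hb
      have hap : a ∈ I p := by
        rcases hat with h6 | ⟨a', h5, h6⟩ | ⟨h6, -⟩
        · exact absurd (h6.trans h4) (C.not_home_singleton hp.1.1)
        · rw [h4, Finset.singleton_inj] at h6
          exact h6 ▸ h5
        · rw [h4] at h6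
          simp at h6
      have hac : a = c := by
        have hah := C.sub p (rungSet_sub hp.1.1) hap
        rcases hN p hp with h7 | ⟨m, rfl, hm, -⟩
        · rw [h7] at hah
          simp only [Finset.mem_insert, Finset.mem_singleton] at hah
          exact hah.resolve_left hax
        · rw [C.home] at hah
          simp only [Finset.mem_insert, Finset.mem_singleton] at hah
          rcases hah with rfl | rfl
          · have := C.unique (side m) w hwU (by simp [hwb])
            rw [this, C.flags] at hxw
            simp only [Finset.mem_insert, Finset.mem_singleton] at hxw
            rcases hxw with hxh | hxh
            · exact absurd hxh.symm (C.l_ne_x _ _)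
            · exact absurd hxh.symm (C.x_ne_side (side_ne_zero m))
          · exact hm.symm
      rw [hwb, hac, Finset.pair_comm]
    · exfalso
      rcases hat with h6 | ⟨a, -, h6⟩ | ⟨-, h7, h8⟩
      · have := C.good_card hp
        rw [h6] at this
        omega
      · rw [h6] at h3
        simp at h3
      · have hxp : x 0 ∉ h p := h8 ▸ hp.2
        rcases hN p hp with h9 | ⟨m, rfl, -⟩
        · exact hxp (by simp [h9])
        · have := C.unique (side m) u (hub_cases hu huv).1 (h7 (by rw [C.home]; simp))
          rw [this, C.home, Finset.card_pair (C.ne _)] at h3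
          omega
  · intro u hu i
    rw [e1 u hu]
    simp only [Finset.mem_insert, Finset.mem_singleton]
    rintro (hh | hh)
    · exact C.l_ne_x _ _ hh
    · exact hcl i hh.symm

end Ctx

end StripCase

section Fork

variable {V : Type*}

/-- The inner nodes of homes of good hub contacts. -/
def touchNodes (G : SimpleGraph V) (U : Set V) (h I : V → Finset ℕ) (ℓ x : Fin 3 → ℕ)
    (v : V) : Set ℕ :=
  {a | a ∈ MinLab.inner U h ℓ x ∧ ∃ p ∈ goodTouch G U h I (x 0) v, a ∈ h p}

/-- Two disjoint node paths from contact nodes to the two terminals. -/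
structure Fork (G : SimpleGraph V) (U : Set V) (h I : V → Finset ℕ) (ℓ x : Fin 3 → ℕ)
    (v : V) (i j : Fin 3) (a b : ℕ) (A B : Set ℕ) : Prop where
  fst : IPath (nodeGraph U h) a A (ℓ i)
  snd : IPath (nodeGraph U h) b B (ℓ j)
  subA : A ⊆ MinLab.inner U h ℓ x
  subB : B ⊆ MinLab.inner U h ℓ x
  disj : Disjoint A B
  memA : a ∈ touchNodes G U h I ℓ x v
  memB : b ∈ touchNodes G U h I ℓ x v
  onlyA : ∀ s ∈ A, s ∈ touchNodes G U h I ℓ x v → s = a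
  onlyB : ∀ s ∈ B, s ∈ touchNodes G U h I ℓ x v → s = b
  hi : i ≠ 0
  hj : j ≠ 0
  hij : i ≠ j

theorem Fork.symm {G : SimpleGraph V} {U : Set V} {h I : V → Finset ℕ} {ℓ x : Fin 3 → ℕ}
    {v : V} {i j : Fin 3} {a b : ℕ} {A B : Set ℕ} (D : Fork G U h I ℓ x v i j a b A B) :
    Fork G U h I ℓ x v j i b a B A :=
  ⟨D.snd, D.fst, D.subB, D.subA, D.disj.symm, D.memB, D.memA, D.onlyB, D.onlyA, D.hj, D.hi,
    D.hij.symm⟩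

variable [Fintype V]

namespace Ctx

variable {G : SimpleGraph V} {U : Set V} {z : Fin 3 → V} {h I : V → Finset ℕ}
  {ℓ x : Fin 3 → ℕ} {v : V}

local notation "𝓦" => rungSet G U h I
local notation "𝓕" => hub G U h I (x 0) v
local notation "𝓧" => touch G U h I (x 0) v
local notation "𝓟" => goodTouch G U h I (x 0) v
local notation "𝓗" => MinLab.inner U h ℓ x
local notation "𝓝" => nodeGraph U h
local notation "𝓣" => touchNodes G U h I ℓ x v

theorem mem_touchNodes (C : Ctx G U z h I ℓ x v) {p : V} (hp : p ∈ 𝓟) {a : ℕ} (ha : a ∈ h p) :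
    a = x 0 ∨ a ∈ 𝓣 := by
  by_cases hx : a = x 0
  · exact Or.inl hx
  refine Or.inr ⟨⟨⟨p, rungSet_sub hp.1.1, ha⟩, hx, ?_⟩, p, hp, ha⟩
  rintro rfl
  exact C.ne_anchor hp (C.unique 0 p (rungSet_sub hp.1.1) ha)

theorem home_of_good (C : Ctx G U z h I ℓ x v) {p : V} (hp : p ∈ 𝓟) {c : ℕ}
    (hc : ∀ a ∈ h p, a ∈ 𝓣 → a = c) : h p = {x 0, c} := by
  refine Finset.eq_of_subset_of_card_le ?_ ?_
  · intro a ha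
    rcases C.mem_touchNodes hp ha with h1 | h1
    · simp [h1]
    · simp [hc a ha h1]
  · rw [C.good_card hp]
    exact Finset.card_le_two

theorem exists_fork_of_linked (C : Ctx G U z h I ℓ x v) {a b : ℕ} (ha : a ∈ 𝓣) (hb : b ∈ 𝓣)
    (hl : Linked 𝓝 𝓗 (fun m => ℓ (side m)) a b) :
    ∃ i j s t S T, Fork G U h I ℓ x v i j s t S T := by
  obtain ⟨A, B, hA, hB, hd, m, ⟨A', hA', pA⟩, B', hB', pB⟩ := hl
  obtain ⟨s, P, S, hs, hsT, hS⟩ := pA.last_hit (· ∈ 𝓣) ⟨a, pA.start_mem, ha⟩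
  obtain ⟨t, Q, T, ht, htT, hT⟩ := pB.last_hit (· ∈ 𝓣) ⟨b, pB.start_mem, hb⟩
  exact ⟨side m, side !m, s, t, S, T, hs.right, ht.right, hs.right_sub.trans (hA'.trans hA),
    ht.right_sub.trans (hB'.trans hB),
    hd.mono (hs.right_sub.trans hA') (ht.right_sub.trans hB'), hsT, htT, hS, hT,
    side_ne_zero m, side_ne_zero _, side_ne_not m⟩

theorem narrow_or_fork (C : Ctx G U z h I ℓ x v) (hP : ∃ p, p ∈ 𝓟) :
    (∃ c ∈ 𝓗, (∀ i, c ≠ ℓ i) ∧ Narrow G U z h I x v c) ∨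
      ∃ i j s t S T, Fork G U h I ℓ x v i j s t S T := by
  by_contra! hcon
  obtain ⟨h1, h2⟩ := hcon
  have hbad : ∀ a ∈ 𝓣, ∀ b ∈ 𝓣, a ≠ b → ¬ Conn 𝓝 𝓗 (ℓ 1) (ℓ 2) ∧
      ∃ m, (a = x (side m) ∧ b = ℓ (side m)) ∨ (a = ℓ (side m) ∧ b = x (side m)) := by
    intro a ha b hb hab
    by_contra hcon
    obtain ⟨i, j, s, t, S, T, D⟩ := C.exists_fork_of_linked ha hb
      (C.terminals.linked ha.1 hb.1 hab (by
        by_contra! hh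
        refine hcon ⟨hh.1, ?_⟩
        obtain ⟨m, hm⟩ := hh.2
        refine ⟨m, ?_⟩
        by_cases h3 : a = x (side m) ∧ b = ℓ (side m)
        · exact Or.inl h3
        · exact Or.inr (hm fun h4 h5 => h3 ⟨h4, h5⟩)))
    exact h2 i j s t S T D
  obtain ⟨p₀, hp₀⟩ := hP
  have hne : ∃ c, c ∈ 𝓣 := by
    by_contra! hcon
    have := C.home_of_good hp₀ (c := x 0) fun a _ ha' => absurd ha' (hcon a)
    have h3 := C.good_card hp₀
    rw [this] at h3
    simp at h3
  by_cases hone : ∃ c ∈ 𝓣, ∀ a ∈ 𝓣, a = c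
  · obtain ⟨c, hc, hall⟩ := hone
    have hh : ∀ p ∈ 𝓟, h p = {x 0, c} := fun p hp =>
      C.home_of_good hp fun a _ ha => hall a ha
    refine h1 c hc.1 ?_ fun p hp => Or.inl (hh p hp)
    rintro i rfl
    have := C.unique i p₀ (rungSet_sub hp₀.1.1) (by simp [hh p₀ hp₀])
    by_cases hi : i = 0
    · subst hi; exact C.ne_anchor hp₀ this
    · have h3 := hh p₀ hp₀
      have h4 : x i ∈ h p₀ := by rw [this, C.home]; simp
      rw [h3] at h4
      simp only [Finset.mem_insert, Finset.mem_singleton] at h4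
      rcases h4 with h4 | h4
      · exact C.x_ne_side hi h4
      · exact C.ne i h4.symm
  · push Not at hone
    obtain ⟨a, ha⟩ := hne
    obtain ⟨b, hb, hab⟩ := hone a ha
    have hm : ∃ m, x (side m) ∈ 𝓣 ∧ ℓ (side m) ∈ 𝓣 := by
      obtain ⟨-, m, ⟨rfl, rfl⟩ | ⟨rfl, rfl⟩⟩ := hbad a ha b hb hab.symm
      · exact ⟨m, ha, hb⟩
      · exact ⟨m, hb, ha⟩
    obtain ⟨m, hmx, hml⟩ := hm
    have hnc : ¬ Conn 𝓝 𝓗 (ℓ (side m)) (ℓ (side !m)) := by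
      have := (hbad a ha b hb hab.symm).1
      cases m
      · exact fun hh => this hh.symm
      · exact this
    have hll : ℓ (side !m) ∉ 𝓣 := by
      intro hh
      obtain ⟨-, k, ⟨h3, -⟩ | ⟨-, h3⟩⟩ := hbad _ hml _ hh
        (fun h4 => side_ne_not m (C.l_inj h4))
      · exact C.l_ne_x _ _ h3
      · exact C.l_ne_x _ _ h3
    refine h1 (x (side m)) hmx.1 (fun i => (C.l_ne_x _ _).symm) fun p hp => ?_
    by_cases hlp : ℓ (side m) ∈ h p
    · refine Or.inr ⟨m, C.unique _ p (rungSet_sub hp.1.1) hlp, rfl, fun w hw hxw => ?_⟩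
      obtain ⟨d, hd, hwd⟩ := C.flag_pair hw hxw
      by_cases hd0 : d = x 0
      · left; rw [hwd, hd0, Finset.pair_comm]
      by_cases hdl : d = ℓ (side m)
      · right; exact C.unique _ w hw (by simp [hwd, hdl])
      have hdl0 : d ≠ ℓ 0 := by
        rintro rfl
        have := C.unique 0 w hw (by simp [hwd])
        subst this
        rw [C.flags] at hxw
        simp only [Finset.mem_insert, Finset.mem_singleton] at hxw
        rcases hxw with h3 | h3
        · exact C.l_ne_x _ _ h3.symm
        · exact C.x_ne_side (side_ne_zero m) h3
      have hdH : d ∈ 𝓗 := ⟨⟨w, hw, by simp [hwd]⟩, hd0, hdl0⟩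
      exfalso
      obtain ⟨k, hk⟩ := C.terminals.cut _ hmx.1 (fun k => (C.l_ne_x _ _).symm) d hdH hd.symm
      rcases Bool.eq_or_eq_not k m with rfl | rfl
      · obtain ⟨T, hT, pT⟩ := hk.symm
        cases pT with
        | single => exact hdl rfl
        | @cons _ b _ T h3 h4 h5 h6 =>
          exact (hT (Or.inr h6.start_mem)).2 (C.adj_l h4)
      · refine hnc (Conn.head hml.1 (?_ : (𝓝).Adj _ (x (side m)))
          (Conn.head hmx.1 (?_ : (𝓝).Adj _ d) (hk.mono Set.sdiff_subset)))
        · exact ⟨C.ne _, z (side m), C.mem _, C.home _⟩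
        · exact ⟨hd, w, hw, hwd⟩
    · refine Or.inl (C.home_of_good hp fun e he heT => ?_)
      by_contra hec
      obtain ⟨-, k, ⟨-, h3⟩ | ⟨h3, -⟩⟩ := hbad e heT _ hmx hec
      · exact C.l_ne_x _ _ h3.symm
      · rcases Bool.eq_or_eq_not k m with rfl | rfl
        · exact hlp (h3 ▸ he)
        · exact hll (h3 ▸ heT)

end Ctx

end Fork

section Pivot

variable {V : Type*}

/-- A node `c` such that all good hub contacts at the ends of a fork are flagged `c`. -/
structure Pivot (G : SimpleGraph V) (U : Set V) (h I : V → Finset ℕ) (ℓ x : Fin 3 → ℕ)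
    (v : V) (i j : Fin 3) (s t : ℕ) (S T : Set ℕ) (c : ℕ) : Prop
    extends Fork G U h I ℓ x v i j s t S T where
  inner : c ∈ MinLab.inner U h ℓ x
  notA : c ∉ S
  notB : c ∉ T
  ne_l : ∀ i, c ≠ ℓ i
  flagA : ∀ p ∈ goodTouch G U h I (x 0) v, s ∈ h p → c ∈ I p
  flagB : ∀ p ∈ goodTouch G U h I (x 0) v, t ∈ h p → c ∈ I p

variable {G : SimpleGraph V} {U : Set V} {z : Fin 3 → V} {h I : V → Finset ℕ}
  {ℓ x : Fin 3 → ℕ} {v : V} {i j : Fin 3} {s t c : ℕ} {S T : Set ℕ}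

theorem Pivot.symm (D : Pivot G U h I ℓ x v i j s t S T c) : Pivot G U h I ℓ x v j i t s T S c :=
  ⟨D.toFork.symm, D.inner, D.notB, D.notA, D.ne_l, D.flagB, D.flagA⟩

theorem Fork.terminal_mem (D : Fork G U h I ℓ x v i j s t S T) {k : Fin 3} (hk : k ≠ 0) :
    ℓ k ∈ S ∪ T := by
  have key : ∀ i j k : Fin 3, k ≠ 0 → i ≠ 0 → j ≠ 0 → i ≠ j → k = i ∨ k = j := by
    intro i j k; omega
  have := key i j k hk D.hi D.hj D.hij
  rcases this with rfl | rfl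
  · exact Or.inl D.fst.end_mem
  · exact Or.inr D.snd.end_mem

/-- Continuing a node path that reaches the fork. -/
theorem Fork.exists_path (D : Fork G U h I ℓ x v i j s t S T) {y m : ℕ} {M : Set ℕ}
    (hM : IPath (nodeGraph U h) y M m) (hm : m ∈ S) (h1 : ∀ a ∈ M, a ∈ S ∪ T → a = m) :
    ∃ R, IPath (nodeGraph U h) y R (ℓ i) ∧ R ⊆ M ∪ S ∧ Disjoint R T := by
  obtain ⟨R, hR, pR⟩ := (hM.conn.mono Set.subset_union_left).trans
    ((D.fst.conn_mem hm).symm.trans D.fst.conn |>.mono (Set.subset_union_right (s := M)))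
  refine ⟨R, pR, hR, Set.disjoint_left.2 fun a ha haT => ?_⟩
  rcases hR ha with h2 | h2
  · have := h1 a h2 (Or.inr haT)
    exact Set.disjoint_left.1 D.disj hm (this ▸ haT)
  · exact Set.disjoint_left.1 D.disj h2 haT

variable [Fintype V]

namespace Ctx

local notation "𝓦" => rungSet G U h I
local notation "𝓕" => hub G U h I (x 0) v
local notation "𝓧" => touch G U h I (x 0) v
local notation "𝓟" => goodTouch G U h I (x 0) v
local notation "𝓗" => MinLab.inner U h ℓ x
local notation "𝓝" => nodeGraph U h
local notation "𝓣" => touchNodes G U h I ℓ x v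

theorem fork_other (C : Ctx G U z h I ℓ x v) (D : Fork G U h I ℓ x v i j s t S T)
    (hno : ∀ p ∈ 𝓟, h p ≠ {s, t}) {q : V} (hq : q ∈ 𝓟) (hs : s ∈ h q) :
    ∃ d, h q = {s, d} ∧ d ∉ S ∧ d ∉ T := by
  obtain ⟨d, hd, hh⟩ := C.rung_pair hq.1.1 hs
  refine ⟨d, hh, fun hdS => ?_, fun hdT => ?_⟩
  · rcases C.mem_touchNodes hq (a := d) (by simp [hh]) with rfl | h1
    · exact zero_notin D.subA hdS
    · exact hd (D.onlyA d hdS h1).symm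
  · rcases C.mem_touchNodes hq (a := d) (by simp [hh]) with rfl | h1
    · exact zero_notin D.subB hdT
    · exact hno q hq (by rw [hh, D.onlyB d hdT h1])

theorem fork_no_sub (C : Ctx G U z h I ℓ x v) (D : Fork G U h I ℓ x v i j s t S T) :
    ∀ p ∈ 𝓟, ¬ ∀ a ∈ h p, a ∈ S := by
  intro p hp hh
  refine C.not_sub_singleton s p hp fun a ha => ?_
  rcases C.mem_touchNodes hp ha with rfl | h1
  · exact absurd (hh _ ha) (zero_notin D.subA)
  · exact D.onlyA a (hh a ha) h1

theorem fork_ne (D : Fork G U h I ℓ x v i j s t S T) : s ≠ t := by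
  rintro rfl
  exact Set.disjoint_left.1 D.disj D.fst.start_mem D.snd.start_mem

theorem exists_pivot (C : Ctx G U z h I ℓ x v) (D : Fork G U h I ℓ x v i j s t S T)
    (hno : ∀ p ∈ 𝓟, h p ≠ {s, t}) : ∃ c, Pivot G U h I ℓ x v i j s t S T c := by
  have key : ∀ q ∈ 𝓟, s ∈ h q → ∀ q' ∈ 𝓟, t ∈ h q' → ∃ c, c ∉ S ∧ c ∉ T ∧ c ∈ I q ∧ c ∈ I q' ∧
      h q = {s, c} ∧ h q' = {t, c} := by
    intro q hq hs q' hq' ht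
    obtain ⟨d, hd, hdS, hdT⟩ := C.fork_other D hno hq hs
    obtain ⟨d', hd', hdS', hdT'⟩ := C.fork_other D.symm
      (fun p hp hh => hno p hp (by rw [hh, Finset.pair_comm])) hq' ht
    obtain ⟨p, A, hA, hp, hph, hpf⟩ := C.exists_arm D.fst hdS (zero_notin D.subA) hq.1.1 hd
      (C.fork_no_sub D)
    obtain ⟨p', B, hB, hp', hph', hpf'⟩ := C.exists_arm D.snd hdS' (zero_notin D.subB) hq'.1.1 hd'
      (C.fork_no_sub D.symm)
    have hp : p ∈ 𝓟 := hp.elim (fun hh => hh ▸ hq) id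
    have hp' : p' ∈ 𝓟 := hp'.elim (fun hh => hh ▸ hq') id
    have hne : ({s, d} : Finset ℕ) ≠ {t, d'} := by
      intro hh
      have : s ∈ ({t, d'} : Finset ℕ) := by rw [← hh]; simp
      simp only [Finset.mem_insert, Finset.mem_singleton] at this
      rcases this with h1 | h1
      · exact fork_ne D h1
      · exact hdT' (h1 ▸ D.fst.start_mem)
    have hc : d = d' ∧ d ∈ I p ∧ d' ∈ I p' := by
      by_contra hcon
      have := (C.two_tails D.hi D.hj D.hij (C.arm_tail hA) (C.arm_tail hB)
        (C.arm_apart hA hB D.disj hne (fun _ => hdT) (fun _ => hdT')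
          fun h1 h2 h3 => hcon ⟨h1, h2, h3⟩) hp hp').1
      exact hne (hph.symm.trans (this.trans hph'))
    obtain ⟨rfl, h1, h2⟩ := hc
    exact ⟨d, hdS, hdT, hpf h1 ▸ h1, hpf' h2 ▸ h2, hd, hd'⟩
  obtain ⟨-, q, hq, hqs⟩ := D.memA
  obtain ⟨-, q', hq', hqt⟩ := D.memB
  obtain ⟨c, hcS, hcT, hc, hc', hh, hh'⟩ := key q hq hqs q' hq' hqt
  have hcT' : c ∈ 𝓣 := by
    refine (C.mem_touchNodes hq (a := c) (by simp [hh])).resolve_left ?_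
    rintro rfl
    exact hq.2 hc
  have hpair : ∀ a b : ℕ, s ≠ a → ({s, a} : Finset ℕ) = {s, b} → a = b := by
    intro a b hsa hab
    have : a ∈ ({s, b} : Finset ℕ) := by rw [← hab]; simp
    simp only [Finset.mem_insert, Finset.mem_singleton] at this
    exact this.resolve_left hsa.symm
  refine ⟨c, D, hcT'.1, hcS, hcT, ?_, ?_, ?_⟩
  · rintro k rfl
    have h1 := C.unique k q (rungSet_sub hq.1.1) (by simp [hh])
    have h2 := C.unique k q' (rungSet_sub hq'.1.1) (by simp [hh'])
    rw [h1, ← h2, hh'] at hh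
    have : s ∈ ({t, ℓ k} : Finset ℕ) := by rw [hh]; simp
    simp only [Finset.mem_insert, Finset.mem_singleton] at this
    rcases this with h3 | h3
    · exact fork_ne D h3
    · exact hcS (h3 ▸ D.fst.start_mem)
  · intro p hp hps
    obtain ⟨c', -, -, h1, h2, -, h3⟩ := key p hp hps q' hq' hqt
    have : c' ∈ ({t, c} : Finset ℕ) := by rw [← hh', h3]; simp
    simp only [Finset.mem_insert, Finset.mem_singleton] at this
    rcases this with rfl | rfl
    · exfalso
      rw [hh'] at h3
      have : c ∈ ({c', c'} : Finset ℕ) := by rw [← h3]; simp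
      simp only [Finset.mem_insert, Finset.mem_singleton, or_self] at this
      exact hcT (this ▸ D.snd.start_mem)
    · exact h1
  · intro p hp hpt
    obtain ⟨c', -, -, h1, h2, h3, -⟩ := key q hq hqs p hp hpt
    have : c' ∈ ({s, c} : Finset ℕ) := by rw [← hh, h3]; simp
    simp only [Finset.mem_insert, Finset.mem_singleton] at this
    rcases this with rfl | rfl
    · exfalso
      rw [hh] at h3
      have : c ∈ ({c', c'} : Finset ℕ) := by rw [← h3]; simp
      simp only [Finset.mem_insert, Finset.mem_singleton, or_self] at this
      exact hcS (this ▸ D.fst.start_mem)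
    · exact h2

theorem pivot_ne_zero (D : Pivot G U h I ℓ x v i j s t S T c) : c ≠ x 0 := D.inner.2.1

theorem pivot_home (C : Ctx G U z h I ℓ x v) {w : V} (hw : w ∈ U) (hc : c ∈ I w) {a : ℕ}
    (ha : a ∈ h w) (hac : a ≠ c) : h w = {a, c} := by
  obtain ⟨b, hb, hh⟩ := C.flag_pair hw hc
  rw [hh] at ha ⊢
  simp only [Finset.mem_insert, Finset.mem_singleton] at ha
  rw [← ha.resolve_left hac, Finset.pair_comm]

theorem pivot_arm (C : Ctx G U z h I ℓ x v) (D : Pivot G U h I ℓ x v i j s t S T c) :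
    ∃ p A, Arm G U h I (x 0) v p S s c A (z i) ∧ p ∈ 𝓟 ∧ h p = {s, c} ∧ c ∈ I p := by
  obtain ⟨-, q, hq, hqs⟩ := D.memA
  have hsc : s ≠ c := fun hh => D.notA (hh ▸ D.fst.start_mem)
  have hqc := D.flagA q hq hqs
  obtain ⟨p, A, hA, hp, hph, -⟩ := C.exists_arm D.fst D.notA (zero_notin D.subA) hq.1.1
    (C.pivot_home (rungSet_sub hq.1.1) hqc hqs hsc) (C.fork_no_sub D.toFork)
  have hp : p ∈ 𝓟 := hp.elim (fun hh => hh ▸ hq) id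
  exact ⟨p, A, hA, hp, hph, D.flagA p hp (by simp [hph])⟩

/-- Every inner node other than the pivot reaches the fork. -/
theorem pivot_reach (C : Ctx G U z h I ℓ x v) (D : Pivot G U h I ℓ x v i j s t S T c) {y : ℕ}
    (hy : y ∈ 𝓗) (hyc : y ≠ c) :
    ∃ m M, IPath 𝓝 y M m ∧ M ⊆ 𝓗 ∧ c ∉ M ∧ (∀ a ∈ M, a ∈ S ∪ T → a = m) ∧ (m ∈ S ∨ m ∈ T) := by
  obtain ⟨k, P, hP, pP⟩ := C.terminals.cut c D.inner (fun _ => D.ne_l _) y hy hyc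
  obtain ⟨m, M, M', hs, hm, hM⟩ := pP.first_hit (· ∈ S ∪ T)
    ⟨_, pP.end_mem, D.terminal_mem (side_ne_zero k)⟩
  exact ⟨m, M, hs.left, fun a ha => (hP (hs.left_sub ha)).1,
    fun hh => (hP (hs.left_sub hh)).2 rfl, hM, hm⟩

theorem pivot_violation (C : Ctx G U z h I ℓ x v) (D : Pivot G U h I ℓ x v i j s t S T c)
    {e m : ℕ} {M : Set ℕ} (hM : IPath 𝓝 e M m) (hMH : M ⊆ 𝓗) (hcM : c ∉ M)
    (hMS : ∀ a ∈ M, a ∈ S ∪ T → a = m) (hm : m ∈ S)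
    (hMe : ∀ a ∈ M, a ∈ 𝓣 → (∃ q ∈ 𝓟, h q ≠ {x 0, c} ∧ c ∉ I q ∧ a ∈ h q) → a = e)
    {q : V} (hq : q ∈ 𝓟) (hqc : h q ≠ {x 0, c}) (hqI : c ∉ I q) (heq : e ∈ h q) : False := by
  obtain ⟨R, pR, hR, hRT⟩ := D.exists_path hM hm hMS
  obtain ⟨d, hed, hd⟩ := C.rung_pair hq.1.1 heq
  have hcR : c ∉ R := fun hh => (hR hh).elim hcM D.notA
  have hRH : R ⊆ 𝓗 := hR.trans (Set.union_subset hMH D.subA)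
  have hR1 : ∀ p ∈ 𝓟, h p ≠ {x 0, c} → c ∉ I p → ∀ a ∈ h p, a ∈ R → a = e := by
    intro p hp h1 h2 a ha haR
    have haT := (C.mem_touchNodes hp ha).resolve_left
      (by rintro rfl; exact zero_notin hRH haR)
    rcases hR haR with h3 | h3
    · exact hMe a h3 haT ⟨p, hp, h1, h2, ha⟩
    · exact absurd (D.flagA p hp (D.onlyA a h3 haT ▸ ha)) h2
  have hdR : d ∉ R := fun hh => hed (hR1 q hq hqc hqI d (by simp [hd]) hh).symm
  obtain ⟨p, A, hA, hp, hph, hpf⟩ := C.exists_arm pR hdR (zero_notin hRH) hq.1.1 hd (by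
    intro p hp hh
    by_cases h1 : h p = {x 0, c}
    · exact hcR (hh c (by simp [h1]))
    by_cases h2 : c ∈ I p
    · exact hcR (hh c (C.sub p (rungSet_sub hp.1.1) h2))
    · exact C.not_sub_singleton e p hp fun a ha => hR1 p hp h1 h2 a ha (hh a ha))
  have hp : p ∈ 𝓟 := hp.elim (fun hh => hh ▸ hq) id
  obtain ⟨p', B, hB, hp', hph', -⟩ := C.pivot_arm D.symm
  have htq : t ∉ h q := fun hh => hqI (D.flagB q hq hh)
  have hne : ({e, d} : Finset ℕ) ≠ {t, c} := by
    intro hh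
    exact htq (by rw [hd, hh]; simp)
  refine hne (hph.symm.trans ((C.two_tails D.hi D.hj D.hij (C.arm_tail hA) (C.arm_tail hB)
    (C.arm_apart hA hB hRT hne ?_ (fun _ => hcR) ?_) hp hp').1.trans hph'))
  · intro _ hdT
    rcases C.mem_touchNodes hq (a := d) (by simp [hd]) with rfl | h1
    · exact zero_notin D.subB hdT
    · exact htq (D.onlyB d hdT h1 ▸ (by simp [hd]))
  · rintro rfl h1 -
    exact hqI (hpf h1 ▸ h1)

/-- All good hub contacts are flagged at the pivot or lie in the strip from it to the anchor. -/
theorem pivot_good (C : Ctx G U z h I ℓ x v) (D : Pivot G U h I ℓ x v i j s t S T c) :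
    ∀ p ∈ 𝓟, h p = {x 0, c} ∨ c ∈ I p := by
  intro q hq
  by_contra! hcon
  obtain ⟨e₀, he₀, he₀T, he₀c⟩ : ∃ a ∈ h q, a ∈ 𝓣 ∧ a ≠ c := by
    by_contra! hh
    exact hcon.1 (C.home_of_good hq hh)
  obtain ⟨m, M, hM, hMH, hcM, hMS, hm⟩ := C.pivot_reach D he₀T.1 he₀c
  obtain ⟨e, N, M', hs, ⟨heT, p, hp, hpc, hpI, hep⟩, hlast⟩ := hM.last_hit
    (fun a => a ∈ 𝓣 ∧ ∃ q ∈ 𝓟, h q ≠ {x 0, c} ∧ c ∉ I q ∧ a ∈ h q)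
    ⟨e₀, hM.start_mem, he₀T, q, hq, hcon.1, hcon.2, he₀⟩
  have h1 := hs.right_sub
  rcases hm with hm | hm
  · exact C.pivot_violation D hs.right (h1.trans hMH) (fun hh => hcM (h1 hh))
      (fun a ha => hMS a (h1 ha)) hm (fun a ha haT hh => hlast a ha ⟨haT, hh⟩) hp hpc hpI hep
  · exact C.pivot_violation D.symm hs.right (h1.trans hMH) (fun hh => hcM (h1 hh))
      (fun a ha hh => hMS a (h1 ha) hh.symm) hm (fun a ha haT hh => hlast a ha ⟨haT, hh⟩)
      hp hpc hpI hep

theorem pivot_adj (C : Ctx G U z h I ℓ x v) (D : Pivot G U h I ℓ x v i j s t S T c) {w : V}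
    (hw : w ∈ U) (hxw : x 0 ∈ I w) (hwc : h w ≠ {x 0, c}) : G.Adj v w := by
  by_cases hw0 : w = z 0
  · rw [hw0]; exact C.adj0
  obtain ⟨y, hy, hwh, hyl⟩ := C.anchor_flag hw hxw hw0
  have hyc : y ≠ c := by
    rintro rfl
    exact hwc (by rw [hwh, Finset.pair_comm])
  have hcall : ∀ q ∈ 𝓟, c ∈ h q := fun q hq => (C.pivot_good D q hq).elim (fun hh => by simp [hh])
    fun hh => C.sub q (rungSet_sub hq.1.1) hh
  have key : ∀ {i j s t S T}, Pivot G U h I ℓ x v i j s t S T c → ∀ {m M}, IPath 𝓝 y M m →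
      M ⊆ 𝓗 → c ∉ M → (∀ a ∈ M, a ∈ S ∪ T → a = m) → m ∈ S → G.Adj v w := by
    intro i j s t S T D m M hM hMH hcM hMS hm
    obtain ⟨R, pR, hR, hRT⟩ := D.exists_path hM hm hMS
    have hcR : c ∉ R := fun hh => (hR hh).elim hcM D.notA
    obtain ⟨p', B, hB, hp', hph', -⟩ := C.pivot_arm D.symm
    refine C.adj_of_arm D.hj D.hi D.hij.symm hB hp' hph' pR
      (hR.trans (Set.union_subset hMH D.subA)) hRT.symm (fun _ => hcR) hw hxw hwh
      (fun q hq hh => hcR (hh c (hcall q hq))) fun q hq hh => ?_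
    have := hcall q hq
    rw [hh] at this
    simp only [Finset.mem_insert, Finset.mem_singleton] at this
    exact this.elim hyc.symm (pivot_ne_zero D)
  obtain ⟨m, M, hM, hMH, hcM, hMS, hm⟩ := C.pivot_reach D hy hyc
  rcases hm with hm | hm
  · exact key D hM hMH hcM hMS hm
  · exact key D.symm hM hMH hcM (fun a ha hh => hMS a ha hh.symm) hm

end Ctx

end Pivot

section PivotCase

variable {V : Type*}

/-- The hub vertices with a good contact flagged at `c` outside the strip `{o, c}`. -/
def hits (G : SimpleGraph V) (U : Set V) (h I : V → Finset ℕ) (o : ℕ) (v : V) (c : ℕ) : Set V :=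
  {f | f ∈ hub G U h I o v ∧
    ∃ w ∈ goodTouch G U h I o v, G.Adj f w ∧ c ∈ I w ∧ h w ≠ {o, c}}

/-- The hub vertices reachable from `v` with no earlier hit. -/
def near (G : SimpleGraph V) (U : Set V) (h I : V → Finset ℕ) (o : ℕ) (v : V) (c : ℕ) : Set V :=
  {f | f ∈ hub G U h I o v ∧ Conn G (insert f (hub G U h I o v \ hits G U h I o v c)) v f}

variable {G : SimpleGraph V} {U : Set V} {z : Fin 3 → V} {h I : V → Finset ℕ}
  {ℓ x : Fin 3 → ℕ} {v : V} {i j : Fin 3} {s t c : ℕ} {S T : Set ℕ}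

variable [Fintype V]

namespace Ctx

local notation "𝓦" => rungSet G U h I
local notation "𝓕" => hub G U h I (x 0) v
local notation "𝓧" => touch G U h I (x 0) v
local notation "𝓟" => goodTouch G U h I (x 0) v
local notation "𝓗" => MinLab.inner U h ℓ x
local notation "𝓝" => nodeGraph U h
local notation "𝓔" => hits G U h I (x 0) v c
local notation "𝓜" => near G U h I (x 0) v c

theorem mem_of_good (C : Ctx G U z h I ℓ x v) (D : Pivot G U h I ℓ x v i j s t S T c) {p : V}
    (hp : p ∈ 𝓟) : c ∈ h p :=
  (C.pivot_good D p hp).elim (fun hh => by simp [hh]) fun hh => C.sub p (rungSet_sub hp.1.1) hh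

theorem pivot_ne_pair (D : Pivot G U h I ℓ x v i j s t S T c) {d : ℕ} (h0 : d ≠ x 0)
    (hc : d ≠ c) : ({d, c} : Finset ℕ) ≠ {x 0, c} := by
  intro hh
  have h1 : d ∈ ({x 0, c} : Finset ℕ) := hh ▸ (by simp)
  simp only [Finset.mem_insert, Finset.mem_singleton] at h1
  exact h1.elim h0 hc

theorem pivot_arm_from (C : Ctx G U z h I ℓ x v) (D : Pivot G U h I ℓ x v i j s t S T c)
    {k : Fin 3} {u : V} {d : ℕ} {R : Set ℕ} (hu : u ∈ U) (hc : c ∈ I u) (hd : h u = {d, c})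
    (hR : IPath 𝓝 d R (ℓ k)) (hRH : R ⊆ 𝓗) (hcR : c ∉ R) :
    ∃ A, Arm G U h I (x 0) v u R d c A (z k) := by
  obtain ⟨p, A, hA, hp, hph, hpu⟩ := C.exists_arm hR hcR (zero_notin hRH) (C.flag_rung hu hc) hd
    fun p hp hh => hcR (hh c (C.mem_of_good D hp))
  have hd0 : d ≠ x 0 := fun hh => zero_notin hRH (hh ▸ hR.start_mem)
  have hdc : d ≠ c := fun hh => hcR (hh ▸ hR.start_mem)
  rcases hp with rfl | hp
  · exact ⟨A, hA⟩
  rcases C.pivot_good D p hp with h1 | h1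
  · exact absurd (hph.symm.trans h1) (pivot_ne_pair D hd0 hdc)
  · have := hpu h1
    subst this
    exact ⟨A, hA⟩

/-- Two arms starting at vertices flagged at a common node meet only there. -/
theorem arms_at (C : Ctx G U z h I ℓ x v) {u u' e e' : V} {R R' : Set ℕ} {d d' : ℕ}
    {A B : Set V} (hA : Arm G U h I (x 0) v u R d c A e) (hB : Arm G U h I (x 0) v u' R' d' c B e')
    (hd : Disjoint R R') :
    ∀ a ∈ A, ∀ b ∈ B, a ≠ b ∧ (G.Adj a b → a = u ∧ b = u') := by
  have hdd : d ≠ d' := fun hh => Set.disjoint_left.1 hd hA.mem (hh ▸ hB.mem)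
  have hdc : d ≠ c := fun hh => hA.notin (hh ▸ hA.mem)
  have hdc' : d' ≠ c := fun hh => hB.notin (hh ▸ hB.mem)
  have hRR : ∀ a ∈ R, a ∉ R' := fun a ha => Set.disjoint_left.1 hd ha
  have hne : ∀ a ∈ A, ∀ b ∈ B, h a ≠ h b := by
    intro a ha b hb hh
    have hda := C.toLab.card_rung (hA.rung ha)
    obtain ⟨p, hp⟩ : (h a).Nonempty := Finset.card_pos.1 (by omega)
    rcases hA.home a ha with h1 | ⟨h1, -⟩ <;> rcases hB.home b hb with h2 | ⟨h2, -⟩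
    · exact hRR p (h1 p hp) (h2 p (hh ▸ hp))
    · exact hA.notin (h1 c (by simp [hh, h2]))
    · exact hB.notin (h2 c (by simp [← hh, h1]))
    · rw [h1, h2] at hh
      have h1 : d ∈ ({d', c} : Finset ℕ) := hh ▸ (by simp)
      simp [hdd, hdc] at h1
  intro a ha b hb
  refine ⟨fun hh => hne a ha b hb (by rw [hh]), fun hab => ?_⟩
  rcases C.toLab.adj_rung (hA.rung ha) (hB.rung hb) hab with h1 | ⟨p, hp, hp'⟩
  · exact absurd h1 (hne a ha b hb)
  have q := C.sub a (rungSet_sub (hA.rung ha)) hp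
  have q' := C.sub b (rungSet_sub (hB.rung hb)) hp'
  rcases hA.home a ha with h1 | ⟨h1, k1⟩ <;> rcases hB.home b hb with h2 | ⟨h2, k2⟩
  · exact absurd (h2 p q') (hRR p (h1 p q))
  · have := h1 p q
    rw [h2] at q'
    simp only [Finset.mem_insert, Finset.mem_singleton] at q'
    rcases q' with rfl | rfl
    · exact absurd hB.mem (hRR p this)
    · exact absurd this hA.notin
  · have := h2 p q'
    rw [h1] at q
    simp only [Finset.mem_insert, Finset.mem_singleton] at q
    rcases q with rfl | rfl
    · exact absurd this (hRR p hA.mem)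
    · exact absurd this hB.notin
  · rw [h1] at q
    rw [h2] at q'
    simp only [Finset.mem_insert, Finset.mem_singleton] at q q'
    rcases q with rfl | rfl
    · rcases q' with h3 | h3
      · exact absurd h3 hdd
      · exact absurd h3 hdc
    · exact ⟨k1 hp, k2 hp'⟩

theorem hit_transfer (C : Ctx G U z h I ℓ x v) (D : Pivot G U h I ℓ x v i j s t S T c)
    {a b : Fin 3} (ha : a ≠ 0) (hb : b ≠ 0) (hab : a ≠ b) {u u' f : V} {d d' : ℕ} {R R' : Set ℕ}
    {P : Set V} (hP : IPath G v P f) (hPF : P ⊆ 𝓕) (hPE : ∀ g ∈ P, g ∈ 𝓔 → g = f)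
    (hu : u ∈ U) (hc : c ∈ I u) (hd : h u = {d, c}) (hfu : G.Adj f u)
    (hu' : u' ∈ U) (hc' : c ∈ I u') (hd' : h u' = {d', c})
    (hR : IPath 𝓝 d R (ℓ a)) (hRH : R ⊆ 𝓗) (hcR : c ∉ R)
    (hR' : IPath 𝓝 d' R' (ℓ b)) (hRH' : R' ⊆ 𝓗) (hcR' : c ∉ R') (hRR : Disjoint R R') :
    G.Adj f u' := by
  have hd0 : ∀ {d : ℕ} {k} {R : Set ℕ}, IPath 𝓝 d R (ℓ k) → R ⊆ 𝓗 → d ≠ x 0 :=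
    fun hR hRH hh => zero_notin hRH (hh ▸ hR.start_mem)
  have hd1 : ∀ {d : ℕ} {k} {R : Set ℕ}, IPath 𝓝 d R (ℓ k) → c ∉ R → d ≠ c :=
    fun hR hRH hh => hRH (hh ▸ hR.start_mem)
  have hdd : d ≠ d' := fun hh => Set.disjoint_left.1 hRR hR.start_mem (hh ▸ hR'.start_mem)
  have hf0 : ∀ {y d}, h y = {d, c} → d ≠ x 0 → y ∈ U → x 0 ∉ I y := by
    intro y d hy hd hyU hxy
    have := C.sub y hyU hxy
    rw [hy] at this
    simp only [Finset.mem_insert, Finset.mem_singleton] at this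
    exact this.elim hd.symm (pivot_ne_zero D).symm
  have hxu := hf0 hd (hd0 hR hRH) hu
  have hxu' := hf0 hd' (hd0 hR' hRH') hu'
  have huW := C.flag_rung hu hc
  have huW' := C.flag_rung hu' hc'
  obtain ⟨A, hA⟩ := C.pivot_arm_from D hu hc hd hR hRH hcR
  obtain ⟨B, hB⟩ := C.pivot_arm_from D hu' hc' hd' hR' hRH' hcR'
  by_contra hfu'
  have hPu : ∀ g ∈ P, G.Adj g u → g = f := fun g hg hgu => hPE g hg
    ⟨hPF hg, u, ⟨⟨huW, g, hPF hg, hgu⟩, hxu⟩, hgu, hc, by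
      rw [hd]; exact pivot_ne_pair D (hd0 hR hRH) (hd1 hR hcR)⟩
  have hPu' : ∀ g ∈ P, ¬ G.Adj g u' := by
    intro g hg hgu
    refine hfu' ((hPE g hg ⟨hPF hg, u', ⟨⟨huW', g, hPF hg, hgu⟩, hxu'⟩, hgu, hc', ?_⟩) ▸ hgu)
    rw [hd']
    exact pivot_ne_pair D (hd0 hR' hRH') (hd1 hR' hcR')
  have huu : G.Adj u u' := C.complete u hu u' hu' c hc hc' fun hh => by
    have h1 : d ∈ ({d', c} : Finset ℕ) := by rw [← hd', ← hh, hd]; simp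
    simp [hdd, hd1 hR hcR] at h1
  have hAB := C.arms_at hA hB hRR
  have huB : u ∉ B := fun hh => (hAB u hA.path.start_mem u hh).1 rfl
  have hu0 : u ≠ z 0 := by
    rintro rfl
    exact hxu (by simp [C.flags])
  have hu0' : u' ≠ z 0 := by
    rintro rfl
    exact hxu' (by simp [C.flags])
  have hnu : ¬ G.Adj (z 0) u := fun hh => hxu (C.anchor_adj_rung huW hh)
  have hnu' : ¬ G.Adj (z 0) u' := fun hh => hxu' (C.anchor_adj_rung huW' hh)
  have hPW : ∀ g ∈ P, g ∉ 𝓦 := fun g hg => C.hub_not_rung (hPF hg)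
  have h0P : IPath G (z 0) ({z 0} ∪ P) f := (IPath.single _).join hP C.adj0.symm
    (by rintro _ rfl hh; exact C.anchor_not_hub (hPF hh)) (by
      rintro _ rfl y hy hh
      by_contra hyv
      exact C.anchor_not_adj_hub (hPF hy) (fun h3 => hyv ⟨rfl, h3⟩) hh)
  have hQ : IPath G (z 0) ({z 0} ∪ P ∪ {u}) u := h0P.join (IPath.single u) hfu
    (by
      rintro y (rfl | hy) hyu
      · exact hu0 (Eq.symm hyu)
      · exact hPW y hy (hyu ▸ huW)) (by
      rintro y (rfl | hy) _ rfl hyu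
      · exact absurd hyu hnu
      · exact ⟨hPu y hy hyu, rfl⟩)
  have hB' : IPath G u ({u} ∪ B) (z b) := (IPath.single u).join hB.path huu
    (by rintro _ rfl; exact huB) (by
      rintro _ rfl y hy hh
      exact ⟨rfl, ((hAB _ hA.path.start_mem y hy).2 hh).2⟩)
  have hUA : ∀ {q : Set V}, q ⊆ 𝓦 → q ⊆ insert v U := fun hq y hy => Or.inr (rungSet_sub (hq hy))
  have hQU : {z 0} ∪ P ∪ {u} ⊆ insert v U := by
    rintro y ((rfl | hy) | rfl)
    · exact Or.inr (C.mem 0)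
    · exact hub_sub (hPF hy)
    · exact Or.inr hu
  have hsub : {z 0} ∪ P ∪ {u} ⊆ insert (z 0) (insert u 𝓕) := by
    rintro y ((rfl | hy) | rfl)
    · exact Or.inl rfl
    · exact Or.inr (Or.inr (hPF hy))
    · exact Or.inr (Or.inl rfl)
  refine C.noclaw a b ha hb hab ⟨u, {z 0} ∪ P ∪ {u}, A, {u} ∪ B, hQ.symm, hA.path, hB', hQU,
    hUA hA.rung, ?_, ((C.tail_sep (C.arm_tail hA)).mono subset_rfl hsub).symm, ?_, ?_⟩
  · rintro y (rfl | hy)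
    · exact Or.inr hu
    · exact hUA hB.rung hy
  · rintro y hy w (rfl | hw) hyw
    · exact Or.inr rfl
    rcases hy with hy | rfl
    swap
    · exact Or.inl rfl
    exfalso
    have hyN : y ∈ insert (z 0) (insert u' 𝓕) := hy.elim Or.inl fun hh => Or.inr (Or.inr (hPF hh))
    rcases C.tail_sep (C.arm_tail hB) w hw y hyN (hyw.imp Eq.symm fun hh => hh.symm) with rfl | rfl
    · rcases hy with rfl | hy
      · exact hyw.elim hu0'.symm hnu'
      · rcases hyw with rfl | hyw
        · exact hPW _ hy huW'
        · exact hPu' y hy hyw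
    · rcases hy with hy | hy
      · exact hu0' hy
      · exact hPW _ hy huW'
  · rintro y hy w (rfl | hw) hyw
    · exact Or.inr rfl
    · rcases hyw with rfl | hyw
      · exact absurd rfl (hAB _ hy _ hw).1
      · exact Or.inl ((hAB y hy w hw).2 hyw).1

/-- The first hub vertex hitting the pivot is complete to its interface. -/
theorem first_hit_complete (C : Ctx G U z h I ℓ x v) (D : Pivot G U h I ℓ x v i j s t S T c)
    {f : V} {P : Set V} (hP : IPath G v P f) (hPF : P ⊆ 𝓕) (hPE : ∀ g ∈ P, g ∈ 𝓔 → g = f)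
    (hf : f ∈ 𝓔) {w : V} (hw : w ∈ U) (hcw : c ∈ I w) (hwc : h w ≠ {x 0, c}) : G.Adj f w := by
  have reach : ∀ {w : V}, w ∈ U → c ∈ I w → h w ≠ {x 0, c} → ∃ d m M, h w = {d, c} ∧
      IPath 𝓝 d M m ∧ M ⊆ 𝓗 ∧ c ∉ M ∧ (∀ a ∈ M, a ∈ S ∪ T → a = m) ∧ (m ∈ S ∨ m ∈ T) := by
    intro w hw hcw hwc
    obtain ⟨d, hdc, hwd⟩ := C.flag_pair hw hcw
    rw [Finset.pair_comm] at hwd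
    have hd0 : d ≠ x 0 := by
      rintro rfl
      exact hwc hwd
    have hdl : d ≠ ℓ 0 := by
      rintro rfl
      have := C.unique 0 w hw (by simp [hwd])
      rw [this, C.flags] at hcw
      simp only [Finset.mem_insert, Finset.mem_singleton] at hcw
      exact hcw.elim (D.ne_l 0) (pivot_ne_zero D)
    obtain ⟨m, M, hM⟩ := C.pivot_reach D (y := d) ⟨⟨w, hw, by simp [hwd]⟩, hd0, hdl⟩ hdc.symm
    exact ⟨d, m, M, hwd, hM⟩
  have go : ∀ {i j s t S T}, Pivot G U h I ℓ x v i j s t S T c → ∀ {u u' d m M},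
      u ∈ U → c ∈ I u → h u = {d, c} → IPath 𝓝 d M m → M ⊆ 𝓗 → c ∉ M →
      (∀ a ∈ M, a ∈ S ∪ T → a = m) → m ∈ S → u' ∈ U → c ∈ I u' → h u' = {t, c} →
      (G.Adj f u ↔ G.Adj f u') := by
    intro i j s t S T D u u' d m M hu hcu hud hM hMH hcM hMS hm hu' hcu' hud'
    obtain ⟨R, pR, hR, hRT⟩ := D.exists_path hM hm hMS
    have hcR : c ∉ R := fun hh => (hR hh).elim hcM D.notA
    have hRH : R ⊆ 𝓗 := hR.trans (Set.union_subset hMH D.subA)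
    exact ⟨fun hh => C.hit_transfer D D.hi D.hj D.hij hP hPF hPE hu hcu hud hh hu' hcu' hud' pR
      hRH hcR D.snd D.subB D.notB hRT, fun hh => C.hit_transfer D D.hj D.hi D.hij.symm hP hPF hPE
      hu' hcu' hud' hh hu hcu hud D.snd D.subB D.notB pR hRH hcR hRT.symm⟩
  obtain ⟨p, -, -, hp, hph, hcp⟩ := C.pivot_arm D
  obtain ⟨q, -, -, hq, hqh, hcq⟩ := C.pivot_arm D.symm
  have hpU := rungSet_sub hp.1.1
  have hqU := rungSet_sub hq.1.1
  have hpq : G.Adj f p ↔ G.Adj f q := go D hpU hcp hph (IPath.single s)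
    (Set.singleton_subset_iff.2 D.memA.1) (fun hh => D.notA (hh ▸ D.fst.start_mem))
    (fun a ha _ => ha) D.fst.start_mem hqU hcq hqh
  have all : ∀ {w : V}, w ∈ U → c ∈ I w → h w ≠ {x 0, c} → (G.Adj f w ↔ G.Adj f p) := by
    intro w hw hcw hwc
    obtain ⟨d, m, M, hwd, hM, hMH, hcM, hMS, hm⟩ := reach hw hcw hwc
    rcases hm with hm | hm
    · rw [hpq]
      exact go D hw hcw hwd hM hMH hcM hMS hm hqU hcq hqh
    · exact go D.symm hw hcw hwd hM hMH hcM (fun a ha hh => hMS a ha hh.symm) hm hpU hcp hph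
  obtain ⟨-, u, hu, hfu, hcu, huc⟩ := hf
  exact (all hw hcw hwc).2 ((all (rungSet_sub hu.1.1) hcu huc).1 hfu)

theorem near_complete (C : Ctx G U z h I ℓ x v) (D : Pivot G U h I ℓ x v i j s t S T c)
    {f : V} (hf : f ∈ 𝓜) (hfE : f ∈ 𝓔) {w : V} (hw : w ∈ U) (hcw : c ∈ I w)
    (hwc : h w ≠ {x 0, c}) : G.Adj f w := by
  obtain ⟨hfF, P, hPs, hP⟩ := hf
  refine C.first_hit_complete D hP (fun g hg => ?_) (fun g hg hgE => ?_) hfE hw hcw hwc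
  · rcases hPs hg with rfl | h1
    · exact hfF
    · exact h1.1
  · rcases hPs hg with rfl | h1
    · rfl
    · exact absurd hgE h1.2

theorem near_step {f g : V} (hf : f ∈ 𝓜) (hfE : f ∉ 𝓔) (hg : g ∈ 𝓕) (ha : G.Adj f g) :
    g ∈ 𝓜 :=
  ⟨hg, (hf.2.mono (Set.insert_subset (Or.inr ⟨hf.1, hfE⟩) (Set.subset_insert _ _))).tail ha
    (Or.inl rfl)⟩

theorem v_near : v ∈ 𝓜 := ⟨v_mem_hub, Conn.refl (Or.inl rfl)⟩

theorem home_of_conn (C : Ctx G U z h I ℓ x v) {f g : V} (hc : Conn G (𝓕 \ {v}) f g) :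
    h g = h f := by
  have := hc.closed (P := {y | y ∈ 𝓕 \ {v} ∧ h y = h f}) ⟨hc.left_mem, rfl⟩ ?_
  · exact this.2
  · rintro a ⟨ha, hfa⟩ b hb hab
    have h1 := hub_cases ha.1 ha.2
    have h2 := hub_cases hb.1 hb.2
    exact ⟨hb, (C.junk_adj h1.1 h1.2.1 h2.1 h2.2.1 hab).symm.trans hfa⟩

theorem pivot_home_of_hit (C : Ctx G U z h I ℓ x v) (D : Pivot G U h I ℓ x v i j s t S T c)
    {f : V} (hf : f ∈ 𝓜) (hfE : f ∈ 𝓔) (hv : f ≠ v) :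
    h f = {c} ∨ ((h f).card = 3 ∧ x 0 ∉ h f) := by
  obtain ⟨p, -, -, hp, hph, hcp⟩ := C.pivot_arm D
  obtain ⟨q, -, -, hq, hqh, hcq⟩ := C.pivot_arm D.symm
  have hs0 : s ≠ x 0 := D.memA.1.2.1
  have ht0 : t ≠ x 0 := D.memB.1.2.1
  have hsc : s ≠ c := fun hh => D.notA (hh ▸ D.fst.start_mem)
  have htc : t ≠ c := fun hh => D.notB (hh ▸ D.snd.start_mem)
  have hst : s ≠ t := fork_ne D.toFork
  have hat : ∀ {p : V}, p ∈ 𝓟 → c ∈ I p → h p ≠ {x 0, c} → Attach h I (h f) p := by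
    intro p hp hcp hph
    have ha := C.near_complete D hf hfE (rungSet_sub hp.1.1) hcp hph
    rcases C.hub_out hf.1 (Or.inr (rungSet_sub hp.1.1)) (fun hh => C.hub_not_rung hh hp.1.1) ha
      with h1 | h1
    · exact absurd h1.1 hv
    · exact h1.2 hv
  have a1 := hat hp hcp (hph ▸ pivot_ne_pair D hs0 hsc)
  have a2 := hat hq hcq (hqh ▸ pivot_ne_pair D ht0 htc)
  have hpq : h p ≠ h q := by
    rw [hph, hqh]
    intro hh
    have h1 : s ∈ ({t, c} : Finset ℕ) := hh ▸ (by simp)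
    simp [hst, hsc] at h1
  have cp := C.good_card hp
  have cq := C.good_card hq
  rcases a1 with h1 | ⟨a, h1, h2⟩ | ⟨h1, h2, h3⟩
  · rcases a2 with h4 | ⟨b, -, h5⟩ | ⟨h4, -⟩
    · exact absurd (h1.trans h4.symm) hpq
    · rw [← h1] at h5; rw [h5] at cp; simp at cp
    · rw [← h1] at h4; omega
  · rcases a2 with h4 | ⟨b, h4, h5⟩ | ⟨h4, -⟩
    · rw [← h4] at h2; rw [h2] at cq; simp at cq
    · rw [h2, Finset.singleton_inj] at h5
      subst h5
      have e1 := C.sub p (rungSet_sub hp.1.1) h1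
      have e2 := C.sub q (rungSet_sub hq.1.1) h4
      rw [hph] at e1
      rw [hqh] at e2
      simp only [Finset.mem_insert, Finset.mem_singleton] at e1 e2
      left
      rw [h2]
      rcases e1 with rfl | rfl
      · exact absurd e2 (by simp [hst, hsc])
      · rfl
    · rw [h2] at h4; simp at h4
  · rcases a2 with h4 | ⟨b, h4, h5⟩ | ⟨-, h5, h6⟩
    · rw [← h4] at h1; omega
    · rw [h5] at h1; simp at h1
    · right
      refine ⟨h1, fun hx => ?_⟩
      have : ({x 0, s, t, c} : Finset ℕ) ⊆ h f := by
        rw [hph] at h2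
        rw [hqh] at h5
        intro y hy
        simp only [Finset.mem_insert, Finset.mem_singleton] at hy
        rcases hy with rfl | rfl | rfl | rfl
        · exact hx
        · exact h2 (by simp)
        · exact h5 (by simp)
        · exact h5 (by simp)
      have := Finset.card_le_card this
      rw [h1, Finset.card_insert_of_notMem, Finset.card_insert_of_notMem,
        Finset.card_pair htc] at this
      · omega
      · simp [hst, hsc]
      · simp [hs0.symm, ht0.symm, (pivot_ne_zero D).symm]

theorem near_home (C : Ctx G U z h I ℓ x v) (D : Pivot G U h I ℓ x v i j s t S T c)
    {f g : V} (hf : f ∈ 𝓜) (hv : f ≠ v) (hg : g ∈ 𝓔) (hc : Conn G (𝓕 \ {v}) f g) :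
    h f = {c} ∨ ((h f).card = 3 ∧ x 0 ∉ h f) := by
  obtain ⟨P, hPs, hP⟩ := hc
  obtain ⟨y, A, B, hs, hy, hA⟩ := hP.first_hit (fun y => y ∈ 𝓔) ⟨g, hP.end_mem, hg⟩
  have hyP := hs.left_sub hs.left.end_mem
  have hfy : h y = h f := C.home_of_conn (hs.left.conn.mono (hs.left_sub.trans hPs))
  rw [← hfy]
  refine C.pivot_home_of_hit D ⟨(hPs hyP).1, ?_⟩ hy (hPs hyP).2
  have h1 : Conn G (insert y (𝓕 \ 𝓔)) f y := hs.left.conn.mono fun a ha => by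
    by_cases hh : a ∈ 𝓔
    · exact Or.inl (hA a ha hh)
    · exact Or.inr ⟨(hPs (hs.left_sub ha)).1, hh⟩
  refine (hf.2.mono ?_).trans h1
  rintro a (rfl | ha)
  · exact h1.left_mem
  · exact Or.inr ha




/-- The home given to hub vertices beyond the first hits. -/
def farHome (o c : ℕ) (κ : Finset ℕ) : Finset ℕ :=
  if κ = {o, c} ∨ (κ.card = 3 ∧ o ∈ κ) then κ
  else if κ.card = 1 ∧ κ ≠ {c} then insert o (insert c κ) else {c}

theorem farHome_cases (o c : ℕ) (κ : Finset ℕ) :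
    ((κ = {o, c} ∨ (κ.card = 3 ∧ o ∈ κ)) ∧ farHome o c κ = κ) ∨
      (∃ a, a ≠ c ∧ κ = {a} ∧ farHome o c κ = {a, o, c}) ∨
      (κ ≠ {o, c} ∧ ¬ (κ.card = 3 ∧ o ∈ κ) ∧ (∀ a, κ = {a} → a = c) ∧ farHome o c κ = {c}) := by
  unfold farHome
  split_ifs with h1 h2
  · exact Or.inl ⟨h1, rfl⟩
  · obtain ⟨a, rfl⟩ := Finset.card_eq_one.1 h2.1
    refine Or.inr (Or.inl ⟨a, fun hh => h2.2 (by rw [hh]), rfl, ?_⟩)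
    ext y; simp; tauto
  · push Not at h1 h2
    refine Or.inr (Or.inr ⟨h1.1, fun hh => h1.2 hh.1 hh.2, fun a ha => ?_, rfl⟩)
    have := h2 (by simp [ha])
    rw [ha, Finset.singleton_inj] at this
    exact this

/-- The anchor-flagged contacts of a first hit lie in the strip of the pivot. -/
theorem near_flagged (C : Ctx G U z h I ℓ x v) (D : Pivot G U h I ℓ x v i j s t S T c)
    {u w : V} (hu : u ∈ 𝓜) (huv : u ≠ v) (hw : w ∈ 𝓦) (hxw : x 0 ∈ I w)
    (hat : Attach h I (h u) w) : h w = {x 0, c} := by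
  obtain ⟨g, hg, hgv, hgu, hcg, p, hp, hgp⟩ := C.hub_touch hu.1 huv
  have hpU := rungSet_sub hp.1.1
  have hap : Attach h I (h u) p := by
    rcases C.hub_out hg (Or.inr hpU) (fun hh => C.hub_not_rung hh hp.1.1) hgp with h3 | h3
    · exact absurd h3.1 hgv
    · rw [← hgu]; exact h3.2 hgv
  have hwU := rungSet_sub hw
  have hxh := C.sub w hwU hxw
  have hcp := C.mem_of_good D hp
  have hwc := C.toLab.card_rung hw
  have hpc := C.good_card hp
  have hhit : c ∈ I p → h p ≠ {x 0, c} → h u = {c} ∨ ((h u).card = 3 ∧ x 0 ∉ h u) :=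
    fun h1 h2 => C.near_home D hu huv ⟨hg, p, hp, hgp, h1, h2⟩ hcg
  have h0c := pivot_ne_zero D
  rcases hat with h3 | ⟨a, h3, h4⟩ | ⟨h3, h4, h5⟩
  · rcases hap with h6 | ⟨a, -, h6⟩ | ⟨h6, -⟩
    · refine Finset.eq_pair_of_mem hwc hxh ?_ h0c.symm
      rw [h3, ← h6]; exact hcp
    · rw [h3, h6] at hwc; simp at hwc
    · rw [h3] at hwc; omega
  · have hax : a ≠ x 0 := by
      rintro rfl
      exact (hub_cases hu.1 huv).2.2 h4
    have hah := C.sub w hwU h3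
    have hwa := Finset.eq_pair_of_mem hwc hxh hah hax.symm
    by_cases hac : a = c
    · rw [hwa, hac]
    exfalso
    have hap' : a ∈ I p := by
      rcases hap with h6 | ⟨a', h5, h6⟩ | ⟨h6, -⟩
      · exact absurd (h6.trans h4) (C.not_home_singleton hp.1.1)
      · rw [h4, Finset.singleton_inj] at h6
        exact h6 ▸ h5
      · rw [h4] at h6; simp at h6
    have hpa := Finset.eq_pair_of_mem hpc (C.sub p hpU hap') hcp hac
    have hpne := hpa ▸ pivot_ne_pair D hax hac
    rcases hhit ((C.pivot_good D p hp).resolve_left hpne) hpne with h1 | h1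
    · rw [h4, Finset.singleton_inj] at h1
      exact hac h1
    · rw [h4] at h1; simp at h1
  · exfalso
    rcases hap with h6 | ⟨a, -, h6⟩ | ⟨-, h7, h8⟩
    · rw [h6] at hpc; omega
    · rw [h6] at h3; simp at h3
    · have hpne : h p ≠ {x 0, c} := fun hh => hp.2 (by rw [h8, hh]; simp)
      rcases hhit (h8 ▸ hcp) hpne with h1 | h1
      · rw [h1] at h3; simp at h3
      · exact h1.2 (h4 hxh)

theorem tl_of_pivot (C : Ctx G U z h I ℓ x v) (D : Pivot G U h I ℓ x v i j s t S T c) :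
    TL G (insert v U) z := by
  classical
  have h0c := pivot_ne_zero D
  let h' : V → Finset ℕ := fun u =>
    if u ∈ 𝓕 then if u ∈ 𝓜 then {x 0, c} else farHome (x 0) c (h u) else h u
  let I' : V → Finset ℕ := fun u => if u ∈ 𝓕 then if u ∈ 𝓜 then
    (if u = v then {x 0} else ∅) ∪ (if u ∈ 𝓔 then {c} else ∅) else ∅ else I u
  have e1 : ∀ u ∈ 𝓜, h' u = {x 0, c} := fun u hu => by simp [h', hu.1, hu]
  have e1' : ∀ u ∈ 𝓜, ∀ a, a ∈ I' u ↔ (u = v ∧ a = x 0) ∨ (u ∈ 𝓔 ∧ a = c) := fun u hu a => by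
    simp only [I', if_pos hu.1, if_pos hu]
    split_ifs <;> simp_all only [Finset.mem_union, Finset.mem_singleton, true_and, false_and,
      Finset.notMem_empty, or_false, false_or]
  have e2 : ∀ u ∈ 𝓕, u ∉ 𝓜 → h' u = farHome (x 0) c (h u) ∧ I' u = ∅ := fun u hu hu' => by
    simp [h', I', hu, hu']
  have e3 : ∀ u, u ∉ 𝓕 → h' u = h u ∧ I' u = I u := fun u hu => by simp [h', I', hu]
  have hUF : ∀ w ∈ insert v U, w ∉ 𝓕 → w ∈ U := fun w hw hh =>
    hw.resolve_left fun h3 => hh (h3 ▸ v_mem_hub)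
  have hvN : ∀ {u}, u ∉ 𝓜 → u ≠ v := fun hu hh => hu (hh ▸ v_near)
  have hcx : ({x 0, c} : Finset ℕ).card = 2 := Finset.card_pair h0c.symm
  have hfar : ∀ u ∈ 𝓕, u ≠ v → h u ≠ {x 0} := fun u hu hv => (hub_cases hu hv).2.2
  have pos : ∀ u ∈ 𝓕, 1 ≤ (h' u).card ∧ (h' u).card ≤ 3 := by
    intro u hu
    by_cases hN : u ∈ 𝓜
    · rw [e1 u hN, hcx]; omega
    rw [(e2 u hu hN).1]
    have hU := (hub_cases hu (hvN hN)).1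
    rcases farHome_cases (x 0) c (h u) with ⟨-, k⟩ | ⟨a, -, -, k⟩ | ⟨-, -, -, k⟩ <;> rw [k]
    · exact ⟨C.pos u hU, C.le u hU⟩
    · exact ⟨Finset.card_pos.2 (by simp), Finset.card_le_three⟩
    · simp
  -- adjacency between a near vertex and another hub vertex
  have hNF : ∀ u ∈ 𝓜, ∀ w ∈ 𝓕, w ∉ 𝓜 → G.Adj u w → LinkOK h' I' u w := by
    intro u hu w hw hwN ha
    have huE : u ∈ 𝓔 := by
      by_contra hh
      exact hwN (near_step hu hh hw ha)
    have hcu := (e1' u hu c).2 (Or.inr ⟨huE, rfl⟩)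
    by_cases huv : u = v
    · have hIv : I' u = h' u := by
        ext a
        rw [e1 u hu, e1' u hu a]
        simp [huv, huv ▸ huE]
      rcases farHome_cases (x 0) c (h w) with ⟨k1, k⟩ | ⟨a, k3, k4, k⟩ | ⟨-, -, -, k⟩
      · rcases k1 with k1 | ⟨k1, k2⟩
        · exact Or.inl (by rw [e1 u hu, (e2 w hw hwN).1, k, k1])
        · obtain ⟨g, hg, hgv, hgu, hcg, p, hp, hgp⟩ := C.hub_touch hw (hvN hwN)
          have hcw : c ∈ h w := by
            have hpU := rungSet_sub hp.1.1
            rcases C.hub_out hg (Or.inr hpU) (fun hh => C.hub_not_rung hh hp.1.1) hgp with h3 | h3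
            · exact absurd h3.1 hgv
            have := h3.2 hgv
            rw [hgu] at this
            rcases this with h6 | ⟨a, -, h6⟩ | ⟨-, h7, h8⟩
            · have := C.good_card hp
              rw [h6] at this; omega
            · rw [h6] at k1; simp at k1
            · exact h7 (C.mem_of_good D hp)
          refine Or.inr (Or.inr (Or.inr (Or.inr (Or.inr ⟨?_, ?_, hIv⟩))))
          · rw [(e2 w hw hwN).1, k, k1]
          · rw [(e2 w hw hwN).1, k, e1 u hu]
            simp [Finset.insert_subset_iff, k2, hcw]
      · have hax : a ≠ x 0 := by
          rintro rfl
          exact hfar w hw (hvN hwN) k4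
        refine Or.inr (Or.inr (Or.inr (Or.inr (Or.inr ⟨?_, ?_, hIv⟩))))
        · rw [(e2 w hw hwN).1, k, Finset.card_insert_of_notMem, hcx]
          simp only [Finset.mem_insert, Finset.mem_singleton]
          rintro (hh | hh)
          · exact hax hh
          · exact k3 hh
        · rw [(e2 w hw hwN).1, k, e1 u hu]
          simp [Finset.insert_subset_iff]
      · exact Or.inr (Or.inr (Or.inr (Or.inl ⟨c, hcu, by rw [(e2 w hw hwN).1, k]⟩)))
    · have hadj : h w = h u := by
        have k1 := hub_cases hu.1 huv
        have k2 := hub_cases hw (hvN hwN)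
        exact (C.junk_adj k1.1 k1.2.1 k2.1 k2.2.1 ha).symm
      refine Or.inr (Or.inr (Or.inr (Or.inl ⟨c, hcu, ?_⟩)))
      rw [(e2 w hw hwN).1, hadj]
      rcases farHome_cases (x 0) c (h u) with ⟨k1, k⟩ | ⟨a, k0, k1, k⟩ | ⟨-, -, -, k⟩
      · exfalso
        rcases C.pivot_home_of_hit D hu huE huv with k2 | k2
        · rcases k1 with k1 | k1
          · rw [k2] at k1
            exact Finset.card_ne_one_of_pair h0c.symm k1.symm
          · rw [k2] at k1; simp at k1
        · rcases k1 with k1 | k1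
          · exact k2.2 (by simp [k1])
          · exact k2.2 k1.2
      · exfalso
        rcases C.pivot_home_of_hit D hu huE huv with k2 | k2
        · rw [k1, Finset.singleton_inj] at k2
          exact k0 k2
        · rw [k1] at k2; simp at k2
      · exact k
  refine ⟨h', I', ℓ, x, C.toLab.patch (Q := 𝓕) hUF e3 ?_ (fun u hu => (pos u hu).1)
    (fun u hu => (pos u hu).2) ?_ ?_ ?_, C.term_patch e3 ?_⟩
  · intro u hu a ha
    by_cases hN : u ∈ 𝓜
    · rw [e1 u hN]
      rcases (e1' u hN a).1 ha with ⟨-, rfl⟩ | ⟨-, rfl⟩ <;> simp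
    · simp [(e2 u hu hN).2] at ha
  · intro u hu a ha
    by_cases hN : u ∈ 𝓜
    · rw [e1 u hN, hcx]
    · simp [(e2 u hu hN).2] at ha
  · intro u hu w hw a hau haw hne
    by_cases hN : u ∈ 𝓜
    swap
    · simp [(e2 u hu hN).2] at hau
    by_cases hwF : w ∈ 𝓕
    · by_cases hwN : w ∈ 𝓜
      · exact absurd ((e1 u hN).trans (e1 w hwN).symm) hne
      · simp [(e2 w hwF hwN).2] at haw
    rw [e1 u hN, (e3 w hwF).1] at hne
    rw [(e3 w hwF).2] at haw
    rcases (e1' u hN a).1 hau with ⟨rfl, rfl⟩ | ⟨hE, rfl⟩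
    · exact C.pivot_adj D (hUF w hw hwF) haw hne.symm
    · exact C.near_complete D hN hE (hUF w hw hwF) haw hne.symm
  · intro u hu w hw ha
    by_cases hwF : w ∈ 𝓕
    · by_cases hN : u ∈ 𝓜 <;> by_cases hwN : w ∈ 𝓜
      · exact Or.inl ((e1 u hN).trans (e1 w hwN).symm)
      · exact hNF u hN w hwF hwN ha
      · exact (hNF w hwN u hu hN ha.symm).symm
      · left
        have k1 := hub_cases hu (hvN hN)
        have k2 := hub_cases hwF (hvN hwN)
        rw [(e2 u hu hN).1, (e2 w hwF hwN).1, C.junk_adj k1.1 k1.2.1 k2.1 k2.2.1 ha]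
    have hwU := hUF w hw hwF
    rcases C.hub_out hu hw hwF ha with ⟨h0, h1, -⟩ | ⟨h1, h2⟩
    · subst h0
      exact Or.inr (Or.inr (Or.inr (Or.inl ⟨x 0, (e1' _ v_near _).2 (Or.inl ⟨rfl, rfl⟩), by
        rw [(e3 w hwF).1, h1]⟩)))
    have hwc := C.toLab.card_rung h1.1
    by_cases hN : u ∈ 𝓜
    · by_cases hxw : x 0 ∈ I w
      · by_cases huv : u = v
        · exact Or.inr (Or.inl ⟨x 0, (e1' u hN _).2 (Or.inl ⟨huv, rfl⟩), by rwa [(e3 w hwF).2]⟩)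
        · left
          rw [e1 u hN, (e3 w hwF).1, C.near_flagged D hN huv h1.1 hxw (h2 huv)]
      by_cases hwh : h w = {x 0, c}
      · exact Or.inl (by rw [e1 u hN, (e3 w hwF).1, hwh])
      have hcw := (C.pivot_good D w ⟨h1, hxw⟩).resolve_left hwh
      exact Or.inr (Or.inl ⟨c, (e1' u hN c).2 (Or.inr ⟨⟨hu, w, ⟨h1, hxw⟩, ha, hcw, hwh⟩, rfl⟩), by
        rwa [(e3 w hwF).2]⟩)
    · have huv := hvN hN
      have hat := h2 huv
      have hatt : Attach h I (farHome (x 0) c (h u)) w → LinkOK h' I' u w := by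
        intro hh
        refine LinkOK.of_attach (e2 u hu hN).1 ?_
        unfold Attach
        rw [(e3 w hwF).1, (e3 w hwF).2]
        exact hh
      apply hatt
      rcases farHome_cases (x 0) c (h u) with ⟨k1, k⟩ | ⟨a, k0, k1, k⟩ | ⟨k1, k2, k3, k⟩ <;> rw [k]
      · exact hat
      · have haw : a ∈ I w := by
          rcases hat with h3 | ⟨b, h3, h4⟩ | ⟨h3, -⟩
          · exact absurd (h3.trans k1) (C.not_home_singleton h1.1)
          · rw [k1, Finset.singleton_inj] at h4
            exact h4 ▸ h3
          · rw [k1] at h3; simp at h3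
        have hax : a ≠ x 0 := by
          rintro rfl
          exact hfar u hu huv k1
        have hah := C.sub w hwU haw
        have hcard : ({a, x 0, c} : Finset ℕ).card = 3 := by
          rw [Finset.card_insert_of_notMem (by simp [hax, k0]), hcx]
        have fin : ∀ b, b ∈ I w → a ≠ b → b ∈ ({a, x 0, c} : Finset ℕ) →
            Attach h I {a, x 0, c} w := by
          intro b hb hab hb3
          have hwh := Finset.eq_pair_of_mem hwc hah (C.sub w hwU hb) hab
          refine Or.inr (Or.inr ⟨hcard, ?_, ?_⟩)
          · rw [hwh]
            exact Finset.insert_subset (by simp) (Finset.singleton_subset_iff.2 hb3)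
          · refine Finset.Subset.antisymm (C.sub w hwU) ?_
            rw [hwh]
            exact Finset.insert_subset haw (Finset.singleton_subset_iff.2 hb)
        by_cases hxw : x 0 ∈ I w
        · exact fin _ hxw hax (by simp)
        · refine fin c ((C.pivot_good D w ⟨h1, hxw⟩).resolve_left fun hh => ?_) k0 (by simp)
          rw [hh] at hah
          simp [hax, k0] at hah
      · refine Or.inr (Or.inl ⟨c, ?_, rfl⟩)
        rcases hat with h3 | ⟨b, h3, h4⟩ | ⟨h3, h4, h5⟩
        · by_cases hxw : x 0 ∈ I w
          · exfalso
            obtain ⟨g, hg, hgv, hgu, hcg, p, hp, hgp⟩ := C.hub_touch hu huv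
            have hpU := rungSet_sub hp.1.1
            rcases C.hub_out hg (Or.inr hpU) (fun hh => C.hub_not_rung hh hp.1.1) hgp with h6 | h6
            · exact hgv h6.1
            have := h6.2 hgv
            rw [hgu] at this
            rcases this with h6 | ⟨a, -, h6⟩ | ⟨h6, -⟩
            · refine k1 (Finset.eq_pair_of_mem (h6 ▸ C.good_card hp) (h3 ▸ C.sub w hwU hxw)
                (h6 ▸ C.mem_of_good D hp) h0c.symm)
            · rw [h3, h6] at hwc; simp at hwc
            · rw [h3] at hwc; omega
          · exact (C.pivot_good D w ⟨h1, hxw⟩).resolve_left (h3 ▸ k1)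
        · rw [k3 b h4] at h3
          exact h3
        · have hxw : x 0 ∉ I w := fun hh => k2 ⟨h3, h4 (C.sub w hwU hh)⟩
          refine (C.pivot_good D w ⟨h1, hxw⟩).resolve_left fun hh => k2 ⟨h3, h4 (by simp [hh])⟩
  · intro u hu k
    by_cases hN : u ∈ 𝓜
    · rw [e1 u hN]
      simp only [Finset.mem_insert, Finset.mem_singleton]
      rintro (hh | hh)
      · exact C.l_ne_x _ _ hh
      · exact D.ne_l k hh.symm
    rw [(e2 u hu hN).1]
    have hU := hub_cases hu (hvN hN)
    have hl := C.l_mem hU.1 (fun m hh => hU.2.1 (hh ▸ C.mem_rungSet m)) k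
    rcases farHome_cases (x 0) c (h u) with ⟨-, k1⟩ | ⟨a, -, k2, k1⟩ | ⟨-, -, -, k1⟩ <;> rw [k1]
    · exact hl
    · rw [k2, Finset.mem_singleton] at hl
      simp only [Finset.mem_insert, Finset.mem_singleton]
      rintro (hh | hh | hh)
      · exact hl hh
      · exact C.l_ne_x _ _ hh
      · exact D.ne_l k hh.symm
    · rw [Finset.mem_singleton]
      exact fun hh => D.ne_l k hh.symm

end Ctx

end PivotCase

section Crossing

variable {V : Type*}

/-- A rung between the ends of a fork that meets the hub in exactly two consecutive vertices. -/
structure Gate (G : SimpleGraph V) (U : Set V) (h I : V → Finset ℕ) (o : ℕ) (v : V) (s t : ℕ)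
    (r r' w w' : V) (A B : Set V) : Prop where
  rung : Rung G U h I s t (A ∪ B) r r'
  fst : IPath G r A w
  snd : IPath G w' B r'
  disj : ∀ u ∈ A, u ∉ B
  adj : G.Adj w w'
  only : ∀ u ∈ A, ∀ y ∈ B, G.Adj u y → u = w ∧ y = w'
  good : w ∈ goodTouch G U h I o v
  good' : w' ∈ goodTouch G U h I o v
  onlyA : ∀ u ∈ A, u ∈ goodTouch G U h I o v → u = w
  onlyB : ∀ u ∈ B, u ∈ goodTouch G U h I o v → u = w'

theorem Gate.symm {G : SimpleGraph V} {U : Set V} {h I : V → Finset ℕ} {o : ℕ} {v : V} {s t : ℕ}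
    {r r' w w' : V} {A B : Set V} (K : Gate G U h I o v s t r r' w w' A B) :
    Gate G U h I o v t s r' r w' w B A :=
  ⟨Set.union_comm A B ▸ K.rung.symm, K.snd.symm, K.fst.symm, fun u hu hu' => K.disj u hu' hu,
    K.adj.symm, fun u hu y hy ha => (K.only y hy u hu ha.symm).symm, K.good', K.good,
    K.onlyB, K.onlyA⟩

variable {G : SimpleGraph V} {U : Set V} {z : Fin 3 → V} {h I : V → Finset ℕ}
  {ℓ x : Fin 3 → ℕ} {v : V} {i j : Fin 3} {s t : ℕ} {S T : Set ℕ}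

variable [Fintype V]

namespace Ctx

local notation "𝓦" => rungSet G U h I
local notation "𝓕" => hub G U h I (x 0) v
local notation "𝓧" => touch G U h I (x 0) v
local notation "𝓟" => goodTouch G U h I (x 0) v
local notation "𝓗" => MinLab.inner U h ℓ x
local notation "𝓝" => nodeGraph U h
local notation "𝓣" => touchNodes G U h I ℓ x v

theorem fork_notin (D : Fork G U h I ℓ x v i j s t S T) : t ∉ S ∧ s ∉ T ∧ x 0 ≠ s ∧ x 0 ≠ t :=
  ⟨fun hh => Set.disjoint_left.1 D.disj hh D.snd.start_mem,
    fun hh => Set.disjoint_left.1 D.disj D.fst.start_mem hh,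
    fun hh => zero_notin D.subA (hh ▸ D.fst.start_mem),
    fun hh => zero_notin D.subB (hh ▸ D.snd.start_mem)⟩

/-- A rung between the ends of a fork extends to a path joining two terminals. -/
theorem rung_line (C : Ctx G U z h I ℓ x v) (D : Fork G U h I ℓ x v i j s t S T) {R : Set V}
    {r r' : V} (hR : Rung G U h I s t R r r') :
    ∃ L, IPath G (z i) L (z j) ∧ R ⊆ L ∧ L ⊆ 𝓦 ∧ (∀ u ∈ L, x 0 ∉ I u) ∧
      ∀ u ∈ L, u ∈ 𝓧 → u ∈ R := by
  obtain ⟨tS, sT, x0s, x0t⟩ := fork_notin D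
  have rR := hR.path.start_mem
  have rR' := hR.path.end_mem
  obtain ⟨A, hA, hAh⟩ := C.exists_leg D.fst (hR.sub rR) hR.fa (by
    intro a ha haS
    rw [hR.home r rR] at ha
    simp only [Finset.mem_insert, Finset.mem_singleton] at ha
    rcases ha with rfl | rfl
    · rfl
    · exact absurd haS tS)
  obtain ⟨B, hB, hBh⟩ := C.exists_leg D.snd (hR.sub rR') hR.fb (by
    intro a ha haS
    rw [hR.home r' rR'] at ha
    simp only [Finset.mem_insert, Finset.mem_singleton] at ha
    rcases ha with rfl | rfl
    · exact absurd haS sT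
    · rfl)
  have p1 := C.rung_append hR.symm hR.path.symm subset_rfl hA tS hAh
  have hside : ∀ u ∈ R ∪ A, u ∈ R ∨ (u ∈ 𝓦 ∧ ∀ a ∈ h u, a ∈ S) := by
    rintro u (hu | hu)
    · exact Or.inl hu
    · rcases hAh u hu with rfl | h1
      · exact Or.inl rR
      · exact Or.inr h1
  have hs : SepAt G r' (R ∪ A) B := by
    intro a ha b hb hab
    rcases hBh b hb with rfl | ⟨hbW, hbT⟩
    · exact Or.inr rfl
    have hbU := rungSet_sub hbW
    rcases hside a ha with haR | ⟨haW, haS⟩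
    · rcases hab with rfl | hab
      · exact absurd (hbT s (by rw [hR.home a haR]; simp)) sT
      rcases C.toLab.adj_rung (hR.mem_rungSet haR) hbW hab with h1 | ⟨k, hk, hk'⟩
      · exact absurd (hbT s (by rw [← h1, hR.home a haR]; simp)) sT
      · have h2 := C.rung_flag_mem (hR.mem_rungSet haR) hk
        rw [hR.home a haR] at h2
        simp only [Finset.mem_insert, Finset.mem_singleton] at h2
        rcases h2 with rfl | rfl
        · exact absurd (hbT k (C.rung_flag_mem hbW hk')) sT
        · exact Or.inl (hR.ub a haR hk)
    · exfalso
      have hd := Set.disjoint_left.1 D.disj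
      have hne : h a ≠ h b := by
        intro heq
        obtain ⟨k, hk⟩ := Finset.card_pos.1 (C.pos a (rungSet_sub haW))
        exact hd (haS k hk) (hbT k (heq ▸ hk))
      rcases hab with rfl | hab
      · exact hne rfl
      rcases C.toLab.adj_rung haW hbW hab with h1 | ⟨k, hk, hk'⟩
      · exact hne h1
      · exact hd (haS k (C.rung_flag_mem haW hk)) (hbT k (C.rung_flag_mem hbW hk'))
  have hall : ∀ u ∈ (R ∪ A) ∪ B, u ∈ R ∨ (u ∈ 𝓦 ∧ ∀ a ∈ h u, a ∈ S) ∨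
      (u ∈ 𝓦 ∧ ∀ a ∈ h u, a ∈ T) := by
    rintro u (hu | hu)
    · rcases hside u hu with h1 | h1
      · exact Or.inl h1
      · exact Or.inr (Or.inl h1)
    · rcases hBh u hu with rfl | h1
      · exact Or.inl rR'
      · exact Or.inr (Or.inr h1)
  have hx : ∀ u ∈ (R ∪ A) ∪ B, x 0 ∉ I u := by
    intro u hu hx
    rcases hall u hu with h1 | ⟨h1, h2⟩ | ⟨h1, h2⟩
    · have := C.rung_flag_mem (hR.mem_rungSet h1) hx
      rw [hR.home u h1] at this
      simp [x0s, x0t] at this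
    · exact zero_notin D.subA (h2 _ (C.rung_flag_mem h1 hx))
    · exact zero_notin D.subB (h2 _ (C.rung_flag_mem h1 hx))
  refine ⟨(R ∪ A) ∪ B, p1.symm.append hB hs, fun u hu => Or.inl (Or.inl hu), ?_, hx, ?_⟩
  · intro u hu
    rcases hall u hu with h1 | ⟨h1, -⟩ | ⟨h1, -⟩
    · exact hR.mem_rungSet h1
    · exact h1
    · exact h1
  · intro u hu huX
    rcases hall u hu with h1 | ⟨h1, h2⟩ | ⟨h1, h2⟩
    · exact h1
    · exact absurd h2 (C.fork_no_sub D u ⟨huX, hx u hu⟩)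
    · exact absurd h2 (C.fork_no_sub D.symm u ⟨huX, hx u hu⟩)

/-- An initial piece of a rung, continued along the fork. -/
theorem leg_arm (C : Ctx G U z h I ℓ x v) (D : Fork G U h I ℓ x v i j s t S T) {R A : Set V}
    {r r' w : V} (hR : Rung G U h I s t R r r') (hA : IPath G r A w) (hAR : A ⊆ R)
    (hr : r' ∈ A → r' = w) (hX : ∀ u ∈ A, u ∈ 𝓟 → u = w) :
    ∃ B, Arm G U h I (x 0) v w S s t B (z i) ∧
      ∀ u ∈ B, u ∈ A ∨ (u ∈ 𝓦 ∧ ∀ a ∈ h u, a ∈ S) := by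
  obtain ⟨tS, sT, x0s, x0t⟩ := fork_notin D
  have rR := hR.path.start_mem
  obtain ⟨B, hB, hBh⟩ := C.exists_leg D.fst (hR.sub rR) hR.fa (by
    intro a ha haS
    rw [hR.home r rR] at ha
    simp only [Finset.mem_insert, Finset.mem_singleton] at ha
    rcases ha with rfl | rfl
    · rfl
    · exact absurd haS tS)
  have hall : ∀ u ∈ A ∪ B, u ∈ A ∨ (u ∈ 𝓦 ∧ ∀ a ∈ h u, a ∈ S) := by
    rintro u (hu | hu)
    · exact Or.inl hu
    · rcases hBh u hu with rfl | h1
      · exact Or.inl hA.start_mem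
      · exact Or.inr h1
  refine ⟨A ∪ B, ⟨C.rung_append hR.symm hA.symm hAR hB tS hBh, ?_, ?_, D.fst.start_mem, tS,
    zero_notin D.subA, ?_⟩, hall⟩
  · intro u hu
    rcases hall u hu with h1 | ⟨h1, -⟩
    · exact hR.mem_rungSet (hAR h1)
    · exact h1
  · intro u hu
    rcases hall u hu with h1 | ⟨-, h1⟩
    · refine Or.inr ⟨hR.home u (hAR h1), fun h2 => ?_⟩
      have := hR.ub u (hAR h1) h2
      subst this
      exact hr h1
    · exact Or.inl h1
  · intro u hu huP
    rcases hall u hu with h1 | ⟨-, h1⟩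
    · exact hX u h1 huP
    · exact absurd h1 (C.fork_no_sub D u huP)

theorem home_not_good (C : Ctx G U z h I ℓ x v) {s t : ℕ} (x0s : x 0 ≠ s) (x0t : x 0 ≠ t) {u : V}
    (hu : u ∈ 𝓦) (hh : h u = {s, t}) (hX : u ∈ 𝓧) : u ∈ 𝓟 := by
  refine ⟨hX, fun hx => ?_⟩
  have := C.rung_flag_mem hu hx
  rw [hh] at this
  simp [x0s, x0t] at this

/-- A rung between the ends of a fork that touches the hub is a gate. -/
theorem exists_gate (C : Ctx G U z h I ℓ x v) (D : Fork G U h I ℓ x v i j s t S T) {R : Set V}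
    {r r' : V} (hR : Rung G U h I s t R r r') (hP : ∃ p ∈ R, p ∈ 𝓟) :
    ∃ w w' A B, R = A ∪ B ∧ Gate G U h I (x 0) v s t r r' w w' A B := by
  obtain ⟨tS, sT, x0s, x0t⟩ := fork_notin D
  have hst := fork_ne D
  obtain ⟨w, w', A, B, hw, hw', hA, hB, hAR, hBR, oA, oB, hcase⟩ :=
    hR.path.trichotomy (fun u => u ∈ 𝓟) hP
  have rA := hA.start_mem
  have rB := hB.end_mem
  rcases hcase with ⟨rfl, hsp⟩ | ⟨hadj, hun, hdis, hon⟩ | hap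
  · exfalso
    obtain ⟨L, hL, hRL, hLW, hLx, hLR⟩ := C.rung_line D hR
    refine C.single_touch D.hi D.hj D.hij hL hLW hLx hw.1 (hRL (hAR hA.end_mem)) ?_
    intro u hu huX
    have huR := hLR u hu huX
    have huP : u ∈ 𝓟 := ⟨huX, hLx u hu⟩
    rw [← hsp.union] at huR
    rcases huR with h1 | h1
    · exact oA u h1 huP
    · exact oB u h1 huP
  · exact ⟨w, w', A, B, hun.symm, hun.symm ▸ hR, hA, hB, hdis, hadj, hon, hw, hw', oA, oB⟩
  · exfalso
    have hrr : r ≠ r' := fun hh => (hap r rA r' rB).1 hh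
    have rnB : r ∉ B := fun hh => (hap r rA r hh).1 rfl
    have rnA : r' ∉ A := fun hh => (hap r' hh r' rB).1 rfl
    obtain ⟨P, hP1, hP2⟩ := C.leg_arm D hR hA hAR (fun hh => absurd hh rnA) oA
    obtain ⟨Q, hQ1, hQ2⟩ := C.leg_arm D.symm hR.symm hB.symm hBR (fun hh => absurd hh rnB) oB
    have hPQ : Apart G P Q := by
      intro a ha b hb
      by_contra hcon
      have hab : a = b ∨ G.Adj a b := by tauto
      have hd := Set.disjoint_left.1 D.disj
      rcases hP2 a ha with haA | ⟨haW, haS⟩ <;> rcases hQ2 b hb with hbB | ⟨hbW, hbT⟩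
      · rcases hab with h1 | h1
        · exact (hap a haA b hbB).1 h1
        · exact (hap a haA b hbB).2 h1
      · have hah := hR.home a (hAR haA)
        have hne : h a ≠ h b := fun h1 => sT (hbT s (by rw [← h1, hah]; simp))
        rcases hab with rfl | hab
        · exact hne rfl
        rcases C.toLab.adj_rung (hR.mem_rungSet (hAR haA)) hbW hab with h1 | ⟨k, hk, hk'⟩
        · exact hne h1
        have h2 := C.rung_flag_mem (hR.mem_rungSet (hAR haA)) hk
        rw [hah] at h2
        simp only [Finset.mem_insert, Finset.mem_singleton] at h2
        rcases h2 with rfl | rfl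
        · exact sT (hbT k (C.rung_flag_mem hbW hk'))
        · exact rnA (hR.ub a (hAR haA) hk ▸ haA)
      · have hbh := hR.home b (hBR hbB)
        have hne : h a ≠ h b := fun h1 => tS (haS t (by rw [h1, hbh]; simp))
        rcases hab with rfl | hab
        · exact hne rfl
        rcases C.toLab.adj_rung haW (hR.mem_rungSet (hBR hbB)) hab with h1 | ⟨k, hk, hk'⟩
        · exact hne h1
        have h2 := C.rung_flag_mem (hR.mem_rungSet (hBR hbB)) hk'
        rw [hbh] at h2
        simp only [Finset.mem_insert, Finset.mem_singleton] at h2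
        rcases h2 with rfl | rfl
        · exact rnB (hR.ua b (hBR hbB) hk' ▸ hbB)
        · exact tS (haS k (C.rung_flag_mem haW hk))
      · have hne : h a ≠ h b := by
          intro heq
          obtain ⟨k, hk⟩ := Finset.card_pos.1 (C.pos a (rungSet_sub haW))
          exact hd (haS k hk) (hbT k (heq ▸ hk))
        rcases hab with rfl | hab
        · exact hne rfl
        rcases C.toLab.adj_rung haW hbW hab with h1 | ⟨k, hk, hk'⟩
        · exact hne h1
        · exact hd (haS k (C.rung_flag_mem haW hk)) (hbT k (C.rung_flag_mem hbW hk'))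
    obtain ⟨-, Y, hY, hYF⟩ := C.two_tails D.hi D.hj D.hij (C.arm_tail hP1) (C.arm_tail hQ1) hPQ
      hw hw'
    have hwA := hA.end_mem
    have hwB := hB.start_mem
    have hww := hap w hwA w' hwB
    have sep1 : SepAt G w A Y := by
      intro a ha y hy hay
      rcases hYF y hy with rfl | rfl | ⟨hyF, -⟩
      · exact Or.inr rfl
      · exfalso
        rcases hay with h1 | h1
        · exact (hap a ha y hwB).1 h1
        · exact (hap a ha y hwB).2 h1
      · left
        have haW := hR.mem_rungSet (hAR ha)
        rcases hay with rfl | hay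
        · exact absurd haW (C.hub_not_rung hyF)
        · exact oA a ha (C.home_not_good x0s x0t haW (hR.home a (hAR ha))
            ⟨haW, y, hyF, hay.symm⟩)
    have sep2 : SepAt G w' (A ∪ Y) B := by
      intro a ha y hy hay
      rcases ha with ha | ha
      · exfalso
        rcases hay with h1 | h1
        · exact (hap a ha y hy).1 h1
        · exact (hap a ha y hy).2 h1
      rcases hYF a ha with rfl | rfl | ⟨haF, -⟩
      · exfalso
        rcases hay with h1 | h1
        · exact (hap a hwA y hy).1 h1
        · exact (hap a hwA y hy).2 h1
      · exact Or.inl rfl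
      · right
        have hyW := hR.mem_rungSet (hBR hy)
        rcases hay with rfl | hay
        · exact absurd hyW (C.hub_not_rung haF)
        · exact oB y hy (C.home_not_good x0s x0t hyW (hR.home y (hBR hy))
            ⟨hyW, a, haF, hay⟩)
    have pth := (hA.append hY sep1).append hB sep2
    have hjunk : ∀ f ∈ Y, f ≠ w → f ≠ w' → f ∈ U ∧ h f = {s, t} ∧ I f = ∅ := by
      intro f hf hfw hfw'
      have hfF : f ∈ 𝓕 ∧ f ≠ v := by
        rcases hYF f hf with h1 | h1 | h1
        · exact absurd h1 hfw
        · exact absurd h1 hfw'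
        · exact h1
      obtain ⟨Y1, Y2, hsp⟩ := hY.split hf
      have hfU := (hub_cases hfF.1 hfF.2).1
      have hIf : I f = ∅ := C.not_flag hfU (C.hub_not_rung hfF.1)
      have hj : ∀ y ∈ Y, y ≠ w → y ≠ w' → y ∈ U ∧ y ∉ 𝓦 := by
        intro y hy h1 h2
        rcases hYF y hy with h3 | h3 | h3
        · exact absurd h3 h1
        · exact absurd h3 h2
        · exact ⟨(hub_cases h3.1 h3.2).1, C.hub_not_rung h3.1⟩
      have nA : w' ∉ Y1 := fun hh => hfw' (hsp.mem_inter hh hsp.right.end_mem).symm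
      have nB : w ∉ Y2 := fun hh => hfw (hsp.mem_inter hsp.left.start_mem hh).symm
      have at1 := C.attach_of_path hsp.left.symm (fun y hy => by
        by_cases h1 : y = w
        · exact Or.inl h1
        · exact Or.inr (hj y (hsp.left_sub hy) h1 fun h2 => nA (h2 ▸ hy))) hw.1.1 hfw
      have at2 := C.attach_of_path hsp.right (fun y hy => by
        by_cases h1 : y = w'
        · exact Or.inl h1
        · exact Or.inr (hj y (hsp.right_sub hy) (fun h2 => nB (h2 ▸ hy)) h1)) hw'.1.1 hfw'
      have hwh := hR.home w (hAR hwA)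
      have hwh' := hR.home w' (hBR hwB)
      have f1 : t ∉ I w := fun h1 => rnA (hR.ub w (hAR hwA) h1 ▸ hwA)
      have f2 : s ∉ I w' := fun h1 => rnB (hR.ua w' (hBR hwB) h1 ▸ hwB)
      refine ⟨hfU, ?_, hIf⟩
      rcases at1 with h1 | ⟨a, ha, h1⟩ | ⟨-, -, h1⟩
      · rw [← h1, hwh]
      · rcases at2 with h2 | ⟨b, hb, h2⟩ | ⟨h2, -⟩
        · rw [← h2, hwh']
        · exfalso
          have hab : a = b := Finset.singleton_injective (h1.symm.trans h2)
          subst hab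
          have := C.rung_flag_mem hw.1.1 ha
          rw [hwh] at this
          simp only [Finset.mem_insert, Finset.mem_singleton] at this
          rcases this with rfl | rfl
          · exact f2 hb
          · exact f1 ha
        · rw [h1] at h2; simp at h2
      · exact absurd (by rw [h1, hwh]; simp) f1
    have hmem : ∀ y ∈ (A ∪ Y) ∪ B, y ∈ R ∨ (y ∈ U ∧ h y = {s, t} ∧ I y = ∅) := by
      rintro y ((hy | hy) | hy)
      · exact Or.inl (hAR hy)
      · by_cases h1 : y = w
        · exact Or.inl (h1 ▸ hAR hwA)
        by_cases h2 : y = w'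
        · exact Or.inl (h2 ▸ hBR hwB)
        · exact Or.inr (hjunk y hy h1 h2)
      · exact Or.inl (hBR hy)
    have newR : Rung G U h I s t ((A ∪ Y) ∪ B) r r' := by
      refine ⟨pth, ?_, ?_, hR.fa, hR.fb, ?_, ?_⟩
      · intro y hy
        rcases hmem y hy with h1 | h1
        · exact hR.sub h1
        · exact h1.1
      · intro y hy
        rcases hmem y hy with h1 | h1
        · exact hR.home y h1
        · exact h1.2.1
      · intro y hy hs
        rcases hmem y hy with h1 | h1
        · exact hR.ua y h1 hs
        · rw [h1.2.2] at hs; simp at hs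
      · intro y hy hs
        rcases hmem y hy with h1 | h1
        · exact hR.ub y h1 hs
        · rw [h1.2.2] at hs; simp at hs
    obtain ⟨a, ha, y, hy, haw, hyw, hay⟩ := hY.exists_exit (P := {w}) rfl fun h1 => hww.1 h1.symm
    have haw' : a = w := haw
    subst haw'
    rcases hYF y hy with h1 | h1 | ⟨h1, -⟩
    · exact hyw h1
    · subst h1; exact hww.2 hay
    · exact C.hub_not_rung h1 (newR.mem_rungSet (Or.inl (Or.inr hy)))

end Ctx

end Crossing

section GateFacts

variable {V : Type*} [Fintype V]

variable {G : SimpleGraph V} {U : Set V} {z : Fin 3 → V} {h I : V → Finset ℕ}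
  {ℓ x : Fin 3 → ℕ} {v : V} {i j : Fin 3} {s t : ℕ} {S T : Set ℕ}

namespace Ctx

local notation "𝓦" => rungSet G U h I
local notation "𝓕" => hub G U h I (x 0) v
local notation "𝓧" => touch G U h I (x 0) v
local notation "𝓟" => goodTouch G U h I (x 0) v
local notation "𝓗" => MinLab.inner U h ℓ x
local notation "𝓝" => nodeGraph U h
local notation "𝓣" => touchNodes G U h I ℓ x v

theorem gate_through (C : Ctx G U z h I ℓ x v) (D : Fork G U h I ℓ x v i j s t S T) {p : V}
    (hp : p ∈ 𝓟) (hh : h p = {s, t}) :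
    ∃ r r' w w' A B, Gate G U h I (x 0) v s t r r' w w' A B ∧ (p = w ∨ p = w') := by
  obtain ⟨R, r, r', hR, hpR⟩ := Rung.of_mem_rungSet hp.1.1 hh
  obtain ⟨w, w', A, B, rfl, K⟩ := C.exists_gate D hR ⟨p, hpR, hp⟩
  refine ⟨r, r', w, w', A, B, K, ?_⟩
  rcases hpR with h1 | h1
  · exact Or.inl (K.onlyA p h1 hp)
  · exact Or.inr (K.onlyB p h1 hp)

theorem gate_flag {o : ℕ} {r r' w w' : V} {A B : Set V}
    (K : Gate G U h I o v s t r r' w w' A B) : t ∉ I w := fun hh => by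
  have := K.rung.ub w (Or.inl K.fst.end_mem) hh
  exact K.disj w K.fst.end_mem (this ▸ K.snd.end_mem)

theorem gate_not_both (C : Ctx G U z h I ℓ x v) (D : Fork G U h I ℓ x v i j s t S T) {p : V}
    (hp : p ∈ 𝓟) (hh : h p = {s, t}) : ¬ (s ∈ I p ∧ t ∈ I p) := by
  rintro ⟨h1, h2⟩
  obtain ⟨r, r', w, w', A, B, K, rfl | rfl⟩ := C.gate_through D hp hh
  · exact gate_flag K h2
  · exact gate_flag K.symm h1

theorem gate_ne_l (C : Ctx G U z h I ℓ x v) (D : Fork G U h I ℓ x v i j s t S T)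
    (hP : ∃ p ∈ 𝓟, h p = {s, t}) (k : Fin 3) : s ≠ ℓ k := by
  rintro rfl
  obtain ⟨p, hp, hh⟩ := hP
  have hpz := C.unique k p (rungSet_sub hp.1.1) (by rw [hh]; simp)
  have hI : I p = h p := by rw [hpz, C.flags, C.home]
  exact C.gate_not_both D hp hh ⟨by rw [hI, hh]; simp, by rw [hI, hh]; simp⟩

/-- The two arms leaving a gate. -/
theorem gate_arm (C : Ctx G U z h I ℓ x v) (D : Fork G U h I ℓ x v i j s t S T)
    {r r' w w' : V} {A B : Set V} (K : Gate G U h I (x 0) v s t r r' w w' A B) :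
    ∃ Y, Arm G U h I (x 0) v w S s t Y (z i) := by
  obtain ⟨Y, hY, -⟩ := C.leg_arm D K.rung K.fst Set.subset_union_left
    (fun hh => absurd K.snd.end_mem (K.disj _ hh)) K.onlyA
  exact ⟨Y, hY⟩

theorem gate_arm_home (C : Ctx G U z h I ℓ x v) (D : Fork G U h I ℓ x v i j s t S T)
    {r r' w w' : V} {A B : Set V} (K : Gate G U h I (x 0) v s t r r' w w' A B) {d : ℕ}
    {p : V} {R : Set ℕ} {b : ℕ} {Y : Set V} (hp : p ∈ 𝓟) (hph : h p = {b, d})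
    (hY : Arm G U h I (x 0) v p R b d Y (z i)) (hRT : Disjoint R T) (hd : d ∉ T)
    (hne : ({b, d} : Finset ℕ) ≠ {s, t}) : False := by
  obtain ⟨Q, hQ⟩ := C.gate_arm D.symm K.symm
  have hw' : h w' = {s, t} := K.rung.home w' (Or.inr K.snd.start_mem)
  have hap := C.arm_apart hY hQ hRT (fun h1 => hne (h1.trans (Finset.pair_comm _ _)))
    (fun _ => hd) (fun h1 => absurd h1 (gate_flag K.symm))
    (fun _ _ h1 => absurd h1 (gate_flag K.symm))
  have := (C.two_tails D.hi D.hj D.hij (C.arm_tail hY) (C.arm_tail hQ) hap hp K.good').1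
  rw [hph, hw'] at this
  exact hne this

theorem gate_good_of_mem (C : Ctx G U z h I ℓ x v) (D : Fork G U h I ℓ x v i j s t S T)
    (hP : ∃ p ∈ 𝓟, h p = {s, t}) {q : V} (hq : q ∈ 𝓟) (hs : s ∈ h q) : h q = {s, t} := by
  by_contra hne
  obtain ⟨p, hp, hh⟩ := hP
  obtain ⟨r, r', w, w', A, B, K, -⟩ := C.gate_through D hp hh
  obtain ⟨d, hsd, hd⟩ := C.rung_pair hq.1.1 hs
  have dS : d ∉ S := fun h1 => by
    rcases C.mem_touchNodes hq (a := d) (by simp [hd]) with rfl | h2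
    · exact zero_notin D.subA h1
    · exact hsd (D.onlyA d h1 h2).symm
  have dT : d ∉ T := fun h1 => by
    rcases C.mem_touchNodes hq (a := d) (by simp [hd]) with rfl | h2
    · exact zero_notin D.subB h1
    · exact hne (by rw [hd, D.onlyB d h1 h2])
  obtain ⟨p', Y, hY, hp', hph, -⟩ := C.exists_arm D.fst dS (zero_notin D.subA) hq.1.1 hd
    (C.fork_no_sub D)
  have hp'P : p' ∈ 𝓟 := by
    rcases hp' with rfl | h1
    · exact hq
    · exact h1
  exact C.gate_arm_home D K hp'P hph hY D.disj dT (hd ▸ hne)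

/-- Every inner node away from a gate connects to the fork. -/
theorem gate_reach (C : Ctx G U z h I ℓ x v) (D : Fork G U h I ℓ x v i j s t S T)
    (hP : ∃ p ∈ 𝓟, h p = {s, t}) {y : ℕ} (hy : y ∈ 𝓗) :
    ∃ m M, IPath 𝓝 y M m ∧ M ⊆ 𝓗 ∧ (∀ a ∈ M, a ∈ S ∪ T → a = m) ∧ (m ∈ S ∨ m ∈ T) := by
  by_cases hys : y = s
  · subst hys
    refine ⟨y, {y}, .single y, ?_, ?_, Or.inl D.fst.start_mem⟩
    · rintro a rfl; exact hy
    · rintro a rfl -; rfl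
  obtain ⟨m, M, hMs, hM⟩ := C.terminals.cut s (D.subA D.fst.start_mem)
    (fun m => C.gate_ne_l D hP _) y hy hys
  obtain ⟨m', A, B, hsp, hm', ho⟩ := hM.first_hit (fun a => a ∈ S ∪ T)
    ⟨_, hM.end_mem, D.terminal_mem (side_ne_zero m)⟩
  exact ⟨m', A, hsp.left, fun a ha => (hMs (hsp.left_sub ha)).1, ho, hm'⟩

theorem gate_violation (C : Ctx G U z h I ℓ x v) (D : Fork G U h I ℓ x v i j s t S T)
    (hP : ∃ p ∈ 𝓟, h p = {s, t}) {e m : ℕ} {M : Set ℕ} (hM : IPath 𝓝 e M m) (hMH : M ⊆ 𝓗)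
    (hMS : ∀ a ∈ M, a ∈ S ∪ T → a = m) (hm : m ∈ S)
    (hMe : ∀ a ∈ M, (∃ q ∈ 𝓟, h q ≠ {s, t} ∧ a ∈ h q) → a = e)
    {q : V} (hq : q ∈ 𝓟) (hqc : h q ≠ {s, t}) (heq : e ∈ h q) : False := by
  obtain ⟨tS, sT, x0s, x0t⟩ := fork_notin D
  obtain ⟨p, hp, hh⟩ := hP
  obtain ⟨r, r', w, w', A, B, K, -⟩ := C.gate_through D hp hh
  obtain ⟨R, hR, hRM, hRT⟩ := D.exists_path hM hm hMS
  obtain ⟨d, hed, hd⟩ := C.rung_pair hq.1.1 heq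
  have hdq : d ∈ h q := by simp [hd]
  have ns : s ∉ h q := fun h1 => hqc (C.gate_good_of_mem D ⟨p, hp, hh⟩ hq h1)
  have hP' : ∃ p ∈ 𝓟, h p = {t, s} := ⟨p, hp, hh.trans (Finset.pair_comm _ _)⟩
  have nt : t ∉ h q := fun h1 => hqc
    ((C.gate_good_of_mem D.symm hP' hq h1).trans (Finset.pair_comm _ _))
  have hRH : R ⊆ 𝓗 := fun a ha => (hRM ha).elim (fun h1 => hMH h1) (fun h1 => D.subA h1)
  have dR : d ∉ R := by
    intro h1
    rcases hRM h1 with h2 | h2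
    · exact hed (hMe d h2 ⟨q, hq, hqc, hdq⟩).symm
    · rcases C.mem_touchNodes hq hdq with rfl | h3
      · exact zero_notin D.subA h2
      · exact ns (D.onlyA d h2 h3 ▸ hdq)
  have dT : d ∉ T := by
    intro h1
    rcases C.mem_touchNodes hq hdq with rfl | h3
    · exact zero_notin D.subB h1
    · exact nt (D.onlyB d h1 h3 ▸ hdq)
  have hno : ∀ p ∈ 𝓟, ¬ ∀ a ∈ h p, a ∈ R := by
    intro p hp hall
    by_cases hpe : h p = {s, t}
    · exact Set.disjoint_left.1 hRT (hall t (by simp [hpe])) D.snd.start_mem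
    have ns' : s ∉ h p := fun h1 => hpe (C.gate_good_of_mem D ⟨_, ‹_›, hh⟩ hp h1)
    refine C.not_sub_singleton e p hp fun a ha => ?_
    rcases hRM (hall a ha) with h2 | h2
    · exact hMe a h2 ⟨p, hp, hpe, ha⟩
    · rcases C.mem_touchNodes hp ha with rfl | h3
      · exact absurd h2 (zero_notin D.subA)
      · exact absurd (D.onlyA a h2 h3 ▸ ha) ns'
  obtain ⟨p', Y, hY, hp', hph, -⟩ := C.exists_arm hR dR (zero_notin hRH) hq.1.1 hd hno
  have hp'P : p' ∈ 𝓟 := by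
    rcases hp' with rfl | h1
    · exact hq
    · exact h1
  exact C.gate_arm_home D K hp'P hph hY hRT dT (hd ▸ hqc)

theorem gate_good (C : Ctx G U z h I ℓ x v) (D : Fork G U h I ℓ x v i j s t S T)
    (hP : ∃ p ∈ 𝓟, h p = {s, t}) : ∀ q ∈ 𝓟, h q = {s, t} := by
  intro q hq
  by_contra hne
  have hP' : ∃ p ∈ 𝓟, h p = {t, s} := by
    obtain ⟨p, hp, hh⟩ := hP
    exact ⟨p, hp, hh.trans (Finset.pair_comm _ _)⟩
  obtain ⟨b, hb, hb0⟩ : ∃ b ∈ h q, b ≠ x 0 := by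
    by_contra hcon
    push Not at hcon
    exact C.not_sub_singleton (x 0) q hq hcon
  have hbH : b ∈ 𝓗 := by
    rcases C.mem_touchNodes hq hb with h1 | h1
    · exact absurd h1 hb0
    · exact h1.1
  obtain ⟨m, M, hM, hMH, hMS, hm⟩ := C.gate_reach D hP hbH
  obtain ⟨e, A, B, hsp, ⟨q', hq', hqc, heq⟩, ho⟩ := hM.last_hit
    (fun a => ∃ q ∈ 𝓟, h q ≠ {s, t} ∧ a ∈ h q) ⟨b, hM.start_mem, q, hq, hne, hb⟩
  rcases hm with hm | hm
  · exact C.gate_violation D hP hsp.right (fun a ha => hMH (hsp.right_sub ha))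
      (fun a ha => hMS a (hsp.right_sub ha)) hm ho hq' hqc heq
  · rw [Finset.pair_comm] at hqc
    refine C.gate_violation D.symm hP' hsp.right (fun a ha => hMH (hsp.right_sub ha))
      (fun a ha h1 => hMS a (hsp.right_sub ha) h1.symm) hm (fun a ha h1 => ?_) hq' hqc heq
    refine ho a ha ?_
    obtain ⟨q1, h2, h3, h4⟩ := h1
    exact ⟨q1, h2, Finset.pair_comm t s ▸ h3, h4⟩

theorem gate_adj (C : Ctx G U z h I ℓ x v) (D : Fork G U h I ℓ x v i j s t S T)
    (hP : ∃ p ∈ 𝓟, h p = {s, t}) {w : V} (hw : w ∈ U) (hxw : x 0 ∈ I w) : G.Adj v w := by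
  by_cases h0 : w = z 0
  · exact h0 ▸ C.adj0
  obtain ⟨y, hy, hwy, -⟩ := C.anchor_flag hw hxw h0
  have hgood := C.gate_good D hP
  obtain ⟨m, M, hM, hMH, hMS, hm⟩ := C.gate_reach D hP hy
  obtain ⟨p, hp, hh⟩ := hP
  obtain ⟨r, r', u, u', A, B, K, -⟩ := C.gate_through D hp hh
  obtain ⟨tS, sT, x0s, x0t⟩ := fork_notin D
  have key : ∀ q ∈ 𝓟, h q ≠ {y, x 0} := by
    intro q hq h1
    rw [hgood q hq] at h1
    have : x 0 ∈ ({s, t} : Finset ℕ) := by rw [h1]; simp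
    simp [x0s, x0t] at this
  rcases hm with hm | hm
  · obtain ⟨R, hR, hRM, hRT⟩ := D.exists_path hM hm hMS
    obtain ⟨Y, hY⟩ := C.gate_arm D.symm K.symm
    refine C.adj_of_arm D.hj D.hi D.hij.symm hY K.good'
      ((hgood _ K.good').trans (Finset.pair_comm _ _)) hR ?_ hRT.symm
      (fun h1 => absurd h1 (gate_flag K.symm)) hw hxw hwy ?_ key
    · exact fun a ha => (hRM ha).elim (fun h1 => hMH h1) (fun h1 => D.subA h1)
    · intro q hq hall
      exact Set.disjoint_left.1 hRT (hall t (by simp [hgood q hq])) D.snd.start_mem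
  · obtain ⟨R, hR, hRM, hRT⟩ := D.symm.exists_path hM hm fun a ha h1 => hMS a ha h1.symm
    obtain ⟨Y, hY⟩ := C.gate_arm D K
    refine C.adj_of_arm D.hi D.hj D.hij hY K.good (hgood _ K.good) hR ?_ hRT.symm
      (fun h1 => absurd h1 (gate_flag K)) hw hxw hwy ?_ key
    · exact fun a ha => (hRM ha).elim (fun h1 => hMH h1) (fun h1 => D.subB h1)
    · intro q hq hall
      exact Set.disjoint_left.1 hRT (hall s (by simp [hgood q hq])) D.fst.start_mem

theorem gate_hub_home (C : Ctx G U z h I ℓ x v) (D : Fork G U h I ℓ x v i j s t S T)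
    (hP : ∃ p ∈ 𝓟, h p = {s, t}) {f : V} (hf : f ∈ 𝓕) (hv : f ≠ v) :
    h f = {s, t} ∨ h f = {s} ∨ h f = {t} := by
  obtain ⟨g, hg, hgv, hgf, -, p, hp, hgp⟩ := C.hub_touch hf hv
  have hph := C.gate_good D hP p hp
  have hgU := hub_cases hg hgv
  rw [← hgf]
  rcases C.toLab.attach_rung hgU.1 (C.not_flag hgU.1 hgU.2.1) hp.1.1 hgp with
    h1 | ⟨a, ha, h1⟩ | ⟨-, -, h1⟩
  · exact Or.inl (h1.symm.trans hph)
  · have := C.rung_flag_mem hp.1.1 ha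
    rw [hph] at this
    simp only [Finset.mem_insert, Finset.mem_singleton] at this
    rcases this with rfl | rfl
    · exact Or.inr (Or.inl h1)
    · exact Or.inr (Or.inr h1)
  · exact absurd ⟨by rw [h1, hph]; simp, by rw [h1, hph]; simp⟩ (C.gate_not_both D hp hph)

end Ctx

end GateFacts

section Glue

variable {V : Type*}

/-- The strip between two nodes together with the new vertex. -/
def cell (U : Set V) (h : V → Finset ℕ) (v : V) (s t : ℕ) : Set V :=
  {u | u = v ∨ (u ∈ U ∧ h u = {s, t})}

/-- A labeling of a cell that is compatible with the nodes `s`, `t` and with the anchor. -/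
structure Glue (G : SimpleGraph V) (U : Set V) (h I : V → Finset ℕ) (v : V) (s t : ℕ)
    (h' I' : V → Finset ℕ) (y a b : ℕ) : Prop where
  lab : Lab G (cell U h v s t) h' I'
  flagA : ∀ u ∈ U, h u = {s, t} → s ∈ I u → a ∈ I' u ∨ h' u = {a}
  flagB : ∀ u ∈ U, h u = {s, t} → t ∈ I u → b ∈ I' u ∨ h' u = {b}
  ofA : ∀ u ∈ U, h u = {s, t} → a ∈ I' u → s ∈ I u
  ofB : ∀ u ∈ U, h u = {s, t} → b ∈ I' u → t ∈ I u
  nA : a ∉ I' v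
  nB : b ∉ I' v
  flagY : y ∈ I' v ∨ h' v = {y}
  nY : ∀ u ∈ U, h u = {s, t} → y ∉ I' u
  ya : y ≠ a
  yb : y ≠ b
  ab : a ≠ b

theorem cell_comm (U : Set V) (h : V → Finset ℕ) (v : V) (s t : ℕ) :
    cell U h v s t = cell U h v t s := by
  ext u; simp only [cell, Set.mem_ofPred_eq, Finset.pair_comm]

variable {G : SimpleGraph V} {U : Set V} {z : Fin 3 → V} {h I : V → Finset ℕ}
  {ℓ x : Fin 3 → ℕ} {v : V} {i j : Fin 3} {s t : ℕ} {S T : Set ℕ}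
  {h' I' : V → Finset ℕ} {y a b : ℕ}

theorem Glue.symm (K : Glue G U h I v s t h' I' y a b) : Glue G U h I v t s h' I' y b a where
  lab := cell_comm U h v s t ▸ K.lab
  flagA u hu hh := K.flagB u hu (hh.trans (Finset.pair_comm _ _))
  flagB u hu hh := K.flagA u hu (hh.trans (Finset.pair_comm _ _))
  ofA u hu hh := K.ofB u hu (hh.trans (Finset.pair_comm _ _))
  ofB u hu hh := K.ofA u hu (hh.trans (Finset.pair_comm _ _))
  nA := K.nB
  nB := K.nA
  flagY := K.flagY
  nY u hu hh := K.nY u hu (hh.trans (Finset.pair_comm _ _))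
  ya := K.yb
  yb := K.ya
  ab := K.ab.symm

theorem Lab.home_step {E : Set V} (L : Lab G E h' I') {u w : V} (hu : u ∈ E) (hw : w ∈ E)
    (hya : y ≠ a) (hP : h' u = {y, a} ∨ h' u = {a} ∨ h' u = {y}) (hyu : y ∉ I' u)
    (hyw : y ∉ I' w) (haw : a ∉ I' w) (hadj : G.Adj u w) :
    h' w = {y, a} ∨ h' w = {a} ∨ h' w = {y} := by
  have hsub : ∀ c ∈ h' u, c = y ∨ c = a := by
    intro c hc
    rcases hP with h1 | h1 | h1 <;> rw [h1] at hc <;> simp at hc <;> tauto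
  have hne : I' u ≠ h' u := by
    intro heq
    rcases hP with h1 | h1 | h1
    · exact hyu (by rw [heq, h1]; simp)
    · have := L.flag u hu a (by rw [heq, h1]; simp)
      rw [h1] at this; simp at this
    · exact hyu (by rw [heq, h1]; simp)
  rcases L.edge u hu w hw hadj with h1 | ⟨c, hc, hc'⟩ | ⟨c, hc, h1⟩ | ⟨c, hc, h1⟩ |
    ⟨h1, -⟩ | ⟨-, -, h1⟩
  · rwa [← h1]
  · rcases hsub c (L.sub u hu hc) with rfl | rfl
    · exact absurd hc hyu
    · exact absurd hc' haw
  · rcases hsub c (by rw [h1]; simp) with rfl | rfl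
    · exact absurd hc hyw
    · exact absurd hc haw
  · rcases hsub c (L.sub u hu hc) with rfl | rfl
    · exact Or.inr (Or.inr h1)
    · exact Or.inr (Or.inl h1)
  · exfalso
    rcases hP with h2 | h2 | h2 <;> rw [h2] at h1
    · rw [Finset.card_pair hya] at h1; omega
    · simp at h1
    · simp at h1
  · exact absurd h1 hne

variable [Fintype V]

namespace Ctx

local notation "𝓦" => rungSet G U h I
local notation "𝓕" => hub G U h I (x 0) v
local notation "𝓧" => touch G U h I (x 0) v
local notation "𝓟" => goodTouch G U h I (x 0) v

theorem hub_conn_same (C : Ctx G U z h I ℓ x v) {g : V} (hg : g ∈ 𝓕) (hv : g ≠ v) :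
    Conn G {f | f ∈ 𝓕 ∧ (f = v ∨ h f = h g)} v g := by
  obtain ⟨P, hP, pP⟩ := hub_conn hg
  refine ⟨P, fun f hf => ⟨hP hf, ?_⟩, pP⟩
  by_cases hfv : f = v
  · exact Or.inl hfv
  right
  obtain ⟨A, B, hsp⟩ := pP.split hf
  refine (C.home_of_conn ⟨B, fun u hu => ⟨hP (hsp.right_sub hu), ?_⟩, hsp.right⟩).symm
  rintro rfl
  exact hfv (hsp.mem_inter hsp.left.start_mem hu).symm

theorem rung_claw (C : Ctx G U z h I ℓ x v) (D : Fork G U h I ℓ x v i j s t S T) {R : Set V}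
    {r r' : V} (hR : Rung G U h I s t R r r') {p : V} (hp : p ∈ R) {K : Set V} (hK : K ⊆ 𝓕)
    (hc : Conn G (insert p (insert (z 0) K)) p (z 0))
    (hone : ∀ u ∈ R, ∀ f ∈ K, G.Adj f u → u = p) : False := by
  obtain ⟨L, hL, hRL, hLW, hLx, hLR⟩ := C.rung_line D hR
  obtain ⟨Q, hQ, pQ⟩ := hc
  obtain ⟨A, B, hsp⟩ := hL.split (hRL hp)
  have hsep : SepAt G p Q L := by
    intro q hq l hl hql
    rcases hQ hq with rfl | rfl | hqK
    · exact Or.inl rfl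
    · exfalso
      refine hLx l hl ?_
      rcases hql with rfl | hql
      · rw [C.flags]; simp
      · exact C.anchor_adj_rung (hLW hl) hql
    · right
      rcases hql with rfl | hql
      · exact absurd (hLW hl) (C.hub_not_rung (hK hqK))
      · exact hone l (hLR l hl ⟨hLW hl, q, hK hqK, hql⟩) q hqK hql
  have hLU : L ⊆ insert v U := fun u hu => Or.inr (rungSet_sub (hLW hu))
  refine C.noclaw i j D.hi D.hj D.hij
    (Claw3.of_split hsp pQ hLU ?_ hsep).swap23.swap12
  intro u hu
  rcases hQ hu with rfl | rfl | h1
  · exact hLU (hRL hp)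
  · exact Or.inr (C.mem 0)
  · exact hub_sub (hK h1)

theorem gate_link (C : Ctx G U z h I ℓ x v) (D : Fork G U h I ℓ x v i j s t S T)
    (hP : ∃ p ∈ 𝓟, h p = {s, t}) {g p : V} (hg : g ∈ 𝓕) (hgv : g ≠ v) (hgs : h g = {s})
    (hp : p ∈ 𝓟) (ha : G.Adj g p) :
    s ∈ I p ∧ ∃ r' w' A B, Gate G U h I (x 0) v s t p r' p w' A B ∧ G.Adj v p ∧ G.Adj v w' := by
  have hph := C.gate_good D hP p hp
  have hat : ∀ f ∈ 𝓕, f ≠ v → h f = {s} → ∀ u ∈ 𝓦, G.Adj f u → s ∈ I u := by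
    intro f hf hfv hfs u hu hfu
    have hfU := hub_cases hf hfv
    rcases C.toLab.attach_rung hfU.1 (C.not_flag hfU.1 hfU.2.1) hu hfu with
      h1 | ⟨c, hc, h1⟩ | ⟨h1, -⟩
    · exact absurd (h1.trans hfs) (C.not_home_singleton hu)
    · rw [hfs] at h1
      exact Finset.singleton_injective h1 ▸ hc
    · rw [hfs] at h1; simp at h1
  have hsp := hat g hg hgv hgs p hp.1.1 ha
  obtain ⟨r, r', w, w', A, B, K, hpw⟩ := C.gate_through D hp hph
  have hpR : p ∈ A ∪ B := by
    rcases hpw with rfl | rfl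
    · exact Or.inl K.fst.end_mem
    · exact Or.inr K.snd.start_mem
  have hpr : p = r := K.rung.ua p hpR hsp
  have hpw' : p = w := by
    rcases hpw with h1 | rfl
    · exact h1
    · exact absurd (hpr ▸ K.snd.start_mem) (K.disj r K.fst.start_mem)
  subst hpr
  subst hpw'
  obtain ⟨tS, sT, x0s, x0t⟩ := fork_notin D
  have hRX : ∀ u ∈ A ∪ B, ∀ f ∈ 𝓕, G.Adj f u → u = p ∨ u = w' := by
    intro u hu f hf hfu
    have hg := C.home_not_good x0s x0t (K.rung.mem_rungSet hu) (K.rung.home u hu)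
      ⟨K.rung.mem_rungSet hu, f, hf, hfu⟩
    rcases hu with h1 | h1
    · exact Or.inl (K.onlyA u h1 hg)
    · exact Or.inr (K.onlyB u h1 hg)
  have hw' : G.Adj v w' := by
    by_contra hcon
    refine C.rung_claw D K.rung hpR (K := {f | f ∈ 𝓕 ∧ (f = v ∨ h f = h g)})
      (fun f hf => hf.1) ?_ ?_
    · refine Conn.head (Or.inl rfl) ha.symm ?_
      exact ((C.hub_conn_same hg hgv).symm.mono
        (fun f hf => Or.inr (Or.inr hf))).tail C.adj0 (Or.inr (Or.inl rfl))
    · rintro u hu f ⟨hf, hfc⟩ hfu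
      rcases hRX u hu f hf hfu with h1 | rfl
      · exact h1
      by_cases hfv : f = v
      · subst hfv; exact absurd hfu hcon
      · exact K.rung.ua u hu (hat f hf hfv ((hfc.resolve_left hfv).trans hgs) u
          (K.rung.mem_rungSet hu) hfu)
  refine ⟨hsp, r', w', A, B, K, ?_, hw'⟩
  by_contra hcon
  have hw'R : w' ∈ A ∪ B := Or.inr K.snd.start_mem
  refine C.rung_claw D K.rung hw'R (K := {v}) (fun f hf => hf ▸ v_mem_hub) ?_ ?_
  · exact Conn.head (Or.inl rfl) hw'.symm
      (Conn.adj (Or.inr (Or.inr rfl)) (Or.inr (Or.inl rfl)) C.adj0)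
  · rintro u hu f rfl hfu
    rcases hRX u hu f v_mem_hub hfu with rfl | h1
    · exact absurd hfu hcon
    · exact h1

theorem glue_center (C : Ctx G U z h I ℓ x v) (D : Fork G U h I ℓ x v i j s t S T)
    (hP : ∃ p ∈ 𝓟, h p = {s, t}) (K : Glue G U h I v s t h' I' y a b) {g p : V} (hg : g ∈ 𝓕)
    (hgv : g ≠ v) (hgs : h g = {s}) (hp : p ∈ 𝓟) (hadj : G.Adj g p) :
    ∃ m, h' v = {y, m} ∧ I' v = {y, m} ∧ m ≠ y ∧ m ≠ a ∧ m ≠ b ∧ h' p = {a, m} ∧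
      I' p = {a, m} := by
  obtain ⟨hsp, r', w', A, B, Q, hvp, hvw⟩ := C.gate_link D hP hg hgv hgs hp hadj
  have hE : ∀ u ∈ A ∪ B, u ∈ cell U h v s t := fun u hu =>
    Or.inr ⟨Q.rung.sub hu, Q.rung.home u hu⟩
  have hpR : p ∈ A ∪ B := Or.inl Q.fst.end_mem
  have hpU := Q.rung.sub hpR
  have hph := Q.rung.home p hpR
  have hvE : v ∈ cell U h v s t := Or.inl rfl
  have hpE := hE p hpR
  have hpY := K.nY p hpU hph
  have L := K.lab
  have one : ∀ u ∈ cell U h v s t, ∀ c d, c ∈ I' u → h' u ≠ {d} := by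
    intro u hu c d hc hd
    have := L.flag u hu c hc
    rw [hd] at this; simp at this
  have three : ∀ u ∈ cell U h v s t, ∀ c, c ∈ I' u ∨ h' u = {c} → (h' u).card ≠ 3 := by
    intro u hu c hc h3
    rcases hc with hc | hc
    · have := L.flag u hu c hc; omega
    · rw [hc] at h3; simp at h3
  have hpA := K.flagA p hpU hph hsp
  rcases L.edge v hvE p hpE hvp with h1 | ⟨m, hm, hm'⟩ | ⟨c, hc, h1⟩ | ⟨c, hc, h1⟩ |
    ⟨h1, -⟩ | ⟨h1, -⟩
  · exfalso
    have hvy : y ∈ I' v := by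
      rcases K.flagY with h2 | h2
      · exact h2
      rcases hpA with h3 | h3
      · have := L.sub p hpE h3
        rw [← h1, h2] at this
        exact absurd (Finset.mem_singleton.1 this).symm K.ya
      · exact absurd (Finset.singleton_injective (h2.symm.trans (h1.trans h3))) K.ya
    have hap : a ∈ I' p := by
      rcases hpA with h3 | h3
      · exact h3
      · exact absurd (h1.trans h3) (one v hvE y a hvy)
    have hκ : h' p = {y, a} := Finset.eq_pair_of_mem (L.flag p hpE a hap)
      (h1 ▸ L.sub v hvE hvy) (L.sub p hpE hap) K.ya
    have hB : ∀ u ∈ B, u ∈ cell U h v s t ∧ y ∉ I' u ∧ a ∉ I' u := by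
      intro u hu
      have huR : u ∈ A ∪ B := Or.inr hu
      refine ⟨hE u huR, K.nY u (Q.rung.sub huR) (Q.rung.home u huR), fun h2 => ?_⟩
      have := Q.rung.ua u huR (K.ofA u (Q.rung.sub huR) (Q.rung.home u huR) h2)
      exact Q.disj p Q.fst.end_mem (this ▸ hu)
    have hw := hB w' Q.snd.start_mem
    have base := L.home_step hpE hw.1 K.ya (Or.inl hκ) hpY hw.2.1 hw.2.2 Q.adj
    have hend := (Q.snd.conn).closed
      (P := {u | u ∈ B ∧ (h' u = {y, a} ∨ h' u = {a} ∨ h' u = {y})}) ⟨Q.snd.start_mem, base⟩ (by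
        rintro u ⟨huB, hu⟩ w hw hadj
        exact ⟨hw, L.home_step (hB u huB).1 (hB w hw).1 K.ya hu (hB u huB).2.1 (hB w hw).2.1
          (hB w hw).2.2 hadj⟩)
    have hrR : r' ∈ A ∪ B := Or.inr Q.snd.end_mem
    have hrb : b ∈ h' r' := by
      rcases K.flagB r' (Q.rung.sub hrR) (Q.rung.home r' hrR) Q.rung.fb with h2 | h2
      · exact L.sub r' (hE r' hrR) h2
      · rw [h2]; simp
    rcases hend.2 with h2 | h2 | h2 <;> rw [h2] at hrb <;> simp at hrb
    · rcases hrb with h3 | h3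
      · exact K.yb h3.symm
      · exact K.ab h3.symm
    · exact K.ab hrb.symm
    · exact K.yb hrb.symm
  · have hvy := K.flagY.resolve_right (one v hvE m y hm)
    have hap := hpA.resolve_right (one p hpE m a hm')
    have my : m ≠ y := fun hh => hpY (hh ▸ hm')
    have ma : m ≠ a := fun hh => K.nA (hh ▸ hm)
    have e1 := Finset.eq_pair_of_mem (L.flag v hvE m hm) (L.sub v hvE hvy) (L.sub v hvE hm) my.symm
    have e2 := Finset.eq_pair_of_mem (L.flag p hpE m hm') (L.sub p hpE hap) (L.sub p hpE hm')
      ma.symm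
    refine ⟨m, e1, ?_, my, ma, fun hh => K.nB (hh ▸ hm), e2, ?_⟩
    · refine Finset.Subset.antisymm (e1 ▸ L.sub v hvE) ?_
      rw [Finset.insert_subset_iff, Finset.singleton_subset_iff]
      exact ⟨hvy, hm⟩
    · refine Finset.Subset.antisymm (e2 ▸ L.sub p hpE) ?_
      rw [Finset.insert_subset_iff, Finset.singleton_subset_iff]
      exact ⟨hap, hm'⟩
  · exfalso
    rcases K.flagY with h2 | h2
    · exact one v hvE y c h2 h1
    · exact hpY (Finset.singleton_injective (h1.symm.trans h2) ▸ hc)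
  · exfalso
    rcases hpA with h2 | h2
    · exact one p hpE a c h2 h1
    · exact K.nA (Finset.singleton_injective (h1.symm.trans h2) ▸ hc)
  · exact absurd h1 (three v hvE y K.flagY)
  · exact absurd h1 (three p hpE a hpA)

end Ctx

end Glue

section Gluing

variable {V : Type*}

theorem LinkOK.image {h I : V → Finset ℕ} {u w : V} (hl : LinkOK h I u w) {ρ : ℕ → ℕ}
    (hρ : Function.Injective ρ) {h' I' : V → Finset ℕ} (hu : h' u = (h u).image ρ)
    (hw : h' w = (h w).image ρ) (iu : I' u = (I u).image ρ) (iw : I' w = (I w).image ρ) :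
    LinkOK h' I' u w := by
  rcases hl with h1 | ⟨c, hc, hc'⟩ | ⟨c, hc, h1⟩ | ⟨c, hc, h1⟩ | ⟨h1, h2, h3⟩ | ⟨h1, h2, h3⟩
  · exact Or.inl (by rw [hu, hw, h1])
  · exact Or.inr (Or.inl ⟨ρ c, iu ▸ Finset.mem_image_of_mem ρ hc,
      iw ▸ Finset.mem_image_of_mem ρ hc'⟩)
  · exact Or.inr (Or.inr (Or.inl ⟨ρ c, iw ▸ Finset.mem_image_of_mem ρ hc, by simp [hu, h1]⟩))
  · exact Or.inr (Or.inr (Or.inr (Or.inl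
      ⟨ρ c, iu ▸ Finset.mem_image_of_mem ρ hc, by simp [hw, h1]⟩)))
  · refine Or.inr (Or.inr (Or.inr (Or.inr (Or.inl ⟨?_, ?_, ?_⟩))))
    · rw [hu, Finset.card_image_of_injective _ hρ, h1]
    · rw [hu, hw]; exact Finset.image_subset_image h2
    · rw [iw, hw, h3]
  · refine Or.inr (Or.inr (Or.inr (Or.inr (Or.inr ⟨?_, ?_, ?_⟩))))
    · rw [hw, Finset.card_image_of_injective _ hρ, h1]
    · rw [hu, hw]; exact Finset.image_subset_image h2
    · rw [iu, hu, h3]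

variable [Fintype V] {G : SimpleGraph V} {U : Set V} {z : Fin 3 → V} {h I : V → Finset ℕ}
  {ℓ x : Fin 3 → ℕ} {v : V} {i j : Fin 3} {s t : ℕ} {S T : Set ℕ}
  {h' I' : V → Finset ℕ} {y a b : ℕ}

namespace Ctx

local notation "𝓦" => rungSet G U h I
local notation "𝓕" => hub G U h I (x 0) v
local notation "𝓧" => touch G U h I (x 0) v
local notation "𝓟" => goodTouch G U h I (x 0) v

theorem glue_mid (C : Ctx G U z h I ℓ x v) (D : Fork G U h I ℓ x v i j s t S T)
    (hP : ∃ p ∈ 𝓟, h p = {s, t}) (K : Glue G U h I v s t h' I' y a b) :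
    ∃ m, m ≠ y ∧ m ≠ a ∧ m ≠ b ∧ ∀ f ∈ 𝓕, f ∉ cell U h v s t → (h' v = {y, m} ∧ I' v = {y, m}) ∧
      ∃ d c, ((d = s ∧ c = a) ∨ (d = t ∧ c = b)) ∧ h f = {d} ∧ ∀ p ∈ 𝓟, G.Adj f p →
        h' p = {c, m} ∧ I' p = {c, m} := by
  have hP' : ∃ p ∈ 𝓟, h p = {t, s} := by simpa only [Finset.pair_comm] using hP
  have key : ∀ f ∈ 𝓕, f ∉ cell U h v s t → ∃ d c m,
      ((d = s ∧ c = a) ∨ (d = t ∧ c = b)) ∧ h f = {d} ∧ m ≠ y ∧ m ≠ a ∧ m ≠ b ∧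
      h' v = {y, m} ∧ I' v = {y, m} ∧ ∀ p ∈ 𝓟, G.Adj f p → h' p = {c, m} ∧ I' p = {c, m} := by
    intro f hf hfc
    have hfv : f ≠ v := fun h0 => hfc (Or.inl h0)
    have uniq : ∀ m n, m ≠ y → ({y, m} : Finset ℕ) = {y, n} → m = n := by
      intro m n hm hmn
      have : m ∈ ({y, n} : Finset ℕ) := by rw [← hmn]; simp
      simpa [hm] using this
    have hfU := (hub_cases hf hfv).1
    obtain ⟨g, hg, hgv, hgf, -, p, hp, hgp⟩ := C.hub_touch hf hfv
    rcases C.gate_hub_home D hP hf hfv with h1 | h1 | h1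
    · exact absurd (Or.inr ⟨hfU, h1⟩) hfc
    · obtain ⟨m, hm, hm', my, ma, mb, -⟩ :=
        C.glue_center D hP K hg hgv (hgf.trans h1) hp hgp
      refine ⟨s, a, m, Or.inl ⟨rfl, rfl⟩, h1, my, ma, mb, hm, hm', fun q hq hfq => ?_⟩
      obtain ⟨n, hn, -, -, -, -, k1, k2⟩ := C.glue_center D hP K hf hfv h1 hq hfq
      rw [uniq m n my (hm.symm.trans hn)]
      exact ⟨k1, k2⟩
    · obtain ⟨m, hm, hm', my, mb, ma, -⟩ :=
        C.glue_center D.symm hP' K.symm hg hgv (hgf.trans h1) hp hgp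
      refine ⟨t, b, m, Or.inr ⟨rfl, rfl⟩, h1, my, ma, mb, hm, hm', fun q hq hfq => ?_⟩
      obtain ⟨n, hn, -, -, -, -, k1, k2⟩ := C.glue_center D.symm hP' K.symm hf hfv h1 hq hfq
      rw [uniq m n my (hm.symm.trans hn)]
      exact ⟨k1, k2⟩
  by_cases hex : ∃ f ∈ 𝓕, f ∉ cell U h v s t
  · obtain ⟨f, hf, hfc⟩ := hex
    obtain ⟨d, c, m, -, -, my, ma, mb, hm, hm', -⟩ := key f hf hfc
    refine ⟨m, my, ma, mb, fun g hg hgc => ⟨⟨hm, hm'⟩, ?_⟩⟩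
    obtain ⟨d, c, n, hdc, hgd, ny, -, -, hn, -, hn'⟩ := key g hg hgc
    have : n ∈ ({y, m} : Finset ℕ) := by rw [← hm, hn]; simp
    obtain rfl : n = m := by simpa [ny] using this
    exact ⟨d, c, hdc, hgd, hn'⟩
  · refine ⟨y + a + b + 1, by omega, by omega, by omega, fun f hf hfc => ?_⟩
    exact absurd ⟨f, hf, hfc⟩ hex

theorem tl_of_glue_image (C : Ctx G U z h I ℓ x v) (D : Fork G U h I ℓ x v i j s t S T)
    (hP : ∃ p ∈ 𝓟, h p = {s, t}) (K : Glue G U h I v s t h' I' y a b) {ρ : ℕ → ℕ}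
    (hρ : Function.Injective ρ) (ρy : ρ y = x 0) (ρa : ρ a = s) (ρb : ρ b = t)
    (hnew : ∀ n, n ≠ y → n ≠ a → n ≠ b → ∀ w ∈ U, ρ n ∉ h w) : TL G (insert v U) z := by
  classical
  obtain ⟨m, my, ma, mb, hmid⟩ := C.glue_mid D hP K
  obtain ⟨-, -, x0s, x0t⟩ := fork_notin D
  have hst : s ≠ t := by
    rw [← ρa, ← ρb]; exact fun h0 => K.ab (hρ h0)
  have hgood := C.gate_good D hP
  have hP' : ∃ p ∈ 𝓟, h p = {t, s} := by simpa only [Finset.pair_comm] using hP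
  have L := K.lab
  set E := cell U h v s t with hE
  set H : V → Finset ℕ := fun u => if u ∈ E then (h' u).image ρ else
    if u ∈ 𝓕 then insert (x 0) (insert (ρ m) (h u)) else h u with hH
  set J : V → Finset ℕ := fun u => if u ∈ E then (I' u).image ρ else I u with hJ
  have HE : ∀ u ∈ E, H u = (h' u).image ρ := fun u hu => by simp [hH, hu]
  have JE : ∀ u ∈ E, J u = (I' u).image ρ := fun u hu => by simp [hJ, hu]
  have HF : ∀ u ∈ 𝓕, u ∉ E → H u = insert (x 0) (insert (ρ m) (h u)) :=
    fun u hu hu' => by simp [hH, hu, hu']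
  have JF : ∀ u, u ∉ E → J u = I u := fun u hu => by simp [hJ, hu]
  have HO : ∀ u, u ∉ E → u ∉ 𝓕 → H u = h u := fun u hu hu' => by simp [hH, hu, hu']
  have hvE : v ∈ E := Or.inl rfl
  have hFU : ∀ f ∈ 𝓕, f ∉ E → f ∈ U ∧ f ∉ 𝓦 ∧ I f = ∅ := by
    intro f hf hfE
    have := hub_cases hf (fun h0 => hfE (h0 ▸ hvE))
    exact ⟨this.1, this.2.1, C.not_flag this.1 this.2.1⟩
  have hOU : ∀ w ∈ insert v U, w ∉ E → w ∈ U := by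
    rintro w (rfl | hw) hwE
    · exact absurd hvE hwE
    · exact hw
  have mU : ∀ w ∈ U, ρ m ∉ h w := hnew m my ma mb
  have Fcard : ∀ f ∈ 𝓕, f ∉ E → (H f).card = 3 := by
    intro f hf hfE
    obtain ⟨-, d, c, hdc, hfd, -⟩ := hmid f hf hfE
    have h2 := mU f (hFU f hf hfE).1
    have : x 0 ≠ ρ m := fun h0 => my (hρ (h0.symm.trans ρy.symm))
    rw [HF f hf hfE]
    rw [hfd] at h2 ⊢
    rw [Finset.card_insert_of_notMem, Finset.card_insert_of_notMem h2, Finset.card_singleton]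
    rcases hdc with ⟨rfl, -⟩ | ⟨rfl, -⟩ <;> simp [*]
  have flg : ∀ u ∈ U, h u = {s, t} → ∀ c ∈ I u, ∃ d, ρ d = c ∧ (d ∈ I' u ∨ h' u = {d}) := by
    intro u hu hh c hc
    have := C.sub u hu hc
    rw [hh, Finset.mem_insert, Finset.mem_singleton] at this
    rcases this with rfl | rfl
    · exact ⟨a, ρa, K.flagA u hu hh hc⟩
    · exact ⟨b, ρb, K.flagB u hu hh hc⟩
  have ofE : ∀ u ∈ E, u = v ∨ (u ≠ v ∧ u ∈ U ∧ h u = {s, t}) := by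
    rintro u (h1 | h1)
    · exact Or.inl h1
    · exact (eq_or_ne u v).imp id fun h2 => ⟨h2, h1⟩
  have outX : ∀ w ∈ U, w ∉ E → w ∈ 𝓧 → x 0 ∈ I w := by
    intro w hw hwE hX
    by_contra h0
    exact hwE (Or.inr ⟨hw, hgood w ⟨hX, h0⟩⟩)
  have lkF : ∀ u ∈ 𝓕, u ∉ E → ∀ w ∈ insert v U, G.Adj u w → LinkOK H J u w := by
    intro u hu huE w hw ha
    obtain ⟨⟨hv1, hv2⟩, d, c, hdc, hud, hp⟩ := hmid u hu huE
    have huv : u ≠ v := fun h0 => huE (h0 ▸ hvE)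
    have ρc : ρ c = d := by rcases hdc with ⟨rfl, rfl⟩ | ⟨rfl, rfl⟩ <;> assumption
    have c3 := Fcard u hu huE
    have hHu := HF u hu huE
    by_cases hwF : w ∈ 𝓕
    · by_cases hwv : w = v
      · subst hwv
        refine Or.inr (Or.inr (Or.inr (Or.inr (Or.inl ⟨c3, ?_, by rw [HE w hvE, JE w hvE, hv1, hv2]⟩))))
        rw [HE w hvE, hv1, hHu]
        intro n; simp [ρy]; tauto
      · have hh := C.home_of_conn (Conn.adj (S := 𝓕 \ {v}) ⟨hu, huv⟩ ⟨hwF, hwv⟩ ha)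
        have hwE : w ∉ E := by
          rintro (h1 | ⟨-, h1⟩)
          · exact hwv h1
          · rw [hh, hud] at h1
            exact Finset.card_ne_one_of_pair hst h1.symm
        exact Or.inl (by rw [hHu, HF w hwF hwE, hh])
    rcases C.hub_out hu hw hwF ha with ⟨h1, -⟩ | ⟨hX, hat⟩
    · exact absurd h1 huv
    have hwU : w ∈ U := rungSet_sub hX.1
    refine Or.inr (Or.inr (Or.inr (Or.inr (Or.inl ⟨c3, ?_⟩))))
    by_cases hwE : w ∈ E
    · rcases ofE w hwE with rfl | ⟨-, -, hh⟩
      · exact absurd v_mem_hub hwF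
      obtain ⟨k1, k2⟩ := hp w (C.home_not_good x0s x0t hX.1 hh hX) ha
      rw [HE w hwE, JE w hwE, k1, k2, hHu, hud]
      refine ⟨?_, rfl⟩
      intro n; simp [ρc]; tauto
    · have hx := outX w hwU hwE hX
      have h2 := C.flag w hwU _ hx
      rw [HO w hwE hwF, JF w hwE, hHu, hud]
      have hdx : d ≠ x 0 := by
        rcases hdc with ⟨rfl, -⟩ | ⟨rfl, -⟩
        exacts [x0s.symm, x0t.symm]
      have hdI : d ∈ I w := by
        rcases hat huv with h3 | ⟨e, he, h3⟩ | ⟨h3, -⟩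
        · rw [h3, hud] at h2; simp at h2
        · rw [hud] at h3
          exact Finset.singleton_injective h3 ▸ he
        · rw [hud] at h3; simp at h3
      have hhw := Finset.eq_pair_of_mem h2 (C.sub w hwU hdI) (C.sub w hwU hx) hdx
      refine ⟨?_, Finset.Subset.antisymm (C.sub w hwU) ?_⟩
      · rw [hhw]; intro n; simp; tauto
      · rw [hhw]; intro n; simp only [Finset.mem_insert, Finset.mem_singleton]
        rintro (rfl | rfl) <;> assumption
  have lkE : ∀ u ∈ E, ∀ w ∈ U, w ∉ E → w ∉ 𝓕 → G.Adj u w → LinkOK H J u w := by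
    intro u hu w hw hwE hwF ha
    have e1 := HE u hu
    have e2 := JE u hu
    have e3 := HO w hwE hwF
    have e4 := JF w hwE
    rcases ofE u hu with rfl | ⟨huv, huU, hh⟩
    · have hx : h w = {x 0} ∨ x 0 ∈ I w := by
        rcases C.hub_out v_mem_hub (Or.inr hw) hwF ha with ⟨-, h1, -⟩ | ⟨h1, -⟩
        · exact Or.inl h1
        · exact Or.inr (outX w hw hwE h1)
      rcases K.flagY with h1 | h1 <;> rcases hx with h2 | h2
      · exact Or.inr (Or.inr (Or.inr (Or.inl ⟨x 0, (by
          rw [e2, ← ρy]; exact Finset.mem_image_of_mem ρ h1), e3.trans h2⟩)))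
      · exact Or.inr (Or.inl ⟨x 0, (by
          rw [e2, ← ρy]; exact Finset.mem_image_of_mem ρ h1), e4 ▸ h2⟩)
      · exact Or.inl (by rw [e1, e3, h1, h2, Finset.image_singleton, ρy])
      · exact Or.inr (Or.inr (Or.inl ⟨x 0, e4 ▸ h2, by rw [e1, h1, Finset.image_singleton, ρy]⟩))
    rcases C.edge u huU w hw ha with h1 | ⟨c, hc, hc'⟩ | ⟨c, -, h1⟩ | ⟨c, hc, h1⟩ |
      ⟨h1, -⟩ | ⟨h1, h2, h3⟩
    · exact absurd (Or.inr ⟨hw, h1 ▸ hh⟩) hwE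
    · obtain ⟨d, rfl, hd | hd⟩ := flg u huU hh c hc
      · exact Or.inr (Or.inl ⟨_, e2 ▸ Finset.mem_image_of_mem ρ hd, e4 ▸ hc'⟩)
      · exact Or.inr (Or.inr (Or.inl ⟨_, e4 ▸ hc', by rw [e1, hd, Finset.image_singleton]⟩))
    · exact absurd (hh.symm.trans h1) (Finset.card_ne_one_of_pair hst)
    · obtain ⟨d, rfl, hd | hd⟩ := flg u huU hh c hc
      · exact Or.inr (Or.inr (Or.inr (Or.inl
          ⟨_, e2 ▸ Finset.mem_image_of_mem ρ hd, e3.trans h1⟩)))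
      · exact Or.inl (by rw [e1, e3, hd, h1, Finset.image_singleton])
    · rw [hh, Finset.card_pair hst] at h1; omega
    · have one : ∀ c d, c ∈ I' u → h' u ≠ {d} := by
        intro c d hc hd
        have := L.flag u hu c hc
        rw [hd] at this; simp at this
      have k1 := K.flagA u huU hh (by rw [h3, hh]; simp)
      have k2 := K.flagB u huU hh (by rw [h3, hh]; simp)
      have hab : a ∈ I' u ∧ b ∈ I' u := by
        rcases k1 with k1 | k1 <;> rcases k2 with k2 | k2
        · exact ⟨k1, k2⟩
        · exact absurd k2 (one _ _ k1)
        · exact absurd k1 (one _ _ k2)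
        · exact absurd (Finset.singleton_injective (k1.symm.trans k2)) K.ab
      have hhu := Finset.eq_pair_of_mem (L.flag u hu a hab.1) (L.sub u hu hab.1)
        (L.sub u hu hab.2) K.ab
      have hIu : I' u = {a, b} := by
        refine Finset.Subset.antisymm (hhu ▸ L.sub u hu) ?_
        intro n; simp only [Finset.mem_insert, Finset.mem_singleton]
        rintro (rfl | rfl)
        exacts [hab.1, hab.2]
      refine Or.inr (Or.inr (Or.inr (Or.inr (Or.inr ⟨e3 ▸ h1, ?_, ?_⟩))))
      · rw [e1, e3, hhu, Finset.image_insert, Finset.image_singleton, ρa, ρb, ← hh]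
        exact h2
      · rw [e1, e2, hhu, hIu]
  have hQs : ∀ u ∈ E ∪ 𝓕, (u ∈ E) ∨ (u ∈ 𝓕 ∧ u ∉ E) := fun u hu =>
    (em (u ∈ E)).imp id fun h0 => ⟨hu.resolve_left h0, h0⟩
  have lab : Lab G (insert v U) H J := by
    refine C.toLab.patch (Q := E ∪ 𝓕) (fun u hu hQ => hOU u hu fun h0 => hQ (Or.inl h0))
      (fun u hQ => ⟨HO u (fun h0 => hQ (Or.inl h0)) (fun h0 => hQ (Or.inr h0)),
        JF u fun h0 => hQ (Or.inl h0)⟩) ?_ ?_ ?_ ?_ ?_ ?_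
    · intro u hu
      rcases hQs u hu with hu | ⟨hu, hu'⟩
      · rw [HE u hu, JE u hu]; exact Finset.image_subset_image (L.sub u hu)
      · rw [JF u hu', (hFU u hu hu').2.2]; exact Finset.empty_subset _
    · intro u hu
      rcases hQs u hu with hu | ⟨hu, hu'⟩
      · rw [HE u hu, Finset.card_image_of_injective _ hρ]; exact L.pos u hu
      · rw [Fcard u hu hu']; omega
    · intro u hu
      rcases hQs u hu with hu | ⟨hu, hu'⟩
      · rw [HE u hu, Finset.card_image_of_injective _ hρ]; exact L.le u hu
      · rw [Fcard u hu hu']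
    · intro u hu c hc
      rcases hQs u hu with hu | ⟨hu, hu'⟩
      · rw [JE u hu, Finset.mem_image] at hc
        obtain ⟨d, hd, -⟩ := hc
        rw [HE u hu, Finset.card_image_of_injective _ hρ]; exact L.flag u hu d hd
      · rw [JF u hu', (hFU u hu hu').2.2] at hc; exact absurd hc (Finset.notMem_empty _)
    · intro u hu w hw c hc hc' hne
      rcases hQs u hu with hu | ⟨hu, hu'⟩
      · rw [JE u hu, Finset.mem_image] at hc
        obtain ⟨d, hd, rfl⟩ := hc
        by_cases hwE : w ∈ E
        · rw [JE w hwE, Finset.mem_image] at hc'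
          obtain ⟨d', hd', h1⟩ := hc'
          obtain rfl := hρ h1
          exact L.complete u hu w hwE d' hd hd' fun h0 => hne (by rw [HE u hu, HE w hwE, h0])
        · rw [JF w hwE] at hc'
          have hwU := hOU w hw hwE
          have hwh : h u = {s, t} → h u ≠ h w := fun h0 h1 => hwE (Or.inr ⟨hwU, h1 ▸ h0⟩)
          have hd3 : d = y ∨ d = a ∨ d = b := by
            by_contra h0
            push Not at h0
            exact hnew d h0.1 h0.2.1 h0.2.2 w hwU (C.sub w hwU hc')
          rcases ofE u hu with rfl | ⟨huv, huU, hh⟩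
          · rcases hd3 with rfl | rfl | rfl
            · exact C.gate_adj D hP hwU (ρy ▸ hc')
            · exact absurd hd K.nA
            · exact absurd hd K.nB
          · refine C.complete u huU w hwU _ ?_ hc' (hwh hh)
            rcases hd3 with rfl | rfl | rfl
            · exact absurd hd (K.nY u huU hh)
            · exact ρa ▸ K.ofA u huU hh hd
            · exact ρb ▸ K.ofB u huU hh hd
      · rw [JF u hu', (hFU u hu hu').2.2] at hc; exact absurd hc (Finset.notMem_empty _)
    · intro u hu w hw ha
      rcases hQs u hu with hu | ⟨hu, hu'⟩
      · by_cases hwE : w ∈ E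
        · exact (L.edge u hu w hwE ha).image hρ (HE u hu) (HE w hwE) (JE u hu) (JE w hwE)
        · by_cases hwF : w ∈ 𝓕
          · exact (lkF w hwF hwE u (hu.elim (fun h0 => Or.inl h0) fun h0 => Or.inr h0.1)
              ha.symm).symm
          · exact lkE u hu w (hOU w hw hwE) hwE hwF ha
      · exact lkF u hu hu' w hw ha
  have zE : ∀ k, z k ∉ E := by
    rintro k (h1 | ⟨-, h1⟩)
    · exact C.notin (h1 ▸ C.mem k)
    · have : ℓ k ∈ ({s, t} : Finset ℕ) := by rw [← h1, C.home k]; simp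
      rw [Finset.mem_insert, Finset.mem_singleton] at this
      rcases this with h2 | h2
      · exact C.gate_ne_l D hP k h2.symm
      · exact C.gate_ne_l D.symm hP' k h2.symm
  have zF : ∀ k, z k ∉ 𝓕 := fun k hk => C.hub_not_rung hk (C.mem_rungSet k)
  refine ⟨H, J, ℓ, x, lab, fun k => Or.inr (C.mem k), C.ne, fun k => ?_, fun k => ?_, ?_⟩
  · rw [HO _ (zE k) (zF k), C.home k]
  · rw [JF _ (zE k), C.flags k]
  · intro k u hu hk
    have hkU : ∀ n, n ≠ y → n ≠ a → n ≠ b → ℓ k ≠ ρ n := fun n h1 h2 h3 h4 =>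
      hnew n h1 h2 h3 (z k) (C.mem k) (by rw [← h4, C.home k]; simp)
    by_cases huE : u ∈ E
    · rw [HE u huE, Finset.mem_image] at hk
      obtain ⟨n, hn, h1⟩ := hk
      exfalso
      by_cases n1 : n = y
      · exact C.l_ne_x k 0 (by rw [← h1, n1, ρy])
      by_cases n2 : n = a
      · exact C.gate_ne_l D hP k (by rw [← h1, n2, ρa])
      by_cases n3 : n = b
      · exact C.gate_ne_l D.symm hP' k (by rw [← h1, n3, ρb])
      exact hkU n n1 n2 n3 h1.symm
    · have huU := hOU u hu huE
      by_cases huF : u ∈ 𝓕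
      · rw [HF u huF huE, Finset.mem_insert, Finset.mem_insert] at hk
        rcases hk with h1 | h1 | h1
        · exact absurd h1 (C.l_ne_x k 0)
        · exact absurd h1 (hkU m my ma mb)
        · exact C.unique k u huU h1
      · rw [HO u huE huF] at hk
        exact C.unique k u huU hk

theorem tl_of_glue (C : Ctx G U z h I ℓ x v) (D : Fork G U h I ℓ x v i j s t S T)
    (hP : ∃ p ∈ 𝓟, h p = {s, t}) (K : Glue G U h I v s t h' I' y a b) :
    TL G (insert v U) z := by
  classical
  obtain ⟨-, -, x0s, x0t⟩ := fork_notin D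
  obtain ⟨p, hp, hph⟩ := id hP
  obtain ⟨N, hN⟩ : ∃ N, ∀ w, ∀ n ∈ h w, n < N := by
    refine ⟨(Finset.univ.biUnion h).sup id + 1, fun w n hn => Nat.lt_succ_of_le ?_⟩
    exact Finset.le_sup (f := id) (Finset.mem_biUnion.2 ⟨w, Finset.mem_univ _, hn⟩)
  have hst : s ≠ t := by
    rintro rfl
    have := C.card_rung hp.1.1
    rw [hph] at this; simp at this
  have h0 := hN (z 0) (x 0) (by rw [C.home 0]; simp)
  have hs := hN p s (by rw [hph]; simp)
  have ht := hN p t (by rw [hph]; simp)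
  have h1 := K.ya
  have h2 := K.yb
  have h3 := K.ab
  refine C.tl_of_glue_image D hP K
    (ρ := fun n => if n = y then x 0 else if n = a then s else if n = b then t else N + n)
    ?_ ?_ ?_ ?_ ?_
  · intro n k hnk
    simp only at hnk
    split_ifs at hnk <;> omega
  · simp
  · simp [h1.symm]
  · simp [h2.symm, h3.symm]
  · intro n n1 n2 n3 w _ hn
    simp only [n1, n2, n3, if_false] at hn
    have := hN w _ hn
    omega

end Ctx

end Gluing

section Recursion

variable {V : Type*}

theorem Lab.adj_terminal {G : SimpleGraph V} {U : Set V} {h I : V → Finset ℕ} {z : Fin 3 → V}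
    {ℓ x : Fin 3 → ℕ} (L : Lab G U h I) (T : Term U z h I ℓ x) {w : V} (hw : w ∈ U) {k : Fin 3}
    (hwz : w ≠ z k) (ha : G.Adj w (z k)) : x k ∈ I w ∨ h w = {x k} := by
  have hl : ℓ k ∉ h w := fun h0 => hwz (T.unique k w hw h0)
  have hh := T.home k
  have hI := T.flags k
  have hlh : ℓ k ∈ h (z k) := by rw [hh]; simp
  have h2 : (h (z k)).card = 2 := by rw [hh, Finset.card_pair (T.ne k)]
  have hx : ∀ c ∈ I (z k), c = ℓ k ∨ c = x k := fun c hc => by simpa [hI] using hc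
  rcases L.edge w hw _ (T.mem k) ha with h1 | ⟨c, hc, hc'⟩ | ⟨c, hc, h1⟩ | ⟨c, hc, h1⟩ |
    ⟨-, h1, -⟩ | ⟨h1, -⟩
  · exact absurd (h1 ▸ hlh) hl
  · rcases hx c hc' with rfl | rfl
    · exact absurd (L.sub w hw hc) hl
    · exact Or.inl hc
  · rcases hx c hc with rfl | rfl
    · exact absurd (h1 ▸ Finset.mem_singleton_self _) hl
    · exact Or.inr h1
  · rw [h1] at h2; simp at h2
  · exact absurd (h1 hlh) hl
  · omega

theorem Lab.terminal_adj {G : SimpleGraph V} {U : Set V} {h I : V → Finset ℕ} {z : Fin 3 → V}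
    {ℓ x : Fin 3 → ℕ} (L : Lab G U h I) (T : Term U z h I ℓ x) {w : V} (hw : w ∈ U) {k : Fin 3}
    (hwz : w ≠ z k) (hx : x k ∈ I w) : G.Adj w (z k) := by
  refine L.complete w hw _ (T.mem k) _ hx (by rw [T.flags k]; simp) fun h0 => hwz ?_
  exact T.unique k w hw (by rw [h0, T.home k]; simp)

variable [Fintype V] {G : SimpleGraph V} {U : Set V} {z : Fin 3 → V} {h I : V → Finset ℕ}
  {ℓ x : Fin 3 → ℕ} {v : V} {i j : Fin 3} {s t : ℕ} {S T : Set ℕ}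

namespace Ctx

local notation "𝓦" => rungSet G U h I
local notation "𝓕" => hub G U h I (x 0) v
local notation "𝓧" => touch G U h I (x 0) v
local notation "𝓟" => goodTouch G U h I (x 0) v

/-- A path leaving the fork node `s` towards a terminal, avoiding the strip of the fork. -/
structure Leg (G : SimpleGraph V) (U : Set V) (h I : V → Finset ℕ) (v z₀ : V) (s t : ℕ)
    (r : V) (T : Set V) (e : V) : Prop where
  path : IPath G r T e
  sub : T ⊆ U
  notin : ∀ u ∈ T, u ∉ cell U h v s t
  ne : ∀ u ∈ T, u ≠ z₀ ∧ ¬ G.Adj z₀ u ∧ ¬ G.Adj v u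
  link : ∀ u ∈ T, ∀ q ∈ U, h q = {s, t} → G.Adj q u → u = r ∧ s ∈ I q
  adj : ∀ q ∈ U, h q = {s, t} → s ∈ I q → G.Adj q r

theorem exists_cell_leg (C : Ctx G U z h I ℓ x v) (D : Fork G U h I ℓ x v i j s t S T)
    (hP : ∃ p ∈ 𝓟, h p = {s, t}) : ∃ r A, Leg G U h I v (z 0) s t r A (z i) ∧
      ∀ u ∈ A, u ∈ 𝓦 ∧ x 0 ∉ h u ∧ ∀ c ∈ h u, c ∈ S := by
  obtain ⟨tS, -, x0s, x0t⟩ := fork_notin D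
  obtain ⟨r, A, hA, hr, hAp⟩ := C.exists_leg_inside D.fst (C.gate_ne_l D hP i)
  have hx : ∀ u ∈ A, x 0 ∉ h u := fun u hu h0 => (D.subA ((hAp u hu).2.1 _ h0)).2.1 rfl
  have hne : ∀ u ∈ A, h u ≠ {s, t} := fun u hu h0 =>
    tS ((hAp u hu).2.1 t (by rw [h0]; simp))
  have hU : A ⊆ U := fun u hu => rungSet_sub (hAp u hu).1
  have hst : s ≠ t := by
    rintro rfl
    obtain ⟨p, hp, hph⟩ := hP
    have := C.card_rung hp.1.1
    rw [hph] at this; simp at this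
  refine ⟨r, A, ⟨hA, hU, ?_, fun u hu => ⟨?_, ?_, ?_⟩, ?_, ?_⟩,
    fun u hu => ⟨(hAp u hu).1, hx u hu, (hAp u hu).2.1⟩⟩
  · rintro u hu (rfl | ⟨-, h1⟩)
    · exact C.notin (hU hu)
    · exact hne u hu h1
  · rintro rfl
    exact hx _ hu (by rw [C.home 0]; simp)
  · intro h0
    rcases C.anchor_adj (hU hu) h0 with h1 | h1
    · exact hx u hu (C.sub u (hU hu) h1)
    · exact hx u hu (by rw [h1]; simp)
  · intro h0
    refine hne u hu (C.gate_good D hP u ⟨⟨(hAp u hu).1, v, v_mem_hub, h0⟩, fun h1 => ?_⟩)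
    exact hx u hu (C.sub u (hU hu) h1)
  · intro u hu q hq hqh ha
    have hu2 := C.card_rung (hAp u hu).1
    have hq2 : (h q).card = 2 := by rw [hqh, Finset.card_pair hst]
    rcases C.edge q hq u (hU hu) ha with h1 | ⟨c, hc, hc'⟩ | ⟨c, hc, h1⟩ | ⟨c, hc, h1⟩ |
      ⟨h1, -⟩ | ⟨h1, -⟩
    · exact absurd (h1.symm.trans hqh) (hne u hu)
    · have h1 := C.sub q hq hc
      rw [hqh, Finset.mem_insert, Finset.mem_singleton] at h1
      rcases h1 with rfl | rfl
      · exact ⟨(hAp u hu).2.2 hc', hc⟩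
      · exact absurd ((hAp u hu).2.1 c (C.sub u (hU hu) hc')) tS
    · rw [h1] at hq2; simp at hq2
    · rw [h1] at hu2; simp at hu2
    · omega
    · omega
  · exact fun q hq hqh hqs => C.complete q hq r (hU hA.start_mem) s hqs hr fun h0 =>
      hne r hA.start_mem (h0.symm.trans hqh)

theorem cell_conn (C : Ctx G U z h I ℓ x v) (D : Fork G U h I ℓ x v i j s t S T)
    (hP : ∃ p ∈ 𝓟, h p = {s, t}) :
    ∃ q ∈ U, h q = {s, t} ∧ s ∈ I q ∧ Conn G (cell U h v s t) v q := by
  obtain ⟨p, hp, hph⟩ := id hP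
  obtain ⟨r, r', w, w', A, B, K, hpw⟩ := C.gate_through D hp hph
  have hR : A ∪ B ⊆ cell U h v s t := fun u hu => Or.inr ⟨K.rung.sub hu, K.rung.home u hu⟩
  have hpR : p ∈ A ∪ B := by
    rcases hpw with rfl | rfl
    exacts [Or.inl K.fst.end_mem, Or.inr K.snd.start_mem]
  have hr := K.rung.path.start_mem
  refine ⟨r, K.rung.sub hr, K.rung.home r hr, K.rung.fa, ?_⟩
  refine Conn.trans ?_ ((K.rung.path.conn_mem hpR).symm.mono hR)
  have hpc := hR hpR
  obtain ⟨f, hf, hfp⟩ := hp.1.2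
  by_cases hfv : f = v
  · exact Conn.adj (Or.inl rfl) hpc (hfv ▸ hfp)
  rcases C.gate_hub_home D hP hf hfv with h1 | h1 | h1
  · refine Conn.tail ((C.hub_conn_same hf hfv).mono ?_) hfp hpc
    rintro g ⟨hg, hgh⟩
    by_cases hgv : g = v
    · exact Or.inl hgv
    · exact Or.inr ⟨(hub_cases hg hgv).1, (hgh.resolve_left hgv).trans h1⟩
  · obtain ⟨-, _, _, _, _, -, h2, -⟩ := C.gate_link D hP hf hfv h1 hp hfp
    exact Conn.adj (Or.inl rfl) hpc h2
  · obtain ⟨-, _, _, _, _, -, h2, -⟩ := C.gate_link D.symm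
      (by simpa only [Finset.pair_comm] using hP) hf hfv h1 hp hfp
    exact Conn.adj (Or.inl rfl) hpc h2

theorem tl_of_gate (C : Ctx G U z h I ℓ x v) (D : Fork G U h I ℓ x v i j s t S T)
    (hP : ∃ p ∈ 𝓟, h p = {s, t}) (hconn : Conn G U (z 0) (z i))
    (IH : ∀ (U' : Set V) (z' : Fin 3 → V), U' ⊂ insert v U → Function.Injective z' →
      (∀ k, Conn G U' (z' 0) (z' k)) → ¬ Claw3 G U' (z' 0) (z' 1) (z' 2) → TL G U' z') :
    TL G (insert v U) z := by
  obtain ⟨-, -, x0s, x0t⟩ := fork_notin D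
  have hP' : ∃ p ∈ 𝓟, h p = {t, s} := by simpa only [Finset.pair_comm] using hP
  obtain ⟨a, A, LA, hA⟩ := C.exists_cell_leg D hP
  obtain ⟨b, B, LB, hB⟩ := C.exists_cell_leg D.symm hP'
  obtain ⟨q, hq, hqh, hqs, hvq⟩ := C.cell_conn D hP
  obtain ⟨q', hq', hqh', hqt, hvq'⟩ := C.cell_conn D.symm hP'
  rw [cell_comm] at hvq'
  have hts : ({t, s} : Finset ℕ) = {s, t} := Finset.pair_comm _ _
  have hAB : Apart G A B := by
    intro u hu w hw
    obtain ⟨c, hc⟩ := Finset.card_pos.1 (C.pos u (LA.sub hu))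
    have hd : ∀ c, c ∈ h u → c ∉ h w := fun c hc hc' =>
      Set.disjoint_left.1 D.disj ((hA u hu).2.2 c hc) ((hB w hw).2.2 c hc')
    refine ⟨fun h0 => hd c hc (h0 ▸ hc), fun h0 => ?_⟩
    rcases C.adj_rung (hA u hu).1 (hB w hw).1 h0 with h1 | ⟨e, he, he'⟩
    · exact hd c hc (h1 ▸ hc)
    · exact hd e (C.sub u (LA.sub hu) he) (C.sub w (LB.sub hw) he')
  have haA := LA.path.start_mem
  have hbB := LB.path.start_mem
  have hz0 : z 0 ∉ cell U h v s t := by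
    rintro (h1 | ⟨-, h1⟩)
    · exact C.notin (h1 ▸ C.mem 0)
    · have : x 0 ∈ ({s, t} : Finset ℕ) := by rw [← h1, C.home 0]; simp
      simp [x0s, x0t] at this
  set E := cell U h v s t with hE
  have hBE : ∀ u ∈ B, u ∉ E := fun u hu => by rw [hE, cell_comm]; exact LB.notin u hu
  have hEU : E ⊆ insert v U := fun u hu => hu.imp id fun h1 => h1.1
  set U' : Set V := E ∪ {z 0, a, b} with hU'
  have hE' : E ⊆ U' := Set.subset_union_left
  have hz' : ∀ k, ![z 0, a, b] k ∈ U' := by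
    intro k; fin_cases k <;> simp [hU']
  have hUU : U' ⊆ insert v U := by
    rintro u (hu | rfl | rfl | rfl)
    exacts [hEU hu, Or.inr (C.mem 0), Or.inr (LA.sub haA), Or.inr (LB.sub hbB)]
  have hvE : v ∈ E := Or.inl rfl
  have hss : U' ⊂ insert v U := by
    refine ⟨hUU, fun h0 => ?_⟩
    have hzi : z 0 ≠ z i := fun h1 => D.hi (C.inj h1).symm
    obtain ⟨Y, hY, hYp⟩ := hconn
    obtain ⟨u, hu, w, hw, hu0, hw0, huw⟩ := hYp.exists_exit (P := {z 0}) rfl hzi.symm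
    obtain rfl : u = z 0 := hu0
    have hwU := hY hw
    have hx : x 0 ∈ h w := by
      rcases C.anchor_adj hwU huw with h1 | h1
      · exact C.sub w hwU h1
      · rw [h1]; simp
    rcases h0 (Or.inr hwU) with (h1 | ⟨-, h1⟩) | h1 | h1 | h1
    · exact C.notin (h1 ▸ hwU)
    · rw [h1] at hx; simp [x0s, x0t] at hx
    · exact hw0 h1
    · exact (hA a haA).2.1 (h1 ▸ hx)
    · exact (hB b hbB).2.1 (h1 ▸ hx)
  have hinj : Function.Injective ![z 0, a, b] := by
    have h1 := (LA.ne a haA).1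
    have h2 := (LB.ne b hbB).1
    have h3 := (hAB a haA b hbB).1
    intro k m hkm
    fin_cases k <;> fin_cases m <;>
      first
        | rfl
        | exact absurd hkm h1
        | exact absurd hkm h2
        | exact absurd hkm h3
        | exact absurd hkm.symm h1
        | exact absurd hkm.symm h2
        | exact absurd hkm.symm h3
  have hco : ∀ k, Conn G U' (![z 0, a, b] 0) (![z 0, a, b] k) := by
    have h0 : Conn G U' (z 0) v := Conn.adj (hz' 0) (hE' hvE) C.adj0.symm
    intro k
    fin_cases k
    · exact Conn.refl (hz' 0)
    · exact (h0.trans (hvq.mono hE')).tail (LA.adj q hq hqh hqs) (hz' 1)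
    · exact (h0.trans (hvq'.mono hE')).tail (LB.adj q' hq' hqh' hqt) (hz' 2)
  have sepA : SepAt G a A U' := by
    intro u hu w hw huw
    rcases hw with (rfl | ⟨hwU, hwh⟩) | rfl | rfl | rfl
    · rcases huw with rfl | huw
      · exact absurd (LA.sub hu) C.notin
      · exact absurd huw.symm (LA.ne u hu).2.2
    · rcases huw with rfl | huw
      · exact absurd (Or.inr ⟨hwU, hwh⟩) (LA.notin u hu)
      · exact Or.inl (LA.link u hu w hwU hwh huw.symm).1
    · rcases huw with rfl | huw
      · exact absurd rfl (LA.ne _ hu).1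
      · exact absurd huw.symm (LA.ne u hu).2.1
    · exact Or.inr rfl
    · exact absurd huw (not_or.2 (hAB u hu _ hbB))
  have sepB : SepAt G b B (U' ∪ A) := by
    intro u hu w hw huw
    rcases hw with ((rfl | ⟨hwU, hwh⟩) | rfl | rfl | rfl) | hw
    · rcases huw with rfl | huw
      · exact absurd (LB.sub hu) C.notin
      · exact absurd huw.symm (LB.ne u hu).2.2
    · rcases huw with rfl | huw
      · exact absurd (Or.inr ⟨hwU, hwh⟩) (hBE u hu)
      · exact Or.inl (LB.link u hu w hwU (hwh.trans hts.symm) huw.symm).1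
    · rcases huw with rfl | huw
      · exact absurd rfl (LB.ne _ hu).1
      · exact absurd huw.symm (LB.ne u hu).2.1
    · exact absurd (huw.imp Eq.symm fun h1 => h1.symm) (not_or.2 (hAB _ haA u hu))
    · exact Or.inr rfl
    · exact absurd (huw.imp Eq.symm fun h1 => h1.symm) (not_or.2 (hAB w hw u hu))
  have hcl : ¬ Claw3 G U' (z 0) a b := by
    intro h0
    refine C.noclaw j i D.hj D.hi D.hij.symm
      (((h0.swap12.extend LA.path sepA (LA.ne a haA).1 (hAB a haA b hbB).1
        Set.subset_union_left Set.subset_union_right).swap23.swap12.extend LB.path sepB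
        (fun h1 => (hAB _ LA.path.end_mem b hbB).1 h1.symm) (LB.ne b hbB).1 (U' := insert v U)
        ?_ ?_).swap23.swap12)
    · rintro u (hu | hu)
      exacts [hUU hu, Or.inr (LA.sub hu)]
    · exact fun u hu => Or.inr (LB.sub hu)
  obtain ⟨h', I', ℓ', x', L, Tm⟩ := IH U' ![z 0, a, b] hss hinj hco hcl
  have xne : ∀ k m, k ≠ m → ¬ G.Adj (![z 0, a, b] k) (![z 0, a, b] m) → x' m ≠ x' k := by
    intro k m hkm hn h0
    refine hn (L.terminal_adj Tm (hz' k) (hinj.ne hkm) ?_)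
    rw [Tm.flags k, h0]; simp
  have enz : ∀ u ∈ E, ∀ k, u ≠ ![z 0, a, b] k := by
    intro u hu k h0
    rw [h0] at hu
    fin_cases k
    exacts [hz0 hu, LA.notin a haA hu, hBE b hbB hu]
  have qE : ∀ u ∈ U, h u = {s, t} → u ∈ E := fun u hu hh => Or.inr ⟨hu, hh⟩
  have K : Glue G U h I v s t h' I' (x' 0) (x' 1) (x' 2) :=
    { lab := L.mono hE'
      flagA := fun u hu hh hs =>
        L.adj_terminal Tm (hE' (qE u hu hh)) (enz u (qE u hu hh) 1) (LA.adj u hu hh hs)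
      flagB := fun u hu hh hs => L.adj_terminal Tm (hE' (qE u hu hh)) (enz u (qE u hu hh) 2)
        (LB.adj u hu (hh.trans hts.symm) hs)
      ofA := fun u hu hh ha => (LA.link a haA u hu hh
        (L.terminal_adj Tm (hE' (qE u hu hh)) (enz u (qE u hu hh) 1) ha)).2
      ofB := fun u hu hh ha => (LB.link b hbB u hu (hh.trans hts.symm)
        (L.terminal_adj Tm (hE' (qE u hu hh)) (enz u (qE u hu hh) 2) ha)).2
      nA := fun ha => (LA.ne a haA).2.2 (L.terminal_adj Tm (hE' hvE) (enz v hvE 1) ha)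
      nB := fun ha => (LB.ne b hbB).2.2 (L.terminal_adj Tm (hE' hvE) (enz v hvE 2) ha)
      flagY := L.adj_terminal Tm (hE' hvE) (enz v hvE 0) C.adj0
      nY := by
        intro u hu hh hy
        rcases C.anchor_adj hu
          (L.terminal_adj Tm (hE' (qE u hu hh)) (enz u (qE u hu hh) 0) hy).symm with h1 | h1
        · have := C.sub u hu h1
          rw [hh] at this; simp [x0s, x0t] at this
        · rw [h1] at hh
          have : s ∈ ({x 0} : Finset ℕ) := by rw [hh]; simp
          exact x0s (Finset.mem_singleton.1 this).symm
      ya := xne 1 0 (by simp) fun h0 => (LA.ne a haA).2.1 h0.symm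
      yb := xne 2 0 (by simp) fun h0 => (LB.ne b hbB).2.1 h0.symm
      ab := xne 2 1 (by simp) fun h0 => (hAB a haA b hbB).2 h0.symm }
  exact C.tl_of_glue D hP K

end Ctx

end Recursion

section ThreeInTree

variable {V : Type*} {G : SimpleGraph V}

theorem Claw3.of_distinct {U : Set V} {z : Fin 3 → V} {i j k : Fin 3} (hij : i ≠ j) (hik : i ≠ k)
    (hjk : j ≠ k) (h : Claw3 G U (z i) (z j) (z k)) : Claw3 G U (z 0) (z 1) (z 2) := by
  fin_cases i <;> fin_cases j <;> fin_cases k <;>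
    first
      | exact absurd rfl hij
      | exact absurd rfl hik
      | exact absurd rfl hjk
      | exact h
      | exact h.swap12
      | exact h.swap23
      | exact h.swap12.swap23
      | exact h.swap23.swap12
      | exact h.swap12.swap23.swap12

theorem TL.perm {U : Set V} {z : Fin 3 → V} (H : TL G U z) (σ : Equiv.Perm (Fin 3)) :
    TL G U (z ∘ σ) := by
  obtain ⟨h, I, ℓ, x, L, T⟩ := H
  exact ⟨h, I, ℓ ∘ σ, x ∘ σ, L, fun i => T.mem _, fun i => T.ne _, fun i => T.home _,
    fun i => T.flags _, fun i => T.unique _⟩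

/-- Three distinct connected vertices that are not the leaves of an induced subdivided claw. -/
structure Triad (G : SimpleGraph V) (U : Set V) (z : Fin 3 → V) : Prop where
  inj : Function.Injective z
  conn : ∀ i j, Conn G U (z i) (z j)
  noclaw : ¬ Claw3 G U (z 0) (z 1) (z 2)

theorem Triad.perm {U : Set V} {z : Fin 3 → V} (H : Triad G U z) (σ : Equiv.Perm (Fin 3)) :
    Triad G U (z ∘ σ) := by
  refine ⟨H.inj.comp σ.injective, fun i j => H.conn _ _, fun h => H.noclaw ?_⟩
  exact Claw3.of_distinct (σ.injective.ne (by simp)) (σ.injective.ne (by simp))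
    (σ.injective.ne (by simp)) h

theorem TL.of_swap {U : Set V} {z : Fin 3 → V} {k : Fin 3}
    (H : TL G U (z ∘ Equiv.swap 0 k)) : TL G U z := by
  have := H.perm (Equiv.swap 0 k)
  have h2 : (z ∘ Equiv.swap 0 k) ∘ Equiv.swap 0 k = z := by funext i; simp
  rwa [h2] at this

theorem IPath.conn_end {a e : V} {T U : Set V} (h : IPath G a T e) (hae : a ≠ e) (hT : T ⊆ U) :
    ∀ u ∈ T, u = a ∨ Conn G (U \ {a}) u e := by
  cases h with
  | single => exact absurd rfl hae
  | @cons a b e T ha hab hun hp =>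
    rintro u (rfl | hu)
    · exact Or.inl rfl
    · right
      refine ((hp.conn_mem hu).symm.trans hp.conn).mono fun w hw => ⟨hT (Or.inr hw), ?_⟩
      rintro rfl
      exact ha hw

theorem tl_of_star {U : Set V} {z : Fin 3 → V} (H : Triad G U z)
    (hadj : ∀ i j, i ≠ j → G.Adj (z i) (z j)) : TL G U z := by
  classical
  let f : V → ℕ := fun u => if u = z 0 then 1 else if u = z 1 then 2 else 3
  have hf : ∀ i, f (z i) = i.val + 1 := by
    have n1 : z 1 ≠ z 0 := H.inj.ne (by simp)
    have n2 : z 2 ≠ z 0 := H.inj.ne (by simp)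
    have n3 : z 2 ≠ z 1 := H.inj.ne (by simp)
    intro i
    fin_cases i <;> simp [f, n1, n2, n3]
  let h : V → Finset ℕ := fun u => if ∃ i, u = z i then {f u, 0} else {0}
  let I : V → Finset ℕ := fun u => if ∃ i, u = z i then {f u, 0} else ∅
  have f0 : ∀ u, f u ≠ 0 := by intro u; simp only [f]; split_ifs <;> simp
  have hz : ∀ i, h (z i) = {i.val + 1, 0} ∧ I (z i) = {i.val + 1, 0} := fun i => by
    simp [h, I, hf]
  have ho : ∀ u, (¬ ∃ i, u = z i) → h u = {0} ∧ I u = ∅ := fun u hu => by simp [h, I, hu]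
  have cs : ∀ u, (∃ i, u = z i) ∨ (¬ ∃ i, u = z i) := fun u => em _
  refine ⟨h, I, fun i => i.val + 1, fun _ => 0, ⟨?_, ?_, ?_, ?_, ?_, ?_⟩,
    fun i => (H.conn i i).left_mem, fun i => by simp, fun i => (hz i).1, fun i => (hz i).2, ?_⟩
  · intro u _
    rcases cs u with ⟨i, rfl⟩ | hu
    · rw [(hz i).1, (hz i).2]
    · rw [(ho u hu).2]; exact Finset.empty_subset _
  · intro u _
    rcases cs u with ⟨i, rfl⟩ | hu
    · rw [(hz i).1, Finset.card_pair (by simp)]; omega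
    · rw [(ho u hu).1]; simp
  · intro u _
    rcases cs u with ⟨i, rfl⟩ | hu
    · rw [(hz i).1, Finset.card_pair (by simp)]; omega
    · rw [(ho u hu).1]; simp
  · intro u _ a ha
    rcases cs u with ⟨i, rfl⟩ | hu
    · rw [(hz i).1, Finset.card_pair (by simp)]
    · rw [(ho u hu).2] at ha; simp at ha
  · intro u _ w _ a ha hb hne
    rcases cs u with ⟨i, rfl⟩ | hu
    · rcases cs w with ⟨j, rfl⟩ | hw
      · exact hadj i j fun h0 => hne (by rw [h0])
      · rw [(ho w hw).2] at hb; simp at hb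
    · rw [(ho u hu).2] at ha; simp at ha
  · intro u _ w _ _
    rcases cs u with ⟨i, rfl⟩ | hu
    · rcases cs w with ⟨j, rfl⟩ | hw
      · exact Or.inr (Or.inl ⟨0, by rw [(hz i).2]; simp, by rw [(hz j).2]; simp⟩)
      · exact Or.inr (Or.inr (Or.inr (Or.inl ⟨0, by rw [(hz i).2]; simp, (ho w hw).1⟩)))
    · rcases cs w with ⟨j, rfl⟩ | hw
      · exact Or.inr (Or.inr (Or.inl ⟨0, by rw [(hz j).2]; simp, (ho u hu).1⟩))
      · exact Or.inl ((ho u hu).1.trans (ho w hw).1.symm)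
  · intro i u _ hi
    rcases cs u with ⟨j, rfl⟩ | hu
    · rw [(hz j).1] at hi
      simp only [Finset.mem_insert, Finset.mem_singleton, Nat.add_right_cancel_iff,
        Nat.add_eq_zero_iff, one_ne_zero, and_false, or_false] at hi
      rw [Fin.ext hi]
    · rw [(ho u hu).1] at hi; simp at hi

variable [Fintype V]

theorem tl_of_leaf {U : Set V} {z : Fin 3 → V} (H : Triad G U z) {v : V} (hv : v ∈ U)
    (hvz : ∀ i, v ≠ z i) (h0 : ∀ i, i ≠ 0 → ¬ Conn G (U \ {v}) (z 0) (z i))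
    (IH : ∀ U' z', U' ⊂ U → Triad G U' z' → TL G U' z') : TL G U z := by
  classical
  set K : Set V := {u | Conn G (U \ {v}) (z 0) u} with hK
  have hz0 : z 0 ∈ K := Conn.refl ⟨(H.conn 0 0).left_mem, (hvz 0).symm⟩
  have hKU : ∀ u ∈ K, u ∈ U ∧ u ≠ v := fun u hu => ⟨hu.right_mem.1, hu.right_mem.2⟩
  have hcl : ∀ u ∈ K, ∀ w ∈ U, G.Adj u w → w = v ∨ w ∈ K := fun u hu w hw ha =>
    (eq_or_ne w v).imp id fun hwv => hu.tail ha ⟨hw, hwv⟩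
  set U' := U \ K with hU'
  have hvU' : v ∈ U' := ⟨hv, fun h1 => (hKU v h1).2 rfl⟩
  have hzK : ∀ i, i ≠ 0 → z i ∉ K := h0
  have hz : ∀ i, i ≠ 0 → z i ∈ U' := fun i hi => ⟨(H.conn i i).left_mem, h0 i hi⟩
  have n1 : v ≠ z 1 := hvz 1
  have n2 : v ≠ z 2 := hvz 2
  have n12 : z 1 ≠ z 2 := H.inj.ne (by simp)
  have hc : ∀ i, i ≠ 0 → Conn G U' v (z i) := by
    intro i hi
    have hvU : Conn G U v (z i) := by
      by_contra hnc
      obtain ⟨T, hT, hp⟩ := H.conn 0 i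
      refine h0 i hi ⟨T, fun u hu => ⟨hT hu, ?_⟩, hp⟩
      rintro rfl
      exact hnc ((hp.symm.conn_mem hu).symm.mono hT)
    obtain ⟨T, hT, hp⟩ := hvU
    refine ⟨T, fun u hu => ⟨hT hu, fun huK => ?_⟩, hp⟩
    rcases hp.conn_end (hvz i) hT u hu with rfl | h1
    · exact (hKU _ huK).2 rfl
    · exact h0 i hi (huK.trans h1)
  have HT : Triad G U' ![v, z 1, z 2] := by
    refine ⟨?_, ?_, fun hcw => H.noclaw ?_⟩
    · intro k m hkm
      fin_cases k <;> fin_cases m <;>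
        first
          | rfl
          | exact absurd hkm n1
          | exact absurd hkm n2
          | exact absurd hkm n12
          | exact absurd hkm.symm n1
          | exact absurd hkm.symm n2
          | exact absurd hkm.symm n12
    · have h1 : ∀ k, Conn G U' v (![v, z 1, z 2] k) := by
        intro k
        fin_cases k
        exacts [Conn.refl hvU', hc 1 (by simp), hc 2 (by simp)]
      exact fun i j => (h1 i).symm.trans (h1 j)
    · obtain ⟨T, hT, hp⟩ : Conn G U v (z 0) := by
        obtain ⟨T, hT, hp⟩ := H.conn 0 1
        have hvT : v ∈ T := by
          by_contra hvT
          exact h0 1 (by simp) ⟨T, fun u hu => ⟨hT hu, fun h1 => hvT (h1 ▸ hu)⟩, hp⟩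
        exact (hp.conn_mem hvT).symm.mono hT
      refine Claw3.extend (U := U') hcw hp ?_ n1 n2 Set.sdiff_subset hT
      intro u hu w hw huw
      rcases hp.conn_end (hvz 0) hT u hu with h1 | h1
      · exact Or.inl h1
      · rcases huw with rfl | huw
        · exact absurd h1.symm hw.2
        · exact Or.inr ((hcl u h1.symm w hw.1 huw).resolve_right hw.2)
  obtain ⟨h, I, ℓ, x, L, T⟩ := IH U' _ ⟨Set.sdiff_subset, fun h1 => (h1 (hKU _ hz0).1).2 hz0⟩ HT
  have Tv : ∀ w ∈ U', ℓ 0 ∈ h w → w = v := T.unique 0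
  have hhv : h v = {ℓ 0, x 0} := T.home 0
  have hx0 : ∀ k, k ≠ 0 → ℓ k ≠ x 0 := by
    intro k hk h1
    have := T.unique k v hvU' (by rw [hhv, h1]; simp)
    fin_cases k
    exacts [hk rfl, n1 this, n2 this]
  have hl0 : ∀ k, k ≠ 0 → ℓ k ≠ ℓ 0 := by
    intro k hk h1
    have := T.unique k v hvU' (by rw [hhv, h1]; simp)
    fin_cases k
    exacts [hk rfl, n1 this, n2 this]
  have hlx : ℓ 0 ≠ x 0 := T.ne 0
  obtain ⟨N, hN⟩ : ∃ N, ∀ w, N ∉ h w := by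
    refine ⟨(Finset.univ.biUnion h).sup id + 1, fun w hn => ?_⟩
    have := Finset.le_sup (f := id) (Finset.mem_biUnion.2 ⟨w, Finset.mem_univ _, hn⟩)
    simp only [id] at this
    omega
  have Nx : N ≠ x 0 := fun h1 => hN v (by rw [hhv, h1]; simp)
  have Nl : N ≠ ℓ 0 := fun h1 => hN v (by rw [hhv, h1]; simp)
  have Nk : ∀ k, N ≠ ℓ k := fun k h1 => hN (![v, z 1, z 2] k) (by rw [T.home k, h1]; simp)
  let m : V → Finset ℕ := fun u => if G.Adj u (z 0) then {N} else ∅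
  let h' : V → Finset ℕ := fun u =>
    if u = z 0 then {ℓ 0, N} else if u = v ∨ u ∈ K then {N, x 0} else h u
  let I' : V → Finset ℕ := fun u =>
    if u = z 0 then {ℓ 0, N} else if u = v then insert (x 0) (m u) else
      if u ∈ K then m u else I u
  have e0 : h' (z 0) = {ℓ 0, N} ∧ I' (z 0) = {ℓ 0, N} := by simp [h', I']
  have ev : h' v = {N, x 0} ∧ I' v = insert (x 0) (m v) := by simp [h', I', hvz 0]
  have eK : ∀ u ∈ K, u ≠ z 0 → h' u = {N, x 0} ∧ I' u = m u := fun u hu hu0 => by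
    simp [h', I', hu0, hu, (hKU u hu).2]
  have eo : ∀ u ∈ U', u ≠ v → h' u = h u ∧ I' u = I u := fun u hu huv => by
    have : u ≠ z 0 := fun h1 => hu.2 (h1 ▸ hz0)
    simp [h', I', this, huv, hu.2]
  have cs : ∀ u ∈ U, u = z 0 ∨ u = v ∨ (u ∈ K ∧ u ≠ z 0) ∨ (u ∈ U' ∧ u ≠ v) := by
    intro u hu
    by_cases h1 : u = z 0
    · exact Or.inl h1
    by_cases h2 : u = v
    · exact Or.inr (Or.inl h2)
    by_cases h3 : u ∈ K
    · exact Or.inr (Or.inr (Or.inl ⟨h3, h1⟩))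
    · exact Or.inr (Or.inr (Or.inr ⟨⟨hu, h3⟩, h2⟩))
  have mm : ∀ u a, a ∈ m u ↔ G.Adj u (z 0) ∧ a = N := by
    intro u a; simp only [m]; split_ifs with h1 <;> simp [h1]
  have hQ : ∀ u, u ∉ insert v K → h' u = h u ∧ I' u = I u := by
    intro u hu
    have h1 : u ≠ v := fun h1 => hu (Or.inl h1)
    have h2 : u ∉ K := fun h1 => hu (Or.inr h1)
    have h3 : u ≠ z 0 := fun h1 => h2 (h1 ▸ hz0)
    simp [h', I', h1, h2, h3]
  have cQ : ∀ u ∈ insert v K, u = z 0 ∨ u = v ∨ (u ∈ K ∧ u ≠ z 0) := by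
    rintro u (hu | hu)
    · exact Or.inr (Or.inl hu)
    · exact (eq_or_ne u (z 0)).imp id fun h1 => Or.inr ⟨hu, h1⟩
  have c2 : ∀ u ∈ insert v K, (h' u).card = 2 := by
    intro u hu
    rcases cQ u hu with rfl | rfl | ⟨h1, h2⟩
    · rw [e0.1, Finset.card_pair Nl.symm]
    · rw [ev.1, Finset.card_pair Nx]
    · rw [(eK u h1 h2).1, Finset.card_pair Nx]
  refine ⟨h', I', ![ℓ 0, ℓ 1, ℓ 2], ![N, x 1, x 2], ?_, ?_⟩
  · refine L.patch (Q := insert v K) (fun u hu h1 => ⟨hu, fun h2 => h1 (Or.inr h2)⟩) hQ ?_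
      (fun u hu => by rw [c2 u hu]; omega) (fun u hu => by rw [c2 u hu]; omega)
      (fun u hu _ _ => c2 u hu) ?_ ?_
    · intro u hu a ha
      rcases cQ u hu with rfl | rfl | ⟨h1, h2⟩
      · rw [e0.1, ← e0.2]; exact ha
      · rw [ev.2, Finset.mem_insert, mm] at ha
        rw [ev.1]; rcases ha with rfl | ⟨-, rfl⟩ <;> simp
      · rw [(eK u h1 h2).2, mm] at ha
        rw [(eK u h1 h2).1, ha.2]; simp
    · intro u hu w hw a ha hb hne
      have keyN : ∀ p q, p ∈ U → q ∈ U → N ∈ I' p → N ∈ I' q → h' p ≠ h' q → p = z 0 →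
          G.Adj p q := by
        rintro p q - hq hp hq' hne rfl
        rcases cs q hq with rfl | rfl | ⟨h1, h2⟩ | ⟨h1, h2⟩
        · exact absurd rfl hne
        · rw [ev.2, Finset.mem_insert, mm] at hq'
          exact (hq'.resolve_left Nx).1.symm
        · rw [(eK q h1 h2).2, mm] at hq'
          exact hq'.1.symm
        · rw [(eo q h1 h2).2] at hq'
          exact absurd (L.sub q h1 hq') (hN q)
      have huU : u ∈ U := hu.elim (fun h1 => h1 ▸ hv) fun h1 => (hKU u h1).1
      by_cases haN : a = N
      · subst haN
        by_cases hw0 : w = z 0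
        · exact (keyN w u hw huU hb ha hne.symm hw0).symm
        rcases cQ u hu with hu0 | hu1
        · exact keyN u w huU hw ha hb hne hu0
        exfalso
        have hu' : h' u = {a, x 0} := by
          rcases hu1 with rfl | ⟨h1, h2⟩
          exacts [ev.1, (eK u h1 h2).1]
        rcases cs w hw with h1 | rfl | ⟨h1, h2⟩ | ⟨h1, h2⟩
        · exact hw0 h1
        · exact hne (hu'.trans ev.1.symm)
        · exact hne (hu'.trans (eK w h1 h2).1.symm)
        · rw [(eo w h1 h2).2] at hb
          exact hN w (L.sub w h1 hb)
      rcases cQ u hu with rfl | rfl | ⟨h1, h2⟩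
      · rw [e0.2, Finset.mem_insert, Finset.mem_singleton] at ha
        obtain rfl := ha.resolve_right haN
        rcases cs w hw with rfl | rfl | ⟨h1, h2⟩ | ⟨h1, h2⟩
        · exact absurd rfl hne
        · rw [ev.2, Finset.mem_insert, mm] at hb
          rcases hb with h1 | ⟨-, h1⟩
          exacts [absurd h1 hlx, absurd h1 haN]
        · rw [(eK w h1 h2).2, mm] at hb
          exact absurd hb.2 haN
        · rw [(eo w h1 h2).2] at hb
          exact absurd (Tv w h1 (L.sub w h1 hb)) h2
      · rw [ev.2, Finset.mem_insert, mm] at ha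
        obtain rfl := ha.resolve_right fun h1 => haN h1.2
        rcases cs w hw with rfl | rfl | ⟨h1, h2⟩ | ⟨h1, h2⟩
        · rw [e0.2, Finset.mem_insert, Finset.mem_singleton] at hb
          rcases hb with h1 | h1
          exacts [absurd h1 hlx.symm, absurd h1 haN]
        · exact absurd rfl hne
        · rw [(eK w h1 h2).2, mm] at hb
          exact absurd hb.2 haN
        · rw [(eo w h1 h2).2] at hb
          exact (L.terminal_adj T h1 (k := 0) h2 hb).symm
      · rw [(eK u h1 h2).2, mm] at ha
        exact absurd ha.2 haN
    · intro u hu w hw ha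
      have key0 : ∀ w ∈ U, G.Adj (z 0) w → N ∈ I' w := by
        intro w hw hw0
        rcases hcl _ hz0 w hw hw0 with rfl | h1
        · rw [ev.2, Finset.mem_insert, mm]; exact Or.inr ⟨hw0.symm, rfl⟩
        · rw [(eK w h1 fun h2 => G.loopless.irrefl _ (h2 ▸ hw0)).2, mm]; exact ⟨hw0.symm, rfl⟩
      have hN0 : N ∈ I' (z 0) := by rw [e0.2]; simp
      have huU : u ∈ U := hu.elim (fun h1 => h1 ▸ hv) fun h1 => (hKU u h1).1
      rcases cs w hw with rfl | rfl | ⟨h1, h2⟩ | ⟨h1, h2⟩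
      · exact Or.inr (Or.inl ⟨N, key0 u huU ha.symm, hN0⟩)
      · rcases cQ u hu with rfl | rfl | ⟨h1, h2⟩
        · exact Or.inr (Or.inl ⟨N, hN0, key0 _ hw ha⟩)
        · exact Or.inl rfl
        · exact Or.inl ((eK u h1 h2).1.trans ev.1.symm)
      · rcases cQ u hu with rfl | rfl | ⟨h3, h4⟩
        · exact Or.inr (Or.inl ⟨N, hN0, key0 _ hw ha⟩)
        · exact Or.inl (ev.1.trans (eK w h1 h2).1.symm)
        · exact Or.inl ((eK u h3 h4).1.trans (eK w h1 h2).1.symm)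
      · obtain rfl : u = v := by
          rcases hu with h3 | h3
          · exact h3
          · exact absurd ((hcl u h3 w hw ha).resolve_left h2) h1.2
        have hxv : x 0 ∈ I' u := by rw [ev.2]; simp
        rcases L.adj_terminal T h1 (k := 0) h2 ha.symm with h3 | h3
        · exact Or.inr (Or.inl ⟨x 0, hxv, (eo w h1 h2).2 ▸ h3⟩)
        · exact Or.inr (Or.inr (Or.inr (Or.inl ⟨x 0, hxv, (eo w h1 h2).1.trans h3⟩)))
  · have ez : ∀ i, i ≠ 0 → h' (z i) = h (z i) ∧ I' (z i) = I (z i) := fun i hi =>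
      eo _ (hz i hi) (hvz i).symm
    have un : ∀ i, i ≠ 0 → (∀ u ∈ U', ℓ i ∈ h u → u = z i) → ∀ u ∈ U, ℓ i ∈ h' u → u = z i := by
      intro i hi hu' u hu hl
      rcases cs u hu with rfl | rfl | ⟨h1, h2⟩ | ⟨h1, h2⟩
      · rw [e0.1, Finset.mem_insert, Finset.mem_singleton] at hl
        rcases hl with h1 | h1
        exacts [absurd h1 (hl0 i hi), absurd h1.symm (Nk i)]
      · rw [ev.1, Finset.mem_insert, Finset.mem_singleton] at hl
        rcases hl with h1 | h1
        exacts [absurd h1.symm (Nk i), absurd h1 (hx0 i hi)]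
      · rw [(eK u h1 h2).1, Finset.mem_insert, Finset.mem_singleton] at hl
        rcases hl with h1 | h1
        exacts [absurd h1.symm (Nk i), absurd h1 (hx0 i hi)]
      · exact hu' u h1 ((eo u h1 h2).1 ▸ hl)
    refine ⟨fun i => (H.conn i i).left_mem, ?_, ?_, ?_, ?_⟩
    · intro i
      fin_cases i
      exacts [Nl.symm, T.ne 1, T.ne 2]
    · intro i
      fin_cases i
      exacts [e0.1, (ez 1 (by simp)).1.trans (T.home 1), (ez 2 (by simp)).1.trans (T.home 2)]
    · intro i
      fin_cases i
      exacts [e0.2, (ez 1 (by simp)).2.trans (T.flags 1), (ez 2 (by simp)).2.trans (T.flags 2)]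
    · intro i
      fin_cases i
      · intro u hu hl
        replace hl : ℓ 0 ∈ h' u := hl
        rcases cs u hu with rfl | rfl | ⟨h1, h2⟩ | ⟨h1, h2⟩
        · rfl
        · rw [ev.1, Finset.mem_insert, Finset.mem_singleton] at hl
          rcases hl with h1 | h1
          exacts [absurd h1.symm Nl, absurd h1 hlx]
        · rw [(eK u h1 h2).1, Finset.mem_insert, Finset.mem_singleton] at hl
          rcases hl with h1 | h1
          exacts [absurd h1.symm Nl, absurd h1 hlx]
        · exact absurd (Tv u h1 ((eo u h1 h2).1 ▸ hl)) h2
      · exact un 1 (by simp) (T.unique 1)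
      · exact un 2 (by simp) (T.unique 2)

theorem tl_of_cut {U : Set V} {z : Fin 3 → V} (H : Triad G U z) {v : V} (hv : v ∈ U)
    (hvz : ∀ i, v ≠ z i) (h0 : ¬ ∀ i j, Conn G (U \ {v}) (z i) (z j))
    (IH : ∀ U' z', U' ⊂ U → Triad G U' z' → TL G U' z') : TL G U z := by
  by_cases hlf : ∃ k, ∀ i, i ≠ k → ¬ Conn G (U \ {v}) (z k) (z i)
  · obtain ⟨k, hk⟩ := hlf
    refine TL.of_swap (k := k) (tl_of_leaf (H.perm _) hv (fun i => hvz _) ?_ IH)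
    intro i hi
    simp only [Function.comp, Equiv.swap_apply_left]
    refine hk _ fun h1 => hi ?_
    exact (Equiv.swap 0 k).injective (h1.trans (Equiv.swap_apply_left 0 k).symm)
  · exfalso
    push Not at hlf
    refine h0 fun i j => ?_
    have hr : ∀ i, Conn G (U \ {v}) (z i) (z i) := fun i =>
      Conn.refl ⟨(H.conn i i).left_mem, (hvz i).symm⟩
    obtain ⟨a, ha, ca⟩ := hlf 0
    obtain ⟨b, hb, cb⟩ := hlf 1
    obtain ⟨c, hc, cc⟩ := hlf 2
    have h01 : Conn G (U \ {v}) (z 0) (z 1) := by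
      fin_cases a
      · exact absurd rfl ha
      · exact ca
      · fin_cases b
        exacts [cb.symm, absurd rfl hb, Conn.trans ca cb.symm]
    have h02 : Conn G (U \ {v}) (z 0) (z 2) := by
      fin_cases c
      exacts [cc.symm, h01.trans cc.symm, absurd rfl hc]
    have h3 : ∀ i, Conn G (U \ {v}) (z 0) (z i) := by
      intro i
      fin_cases i
      exacts [hr 0, h01, h02]
    exact (h3 i).symm.trans (h3 j)

theorem tl_of_remove {U : Set V} {z : Fin 3 → V} (H : Triad G U z) {v : V} (hv : v ∈ U)
    (hadj : G.Adj v (z 0)) (hna : ∀ i, i ≠ 0 → ¬ G.Adj (z 0) (z i))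
    (hc : ∀ i j, Conn G (U \ {v}) (z i) (z j))
    (IH : ∀ U' z', U' ⊂ U → Triad G U' z' → TL G U' z') : TL G U z := by
  have hins : insert v (U \ {v}) = U := Set.insert_sdiff_singleton.trans (Set.insert_eq_of_mem hv)
  have hT : Triad G (U \ {v}) z :=
    ⟨H.inj, hc, fun h => H.noclaw (h.mono Set.sdiff_subset)⟩
  obtain ⟨h, I, ℓ, x, M⟩ :=
    (IH (U \ {v}) z ⟨Set.sdiff_subset, fun h1 => (h1 hv).2 rfl⟩ hT).exists_minLab H.inj
  have C : Ctx G (U \ {v}) z h I ℓ x v :=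
    { toMinLab := M
      notin := fun h1 => h1.2 rfl
      adj0 := hadj
      nadj := hna
      noclaw := fun i j hi hj hij h1 => H.noclaw
        (Claw3.of_distinct hi.symm hj.symm hij (hins ▸ h1)) }
  rw [← hins]
  by_cases hP : ∃ p, p ∈ goodTouch G (U \ {v}) h I (x 0) v
  · rcases C.narrow_or_fork hP with ⟨c, hc1, hcl, hN⟩ | ⟨i, j, s, t, S, T, D⟩
    · exact C.tl_of_narrow hc1 hcl hN hP
    · by_cases hg : ∃ p ∈ goodTouch G (U \ {v}) h I (x 0) v, h p = {s, t}
      · refine C.tl_of_gate D hg (hc 0 i) fun U' z' hU hz hco hcl => IH U' z' (hins ▸ hU) ?_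
        exact ⟨hz, fun k m => (hco k).symm.trans (hco m), hcl⟩
      · push Not at hg
        obtain ⟨c, E⟩ := C.exists_pivot D hg
        exact C.tl_of_pivot E
  · push Not at hP
    exact C.tl_of_empty hP

theorem three_in_tree {U : Set V} {z : Fin 3 → V} (H : Triad G U z) : TL G U z := by
  induction hn : U.ncard using Nat.strong_induction_on generalizing U z with
  | _ n ih =>
    have IH : ∀ U' z', U' ⊂ U → Triad G U' z' → TL G U' z' := fun U' z' hU' H' =>
      ih _ (hn ▸ Set.ncard_lt_ncard hU' U.toFinite) H' rfl
    have anchor : ∀ z : Fin 3 → V, Triad G U z → (∀ i, i ≠ 0 → ¬ G.Adj (z 0) (z i)) →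
        TL G U z := by
      intro z H hna
      obtain ⟨T, hT, hp⟩ := H.conn 0 1
      have h01 : z 1 ≠ z 0 := H.inj.ne (by simp)
      obtain ⟨u, hu, v, hv, hu0, hv0, huv⟩ := hp.exists_exit (P := {z 0}) rfl h01
      obtain rfl : u = z 0 := hu0
      have hvz : ∀ i, v ≠ z i := by
        rintro i rfl
        by_cases hi : i = 0
        · exact hv0 (hi ▸ rfl)
        · exact hna i hi huv
      by_cases hc : ∀ i j, Conn G (U \ {v}) (z i) (z j)
      · exact tl_of_remove H (hT hv) huv.symm hna hc IH
      · exact tl_of_cut H (hT hv) hvz hc IH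
    by_cases hk : ∃ k, ∀ i, i ≠ k → ¬ G.Adj (z k) (z i)
    · obtain ⟨k, hk⟩ := hk
      refine TL.of_swap (k := k) (anchor _ (H.perm _) ?_)
      intro i hi
      simp only [Function.comp, Equiv.swap_apply_left]
      refine hk _ fun h1 => hi ?_
      exact (Equiv.swap 0 k).injective (h1.trans (Equiv.swap_apply_left 0 k).symm)
    push Not at hk
    have mid : ∀ k i j, i ≠ k → j ≠ k → i ≠ j → G.Adj (z k) (z i) → G.Adj (z k) (z j) →
        G.Adj (z i) (z j) := by
      intro k i j hi hj hij hki hkj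
      by_contra hcon
      have hm : ∀ i, z i ∈ U := fun i => (H.conn i i).left_mem
      refine H.noclaw (Claw3.of_distinct hi.symm hj.symm hij
        ⟨z k, {z k}, {z k, z i}, {z k, z j}, IPath.single _, IPath.pair hki, IPath.pair hkj,
          ?_, ?_, ?_, ?_, ?_, ?_⟩)
      · rintro u rfl; exact hm k
      · rintro u (rfl | rfl); exacts [hm k, hm i]
      · rintro u (rfl | rfl); exacts [hm k, hm j]
      · rintro u rfl w - -; exact Or.inl rfl
      · rintro u rfl w - -; exact Or.inl rfl
      · rintro u (rfl | rfl) w (rfl | rfl) huw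
        · exact Or.inl rfl
        · exact Or.inl rfl
        · exact Or.inr rfl
        · exact absurd huw (not_or.2 ⟨H.inj.ne hij, hcon⟩)
    have three : ∀ i j : Fin 3, i ≠ j → ∃ k, k ≠ i ∧ k ≠ j ∧ ∀ m, m = i ∨ m = j ∨ m = k := by
      decide
    refine tl_of_star H fun i j hij => ?_
    obtain ⟨k, hki, hkj, hall⟩ := three i j hij
    obtain ⟨a, ha, hia⟩ := hk i
    obtain ⟨b, hb, hjb⟩ := hk j
    rcases hall a with rfl | rfl | rfl
    · exact absurd rfl ha
    · exact hia
    · rcases hall b with rfl | rfl | rfl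
      · exact hjb.symm
      · exact absurd rfl hb
      · exact mid _ i j ha.symm hb.symm hij hia.symm hjb.symm

end ThreeInTree

section Conversion

variable {V : Type*} {G : SimpleGraph V} {X : Set V} {h I : V → Finset ℕ}

/-- A labeling in which every strip has both interfaces and every triangle has its edges. -/
structure RigidLab (G : SimpleGraph V) (X : Set V) (h I : V → Finset ℕ) : Prop
    extends Lab G X h I where
  strip : ∀ u ∈ X, ∀ a b, a ≠ b → h u = {a, b} → ∃ w ∈ X, h w = {a, b} ∧ a ∈ I w
  tri : ∀ u ∈ X, ∀ a b c, a ≠ b → a ≠ c → b ≠ c → h u = {a, b, c} → ∃ w ∈ X, h w = {a, b}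

/-- The vertices whose home is comparable with `κ`. -/
def span (h : V → Finset ℕ) (κ : Finset ℕ) : Set V := {u | h u ⊆ κ ∨ κ ⊆ h u}

namespace RigidLab

/-- The pattern graph of a rigid labeling. -/
abbrev pattern (X : Set V) (h : V → Finset ℕ) : SimpleGraph (usedNodes X h) :=
  (nodeGraph X h).comap Subtype.val

theorem tri_pattern (R : RigidLab G X h I) {u : V} (hu : u ∈ X) {a b c : usedNodes X h}
    (hab : a.1 ≠ b.1) (hac : a.1 ≠ c.1) (hbc : b.1 ≠ c.1) (hh : h u = {a.1, b.1, c.1}) :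
    Tri (pattern X h) a b c := by
  refine ⟨⟨hab, R.tri u hu _ _ _ hab hac hbc hh⟩, ⟨hbc, R.tri u hu _ _ _ hbc hab.symm hac.symm ?_⟩,
    ⟨hac, R.tri u hu _ _ _ hac hab hbc.symm ?_⟩⟩
  · rw [hh]; ext n; simp only [Finset.mem_insert, Finset.mem_singleton]; tauto
  · rw [hh]; ext n; simp only [Finset.mem_insert, Finset.mem_singleton]; tauto

theorem edge_aux (R : RigidLab G X h I) {u w : V} (hu : u ∈ X) (hw : w ∈ X)
    (hl : LinkOK h I u w) :
    h u = h w ∨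
    (∃ a b c : usedNodes X h, a.1 ≠ b.1 ∧ a.1 ≠ c.1 ∧ b.1 ≠ c.1 ∧ h u = {a.1, b.1} ∧ a.1 ∈ I u ∧
      h w = {a.1, c.1} ∧ a.1 ∈ I w) ∨
    (∃ a b : usedNodes X h, a.1 ≠ b.1 ∧ ((h u = {a.1, b.1} ∧ a.1 ∈ I u ∧ h w = {a.1}) ∨
      (h w = {a.1, b.1} ∧ a.1 ∈ I w ∧ h u = {a.1}))) ∨
    (∃ a b c : usedNodes X h, a.1 ≠ b.1 ∧ a.1 ≠ c.1 ∧ b.1 ≠ c.1 ∧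
      ((h u = {a.1, b.1, c.1} ∧ h w = {a.1, b.1} ∧ a.1 ∈ I w ∧ b.1 ∈ I w) ∨
      (h w = {a.1, b.1, c.1} ∧ h u = {a.1, b.1} ∧ a.1 ∈ I u ∧ b.1 ∈ I u))) := by
  have pair : ∀ u ∈ X, ∀ a ∈ I u, ∃ b, a ≠ b ∧ h u = {a, b} := fun u hu a ha =>
    Finset.exists_eq_pair (R.flag u hu a ha) (R.sub u hu ha)
  have node : ∀ u ∈ X, ∀ a, a ∈ h u → ∃ b : usedNodes X h, b.1 = a := fun u hu a ha =>
    ⟨⟨a, u, hu, ha⟩, rfl⟩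
  have single : ∀ u ∈ X, ∀ w a, a ∈ I u → h w = {a} → ∃ a b : usedNodes X h, a.1 ≠ b.1 ∧
      h u = {a.1, b.1} ∧ a.1 ∈ I u ∧ h w = {a.1} := by
    intro u hu w a ha hw
    obtain ⟨b, hab, hh⟩ := pair u hu a ha
    exact ⟨⟨a, u, hu, by simp [hh]⟩, ⟨b, u, hu, by simp [hh]⟩, hab, hh, ha, hw⟩
  have triple : ∀ u ∈ X, ∀ w ∈ X, (h u).card = 3 → h w ⊆ h u → I w = h w →
      ∃ a b c : usedNodes X h, a.1 ≠ b.1 ∧ a.1 ≠ c.1 ∧ b.1 ≠ c.1 ∧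
        h u = {a.1, b.1, c.1} ∧ h w = {a.1, b.1} ∧ a.1 ∈ I w ∧ b.1 ∈ I w := by
    intro u hu w hw h3 hs he
    obtain ⟨a, ha⟩ := Finset.card_pos.1 (R.pos w hw)
    obtain ⟨b, hab, hh⟩ := pair w hw a (he ▸ ha)
    obtain ⟨c, hcu, hcw⟩ : ∃ c ∈ h u, c ∉ h w := by
      by_contra! hcon
      have := Finset.card_le_card hcon
      rw [h3, R.flag w hw a (he ▸ ha)] at this
      omega
    have hb : b ∈ h w := by simp [hh]
    have hca : a ≠ c := by rintro rfl; exact hcw ha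
    have hcb : b ≠ c := by rintro rfl; exact hcw hb
    refine ⟨⟨a, w, hw, ha⟩, ⟨b, w, hw, hb⟩, ⟨c, u, hu, hcu⟩, hab, hca, hcb, ?_, hh, (by
      rwa [he]), (by rwa [he])⟩
    refine (Finset.eq_of_subset_of_card_le ?_ ?_).symm
    · intro n hn
      simp only [Finset.mem_insert, Finset.mem_singleton] at hn
      rcases hn with rfl | rfl | rfl
      exacts [hs ha, hs hb, hcu]
    · rw [h3, Finset.card_eq_three.2 ⟨a, b, c, hab, hca, hcb, rfl⟩]
  rcases hl with h1 | ⟨a, hau, haw⟩ | ⟨a, ha, he⟩ | ⟨a, ha, he⟩ | ⟨h1, h2, h3⟩ | ⟨h1, h2, h3⟩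
  · exact Or.inl h1
  · obtain ⟨b, hab, hb⟩ := pair u hu a hau
    obtain ⟨c, hac, hc⟩ := pair w hw a haw
    by_cases hbc : b = c
    · exact Or.inl (by rw [hb, hc, hbc])
    · exact Or.inr (Or.inl ⟨⟨a, u, hu, by simp [hb]⟩, ⟨b, u, hu, by simp [hb]⟩,
        ⟨c, w, hw, by simp [hc]⟩, hab, hac, hbc, hb, hau, hc, haw⟩)
  · obtain ⟨a, b, hab, h1, h2, h3⟩ := single w hw u a ha he
    exact Or.inr (Or.inr (Or.inl ⟨a, b, hab, Or.inr ⟨h1, h2, h3⟩⟩))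
  · obtain ⟨a, b, hab, h1, h2, h3⟩ := single u hu w a ha he
    exact Or.inr (Or.inr (Or.inl ⟨a, b, hab, Or.inl ⟨h1, h2, h3⟩⟩))
  · obtain ⟨a, b, c, h4, h5, h6, h7⟩ := triple u hu w hw h1 h2 h3
    exact Or.inr (Or.inr (Or.inr ⟨a, b, c, h4, h5, h6, Or.inl h7⟩))
  · obtain ⟨a, b, c, h4, h5, h6, h7⟩ := triple w hw u hu h1 h2 h3
    exact Or.inr (Or.inr (Or.inr ⟨a, b, c, h4, h5, h6, Or.inr h7⟩))

/-- The extended strip decomposition described by a rigid labeling. -/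
def toESD (R : RigidLab G X h I) : ESD (G.induce X) (pattern X h) where
  ηv x := {v | h v = {x.1}}
  ηe x y := {v | x.1 ≠ y.1 ∧ h v = {x.1, y.1}}
  ηi x y := {v | x.1 ≠ y.1 ∧ h v = {x.1, y.1} ∧ x.1 ∈ I v}
  ηt x y z := {v | x.1 ≠ y.1 ∧ x.1 ≠ z.1 ∧ y.1 ≠ z.1 ∧ h v = {x.1, y.1, z.1}}
  ηe_symm x y := by
    ext v
    simp only [Set.mem_ofPred_eq, Finset.pair_comm x.1 y.1, ne_comm (a := x.1)]
  ηt_symm12 x y z := by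
    ext v
    simp only [Set.mem_ofPred_eq, Finset.insert_comm x.1 y.1, ne_comm (a := x.1) (b := y.1)]
    tauto
  ηt_symm23 x y z := by
    ext v
    simp only [Set.mem_ofPred_eq, Finset.pair_comm y.1 z.1, ne_comm (a := y.1) (b := z.1)]
    tauto
  ηe_empty x y hn := by
    ext v
    simp only [Set.mem_ofPred_eq, Set.mem_empty_iff_false, iff_false]
    exact fun hv => hn ⟨hv.1, v.1, v.2, hv.2⟩
  ηt_empty x y z hn := by
    ext v
    simp only [Set.mem_ofPred_eq, Set.mem_empty_iff_false, iff_false]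
    exact fun hv => hn (R.tri_pattern v.2 hv.1 hv.2.1 hv.2.2.1 hv.2.2.2)
  ηi_sub x y v hv := ⟨hv.1, hv.2.1⟩
  cover v := by
    have h1 := R.pos v.1 v.2
    have h3 := R.le v.1 v.2
    have node : ∀ a, a ∈ h v → a ∈ usedNodes X h := fun a ha => ⟨v.1, v.2, ha⟩
    obtain h1 | h2 | h3 : (h v).card = 1 ∨ (h v).card = 2 ∨ (h v).card = 3 := by omega
    · obtain ⟨a, ha⟩ := Finset.card_eq_one.1 h1
      exact Or.inl ⟨⟨a, node a (by simp [ha])⟩, ha⟩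
    · obtain ⟨a, b, hab, hh⟩ := Finset.card_eq_two.1 h2
      exact Or.inr (Or.inl ⟨⟨a, node a (by simp [hh])⟩, ⟨b, node b (by simp [hh])⟩, hab, hh⟩)
    · obtain ⟨a, b, c, hab, hac, hbc, hh⟩ := Finset.card_eq_three.1 h3
      exact Or.inr (Or.inr ⟨⟨a, node a (by simp [hh])⟩, ⟨b, node b (by simp [hh])⟩,
        ⟨c, node c (by simp [hh])⟩, hab, hac, hbc, hh⟩)
  disj_vv x y hxy := by
    refine Set.eq_empty_of_forall_notMem fun v hv => hxy (Subtype.ext ?_)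
    exact Finset.singleton_injective (hv.1.symm.trans hv.2)
  disj_ve x y z := by
    refine Set.eq_empty_of_forall_notMem fun v hv => ?_
    have := congrArg Finset.card (hv.1.symm.trans hv.2.2)
    rw [Finset.card_pair hv.2.1, Finset.card_singleton] at this
    omega
  disj_vt x a b c := by
    refine Set.eq_empty_of_forall_notMem fun v hv => ?_
    have := congrArg Finset.card (hv.1.symm.trans hv.2.2.2.2)
    rw [Finset.card_eq_three.2 ⟨_, _, _, hv.2.1, hv.2.2.1, hv.2.2.2.1, rfl⟩,
      Finset.card_singleton] at this
    omega
  disj_ee x y a b h1 h2 := by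
    refine Set.eq_empty_of_forall_notMem fun v hv => ?_
    have he := hv.1.2.symm.trans hv.2.2
    have hx := (Finset.ext_iff.1 he x.1).1 (by simp)
    have hy := (Finset.ext_iff.1 he y.1).1 (by simp)
    rw [Finset.mem_insert, Finset.mem_singleton] at hx hy
    have hne := hv.1.1
    simp only [Subtype.ext_iff] at h1 h2
    omega
  disj_et x y a b c := by
    refine Set.eq_empty_of_forall_notMem fun v hv => ?_
    have := congrArg Finset.card (hv.1.2.symm.trans hv.2.2.2.2)
    rw [Finset.card_eq_three.2 ⟨_, _, _, hv.2.1, hv.2.2.1, hv.2.2.2.1, rfl⟩,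
      Finset.card_pair hv.1.1] at this
    omega
  disj_tt a b c d e f hne := by
    refine Set.eq_empty_of_forall_notMem fun v hv => hne ?_
    have he := hv.1.2.2.2.symm.trans hv.2.2.2.2
    ext x
    have := Finset.ext_iff.1 he x.1
    simpa [Subtype.ext_iff] using this
  complete x y z hxy hxz hyz u hu v hv := by
    refine R.complete u.1 u.2 v.1 v.2 x.1 hu.2.2 hv.2.2 fun he => hyz (Subtype.ext ?_)
    have h1 : y.1 ∈ h v := he ▸ (by simp [hu.2.1] : y.1 ∈ h u)
    rw [hv.2.1, Finset.mem_insert, Finset.mem_singleton] at h1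
    exact h1.resolve_left hu.1.symm
  edge_cond u v huv := by
    rcases R.edge_aux u.2 v.2 (R.edge u.1 u.2 v.1 v.2 huv) with he | hc | hc | hc
    · have node : ∀ a, a ∈ h u → a ∈ usedNodes X h := fun a ha => ⟨u.1, u.2, ha⟩
      have h1 := R.pos u.1 u.2
      have h3 := R.le u.1 u.2
      obtain h1 | h2 | h3 : (h u).card = 1 ∨ (h u).card = 2 ∨ (h u).card = 3 := by omega
      · obtain ⟨a, ha⟩ := Finset.card_eq_one.1 h1
        exact Or.inl ⟨⟨a, node a (by simp [ha])⟩, ha, he ▸ ha⟩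
      · obtain ⟨a, b, hab, hh⟩ := Finset.card_eq_two.1 h2
        exact Or.inr (Or.inl ⟨⟨a, node a (by simp [hh])⟩, ⟨b, node b (by simp [hh])⟩,
          ⟨hab, hh⟩, hab, he ▸ hh⟩)
      · obtain ⟨a, b, c, hab, hac, hbc, hh⟩ := Finset.card_eq_three.1 h3
        exact Or.inr (Or.inr (Or.inl ⟨⟨a, node a (by simp [hh])⟩, ⟨b, node b (by simp [hh])⟩,
          ⟨c, node c (by simp [hh])⟩, ⟨hab, hac, hbc, hh⟩, hab, hac, hbc, he ▸ hh⟩))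
    · obtain ⟨a, b, c, hab, hac, hbc, h1, h2, h3, h4⟩ := hc
      exact Or.inr (Or.inr (Or.inr (Or.inl ⟨a, b, c, ⟨hab, u.1, u.2, h1⟩, ⟨hac, v.1, v.2, h3⟩,
        fun he => hbc (congrArg _ he), Or.inl ⟨⟨hab, h1, h2⟩, hac, h3, h4⟩⟩)))
    · obtain ⟨a, b, hab, ⟨h1, h2, h3⟩ | ⟨h1, h2, h3⟩⟩ := hc
      · exact Or.inr (Or.inr (Or.inr (Or.inr (Or.inl
          ⟨a, b, ⟨hab, u.1, u.2, h1⟩, Or.inl ⟨⟨hab, h1, h2⟩, h3⟩⟩))))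
      · exact Or.inr (Or.inr (Or.inr (Or.inr (Or.inl
          ⟨a, b, ⟨hab, v.1, v.2, h1⟩, Or.inr ⟨⟨hab, h1, h2⟩, h3⟩⟩))))
    · obtain ⟨a, b, c, hab, hac, hbc, ⟨h1, h2, h3, h4⟩ | ⟨h1, h2, h3, h4⟩⟩ := hc
      · exact Or.inr (Or.inr (Or.inr (Or.inr (Or.inr ⟨a, b, c, R.tri_pattern u.2 hab hac hbc h1,
          Or.inl ⟨⟨hab, hac, hbc, h1⟩, ⟨hab, h2, h3⟩, hab.symm, (by
            rw [h2, Finset.pair_comm]), h4⟩⟩))))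
      · exact Or.inr (Or.inr (Or.inr (Or.inr (Or.inr ⟨a, b, c, R.tri_pattern v.2 hab hac hbc h1,
          Or.inr ⟨⟨hab, hac, hbc, h1⟩, ⟨hab, h2, h3⟩, hab.symm, (by
            rw [h2, Finset.pair_comm]), h4⟩⟩))))

theorem exists_strip (R : RigidLab G X h I) {u : V} (hu : u ∈ X) {a b : ℕ} (ha : a ∈ h u)
    (hb : b ∈ h u) (hab : a ≠ b) : ∃ w ∈ X, h w = {a, b} := by
  have h3 := R.le u hu
  by_cases hc : (h u).card = 3
  · obtain ⟨c, d, hac, had, hcd, hh⟩ := Finset.exists_eq_triple hc ha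
    have hb' := hb
    rw [hh, Finset.mem_insert, Finset.mem_insert, Finset.mem_singleton] at hb'
    rcases hb' with rfl | rfl | rfl
    · exact absurd rfl hab
    · exact R.tri u hu _ _ _ hac had hcd hh
    · exact R.tri u hu _ _ _ had hac hcd.symm (hh.trans (by rw [Finset.pair_comm]))
  · refine ⟨u, hu, (Finset.eq_of_subset_of_card_le (Finset.insert_subset ha (by simpa)) ?_).symm⟩
    rw [Finset.card_pair hab]
    omega

theorem isRigid_toESD (R : RigidLab G X h I) : R.toESD.IsRigid := by
  refine ⟨fun x y hxy => ?_, fun x hx => ?_⟩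
  · obtain ⟨hne, u, hu, hh⟩ := hxy
    obtain ⟨w, hw, h1, h2⟩ := R.strip u hu _ _ hne hh
    exact ⟨⟨w, hw⟩, hne, h1, h2⟩
  · obtain ⟨u, hu, hxu⟩ := x.2
    refine ⟨⟨u, hu⟩, Finset.eq_singleton_iff_unique_mem.2 ⟨hxu, fun b hb => ?_⟩⟩
    by_contra hne
    exact hx ⟨b, u, hu, hb⟩ ⟨Ne.symm hne, R.exists_strip hu hxu hb (Ne.symm hne)⟩

theorem exists_particle [Fintype V] [Fintype X] (R : RigidLab G X h I) (w : V → ℕ) {m : ℕ}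
    (hs : ¬ R.toESD.ParticlesSmall (fun v => w v.1) m) :
    ∃ a b, a ≠ b ∧ m < wsum w (X ∩ span h {a, b}) ∧
      ((∃ u ∈ X, h u = {a, b}) ∨ ∀ u ∈ X, b ∉ h u ∧ a ∉ I u) := by
  classical
  by_contra! hcon
  have key : ∀ P : Set X, ∀ a b : ℕ, a ≠ b → (∀ v ∈ P, v.1 ∈ span h {a, b}) →
      ((∃ u ∈ X, h u = {a, b}) ∨ ∀ u ∈ X, b ∉ h u ∧ a ∉ I u) →
      wsum (fun v : X => w v.1) P ≤ m := by
    intro P a b hab hP hor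
    by_contra! hlt
    have hle : m < wsum w (X ∩ span h {a, b}) := by
      refine hlt.trans_le ?_
      unfold wsum
      refine (Finset.sum_map _ (Function.Embedding.subtype (· ∈ X)) w).ge.trans ?_
      refine Finset.sum_le_sum_of_subset fun v hv => ?_
      obtain ⟨u, hu, rfl⟩ := Finset.mem_map.1 hv
      rw [Set.Finite.mem_toFinset] at hu ⊢
      exact ⟨u.2, hP u hu⟩
    obtain ⟨h1, h2⟩ := hcon a b hab hle
    rcases hor with ⟨u, hu, hh⟩ | hor
    · exact h1 u hu hh
    · obtain ⟨u, hu, hh⟩ := h2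
      exact (hor u hu).2 (hh (hor u hu).1)
  have edge : ∀ x y : usedNodes X h, (pattern X h).Adj x y → ∀ P : Set X,
      P ⊆ R.toESD.fullEdge x y → wsum (fun v : X => w v.1) P ≤ m := by
    intro x y hxy P hP
    refine key P x.1 y.1 hxy.1 (fun v hv => ?_) (Or.inl hxy.2)
    rcases hP hv with ((h1 | h1) | ⟨_, h1⟩) | ⟨r, _, _, _, h1⟩
    · exact Or.inl (by rw [(h1 : h v = {x.1})]; simp)
    · exact Or.inl (by rw [(h1 : h v = {y.1})]; simp)
    · exact Or.inl h1.subset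
    · refine Or.inr ?_
      rw [h1]
      intro n
      simp only [Finset.mem_insert, Finset.mem_singleton]
      tauto
  have full : ∀ x y : usedNodes X h, R.toESD.ηe x y ⊆ R.toESD.fullEdge x y := fun x y v hv =>
    Or.inl (Or.inr hv)
  refine hs ⟨fun x => ?_, fun x y hxy => edge x y hxy _ fun v hv => full x y hv.1,
    fun x y hxy => edge x y hxy _ fun v hv => ?_, fun x y hxy => edge x y hxy _ subset_rfl,
    fun x y z hxyz => edge x y hxyz.1 _ fun v hv => Or.inr ⟨z, hv⟩⟩
  · by_cases hx : ∃ y, (pattern X h).Adj x y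
    · obtain ⟨y, hxy⟩ := hx
      exact edge x y hxy _ fun v hv => Or.inl (Or.inl (Or.inl hv))
    · push Not at hx
      obtain ⟨b, hb⟩ := Infinite.exists_notMem_finset (Finset.univ.biUnion h ∪ {x.1})
      rw [Finset.mem_union, Finset.mem_biUnion, Finset.mem_singleton] at hb
      push Not at hb
      refine key _ x.1 b (Ne.symm hb.2) (fun v hv => Or.inl ?_) (Or.inr fun u hu =>
        ⟨hb.1 u (Finset.mem_univ _), fun hxu => ?_⟩)
      · rw [(hv : h v = {x.1})]
        simp
      · obtain ⟨c, hc, hh⟩ := Finset.exists_eq_pair (R.flag u hu _ hxu) (R.sub u hu hxu)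
        exact hx ⟨c, u, hu, by simp [hh]⟩ ⟨hc, u, hu, hh⟩
  · rcases hv with hv | hv
    · exact Or.inl (Or.inl (Or.inl hv))
    · exact full x y hv.1

end RigidLab

/-- Leaving the neighborhood of a strip means meeting one of its flags. -/
theorem Lab.exit_span {κ : Finset ℕ} (L : Lab G X h I) (hκ : κ.card = 2) {u w : V} (hu : u ∈ X)
    (hw : w ∈ X) (ha : G.Adj u w) (hus : u ∈ span h κ) (hws : w ∉ span h κ) :
    ∃ c ∈ κ, c ∈ I w ∧ c ∈ h u := by
  have hwκ : ∀ c, h w = {c} → c ∉ κ := fun c hc hcκ => hws (Or.inl (by simp [hc, hcκ]))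
  rcases L.edge u hu w hw ha with h1 | ⟨a, hau, haw⟩ | ⟨a, haw, he⟩ | ⟨a, hau, he⟩ | ⟨h1, h2, h3⟩ |
      ⟨h1, h2, h3⟩
  · exact absurd (h1 ▸ hus : h w ⊆ κ ∨ κ ⊆ h w) hws
  · have h2 := L.flag u hu a hau
    have : h u = κ := by
      rcases hus with hs | hs
      · exact Finset.eq_of_subset_of_card_le hs (by omega)
      · exact (Finset.eq_of_subset_of_card_le hs (by omega)).symm
    exact ⟨a, this ▸ L.sub u hu hau, haw, L.sub u hu hau⟩
  · rcases hus with hs | hs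
    · exact ⟨a, hs (by simp [he]), haw, by simp [he]⟩
    · have := Finset.card_le_card hs
      rw [he, Finset.card_singleton] at this
      omega
  · have h2 := L.flag u hu a hau
    have : h u = κ := by
      rcases hus with hs | hs
      · exact Finset.eq_of_subset_of_card_le hs (by omega)
      · exact (Finset.eq_of_subset_of_card_le hs (by omega)).symm
    exact absurd (this ▸ L.sub u hu hau) (hwκ a he)
  · have hs : κ ⊆ h u := by
      rcases hus with hs | hs
      · have := Finset.card_le_card hs
        omega
      · exact hs
    have hp := L.pos w hw
    by_contra! hcon
    have hd : Disjoint κ (h w) := Finset.disjoint_left.2 fun c hc hcw =>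
      hcon c hc (h3 ▸ hcw) (hs hc)
    have hle := Finset.card_le_card (Finset.union_subset hs h2)
    rw [Finset.card_union_of_disjoint hd] at hle
    obtain ⟨c, hc⟩ := Finset.card_pos.1 hp
    have := L.flag w hw c (h3 ▸ hc)
    omega
  · obtain ⟨c, hc⟩ := Finset.card_pos.1 (L.pos u hu)
    have hf := L.flag u hu c (h3 ▸ hc)
    have : h u = κ := by
      rcases hus with hs | hs
      · exact Finset.eq_of_subset_of_card_le hs (by omega)
      · exact (Finset.eq_of_subset_of_card_le hs (by omega)).symm
    exact absurd (Or.inr (this ▸ h2)) hws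

end Conversion

section IndexedPaths

variable {V : Type*} {G : SimpleGraph V}

/-- `v 0, …, v (k - 1)` is an induced path. -/
structure IndPath (G : SimpleGraph V) (v : ℕ → V) (k : ℕ) : Prop where
  inj : ∀ i j, i < k → j < k → v i = v j → i = j
  adj : ∀ i j, i < k → j < k → (G.Adj (v i) (v j) ↔ i + 1 = j ∨ j + 1 = i)

theorem IndPath.ipath {v : ℕ → V} {k : ℕ} (P : IndPath G v k) {a b : ℕ} (hab : a ≤ b)
    (hb : b < k) : IPath G (v a) (v '' Set.Icc a b) (v b) := by
  induction b, hab using Nat.le_induction with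
  | base => simpa using IPath.single (v a)
  | succ b hab ih =>
    have he : v '' Set.Icc a (b + 1) = v '' Set.Icc a b ∪ {v (b + 1)} := by
      rw [← Set.image_singleton, ← Set.image_union]
      congr 1
      ext n
      simp only [Set.mem_Icc, Set.mem_union, Set.mem_singleton_iff]
      omega
    rw [he]
    refine (ih (by omega)).join (IPath.single _) ((P.adj _ _ (by omega) hb).2 (Or.inl rfl)) ?_ ?_
    · rintro _ ⟨n, hn, rfl⟩ h1
      have h2 := P.inj _ _ (by have := hn.2; omega) hb h1
      have := hn.2
      omega
    · rintro _ ⟨n, hn, rfl⟩ _ rfl ha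
      have h2 := (P.adj _ _ (by have := hn.2; omega) hb).1 ha
      have h3 := hn.2
      have h4 : n = b := by omega
      exact ⟨by rw [h4], rfl⟩

theorem IPath.exists_indPath {a e : V} {T : Set V} (h : IPath G a T e) :
    ∃ v n, IndPath G v (n + 1) ∧ v 0 = a ∧ T = v '' Set.Iic n := by
  induction h with
  | single a => exact ⟨fun _ => a, 0, ⟨by intros; omega, by
      intro i j hi hj
      simp only [SimpleGraph.irrefl, false_iff]
      omega⟩, rfl, by simp⟩
  | @cons a b e T ha hab hn hp ih =>
    obtain ⟨v, n, P, rfl, rfl⟩ := ih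
    have hmem : ∀ i, i < n + 1 → v i ∈ v '' Set.Iic n := fun i hi =>
      ⟨i, Set.mem_Iic.2 (by omega), rfl⟩
    have h0 : ∀ j, j < n + 1 → (G.Adj a (v j) ↔ j = 0) := fun j hj =>
      ⟨fun h1 => P.inj _ _ hj (by omega) (hn _ (hmem j hj) h1), fun h1 => h1 ▸ hab⟩
    refine ⟨fun i => Nat.casesOn i a v, n + 1, ⟨?_, ?_⟩, rfl, ?_⟩
    · rintro (_ | i) (_ | j) hi hj he
      · rfl
      · exact absurd (show a ∈ _ from (show a = v j from he) ▸ hmem j (by omega)) ha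
      · exact absurd (show a ∈ _ from (show v i = a from he) ▸ hmem i (by omega)) ha
      · rw [P.inj i j (by omega) (by omega) he]
    · rintro (_ | i) (_ | j) hi hj
      · simp
      · exact (h0 j (by omega)).trans (by omega)
      · exact (G.adj_comm _ _).trans ((h0 i (by omega)).trans (by omega))
      · exact (P.adj i j (by omega) (by omega)).trans (by omega)
    · ext y
      constructor
      · rintro (rfl | ⟨i, hi, rfl⟩)
        · exact ⟨0, by simp, rfl⟩
        · exact ⟨i + 1, by simpa using hi, rfl⟩
      · rintro ⟨_ | i, hi, rfl⟩
        · exact Or.inl rfl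
        · exact Or.inr ⟨i, by simpa using hi, rfl⟩

theorem sttt_of_legs {t : ℕ} {m : V} {T : Fin 3 → Set V} {e : Fin 3 → V}
    (hp : ∀ i, IPath G m (T i) (e i)) (hs : ∀ i j, i ≠ j → SepAt G m (T i) (T j))
    (hc : ∀ i, t < (T i).ncard) : Nonempty (Sttt t ↪g G) := by
  choose v n P hv0 hT using fun i => (hp i).exists_indPath
  have hn : ∀ i, t ≤ n i := by
    intro i
    have h1 := hc i
    have h2 := Set.ncard_image_le (f := v i) (Set.finite_Iic (n i))
    rw [hT i] at h1
    have h3 : (Set.Iic (n i)).ncard = n i + 1 := by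
      rw [Set.ncard_eq_toFinset_card', Set.toFinset_Iic, Nat.card_Iic]
    omega
  have hmem : ∀ i (s : Fin t), v i (s + 1) ∈ T i := fun i s => by
    rw [hT i]
    exact ⟨s + 1, Set.mem_Iic.2 (by have := hn i; omega), rfl⟩
  have hne : ∀ i (s : Fin t), v i (s + 1) ≠ m := fun i s h1 => by
    have := (P i).inj (s + 1) 0 (by have := hn i; omega) (by omega) (h1.trans (hv0 i).symm)
    omega
  have hcross : ∀ i j (r s : Fin t), i ≠ j → v i (r + 1) ≠ v j (s + 1) ∧
      ¬ G.Adj (v i (r + 1)) (v j (s + 1)) := by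
    intro i j r s hij
    refine ⟨fun h1 => ?_, fun h1 => ?_⟩
    · exact (hs i j hij _ (hmem i r) _ (hmem j s) (Or.inl h1)).elim (hne i r) (hne j s)
    · exact (hs i j hij _ (hmem i r) _ (hmem j s) (Or.inr h1)).elim (hne i r) (hne j s)
  have hm : ∀ i (s : Fin t), G.Adj m (v i (s + 1)) ↔ s.val = 0 := by
    intro i s
    rw [← hv0 i, (P i).adj 0 (s + 1) (by omega) (by have := hn i; omega)]
    omega
  refine ⟨⟨⟨Sum.elim (fun _ => m) fun p => v p.1 (p.2 + 1), ?_⟩, ?_⟩⟩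
  · rintro (_ | ⟨i, r⟩) (_ | ⟨j, s⟩) he
    · rfl
    · exact absurd he.symm (hne j s)
    · exact absurd he (hne i r)
    · by_cases hij : i = j
      · subst hij
        have := (P i).inj (r + 1) (s + 1) (by have := hn i; omega) (by have := hn i; omega) he
        rw [show r = s from Fin.ext (by omega)]
      · exact absurd he (hcross i j r s hij).1
  · rintro (_ | ⟨i, r⟩) (_ | ⟨j, s⟩)
    · simp
    · exact (hm j s).trans (by simp [Sttt, StttRel])
    · exact (G.adj_comm _ _).trans ((hm i r).trans (by simp [Sttt, StttRel]))
    · by_cases hij : i = j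
      · subst hij
        have := (P i).adj (r + 1) (s + 1) (by have := hn i; omega) (by have := hn i; omega)
        refine this.trans ?_
        simp only [Sttt, StttRel, SimpleGraph.fromRel_adj, true_and, ne_eq, Sum.inr.injEq,
          Prod.mk.injEq, Fin.ext_iff]
        omega
      · refine iff_of_false (hcross i j r s hij).2 ?_
        simp [Sttt, StttRel, hij, Ne.symm hij]

theorem Claw3.sttt {U : Set V} {z e : Fin 3 → V} {R : Fin 3 → Set V} {t : ℕ}
    (h : Claw3 G U (z 0) (z 1) (z 2)) (hR : ∀ i, IPath G (z i) (R i) (e i))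
    (hc : ∀ i, t < (R i).ncard) (hU : ∀ i, SepAt G (z i) (R i) U)
    (hs : ∀ i j, i ≠ j → Apart G (R i) (R j)) : Nonempty (Sttt t ↪g G) := by
  obtain ⟨m, A, B, C, hA, hB, hC, hAU, hBU, hCU, hAB, hAC, hBC⟩ := h
  obtain ⟨T, hT, hTU, hTs⟩ : ∃ T : Fin 3 → Set V, (∀ i, IPath G m (T i) (z i)) ∧
      (∀ i, T i ⊆ U) ∧ ∀ i j, i ≠ j → SepAt G m (T i) (T j) := by
    refine ⟨![A, B, C], ?_, ?_, ?_⟩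
    · intro i
      fin_cases i
      exacts [hA, hB, hC]
    · intro i
      fin_cases i
      exacts [hAU, hBU, hCU]
    · intro i j hij
      fin_cases i <;> fin_cases j <;>
        first
          | exact absurd rfl hij
          | exact hAB
          | exact hAC
          | exact hBC
          | exact hAB.symm
          | exact hAC.symm
          | exact hBC.symm
  have cross : ∀ i j, i ≠ j → SepAt G m (R i) (T j) := by
    intro i j hij x hx y hy hxy
    rcases hU i x hx y (hTU j hy) hxy with rfl | rfl
    · exact hTs i j hij _ (hT i).end_mem _ hy hxy
    · exact Or.inr ((hTs i j hij _ (hT i).end_mem _ hy (Or.inl rfl)).elim id id)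
  refine sttt_of_legs (m := m) (T := fun i => T i ∪ R i) (e := e) (fun i => ?_) ?_ fun i => ?_
  · exact (hT i).append (hR i) ((hU i).symm.mono (hTU i) subset_rfl)
  · rintro i j hij x (hx | hx) y (hy | hy) hxy
    · exact hTs i j hij x hx y hy hxy
    · exact (cross j i hij.symm).symm x hx y hy hxy
    · exact cross i j hij x hx y hy hxy
    · exact absurd hxy (not_or.2 (hs i j hij x hx y hy))
  · exact (hc i).trans_le (Set.ncard_le_ncard Set.subset_union_right
      ((hT i).finite.union (hR i).finite))

end IndexedPaths

section LabeledPaths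

variable {V : Type*} {G : SimpleGraph V}

/-- A labeling together with an induced path `v a, …, v b` joining two terminals. -/
structure LabPath (G : SimpleGraph V) (U : Set V) (z : Fin 3 → V) (h I : V → Finset ℕ)
    (ℓ x : Fin 3 → ℕ) (v : ℕ → V) (k a b : ℕ) : Prop
    extends Lab G U h I, Term U z h I ℓ x, IndPath G v k where
  ab : a < b
  bk : b < k
  left : v a = z 0
  right : v b = z 1
  on : ∀ n, a ≤ n → n ≤ b → v n ∈ U

theorem exists_step_below {P : ℕ → Prop} {a m : ℕ} (ham : a ≤ m) (ha : ¬ P a) (hm : P m) :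
    ∃ n, a ≤ n ∧ n < m ∧ ¬ P n ∧ P (n + 1) := by
  induction m, ham using Nat.le_induction with
  | base => exact absurd hm ha
  | succ m ham ih =>
    by_cases h : P m
    · obtain ⟨n, h1, h2, h3⟩ := ih h
      exact ⟨n, h1, h2.trans m.lt_succ_self, h3⟩
    · exact ⟨m, ham, m.lt_succ_self, h, hm⟩

theorem exists_step_above {P : ℕ → Prop} {m b : ℕ} (hmb : m ≤ b) (hb : ¬ P b) (hm : P m) :
    ∃ n, m ≤ n ∧ n < b ∧ P n ∧ ¬ P (n + 1) := by
  obtain ⟨n, h1, h2, h3, h4⟩ :=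
    exists_step_below (P := fun n => ¬ P n) hmb (not_not.2 hm) hb
  exact ⟨n, h1, h2, not_not.1 h3, h4⟩

theorem Term.home_of_span {U : Set V} {z : Fin 3 → V} {h I : V → Finset ℕ} {ℓ x : Fin 3 → ℕ}
    (T : Term U z h I ℓ x) {κ : Finset ℕ} (hκ : κ.card = 2) {i : Fin 3} (hs : z i ∈ span h κ) :
    h (z i) = κ := by
  have hc : (h (z i)).card = 2 := by rw [T.home, Finset.card_pair (T.ne i)]
  rcases hs with hs | hs
  · exact Finset.eq_of_subset_of_card_le hs (by omega)
  · exact (Finset.eq_of_subset_of_card_le hs (by omega)).symm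

theorem not_mem_span {h : V → Finset ℕ} {κ : Finset ℕ} {u : V} (hu : u ∉ span h κ) : h u ≠ κ :=
  fun he => hu (Or.inl he.subset)

namespace LabPath

variable {U : Set V} {z : Fin 3 → V} {h I : V → Finset ℕ} {ℓ x : Fin 3 → ℕ} {v : ℕ → V}
  {k a b : ℕ}

theorem eq_left (Q : LabPath G U z h I ℓ x v k a b) {n : ℕ} (han : a ≤ n) (hnb : n ≤ b)
    (hn : ℓ 0 ∈ h (v n)) : n = a := by
  have h1 := Q.unique 0 _ (Q.on n han hnb) hn
  have := Q.ab
  have := Q.bk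
  exact Q.toIndPath.inj n a (by omega) (by omega) (h1.trans Q.left.symm)

theorem eq_right (Q : LabPath G U z h I ℓ x v k a b) {n : ℕ} (han : a ≤ n) (hnb : n ≤ b)
    (hn : ℓ 1 ∈ h (v n)) : n = b := by
  have h1 := Q.unique 1 _ (Q.on n han hnb) hn
  have := Q.bk
  exact Q.toIndPath.inj n b (by omega) (by omega) (h1.trans Q.right.symm)

theorem home_left (Q : LabPath G U z h I ℓ x v k a b) : ℓ 0 ∈ h (v a) := by
  rw [Q.left, Q.home]
  simp

theorem home_right (Q : LabPath G U z h I ℓ x v k a b) : ℓ 1 ∈ h (v b) := by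
  rw [Q.right, Q.home]
  simp

theorem near (Q : LabPath G U z h I ℓ x v k a b) {p q c : ℕ} (hap : a ≤ p) (hpq : p < q)
    (hqb : q ≤ b) (hp : c ∈ I (v p)) (hq : c ∈ I (v q)) (hh : h (v p) ≠ h (v q)) : q = p + 1 := by
  have := Q.bk
  have h1 := Q.complete _ (Q.on p hap (by omega)) _ (Q.on q (by omega) hqb) c hp hq hh
  have h2 := (Q.toIndPath.adj p q (by omega) (by omega)).1 h1
  omega

/-- Distinct vertices of the path with a common home do not share a flag. -/
theorem no_bounce (Q : LabPath G U z h I ℓ x v k a b) {p q c : ℕ} (hap : a ≤ p) (hpq : p < q)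
    (hqb : q ≤ b) (hp : c ∈ I (v p)) (hq : c ∈ I (v q)) : h (v p) ≠ h (v q) := by
  induction p using Nat.strong_induction_on generalizing q c with
  | _ p ih =>
  intro he
  have hbk := Q.bk
  have hpU := Q.on p hap (by omega)
  have hqU := Q.on q (by omega) hqb
  have hκ := Q.flag _ hpU c hp
  have hcκ := Q.sub _ hpU hp
  have hsp : ∀ n, h (v n) = h (v p) → v n ∈ span h (h (v p)) := fun n hn => Or.inl hn.subset
  have hna : v a ∉ span h (h (v p)) := by
    intro hs
    have h1 := Q.home_of_span hκ (Q.left ▸ hs)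
    rw [← Q.left] at h1
    have h2 := Q.eq_left hap (by omega) (h1 ▸ Q.home_left)
    have h3 := Q.eq_left (n := q) (by omega) hqb ((h1.trans he) ▸ Q.home_left)
    omega
  have hnb : v b ∉ span h (h (v p)) := by
    intro hs
    have h1 := Q.home_of_span hκ (Q.right ▸ hs)
    rw [← Q.right] at h1
    have h2 := Q.eq_right hap (by omega) (h1 ▸ Q.home_right)
    have h3 := Q.eq_right (n := q) (by omega) hqb ((h1.trans he) ▸ Q.home_right)
    omega
  obtain ⟨n, h1, h2, h3, h4⟩ := exists_step_below (P := fun n => v n ∈ span h (h (v p))) hap hna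
    (hsp p rfl)
  obtain ⟨m, h5, h6, h7, h8⟩ := exists_step_above (P := fun n => v n ∈ span h (h (v p))) hqb hnb
    (hsp q he.symm)
  have hnU := Q.on n (by omega) (by omega)
  have hmU := Q.on (m + 1) (by omega) (by omega)
  obtain ⟨f, hf, hfn, _⟩ := Q.exit_span hκ (Q.on (n + 1) (by omega) (by omega)) hnU
    ((Q.toIndPath.adj _ _ (by omega) (by omega)).2 (Or.inr rfl)) h4 h3
  obtain ⟨g, hg, hgm, _⟩ := Q.exit_span hκ (Q.on m (by omega) (by omega)) hmU
    ((Q.toIndPath.adj _ _ (by omega) (by omega)).2 (Or.inl rfl)) h7 h8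
  have hfc : c ≠ f := by
    rintro rfl
    have := Q.near h1 (by omega) hqb hfn hq (he ▸ not_mem_span h3)
    omega
  have hgc : c ≠ g := by
    rintro rfl
    have := Q.near hap (by omega) h6 hp hgm (not_mem_span h8).symm
    omega
  have hfg : f = g := by
    have h9 := Finset.eq_pair_of_mem hκ hcκ hf hfc
    rw [h9, Finset.mem_insert, Finset.mem_singleton] at hg
    exact (hg.resolve_left hgc.symm).symm
  subst hfg
  by_cases heq : h (v n) = h (v (m + 1))
  · exact ih n h2 h1 (by omega) h6 hfn hgm heq
  · have := Q.near h1 (by omega) h6 hfn hgm heq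
    omega

theorem flag_near (Q : LabPath G U z h I ℓ x v k a b) {p q c : ℕ} (hap : a ≤ p) (hpq : p < q)
    (hqb : q ≤ b) (hp : c ∈ I (v p)) (hq : c ∈ I (v q)) : q = p + 1 :=
  Q.near hap hpq hqb hp hq (Q.no_bounce hap hpq hqb hp hq)

theorem card_terminal (Q : LabPath G U z h I ℓ x v k a b) (i : Fin 3) : (h (z i)).card = 2 := by
  rw [Q.home, Finset.card_pair (Q.toTerm.ne i)]

/-- The path only visits strips. -/
theorem card_home (Q : LabPath G U z h I ℓ x v k a b) {m : ℕ} (ham : a ≤ m) (hmb : m ≤ b) :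
    (h (v m)).card = 2 := by
  by_contra hc
  have hbk := Q.bk
  have hmU := Q.on m ham hmb
  have hI : ∀ u ∈ U, h u = h (v m) → ∀ c, c ∉ I u := fun u hu hh c hcu =>
    hc (hh ▸ Q.flag u hu c hcu)
  have key : ∀ u ∈ U, ∀ w ∈ U, G.Adj u w → h u = h (v m) → h w ≠ h (v m) →
      (∃ c, c ∈ I w ∧ h (v m) = {c}) ∨ ((h (v m)).card = 3 ∧ h w ⊆ h (v m) ∧ I w = h w) := by
    intro u hu w hw ha hhu hhw
    rcases Q.edge u hu w hw ha with h1 | ⟨c, h1, _⟩ | ⟨c, h1, h2⟩ | ⟨c, h1, _⟩ | ⟨h1, h2, h3⟩ |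
        ⟨h1, h2, h3⟩
    · exact absurd (h1.symm.trans hhu) hhw
    · exact absurd h1 (hI u hu hhu c)
    · exact Or.inl ⟨c, h1, hhu ▸ h2⟩
    · exact absurd h1 (hI u hu hhu c)
    · exact Or.inr ⟨hhu ▸ h1, hhu ▸ h2, h3⟩
    · obtain ⟨c, hc⟩ := Finset.card_pos.1 (Q.pos u hu)
      exact absurd (h3 ▸ hc) (hI u hu hhu c)
  obtain ⟨n, h1, h2, h3, h4⟩ := exists_step_below (P := fun n => h (v n) = h (v m)) ham
    (fun he => hc (he ▸ Q.left ▸ Q.card_terminal 0)) rfl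
  obtain ⟨l, h5, h6, h7, h8⟩ := exists_step_above (P := fun n => h (v n) = h (v m)) hmb
    (fun he => hc (he ▸ Q.right ▸ Q.card_terminal 1)) rfl
  have hnU := Q.on n (by omega) (by omega)
  have hlU := Q.on (l + 1) (by omega) (by omega)
  have common : ∃ c, c ∈ I (v n) ∧ c ∈ I (v (l + 1)) := by
    rcases key _ (Q.on (n + 1) (by omega) (by omega)) _ hnU
      ((Q.toIndPath.adj _ _ (by omega) (by omega)).2 (Or.inr rfl)) h4 h3 with
      ⟨c, hcn, hc1⟩ | ⟨hc3, hs, he⟩ <;>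
    rcases key _ (Q.on l (by omega) (by omega)) _ hlU
      ((Q.toIndPath.adj _ _ (by omega) (by omega)).2 (Or.inl rfl)) h7 h8 with
      ⟨d, hdl, hd1⟩ | ⟨hd3, hs', he'⟩
    · exact ⟨c, hcn, Finset.singleton_injective (hd1.symm.trans hc1) ▸ hdl⟩
    · rw [hc1, Finset.card_singleton] at hd3
      omega
    · rw [hd1, Finset.card_singleton] at hc3
      omega
    · rw [he, he']
      by_contra! hcon
      have hle := Finset.card_le_card (Finset.union_subset hs hs')
      rw [Finset.card_union_of_disjoint (Finset.disjoint_left.2 hcon)] at hle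
      obtain ⟨c, hc⟩ := Finset.card_pos.1 (Q.pos _ hnU)
      obtain ⟨d, hd⟩ := Finset.card_pos.1 (Q.pos _ hlU)
      have := Q.flag _ hnU c (he ▸ hc)
      have := Q.flag _ hlU d (he' ▸ hd)
      omega
  obtain ⟨c, hcn, hcl⟩ := common
  have := Q.flag_near h1 (by omega) h6 hcn hcl
  omega

theorem common_flag (Q : LabPath G U z h I ℓ x v k a b) {m : ℕ} (ham : a ≤ m) (hmb : m < b)
    (hne : h (v m) ≠ h (v (m + 1))) : ∃ c, c ∈ I (v m) ∧ c ∈ I (v (m + 1)) := by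
  have hbk := Q.bk
  have h1 := Q.card_home ham hmb.le
  have h2 := Q.card_home (m := m + 1) (by omega) (by omega)
  rcases Q.edge _ (Q.on m ham hmb.le) _ (Q.on (m + 1) (by omega) (by omega))
    ((Q.toIndPath.adj _ _ (by omega) (by omega)).2 (Or.inl rfl)) with
    h3 | h3 | ⟨c, _, h3⟩ | ⟨c, _, h3⟩ | ⟨h3, _⟩ | ⟨h3, _⟩
  · exact absurd h3 hne
  · exact h3
  · rw [h3, Finset.card_singleton] at h1
    omega
  · rw [h3, Finset.card_singleton] at h2
    omega
  · omega
  · omega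

/-- The path crosses every strip which it visits. -/
theorem crosses (Q : LabPath G U z h I ℓ x v k a b) {m : ℕ} (ham : a ≤ m) (hmb : m ≤ b)
    (hz0 : h (v m) ≠ h (z 0)) (hz1 : h (v m) ≠ h (z 1)) {c : ℕ} (hc : c ∈ h (v m)) :
    ∃ p q, a ≤ p ∧ p ≤ b ∧ a ≤ q ∧ q ≤ b ∧ c ∈ I (v p) ∧ h (v p) = h (v m) ∧
      c ∈ I (v q) ∧ h (v q) ≠ h (v m) := by
  have hbk := Q.bk
  obtain ⟨n, h1, h2, h3, h4⟩ := exists_step_below (P := fun n => h (v n) = h (v m)) ham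
    (fun he => hz0 (by rw [← Q.left, he])) rfl
  obtain ⟨l, h5, h6, h7, h8⟩ := exists_step_above (P := fun n => h (v n) = h (v m)) hmb
    (fun he => hz1 (by rw [← Q.right, he])) rfl
  obtain ⟨f, hf, hf'⟩ := Q.common_flag h1 (by omega) fun he => h3 (he.trans h4)
  obtain ⟨g, hg, hg'⟩ := Q.common_flag (m := l) (by omega) h6 fun he => h8 (he.symm.trans h7)
  have hfg : f ≠ g := by
    rintro rfl
    have := Q.flag_near h1 (by omega) h6 hf hg'
    omega
  have hfm : f ∈ h (v m) := h4 ▸ Q.sub _ (Q.on (n + 1) (by omega) (by omega)) hf'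
  have hgm : g ∈ h (v m) := h7 ▸ Q.sub _ (Q.on l (by omega) (by omega)) hg
  have he := Finset.eq_pair_of_mem (Q.card_home ham hmb) hfm hgm hfg
  rw [he, Finset.mem_insert, Finset.mem_singleton] at hc
  rcases hc with rfl | rfl
  · exact ⟨n + 1, n, by omega, by omega, by omega, by omega, hf', h4, hf, h3⟩
  · exact ⟨l, l + 1, by omega, by omega, by omega, by omega, hg, h7, hg', h8⟩

/-- Every flag met by the path, other than a terminal one, is met twice. -/
theorem flag_twice (Q : LabPath G U z h I ℓ x v k a b) {m : ℕ} (ham : a ≤ m) (hmb : m ≤ b) {c : ℕ}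
    (hc : c ∈ I (v m)) (hc0 : c ≠ ℓ 0) (hc1 : c ≠ ℓ 1) :
    ∃ q, a ≤ q ∧ q ≤ b ∧ c ∈ I (v q) ∧ h (v q) ≠ h (v m) := by
  have hbk := Q.bk
  have hab := Q.ab
  have hch := Q.sub _ (Q.on m ham hmb) hc
  by_cases h0 : h (v m) = h (z 0)
  · have hm := Q.eq_left ham hmb (by rw [h0, Q.home]; simp)
    subst hm
    have hne : h (v (m + 1)) ≠ h (v m) := fun he => by
      have := Q.eq_left (n := m + 1) (by omega) (by omega) (he ▸ Q.home_left)
      omega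
    obtain ⟨f, hf, hf'⟩ := Q.common_flag le_rfl hab hne.symm
    refine ⟨m + 1, by omega, by omega, ?_, hne⟩
    have hfh := Q.sub _ (Q.on m ham hmb) hf
    have hfl : f ≠ ℓ 0 := by
      rintro rfl
      have := Q.eq_left (n := m + 1) (by omega) (by omega)
        (Q.sub _ (Q.on (m + 1) (by omega) (by omega)) hf')
      omega
    rw [h0, Q.home, Finset.mem_insert, Finset.mem_singleton] at hfh hch
    rwa [hch.resolve_left hc0, ← hfh.resolve_left hfl]
  by_cases h1 : h (v m) = h (z 1)
  · have hm := Q.eq_right ham hmb (by rw [h1, Q.home]; simp)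
    obtain ⟨n, rfl⟩ : ∃ n, m = n + 1 := ⟨m - 1, by omega⟩
    have hlr : ℓ 1 ∈ h (v (n + 1)) := by rw [h1, Q.home]; simp
    have hne : h (v n) ≠ h (v (n + 1)) := fun he => by
      have := Q.eq_right (n := n) (by omega) (by omega) (he ▸ hlr)
      omega
    obtain ⟨f, hf, hf'⟩ := Q.common_flag (m := n) (by omega) (by omega) hne
    refine ⟨n, by omega, by omega, ?_, hne⟩
    have hfh := Q.sub _ (Q.on (n + 1) ham hmb) hf'
    have hfl : f ≠ ℓ 1 := by
      rintro rfl
      have := Q.eq_right (n := n) (by omega) (by omega)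
        (Q.sub _ (Q.on n (by omega) (by omega)) hf)
      omega
    rw [h1, Q.home, Finset.mem_insert, Finset.mem_singleton] at hfh hch
    rwa [hch.resolve_left hc1, ← hfh.resolve_left hfl]
  obtain ⟨_, q, _, _, h4, h5, _, _, h6, h7⟩ := Q.crosses ham hmb h0 h1 hch
  exact ⟨q, h4, h5, h6, h7⟩

end LabPath

end LabeledPaths

section Dominators

variable {V : Type*} {G : SimpleGraph V}

/-- `R` dominates every vertex flagged `c`, provided that two strips are flagged `c`,
and it contains the vertices flagged `c` of the path if there are two of them. -/
structure Dominators (U : Set V) (h I : V → Finset ℕ) (v : ℕ → V) (a b c : ℕ) (R : Set V) :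
    Prop where
  flag : ∀ r ∈ R, r ∈ U ∧ c ∈ I r
  two : ∀ u ∈ U, ∀ w ∈ U, c ∈ I u → c ∈ I w → h u ≠ h w → ∃ r ∈ R, ∃ s ∈ R, h r ≠ h s
  path : ∀ p q, a ≤ p → p ≤ b → a ≤ q → q ≤ b → c ∈ I (v p) → c ∈ I (v q) →
    h (v q) ≠ h (v p) → v p ∈ R

theorem Dominators.home_eq {U R : Set V} {h I : V → Finset ℕ} {v : ℕ → V} {a b c : ℕ}
    (D : Dominators U h I v a b c R) (L : Lab G U h I) {e w : V} (he : e ∈ U) (hw : w ∈ U)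
    (hce : c ∈ I e) (hcw : c ∈ I w) (hR : ∀ r ∈ R, ¬ G.Adj r e) : h w = h e := by
  by_contra hne
  obtain ⟨r, hr, s, hs, hrs⟩ := D.two w hw e he hcw hce hne
  have key : ∀ r ∈ R, h r = h e := fun r hr => by
    by_contra hre
    exact hR r hr (L.complete r (D.flag r hr).1 e he c (D.flag r hr).2 hce hre)
  exact hrs ((key r hr).trans (key s hs).symm)

namespace LabPath

variable {U : Set V} {z : Fin 3 → V} {h I : V → Finset ℕ} {ℓ x : Fin 3 → ℕ} {v : ℕ → V}
  {k a b : ℕ}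

theorem exists_dominators (Q : LabPath G U z h I ℓ x v k a b) (c : ℕ) :
    ∃ R : Finset V, R.card ≤ 2 ∧ Dominators U h I v a b c R := by
  classical
  by_cases hL : ∃ p q, a ≤ p ∧ p < q ∧ q ≤ b ∧ c ∈ I (v p) ∧ c ∈ I (v q)
  · obtain ⟨p, q, hap, hpq, hqb, hp, hq⟩ := hL
    refine ⟨{v p, v q}, Finset.card_le_two, ?_, ?_, ?_⟩
    · intro r hr
      simp only [Finset.coe_insert, Finset.coe_singleton, Set.mem_insert_iff,
        Set.mem_singleton_iff] at hr
      rcases hr with rfl | rfl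
      exacts [⟨Q.on p hap (by omega), hp⟩, ⟨Q.on q (by omega) hqb, hq⟩]
    · exact fun _ _ _ _ _ _ _ => ⟨v p, by simp, v q, by simp, Q.no_bounce hap hpq hqb hp hq⟩
    · intro m _ ham hmb _ _ hm _ _
      have h1 := Q.flag_near hap hpq hqb hp hq
      have h2 : m = p ∨ m = q := by
        by_contra! hne
        rcases lt_or_gt_of_ne hne.1 with h3 | h3
        · have h4 := Q.flag_near ham h3 (by omega) hm hp
          have h5 := Q.flag_near ham (by omega) hqb hm hq
          omega
        · have h4 := Q.flag_near hap h3 hmb hp hm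
          omega
      rcases h2 with rfl | rfl <;> simp
  · have hpath : ∀ p q, a ≤ p → p ≤ b → a ≤ q → q ≤ b → c ∈ I (v p) → c ∈ I (v q) →
        h (v q) ≠ h (v p) → False := by
      intro p q hap hpb haq hqb hp hq hne
      rcases lt_trichotomy p q with h1 | rfl | h1
      · exact hL ⟨p, q, hap, h1, hqb, hp, hq⟩
      · exact hne rfl
      · exact hL ⟨q, p, haq, h1, hpb, hq, hp⟩
    by_cases hU : ∃ u ∈ U, ∃ w ∈ U, c ∈ I u ∧ c ∈ I w ∧ h u ≠ h w
    · obtain ⟨u, hu, w, hw, hcu, hcw, hne⟩ := hU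
      refine ⟨{u, w}, Finset.card_le_two, ?_, ?_, ?_⟩
      · intro r hr
        simp only [Finset.coe_insert, Finset.coe_singleton, Set.mem_insert_iff,
          Set.mem_singleton_iff] at hr
        rcases hr with rfl | rfl
        exacts [⟨hu, hcu⟩, ⟨hw, hcw⟩]
      · exact fun _ _ _ _ _ _ _ => ⟨u, by simp, w, by simp, hne⟩
      · exact fun p q h1 h2 h3 h4 h5 h6 h7 => (hpath p q h1 h2 h3 h4 h5 h6 h7).elim
    · refine ⟨∅, by simp, by simp, ?_, ?_⟩
      · exact fun u hu w hw h1 h2 h3 => absurd ⟨u, hu, w, hw, h1, h2, h3⟩ hU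
      · exact fun p q h1 h2 h3 h4 h5 h6 h7 => (hpath p q h1 h2 h3 h4 h5 h6 h7).elim

/-- A connected set living around one strip, and away from the dominators of its two ends,
does not see both the path and a second path ending in the third terminal. -/
theorem not_touch (Q : LabPath G U z h I ℓ x v k a b) {κ : Finset ℕ} (hκ : κ.card = 2)
    {R E : Set V} (hR : ∀ c ∈ κ, ∃ R' ⊆ R, Dominators U h I v a b c R')
    (hEU : E ⊆ U) (hEz : ∀ e ∈ E, ∀ i, e ≠ z i) (hER : ∀ e ∈ E, ∀ r ∈ R, ¬ G.Adj r e)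
    (hconn : ∀ e ∈ E, ∀ f ∈ E, Conn G E e f) (hmeet : ∃ e ∈ E, e ∈ span h κ)
    (hκE : ∀ c ∈ κ, (∃ w ∈ U, h w = κ ∧ c ∈ I w) ∨ ∀ e ∈ E, c ∉ I e)
    {j : ℕ} (hbj : b + 1 < j) (hj : v j = z 2) (hr : ∀ n, j ≤ n → n < k → v n ∈ U)
    {e f : V} (he : e ∈ E) (hf : f ∈ E) {m n : ℕ} (ham : a ≤ m) (hmb : m ≤ b)
    (hem : e = v m ∨ G.Adj (v m) e) (hjn : j ≤ n) (hnk : n < k)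
    (hfn : f = v n ∨ G.Adj (v n) f) : False := by
  have hbk := Q.bk
  have hab := Q.ab
  have hflag : ∀ e ∈ E, ∀ c ∈ κ, c ∈ I e → h e = κ := by
    intro e he c hc hce
    rcases hκE c hc with ⟨w, hw, hwκ, hcw⟩ | h1
    · obtain ⟨R', hR', D⟩ := hR c hc
      exact (D.home_eq Q.toLab (hEU he) hw hce hcw fun r hr => hER e he r (hR' hr)).symm.trans hwκ
    · exact absurd hce (h1 e he)
  have hspan : ∀ e ∈ E, e ∈ span h κ := by
    obtain ⟨e₀, he₀, hs₀⟩ := hmeet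
    refine fun e he => ((hconn e₀ he₀ e he).closed (P := E ∩ span h κ) ⟨he₀, hs₀⟩ ?_).2
    intro u hu w hw ha
    refine ⟨hw, ?_⟩
    by_contra hws
    obtain ⟨c, hc, hcw, _⟩ := Q.exit_span hκ (hEU hu.1) (hEU hw) ha hu.2 hws
    exact not_mem_span hws (hflag w hw c hc hcw)
  have hℓ : ∀ e ∈ E, ∀ i, ℓ i ∉ h e := fun e he i hi => hEz e he i (Q.unique i e (hEU he) hi)
  have hmU := Q.on m ham hmb
  have hnear : G.Adj (v m) e → ∀ c ∈ κ, c ∈ I (v m) → c ≠ ℓ 0 → c ≠ ℓ 1 → False := by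
    intro ha c hc hcm h0 h1
    obtain ⟨q, haq, hqb, hcq, hne⟩ := Q.flag_twice ham hmb hcm h0 h1
    obtain ⟨R', hR', D⟩ := hR c hc
    exact hER e he _ (hR' (D.path m q ham hmb haq hqb hcm hcq hne)) ha
  have hms : v m ∈ span h κ := by
    by_contra hns
    rcases hem with rfl | ha
    · exact hns (hspan _ he)
    · obtain ⟨c, hc, hcm, hce⟩ := Q.exit_span hκ (hEU he) hmU ha.symm (hspan e he) hns
      refine hnear ha c hc hcm ?_ ?_
      · rintro rfl
        exact hℓ e he _ hce
      · rintro rfl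
        exact hℓ e he _ hce
  have hmκ : h (v m) = κ := by
    have h2 := Q.card_home ham hmb
    rcases hms with hs | hs
    · exact Finset.eq_of_subset_of_card_le hs (by omega)
    · exact (Finset.eq_of_subset_of_card_le hs (by omega)).symm
  have hxℓ : ∀ i j, i ≠ j → z i ≠ z j → x i ≠ ℓ j := by
    intro i j _ hz hx
    exact hz (Q.unique j _ (Q.toTerm.mem i) (by rw [Q.home, ← hx]; simp))
  have h01 : z 0 ≠ z 1 := by
    intro h1
    rw [← Q.left, ← Q.right] at h1
    have := Q.toIndPath.inj a b (by omega) hbk h1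
    omega
  have hterm : ∀ i, (∀ j, j = 0 ∨ j = 1 → x i ≠ ℓ j) → h (v m) ≠ h (z i) := by
    intro i hi hme
    have hmz : v m = z i := Q.unique i _ hmU (by rw [hme, Q.home]; simp)
    have ha : G.Adj (v m) e := hem.resolve_left fun h1 => hEz e he i (h1.trans hmz)
    have hzκ : κ = {ℓ i, x i} := by rw [← hmκ, hme, Q.home]
    have hxκ : x i ∈ κ := by rw [hzκ]; simp
    exact hnear ha (x i) hxκ (by rw [hmz, Q.flags]; simp) (hi 0 (Or.inl rfl)) (hi 1 (Or.inr rfl))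
  have hm0 : h (v m) ≠ h (z 0) := by
    refine hterm 0 ?_
    rintro j (rfl | rfl)
    exacts [(Q.toTerm.ne 0).symm, hxℓ 0 1 (by simp) h01]
  have hm1 : h (v m) ≠ h (z 1) := by
    refine hterm 1 ?_
    rintro j (rfl | rfl)
    exacts [hxℓ 1 0 (by simp) h01.symm, (Q.toTerm.ne 1).symm]
  have hjs : v j ∉ span h κ := by
    intro hs
    have h1 := Q.home_of_span hκ (hj ▸ hs)
    have h2 : v m = z 2 := Q.unique 2 _ hmU (by rw [hmκ, ← h1, Q.home]; simp)
    rw [← hj] at h2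
    have := Q.toIndPath.inj m j (by omega) (by omega) h2
    omega
  obtain ⟨l, hjl, hlk, c, hc, hcl, hls⟩ :
      ∃ l, j ≤ l ∧ l < k ∧ ∃ c ∈ κ, c ∈ I (v l) ∧ v l ∉ span h κ := by
    by_cases hns : v n ∈ span h κ
    · obtain ⟨l, h1, h2, h3, h4⟩ := exists_step_below (P := fun n => v n ∈ span h κ) hjn hjs hns
      obtain ⟨c, hc, hcl, _⟩ := Q.exit_span hκ (hr (l + 1) (by omega) (by omega))
        (hr l h1 (by omega)) ((Q.toIndPath.adj _ _ (by omega) (by omega)).2 (Or.inr rfl)) h4 h3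
      exact ⟨l, h1, by omega, c, hc, hcl, h3⟩
    · have ha := hfn.resolve_left fun h1 => hns (h1 ▸ hspan f hf)
      obtain ⟨c, hc, hcl, _⟩ := Q.exit_span hκ (hEU hf) (hr n hjn hnk) ha.symm (hspan f hf) hns
      exact ⟨n, hjn, hnk, c, hc, hcl, hns⟩
  obtain ⟨p, _, hap, hpb, _, _, hcp, hpm, _⟩ := Q.crosses ham hmb hm0 hm1 (hmκ.symm ▸ hc)
  have hadj := Q.complete _ (Q.on p hap hpb) _ (hr l hjl hlk) c hcp hcl
    (by rw [hpm, hmκ]; exact (not_mem_span hls).symm)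
  have := (Q.toIndPath.adj p l (by omega) hlk).1 hadj
  omega

end LabPath

end Dominators

section BigComponents

variable {V : Type*} {G : SimpleGraph V}

/-- The vertices outside the closed neighborhood of `S`. -/
def free (G : SimpleGraph V) (S : Set V) : Set V := Set.univ \ closedNbhd G S

theorem mem_free {S : Set V} {u : V} : u ∈ free G S ↔ ∀ s ∈ S, u ≠ s ∧ ¬ G.Adj s u := by
  simp only [free, closedNbhd, Set.mem_sdiff, Set.mem_univ, true_and, Set.mem_union,
    Set.mem_ofPred_eq, not_or, not_exists, not_and]
  exact ⟨fun h s hs => ⟨fun he => h.1 (he ▸ hs), h.2 s hs⟩,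
    fun h => ⟨fun hu => (h u hu).1 rfl, fun s hs => (h s hs).2⟩⟩

theorem mem_free_image {v : ℕ → V} {A : Set ℕ} {u : V} :
    u ∈ free G (v '' A) ↔ ∀ n ∈ A, u ≠ v n ∧ ¬ G.Adj (v n) u := by
  rw [mem_free, Set.forall_mem_image]

theorem free_anti {S S' : Set V} (h : S ⊆ S') : free G S' ⊆ free G S := fun _ hu =>
  mem_free.2 fun s hs => mem_free.1 hu s (h hs)

theorem IndPath.extend {v : ℕ → V} {n : ℕ} (P : IndPath G v (n + 1)) {y : V}
    (hy : G.Adj (v n) y) (hn : ∀ i < n, y ≠ v i ∧ ¬ G.Adj (v i) y) :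
    IndPath G (Function.update v (n + 1) y) (n + 2) := by
  have h1 : ∀ i, i < n + 1 → Function.update v (n + 1) y i = v i := fun i hi =>
    Function.update_of_ne (by omega) _ _
  have h2 : Function.update v (n + 1) y (n + 1) = y := Function.update_self _ _ _
  have h3 : ∀ i, i < n + 1 → y ≠ v i ∧ (G.Adj (v i) y ↔ i = n) := by
    intro i hi
    rcases Nat.lt_succ_iff_lt_or_eq.1 hi with hi | rfl
    · exact ⟨(hn i hi).1, fun h => absurd h (hn i hi).2, by omega⟩
    · exact ⟨hy.ne', fun _ => rfl, fun _ => hy⟩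
  constructor
  · intro i j hi hj he
    rcases Nat.lt_succ_iff_lt_or_eq.1 hi with hi | rfl <;>
      rcases Nat.lt_succ_iff_lt_or_eq.1 hj with hj | rfl
    · rw [h1 i hi, h1 j hj] at he
      exact P.inj i j hi hj he
    · rw [h1 i hi, h2] at he
      exact absurd he.symm (h3 i hi).1
    · rw [h1 j hj, h2] at he
      exact absurd he (h3 j hj).1
    · rfl
  · intro i j hi hj
    rcases Nat.lt_succ_iff_lt_or_eq.1 hi with hi | rfl <;>
      rcases Nat.lt_succ_iff_lt_or_eq.1 hj with hj | rfl
    · rw [h1 i hi, h1 j hj]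
      exact P.adj i j hi hj
    · rw [h1 i hi, h2, (h3 i hi).2]
      omega
    · rw [h1 j hj, h2, G.adj_comm, (h3 j hj).2]
      omega
    · simp

variable [Fintype V] {w : V → ℕ}

/-- More than half of the total weight lies in `S`. -/
def Big (w : V → ℕ) (S : Set V) : Prop := wsum w Set.univ / 2 < wsum w S

theorem Big.mono {S S' : Set V} (h : Big w S) (hS : S ⊆ S') : Big w S' :=
  lt_of_lt_of_le h (Finset.sum_le_sum_of_subset (by simpa using hS))

theorem Big.inter {S S' : Set V} (h : Big w S) (h' : Big w S') : ∃ u ∈ S, u ∈ S' := by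
  classical
  by_contra hn
  have hd : Disjoint S.toFinite.toFinset S'.toFinite.toFinset := by
    rw [Finset.disjoint_left]
    intro u hu hu'
    exact hn ⟨u, by simpa using hu, by simpa using hu'⟩
  have h1 : wsum w S + wsum w S' ≤ wsum w Set.univ := by
    unfold wsum
    rw [← Finset.sum_union hd]
    exact Finset.sum_le_sum_of_subset (by intro u _; simp)
  unfold Big at h h'
  omega

/-- `E` is a connected component of `G[X]` holding more than half of the total weight. -/
structure BigComp (G : SimpleGraph V) (w : V → ℕ) (X E : Set V) : Prop where
  sub : E ⊆ X
  big : Big w E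
  conn : ∀ u ∈ E, ∀ y ∈ E, Conn G E u y
  closed : ∀ u ∈ E, ∀ y ∈ X, G.Adj u y → y ∈ E

theorem BigComp.nonempty {X E : Set V} (h : BigComp G w X E) : E.Nonempty :=
  let ⟨u, hu, _⟩ := h.big.inter h.big
  ⟨u, hu⟩

theorem BigComp.sub_of_sub {X X' E E' : Set V} (h : BigComp G w X E) (h' : BigComp G w X' E')
    (hX : X' ⊆ X) : E' ⊆ E := by
  obtain ⟨u, hu, hu'⟩ := h.big.inter h'.big
  intro y hy
  exact (h'.conn u hu' y hy).closed hu fun p hp q hq hpq => h.closed p hp q (hX (h'.sub hq)) hpq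

theorem exists_bigComp {X B : Set V} (hB : Big w B)
    (hc : ∀ u ∈ B, ∀ y ∈ B, Conn G X u y) : ∃ E, BigComp G w X E := by
  obtain ⟨u, hu, _⟩ := hB.inter hB
  have key : ∀ y, Conn G X u y → Conn G {y | Conn G X u y} u y := by
    rintro y ⟨T, hT, hp⟩
    exact ⟨T, fun q hq => (hp.conn_mem hq).mono hT, hp⟩
  exact ⟨{y | Conn G X u y}, fun y hy => hy.right_mem, hB.mono fun y hy => hc u hu y hy,
    fun p hp q hq => (key p hp).symm.trans (key q hq), fun p hp q hq hpq => hp.tail hpq hq⟩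

theorem BigComp.shrink {X Y E : Set V} (h : BigComp G w X E) (hY : E ⊆ Y) :
    ∃ E', BigComp G w Y E' :=
  exists_bigComp h.big fun u hu y hy => (h.conn u hu y hy).mono hY

/-- Deleting the closed neighborhood of at most `N` vertices never leaves a graph with a rigid
labeling all of whose particles are light. -/
def Stuck (G : SimpleGraph V) (w : V → ℕ) (N : ℕ) : Prop :=
  ∀ S : Finset V, S.card ≤ N → ∀ h I, RigidLab G (free G S) h I →
    ∃ a b, a ≠ b ∧ Big w (free G S ∩ span h {a, b}) ∧
      ((∃ u ∈ free G S, h u = {a, b}) ∨ ∀ u ∈ free G S, b ∉ h u ∧ a ∉ I u)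

theorem stuck_of_not_exists {N : ℕ} (hn : ¬ ∃ S : Finset V, S.card ≤ N ∧
    ∃ (H' : Type) (H : SimpleGraph H')
      (D : ESD (SimpleGraph.induce (Set.univ \ closedNbhd G (↑S : Set V)) G) H),
      D.IsRigid ∧ ∃ _ : Fintype ↥(Set.univ \ closedNbhd G (↑S : Set V)),
        D.ParticlesSmall (fun v => w v.val) (wsum w Set.univ / 2)) : Stuck G w N := by
  classical
  intro S hS h I R
  have : Fintype (free G (↑S : Set V)) := Fintype.ofFinite _
  exact R.exists_particle w fun hs => hn ⟨S, hS, _, _, R.toESD, R.isRigid_toESD, this, hs⟩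

theorem Stuck.exists_comp {N : ℕ} (H : Stuck G w N) {S : Finset V} (hS : S.card ≤ N) :
    ∃ E, BigComp G w (free G S) E := by
  have e := Fintype.equivFin V
  let c : V → ℕ := fun u => sInf ((fun y => (e y).1) '' {y | Conn G (free G S) u y})
  have hc : ∀ u ∈ free G (↑S : Set V), ∃ y, Conn G (free G S) u y ∧ (e y).1 = c u := fun u hu =>
    Nat.sInf_mem (s := (fun y => (e y).1) '' {y | Conn G (free G S) u y})
      ⟨_, u, Conn.refl hu, rfl⟩
  have one : ∀ (u : V) (a b : ℕ), a ∈ ({c u} : Finset ℕ) → b ∈ ({c u} : Finset ℕ) → a = b := by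
    intro u a b ha hb
    rw [Finset.mem_singleton] at ha hb
    exact ha.trans hb.symm
  have R : RigidLab G (free G S) (fun u => {c u}) (fun _ => ∅) := by
    refine ⟨⟨by simp, by simp, by simp, by simp, by simp, fun u hu y hy huy => Or.inl ?_⟩, ?_, ?_⟩
    · have he : {p | Conn G (free G S) u p} = {p | Conn G (free G S) y p} := by
        ext p
        exact ⟨fun hp => hp.head hy huy.symm, fun hp => hp.head hu huy⟩
      simp only [c, he]
    · intro u _ a b hab hh
      exact absurd (one u a b (by rw [hh]; simp) (by rw [hh]; simp)) hab
    · intro u _ a b d hab _ _ hh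
      exact absurd (one u a b (by rw [hh]; simp) (by rw [hh]; simp)) hab
  obtain ⟨a, b, hab, hB, ⟨u, _, hh⟩ | hb⟩ := H S hS _ _ R
  · exact absurd (one u a b (by rw [hh]; simp) (by rw [hh]; simp)) hab
  have ha : ∀ u ∈ free G (↑S : Set V) ∩ span (fun u => {c u}) {a, b}, c u = a := by
    rintro u ⟨hu, hs | hs⟩
    · have h1 := (hb u hu).1
      rw [Finset.singleton_subset_iff, Finset.mem_insert, Finset.mem_singleton] at hs
      rw [Finset.mem_singleton] at h1
      exact hs.resolve_right fun he => h1 he.symm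
    · exact absurd (one u a b (hs (by simp)) (hs (by simp))) hab
  refine exists_bigComp hB fun u hu y hy => ?_
  obtain ⟨p, hp, hpa⟩ := hc u hu.1
  obtain ⟨q, hq, hqa⟩ := hc y hy.1
  have hpq : p = q := e.injective (Fin.ext (by rw [hpa, hqa, ha u hu, ha y hy]))
  exact hp.trans (hpq ▸ hq.symm)

/-- Gyárfás' path argument. -/
theorem exists_unsplit_path [Nonempty V] (G : SimpleGraph V) (w : V → ℕ) :
    ∃ v k, IndPath G v k ∧ ¬ ∃ E, BigComp G w (free G (v '' Set.Iio k)) E := by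
  by_contra hn
  push Not at hn
  have key : ∀ n, ∃ v E, IndPath G v (n + 1) ∧ BigComp G w (free G (v '' Set.Iio n)) E ∧
      ∃ e ∈ E, e = v n ∨ G.Adj (v n) e := by
    intro n
    induction n with
    | zero =>
      obtain ⟨E, hE⟩ := hn (fun _ => Classical.arbitrary V) 0 ⟨by simp, by simp⟩
      obtain ⟨e, he⟩ := hE.nonempty
      refine ⟨fun _ => e, E, ⟨by intros; omega, ?_⟩, ?_, e, he, Or.inl rfl⟩
      · intro i j hi hj
        simp only [SimpleGraph.irrefl, false_iff]
        omega
      · simpa using hE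
    | succ n ih =>
      obtain ⟨v, E, P, hE, e, he, hv⟩ := ih
      obtain ⟨E', hE'⟩ := hn v (n + 1) P
      have hEE := hE.sub_of_sub hE' (free_anti (Set.image_mono (Set.Iio_subset_Iio (by omega))))
      have hnE : ∀ q ∈ E', q ≠ v n ∧ ¬ G.Adj (v n) q := fun q hq =>
        mem_free_image.1 (hE'.sub hq) n (Set.mem_Iio.2 (by omega))
      obtain ⟨q, hq⟩ := hE'.nonempty
      obtain ⟨T, hT, hp⟩ := hE.conn q (hEE hq) e he
      obtain ⟨p, _, y, hy, hpE, hyE, hpy⟩ := hp.exists_exit hq fun h1 =>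
        hv.elim (hnE e h1).1 (hnE e h1).2
      have hyf := mem_free_image.1 (hE.sub (hT hy))
      have hvy : G.Adj (v n) y := by
        by_contra hvy
        refine hyE (hE'.closed p hpE y (mem_free_image.2 fun i hi => ?_) hpy)
        rcases Nat.lt_succ_iff_lt_or_eq.1 hi with hi | rfl
        · exact hyf i hi
        · exact ⟨fun he => (hnE p hpE).2 (he ▸ hpy.symm), hvy⟩
      refine ⟨_, E', P.extend hvy fun i hi => hyf i hi, ?_, p, hpE, Or.inr ?_⟩
      · have : Function.update v (n + 1) y '' Set.Iio (n + 1) = v '' Set.Iio (n + 1) :=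
          Set.image_congr fun i hi => Function.update_of_ne (ne_of_lt hi) _ _
        rwa [this]
      · rw [Function.update_self]
        exact hpy.symm
  obtain ⟨v, E, P, -⟩ := key (Fintype.card V)
  have := Fintype.card_le_of_injective (fun i : Fin (Fintype.card V + 1) => v i)
    fun i j h => Fin.ext (P.inj i j i.2 j.2 h)
  rw [Fintype.card_fin] at this
  omega

end BigComponents

section PathWindows

variable {V : Type*} {G : SimpleGraph V}

theorem MinLab.rigidLab [Fintype V] {X : Set V} {z : Fin 3 → V} {h I : V → Finset ℕ} {ℓ x : Fin 3 → ℕ}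
    (M : MinLab G (X ∪ Set.range z) z h I ℓ x) (hX : ∀ i, z i ∉ X) : RigidLab G X h I := by
  have key : ∀ u ∈ X, ∀ y ∈ X ∪ Set.range z, h y ⊆ h u → y ∈ X := by
    rintro u hu y (hy | ⟨i, rfl⟩) hs
    · exact hy
    · have h1 := M.unique i u (Or.inl hu) (hs (by rw [M.home]; simp))
      exact absurd (h1 ▸ hu) (hX i)
  refine ⟨M.toLab.mono Set.subset_union_left, fun u hu a b hab hh => ?_,
    fun u hu a b c hab hac hbc hh => ?_⟩
  · obtain ⟨T, r, s, hT⟩ := M.exists_rung (Or.inl hu) hab hh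
    have hr := hT.home r hT.path.start_mem
    exact ⟨r, key u hu r (hT.sub hT.path.start_mem) (by rw [hr, hh]), hr, hT.fa⟩
  · have hh' : h u = {c, a, b} := by
      rw [hh]
      ext n
      simp only [Finset.mem_insert, Finset.mem_singleton]
      tauto
    obtain ⟨y, hy, hhy⟩ := M.exists_pair (Or.inl hu) hac.symm hbc.symm hab hh'
    refine ⟨y, key u hu y hy ?_, hhy⟩
    rw [hhy, hh']
    exact Finset.subset_insert _ _

theorem IndPath.conn {v : ℕ → V} {k : ℕ} (P : IndPath G v k) {U : Set V} {a b : ℕ} (hab : a ≤ b)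
    (hb : b < k) (hU : ∀ n, a ≤ n → n ≤ b → v n ∈ U) : Conn G U (v a) (v b) :=
  (P.ipath hab hb).conn.mono (by rintro _ ⟨n, hn, rfl⟩; exact hU n hn.1 hn.2)

theorem IndPath.ncard {v : ℕ → V} {k : ℕ} (P : IndPath G v k) {a b : ℕ} (hb : b < k) :
    (v '' Set.Icc a b).ncard = b + 1 - a := by
  rw [Set.InjOn.ncard_image fun i hi j hj he =>
    P.inj i j (lt_of_le_of_lt hi.2 hb) (lt_of_le_of_lt hj.2 hb) he,
    Set.ncard_eq_toFinset_card', Set.toFinset_Icc, Nat.card_Icc]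

theorem IndPath.apart {v : ℕ → V} {k : ℕ} (P : IndPath G v k) {a b c d : ℕ} (hd : d < k)
    (hbc : b + 1 < c) : Apart G (v '' Set.Icc a b) (v '' Set.Icc c d) := by
  rintro _ ⟨i, ⟨_, hi⟩, rfl⟩ _ ⟨j, ⟨hj, hj'⟩, rfl⟩
  refine ⟨fun he => ?_, fun he => ?_⟩
  · have := P.inj i j (by omega) (by omega) he
    omega
  · have := (P.adj i j (by omega) (by omega)).1 he
    omega

/-- The first `t` indices, and those strictly between `i` and `l`. -/
def window (t i l : ℕ) : Finset ℕ := Finset.range t ∪ Finset.Ioo i l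

theorem mem_window {t i l n : ℕ} : n ∈ window t i l ↔ n < t ∨ i < n ∧ n < l := by
  simp [window]

theorem card_window (t i l : ℕ) : (window t i l).card ≤ t + (l - i - 1) :=
  (Finset.card_union_le _ _).trans (by rw [Finset.card_range, Nat.card_Ioo])

/-- If a connected set off the window touches the path on both sides of it, then the three path
vertices bordering the window form a triad in the rest of `G`. -/
theorem IndPath.triad {v : ℕ → V} {k t i : ℕ} (P : IndPath G v k)
    (hF : ¬ Nonempty (Sttt t ↪g G)) (ht : 1 ≤ t) (hi : t + 2 ≤ i) (hk : i + 2 * t + 2 < k)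
    {X K : Set V} (hX : X = free G (v '' window t i (i + 2 * t + 2))) (hKX : K ⊆ X)
    (hK : ∀ e ∈ K, ∀ f ∈ K, Conn G K e f)
    (hl : ∃ e ∈ K, ∃ m, t ≤ m ∧ m ≤ i ∧ (e = v m ∨ G.Adj (v m) e))
    (hr : ∃ e ∈ K, ∃ n, i + 2 * t + 2 ≤ n ∧ n < k ∧ (e = v n ∨ G.Adj (v n) e)) :
    let z := ![v t, v i, v (i + 2 * t + 2)]
    Triad G (X ∪ Set.range z) z ∧ (∀ l, z l ∉ X) ∧
      (∀ n, t ≤ n → n ≤ i → v n ∈ X ∪ Set.range z) ∧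
      ∀ n, i + 2 * t + 2 ≤ n → n < k → v n ∈ X ∪ Set.range z := by
  intro z
  have memX : ∀ u, u ∈ X ↔ ∀ n, n < t ∨ i < n ∧ n < i + 2 * t + 2 →
      u ≠ v n ∧ ¬ G.Adj (v n) u := by
    intro u
    rw [hX, mem_free_image]
    simp only [Finset.mem_coe, mem_window]
  have inX : ∀ n, n < k → t < n ∧ n < i ∨ i + 2 * t + 2 < n → v n ∈ X := by
    intro n hn hn'
    rw [memX]
    intro p hp
    refine ⟨fun he => ?_, fun he => ?_⟩
    · have := P.inj n p hn (by omega) he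
      omega
    · have := (P.adj p n (by omega) hn).1 he
      omega
  have zmem : ∀ l, z l ∈ X ∪ Set.range z := fun l => Or.inr ⟨l, rfl⟩
  have left : ∀ n, t ≤ n → n ≤ i → v n ∈ X ∪ Set.range z := by
    intro n h1 h2
    rcases h1.eq_or_lt with rfl | h1
    · exact zmem 0
    rcases h2.eq_or_lt with rfl | h2
    · exact zmem 1
    exact Or.inl (inX n (by omega) (by omega))
  have right : ∀ n, i + 2 * t + 2 ≤ n → n < k → v n ∈ X ∪ Set.range z := by
    intro n h1 h2
    rcases h1.eq_or_lt with rfl | h1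
    · exact zmem 2
    exact Or.inl (inX n h2 (by omega))
  have zX : ∀ l, z l ∉ X := by
    intro l hl
    rw [memX] at hl
    fin_cases l
    · exact (hl (t - 1) (by omega)).2 ((P.adj _ _ (by omega) (by omega)).2 (by omega))
    · exact (hl (i + 1) (by omega)).2 ((P.adj _ _ (by omega) (by omega)).2 (by omega))
    · exact (hl (i + 2 * t + 1) (by omega)).2 ((P.adj _ _ (by omega) (by omega)).2 (by omega))
  have zinj : Function.Injective z := by
    have h01 : v t ≠ v i := fun he => by have := P.inj _ _ (by omega) (by omega) he; omega
    have h02 : v t ≠ v (i + 2 * t + 2) := fun he => by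
      have := P.inj _ _ (by omega) (by omega) he; omega
    have h12 : v i ≠ v (i + 2 * t + 2) := fun he => by
      have := P.inj _ _ (by omega) (by omega) he; omega
    intro p q hpq
    fin_cases p <;> fin_cases q <;> first
      | rfl
      | exact absurd hpq h01
      | exact absurd hpq h02
      | exact absurd hpq h12
      | exact absurd hpq.symm h01
      | exact absurd hpq.symm h02
      | exact absurd hpq.symm h12
  refine ⟨⟨zinj, ?_, fun hC => hF ?_⟩, zX, left, right⟩
  · obtain ⟨e, he, m, h1, h2, hm⟩ := hl
    obtain ⟨f, hf, n, h3, h4, hn⟩ := hr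
    have hKU : K ⊆ X ∪ Set.range z := hKX.trans Set.subset_union_left
    have reach : ∀ u f, f ∈ K → (f = u ∨ G.Adj u f) → u ∈ X ∪ Set.range z →
        Conn G (X ∪ Set.range z) u e := by
      intro u f hf hu hU
      have h5 := (hK f hf e he).mono hKU
      rcases hu with rfl | hu
      · exact h5
      · exact h5.head hU hu
    have toE : ∀ l, Conn G (X ∪ Set.range z) (z l) e := by
      intro l
      fin_cases l
      · exact (P.conn h1 (by omega) fun p hp hp' => left p hp (by omega)).trans
          (reach _ e he hm (left m h1 h2))
      · exact (P.conn h2 (by omega) fun p hp hp' => left p (by omega) hp').symm.trans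
          (reach _ e he hm (left m h1 h2))
      · exact (P.conn h3 h4 fun p hp hp' => right p hp (by omega)).trans
          (reach _ f hf hn (right n h3 h4))
    exact fun p q => (toE p).trans (toE q).symm
  · have h01 : Apart G (v '' Set.Icc 0 t) (v '' Set.Icc i (i + t)) :=
      P.apart (by omega) (by omega)
    have h02 : Apart G (v '' Set.Icc 0 t) (v '' Set.Icc (i + t + 2) (i + 2 * t + 2)) :=
      P.apart (by omega) (by omega)
    have h12 : Apart G (v '' Set.Icc i (i + t)) (v '' Set.Icc (i + t + 2) (i + 2 * t + 2)) :=
      P.apart (by omega) (by omega)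
    have sep : ∀ (A : Set V) l, (∀ p ∈ A, p = z l ∨ ∃ n, p = v n ∧
        (n < t ∨ i < n ∧ n < i + 2 * t + 2)) → (∀ m, m ≠ l → ∀ p ∈ A, p ≠ z m ∧ ¬ G.Adj p (z m)) →
        SepAt G (z l) A (X ∪ Set.range z) := by
      intro A l h1 h2 p hp q hq hpq
      rcases h1 p hp with h3 | ⟨n, rfl, hn⟩
      · exact Or.inl h3
      rcases hq with hq | ⟨m, rfl⟩
      · have h3 := (memX q).1 hq n hn
        exact hpq.elim (fun he => absurd he.symm h3.1) fun he => absurd he h3.2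
      · by_cases hm : m = l
        · exact Or.inr (by rw [hm])
        · have h3 := h2 m hm _ hp
          exact hpq.elim (fun he => absurd he h3.1) fun he => absurd he h3.2
    have e0 : v t ∈ v '' Set.Icc 0 t := ⟨t, ⟨by omega, le_rfl⟩, rfl⟩
    have e1 : v i ∈ v '' Set.Icc i (i + t) := ⟨i, ⟨le_rfl, by omega⟩, rfl⟩
    have e2 : v (i + 2 * t + 2) ∈ v '' Set.Icc (i + t + 2) (i + 2 * t + 2) :=
      ⟨_, ⟨by omega, le_rfl⟩, rfl⟩
    refine hC.sttt (e := ![v 0, v (i + t), v (i + t + 2)])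
      (R := ![v '' Set.Icc 0 t, v '' Set.Icc i (i + t),
        v '' Set.Icc (i + t + 2) (i + 2 * t + 2)]) ?_ ?_ ?_ ?_
    · intro l
      fin_cases l
      · exact (P.ipath (by omega) (by omega)).symm
      · exact P.ipath (by omega) (by omega)
      · exact (P.ipath (by omega) (by omega)).symm
    · intro l
      fin_cases l
      · exact lt_of_lt_of_eq (by omega) (P.ncard (by omega)).symm
      · exact lt_of_lt_of_eq (by omega) (P.ncard (by omega)).symm
      · exact lt_of_lt_of_eq (by omega) (P.ncard (by omega)).symm
    · intro l
      fin_cases l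
      · refine sep _ 0 ?_ ?_
        · rintro _ ⟨n, ⟨_, hn⟩, rfl⟩
          rcases hn.eq_or_lt with rfl | hn
          · exact Or.inl rfl
          · exact Or.inr ⟨n, rfl, by omega⟩
        · intro m hm p hp
          fin_cases m
          · exact absurd rfl hm
          · exact h01 p hp _ e1
          · exact h02 p hp _ e2
      · refine sep _ 1 ?_ ?_
        · rintro _ ⟨n, ⟨hn, hn'⟩, rfl⟩
          rcases hn.eq_or_lt with rfl | hn
          · exact Or.inl rfl
          · exact Or.inr ⟨n, rfl, by omega⟩
        · intro m hm p hp
          fin_cases m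
          · exact h01.symm p hp _ e0
          · exact absurd rfl hm
          · exact h12 p hp _ e2
      · refine sep _ 2 ?_ ?_
        · rintro _ ⟨n, ⟨hn', hn⟩, rfl⟩
          rcases hn.eq_or_lt with rfl | hn
          · exact Or.inl rfl
          · exact Or.inr ⟨n, rfl, by omega⟩
        · intro m hm p hp
          fin_cases m
          · exact h02.symm p hp _ e0
          · exact h12.symm p hp _ e1
          · exact absurd rfl hm
    · intro p q hpq
      fin_cases p <;> fin_cases q <;> first
        | exact absurd rfl hpq
        | exact h01
        | exact h02
        | exact h12
        | exact h01.symm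
        | exact h02.symm
        | exact h12.symm

end PathWindows

section MainTheorem

variable {V : Type*} {G : SimpleGraph V} [Fintype V] {w : V → ℕ}

/-- Besides a window around `i`, it suffices to delete four vertices with their neighborhoods to
make the heavy component avoid one of the two sides of the path. -/
theorem IndPath.exists_avoiding {v : ℕ → V} {k t i : ℕ} (P : IndPath G v k)
    (H : Stuck G w (3 * t + 11)) (hF : ¬ Nonempty (Sttt t ↪g G)) (ht : 1 ≤ t) (hti : t ≤ i)
    (hik : i < k) : ∃ R : Finset V, R.card ≤ 4 ∧
      ∃ E, BigComp G w (free G (v '' window t i (i + 2 * t + 2) ∪ R)) E ∧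
        (E ⊆ free G (v '' Set.Icc t i) ∨ E ⊆ free G (v '' Set.Ico (i + 2 * t + 2) k)) := by
  classical
  have hcard : ((window t i (i + 2 * t + 2)).image v).card ≤ 3 * t + 1 :=
    Finset.card_image_le.trans ((card_window _ _ _).trans (by omega))
  have comp : ∀ R : Finset V, R.card ≤ 4 →
      ∃ E, BigComp G w (free G (v '' window t i (i + 2 * t + 2) ∪ R)) E := by
    intro R hR
    have h1 := Finset.card_union_le ((window t i (i + 2 * t + 2)).image v) R
    obtain ⟨E, hE⟩ := H.exists_comp (S := (window t i (i + 2 * t + 2)).image v ∪ R) (by omega)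
    rw [Finset.coe_union, Finset.coe_image] at hE
    exact ⟨E, hE⟩
  by_cases hi : i ≤ t + 1
  · have hR : ((Finset.Icc t i).image v).card ≤ 4 :=
      Finset.card_image_le.trans (by rw [Nat.card_Icc]; omega)
    obtain ⟨E, hE⟩ := comp _ hR
    refine ⟨_, hR, E, hE, Or.inl (hE.sub.trans (free_anti ?_))⟩
    rw [Finset.coe_image, Finset.coe_Icc]
    exact Set.subset_union_right
  obtain ⟨K, hK⟩ := comp ∅ (by simp)
  by_cases hn : K ⊆ free G (v '' Set.Icc t i) ∨ K ⊆ free G (v '' Set.Ico (i + 2 * t + 2) k)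
  · exact ⟨∅, by simp, K, hK, hn⟩
  rw [Finset.coe_empty, Set.union_empty] at hK
  have touch : ∀ (E : Set V) (A : Set ℕ), ¬ E ⊆ free G (v '' A) →
      ∃ e ∈ E, ∃ n ∈ A, e = v n ∨ G.Adj (v n) e := by
    intro E A hE
    by_contra hc
    push Not at hc
    exact hE fun e he => mem_free_image.2 fun n hn => hc e he n hn
  rw [not_or] at hn
  obtain ⟨e, he, m, hm, hem⟩ := touch K _ hn.1
  obtain ⟨f, hf, n, hn, hfn⟩ := touch K _ hn.2
  have hjk : i + 2 * t + 2 < k := lt_of_le_of_lt hn.1 hn.2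
  obtain ⟨T, hzX, hleft, hright⟩ := P.triad hF ht (by omega) hjk rfl hK.sub hK.conn
    ⟨e, he, m, hm.1, hm.2, hem⟩ ⟨f, hf, n, hn.1, hn.2, hfn⟩
  obtain ⟨h, I, ℓ, x, M⟩ := (three_in_tree T).exists_minLab T.inj
  have R := M.rigidLab hzX
  have Q : LabPath G _ _ h I ℓ x v k t i :=
    ⟨M.toLab, M.toTerm, P, by omega, hik, rfl, rfl, hleft⟩
  have hS := H ((window t i (i + 2 * t + 2)).image v) (by omega) h I
  rw [Finset.coe_image] at hS
  obtain ⟨a, b, hab, hB, halt⟩ := hS R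
  obtain ⟨Ra, hRa, Da⟩ := Q.exists_dominators a
  obtain ⟨Rb, hRb, Db⟩ := Q.exists_dominators b
  have hR : (Ra ∪ Rb).card ≤ 4 := (Finset.card_union_le _ _).trans (by omega)
  obtain ⟨E, hE⟩ := comp _ hR
  have hEX : E ⊆ free G (v '' window t i (i + 2 * t + 2)) :=
    hE.sub.trans (free_anti Set.subset_union_left)
  refine ⟨_, hR, E, hE, ?_⟩
  by_contra hc
  rw [not_or] at hc
  obtain ⟨e, he, m, hm, hem⟩ := touch E _ hc.1
  obtain ⟨f, hf, n, hn, hfn⟩ := touch E _ hc.2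
  refine Q.not_touch (κ := {a, b}) (Finset.card_pair hab) (R := ↑(Ra ∪ Rb)) ?_
    (hEX.trans Set.subset_union_left) (fun e he l hel => hzX l (hel ▸ hEX he))
    (fun e he r hr => (mem_free.1 (hE.sub he) r (Or.inr hr)).2) hE.conn ?_ ?_
    (show i + 1 < i + 2 * t + 2 by omega) rfl hright he hf hm.1 hm.2 hem hn.1 hn.2 hfn
  · intro c hc
    rw [Finset.mem_insert, Finset.mem_singleton] at hc
    rcases hc with rfl | rfl
    · exact ⟨Ra, by simp, Da⟩
    · exact ⟨Rb, by simp, Db⟩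
  · obtain ⟨u, hu, hu'⟩ := hE.big.inter hB
    exact ⟨u, hu, hu'.2⟩
  · intro c hc
    rw [Finset.mem_insert, Finset.mem_singleton] at hc
    rcases halt with ⟨u, hu, hh⟩ | halt
    · left
      rcases hc with rfl | rfl
      · obtain ⟨y, hy, h1, h2⟩ := R.strip u hu c b hab hh
        exact ⟨y, Or.inl hy, h1, h2⟩
      · obtain ⟨y, hy, h1, h2⟩ := R.strip u hu c a hab.symm (by rw [hh, Finset.pair_comm])
        exact ⟨y, Or.inl hy, by rw [h1, Finset.pair_comm], h2⟩
    · right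
      rcases hc with rfl | rfl
      · exact fun e he => (halt e (hEX he)).2
      · exact fun e he hce => (halt e (hEX he)).1 (R.sub e (hEX he) hce)

theorem Stuck.false {t : ℕ} (H : Stuck G w (3 * t + 11)) (hF : ¬ Nonempty (Sttt t ↪g G))
    (ht : 1 ≤ t) : False := by
  classical
  have : Nonempty V := by
    obtain ⟨E, hE⟩ := H.exists_comp (S := ∅) (by simp)
    exact hE.nonempty.to_type
  obtain ⟨v, k, P, hP⟩ := exists_unsplit_path G w
  have hk : 3 * t + 11 < k := by
    by_contra hk
    obtain ⟨E, hE⟩ := H.exists_comp (S := (Finset.range k).image v)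
      (Finset.card_image_le.trans (by rw [Finset.card_range]; omega))
    rw [Finset.coe_image, Finset.coe_range] at hE
    exact hP ⟨E, hE⟩
  let L : ℕ → Prop := fun i => ∃ R : Finset V, R.card ≤ 4 ∧
    ∃ E, BigComp G w (free G (v '' window t i (i + 2 * t + 2) ∪ R)) E ∧
      E ⊆ free G (v '' Set.Icc t i)
  have wfree : ∀ {i l : ℕ} {R : Set V} {u : V}, u ∈ free G (v '' window t i l ∪ R) →
      ∀ n, n < t ∨ i < n ∧ n < l → u ≠ v n ∧ ¬ G.Adj (v n) u := fun hu n hn =>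
    mem_free.1 hu _ (Or.inl ⟨n, Finset.mem_coe.2 (mem_window.2 hn), rfl⟩)
  have start : L t := by
    obtain ⟨R, hR, E, hE, h | h⟩ := P.exists_avoiding H hF ht le_rfl (by omega)
    · exact ⟨R, hR, E, hE, h⟩
    · have hR : ({v t} : Finset V).card ≤ 4 := by simp
      have h1 := Finset.card_union_le ((window t t (t + 2 * t + 2)).image v) {v t}
      have h2 : ((window t t (t + 2 * t + 2)).image v).card ≤ 3 * t + 1 :=
        Finset.card_image_le.trans ((card_window _ _ _).trans (by omega))
      obtain ⟨E, hE⟩ := H.exists_comp (S := (window t t (t + 2 * t + 2)).image v ∪ {v t})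
        (by omega)
      rw [Finset.coe_union, Finset.coe_image] at hE
      refine ⟨_, hR, E, hE, hE.sub.trans (free_anti ?_)⟩
      simp
  have last : ¬ L (k - 1) := by
    rintro ⟨R, _, E, hE, h⟩
    refine hP (hE.shrink fun u hu => mem_free_image.2 fun n hn => ?_)
    rw [Set.mem_Iio] at hn
    by_cases hnt : n < t
    · exact wfree (hE.sub hu) n (Or.inl hnt)
    · exact mem_free_image.1 (h hu) n ⟨by omega, by omega⟩
  obtain ⟨i, hti, hik, ⟨R, hR, E, hE, h⟩, hn⟩ :=
    exists_step_above (P := L) (show t ≤ k - 1 by omega) last start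
  obtain ⟨R', hR', E', hE', h' | h'⟩ :=
    P.exists_avoiding H hF ht (show t ≤ i + 1 by omega) (by omega)
  · exact hn ⟨R', hR', E', hE', h'⟩
  have h1 := Finset.card_union_le ((window t i (i + 2 * t + 3)).image v) (R ∪ R')
  have h2 := Finset.card_union_le R R'
  have h3 : ((window t i (i + 2 * t + 3)).image v).card ≤ 3 * t + 2 :=
    Finset.card_image_le.trans ((card_window _ _ _).trans (by omega))
  obtain ⟨F, hF⟩ := H.exists_comp (S := (window t i (i + 2 * t + 3)).image v ∪ (R ∪ R'))
    (by omega)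
  rw [Finset.coe_union, Finset.coe_image, Finset.coe_union] at hF
  have sub : ∀ j l (A : Set V), i ≤ j → l ≤ i + 2 * t + 3 → A ⊆ R ∪ R' →
      v '' window t j l ∪ A ⊆ v '' window t i (i + 2 * t + 3) ∪ (R ∪ R') := by
    intro j l A hj hl hA
    refine Set.union_subset_union (Set.image_mono fun n hn => ?_) hA
    rw [Finset.mem_coe, mem_window] at hn ⊢
    omega
  have hFE := hE.sub_of_sub hF
    (free_anti (sub i _ R le_rfl (by omega) Set.subset_union_left))
  have hFE' := hE'.sub_of_sub hF
    (free_anti (sub (i + 1) _ R' (by omega) (by omega) Set.subset_union_right))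
  refine hP (hF.shrink fun u hu => mem_free_image.2 fun n hn => ?_)
  rw [Set.mem_Iio] at hn
  by_cases h4 : n < t ∨ i < n ∧ n < i + 2 * t + 3
  · exact wfree (hF.sub hu) n h4
  by_cases h5 : n ≤ i
  · exact mem_free_image.1 (h (hFE hu)) n ⟨by omega, h5⟩
  · exact mem_free_image.1 (h' (hFE' hu)) n ⟨by omega, hn⟩

end MainTheorem

open scoped Classical in
/-- main theorem, existence version: either `G` contains an induced
`S_{t,t,t}`, or there is a set `S` of at most `3t + 11` vertices and a rigid extended
strip decomposition of `G - N[S]` whose every particle has weight at most half. -/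
theorem main_theorem {V : Type*} [Fintype V]
    (G : SimpleGraph V) (w : V → ℕ) (t : ℕ) (ht : 1 ≤ t) :
    Nonempty (Sttt t ↪g G) ∨
    ∃ S : Finset V, S.card ≤ 3 * t + 11 ∧
      ∃ (H' : Type) (H : SimpleGraph H')
        (D : ESD (SimpleGraph.induce (Set.univ \ closedNbhd G (↑S : Set V)) G) H),
        D.IsRigid ∧
        D.ParticlesSmall (fun v => w v.val) (wsum w Set.univ / 2) := by
  by_contra hc
  rw [not_or] at hc
  refine (stuck_of_not_exists (w := w) ?_).false hc.1 ht
  rintro ⟨S, hS, H', H, D, hD, inst, hs⟩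
  refine hc.2 ⟨S, hS, H', H, D, hD, ?_⟩
  convert hs
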